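/- Let G be a separated single-crossing topological multigraph on n vertices with e edges, where e ≥ 4n. Then the crossing number of G satisfies cr(G) ≥ 10⁻²⁵ · e³ / (n² · log₂(e/n)). -/

import Mathlib

open Set

/-- A topological multigraph: a finite vertex set `V ⊂ ℝ²` together with a finite family of
edges, each represented by a continuous injective arc `[0,1] → ℝ²` whose endpoints are two
distinct vertices and whose interior avoids all vertices. -/
structure TopMultigraph where
  V : Finset (ℝ × ℝ)
  ι : Type
  fintype_ι : Fintype ι
  arc : ι → unitInterval → ℝ × ℝ
  continuous_arc : ∀ e, Continuous (arc e)
  injective_arc : ∀ e, Function.Injective (arc e)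
  source_mem : ∀ e, arc e 0 ∈ V
  target_mem : ∀ e, arc e 1 ∈ V
  ends_ne : ∀ e, arc e 0 ≠ arc e 1
  interior_avoids : ∀ e (t : unitInterval), t ≠ 0 → t ≠ 1 → arc e t ∉ V

namespace TopMultigraph

variable (G : TopMultigraph)

instance : Fintype G.ι := G.fintype_ι

/-- The number of edges of `G`. -/
noncomputable def edgeCount : ℕ := Nat.card G.ι

/-- The interior of an edge: the image of the open interval `(0,1)`. -/
def arcInterior (e : G.ι) : Set (ℝ × ℝ) :=
  G.arc e '' {t : unitInterval | t ≠ 0 ∧ t ≠ 1}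

/-- The set of the two endpoints of an edge. -/
def endpoints (e : G.ι) : Set (ℝ × ℝ) := {G.arc e 0, G.arc e 1}

/-- Two distinct edges are parallel if they join the same pair of vertices. -/
def Parallel (e f : G.ι) : Prop := e ≠ f ∧ G.endpoints e = G.endpoints f

/-- Two edges are independent if they share no endpoint. -/
def Independent (e f : G.ι) : Prop := Disjoint (G.endpoints e) (G.endpoints f)

/-- Two edges cross if their open arcs share a common point. -/
def Cross (e f : G.ι) : Prop := (G.arcInterior e ∩ G.arcInterior f).Nonempty

/-- `G` is single-crossing if any two distinct edges share at most one common interior point. -/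
def SingleCrossing : Prop :=
  ∀ e f : G.ι, e ≠ f → (G.arcInterior e ∩ G.arcInterior f).Subsingleton

/-- An edge `e` joins `u` and `v` if its endpoint set is `{u, v}`. -/
def Joins (e : G.ι) (u v : ℝ × ℝ) : Prop := G.endpoints e = {u, v}

/-- The union of the images of all edges of `G` joining `u` and `v`. -/
def pairUnion (u v : ℝ × ℝ) : Set (ℝ × ℝ) :=
  ⋃ e ∈ {e : G.ι | G.Joins e u v}, Set.range (G.arc e)

/-- `ℓ` is a lens of `G` at the pair `{u, v}`: `u ≠ v` are joined by at least one edge, no two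
of the parallel edges joining them cross, and `ℓ` is a bounded connected component of the
complement of the union of the edges joining `u` and `v`. -/
def IsLensAt (u v : ℝ × ℝ) (ℓ : Set (ℝ × ℝ)) : Prop :=
  u ≠ v ∧ (∃ e, G.Joins e u v) ∧
  (∀ e f : G.ι, G.Joins e u v → G.Joins f u v → e ≠ f → ¬ G.Cross e f) ∧
  Bornology.IsBounded ℓ ∧
  ∃ x ∈ (G.pairUnion u v)ᶜ, ℓ = connectedComponentIn (G.pairUnion u v)ᶜ x

/-- `ℓ` is a lens of `G`. -/
def IsLens (ℓ : Set (ℝ × ℝ)) : Prop := ∃ u v, G.IsLensAt u v ℓ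

/-- `L(G)`: the set of all lenses of `G`. -/
def lenses : Set (Set (ℝ × ℝ)) := {ℓ | G.IsLens ℓ}

/-- No two parallel edges of `G` cross. -/
def ParallelNoncrossing : Prop := ∀ e f : G.ι, G.Parallel e f → ¬ G.Cross e f

/-- `G` is separated: no two parallel edges cross and every lens contains a vertex. -/
def Separated : Prop :=
  G.ParallelNoncrossing ∧ ∀ ℓ, G.IsLens ℓ → ∃ v ∈ G.V, v ∈ ℓ

/-- The crossing number of `G`: the number of unordered pairs of distinct edges that cross. -/
noncomputable def crossingNumber : ℕ :=
  Nat.card {p : Sym2 G.ι // ¬ p.IsDiag ∧ ∀ e ∈ p, ∀ f ∈ p, e ≠ f → G.Cross e f}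

/-- The degree of a vertex: the number of edges incident to it. -/
noncomputable def degree (v : ℝ × ℝ) : ℕ :=
  Nat.card {e : G.ι // v ∈ G.endpoints e}

end TopMultigraph

namespace CL

/-- continuous logs exist on compact star-convex sets -/
theorem exists_log {E : Type*} [NormedAddCommGroup E] [NormedSpace ℝ E] {K : Set E}
    (hK : IsCompact K) {x0 : E} (hx0 : x0 ∈ K) (hs : StarConvex ℝ x0 K) {f : E → ℂ}
    (hf : ContinuousOn f K) (h0 : ∀ x ∈ K, f x ≠ 0) :
    ∃ L : E → ℂ, ContinuousOn L K ∧ ∀ x ∈ K, Complex.exp (L x) = f x := by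
  classical
  -- lower bound
  have hne : K.Nonempty := ⟨x0, hx0⟩
  obtain ⟨xm, hxm, hmin⟩ := hK.exists_isMinOn hne (hf.norm)
  set m := ‖f xm‖ with hm
  have hmpos : 0 < m := norm_pos_iff.2 (h0 xm hxm)
  have huc := hK.uniformContinuousOn_of_continuous hf
  rw [Metric.uniformContinuousOn_iff] at huc
  obtain ⟨δ, hδ, huc⟩ := huc m hmpos
  obtain ⟨R, hR⟩ := hK.isBounded.exists_norm_le
  have hR0 : 0 ≤ R := (norm_nonneg x0).trans (hR x0 hx0)
  obtain ⟨N, hN⟩ := exists_nat_gt (2 * R / δ)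
  have hNpos : (0 : ℝ) < N := lt_of_le_of_lt (by positivity) hN
  have hN0 : N ≠ 0 := by rintro rfl; simp at hNpos
  let g : ℕ → E → E := fun k x => x0 + ((k : ℝ) / N) • (x - x0)
  have hg : ∀ k ≤ N, ∀ x ∈ K, g k x ∈ K := by
    intro k hk x hx
    have h1 : (k : ℝ) / N ≤ 1 := by
      rw [div_le_one hNpos]; exact_mod_cast hk
    have h2 : 0 ≤ (k : ℝ) / N := by positivity
    have := hs hx (a := 1 - k / N) (b := k / N) (by linarith) h2 (by ring)
    convert this using 1
    simp only [g, smul_sub, sub_smul, one_smul]; abel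
  have hgc : ∀ k, Continuous (g k) := by
    intro k; simp only [g]; fun_prop
  have hd : ∀ k < N, ∀ x ∈ K, dist (g (k + 1) x) (g k x) < δ := by
    intro k hk x hx
    have : g (k+1) x - g k x = (1 / (N : ℝ)) • (x - x0) := by
      simp only [g]; push_cast
      rw [add_sub_add_left_eq_sub, ← sub_smul]; congr 1; ring
    rw [dist_eq_norm, this, norm_smul, Real.norm_of_nonneg (by positivity)]
    have h3 : ‖x - x0‖ ≤ 2 * R := (norm_sub_le _ _).trans (by linarith [hR x hx, hR x0 hx0])
    calc 1 / (N : ℝ) * ‖x - x0‖ ≤ 1 / N * (2 * R) := by gcongr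
      _ < δ := by
        rw [div_lt_iff₀ hδ] at hN
        rw [one_div, inv_mul_lt_iff₀ hNpos]; linarith
  have hr : ∀ k < N, ∀ x ∈ K, f (g (k+1) x) / f (g k x) ∈ Complex.slitPlane := by
    intro k hk x hx
    have h1 := huc _ (hg (k+1) hk x hx) _ (hg k hk.le x hx) (hd k hk x hx)
    have h2 : m ≤ ‖f (g k x)‖ := hmin (hg k hk.le x hx)
    have h3 := h0 _ (hg k hk.le x hx)
    have : f (g (k+1) x) / f (g k x) = 1 + (f (g (k+1) x) - f (g k x)) / f (g k x) := by
      field_simp; ring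
    rw [this]
    apply Complex.mem_slitPlane_of_norm_lt_one
    rw [norm_div, div_lt_one (norm_pos_iff.2 h3)]
    rw [dist_eq_norm] at h1; linarith
  refine ⟨fun x => Complex.log (f x0) + ∑ k ∈ Finset.range N,
    Complex.log (f (g (k+1) x) / f (g k x)), ?_, ?_⟩
  · apply continuousOn_const.add
    apply continuousOn_finsetSum
    intro k hk
    have hk' := Finset.mem_range.1 hk
    apply ContinuousOn.clog
    · apply ContinuousOn.div
      · exact hf.comp (hgc _).continuousOn (fun x hx => hg _ hk' x hx)
      · exact hf.comp (hgc _).continuousOn (fun x hx => hg _ hk'.le x hx)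
      · intro x hx; exact h0 _ (hg _ hk'.le x hx)
    · exact hr k hk'
  · intro x hx
    have key : ∀ j ≤ N, Complex.exp (Complex.log (f x0) + ∑ k ∈ Finset.range j,
        Complex.log (f (g (k+1) x) / f (g k x))) = f (g j x) := by
      intro j
      induction j with
      | zero => intro _; simp [g, Complex.exp_log (h0 _ hx0)]
      | succ j ih =>
        intro hj
        rw [Finset.sum_range_succ, ← add_assoc, Complex.exp_add, ih (by omega), Complex.exp_log]
        · rw [mul_div_cancel₀]; exact h0 _ (hg j (by omega) x hx)
        · exact div_ne_zero (h0 _ (hg _ hj x hx)) (h0 _ (hg j (by omega) x hx))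
    rw [key N le_rfl]
    congr 1; simp only [g]; rw [div_self hNpos.ne']; simp

end CL

namespace CL

/-- normalized exponential -/
noncomputable def ex (z : ℂ) : ℂ := Complex.exp (2 * Real.pi * Complex.I * z)

theorem ex_add (z w : ℂ) : ex (z + w) = ex z * ex w := by
  simp only [ex, mul_add, Complex.exp_add]
theorem ex_sub (z w : ℂ) : ex (z - w) = ex z / ex w := by
  simp only [ex, mul_sub, Complex.exp_sub]
theorem ex_ne (z : ℂ) : ex z ≠ 0 := Complex.exp_ne_zero _
theorem ex_neg (z : ℂ) : ex (-z) = (ex z)⁻¹ := by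
  simp only [ex, mul_neg, Complex.exp_neg]
theorem ex_zero : ex 0 = 1 := by simp [ex]
theorem ex_eq_one {z : ℂ} : ex z = 1 ↔ ∃ n : ℤ, z = n := by
  unfold ex
  rw [Complex.exp_eq_one_iff]
  have : (2 * Real.pi * Complex.I : ℂ) ≠ 0 := Complex.two_pi_I_ne_zero
  constructor
  · rintro ⟨n, h⟩; refine ⟨n, mul_left_cancel₀ this (h.trans (mul_comm _ _))⟩
  · rintro ⟨n, h⟩; exact ⟨n, by rw [h, mul_comm]⟩
theorem ex_int (n : ℤ) : ex n = 1 := ex_eq_one.2 ⟨n, rfl⟩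
theorem ex_half : ex (1/2) = -1 := by
  unfold ex; rw [show (2 * Real.pi * Complex.I * (1/2) : ℂ) = Real.pi * Complex.I by ring]
  exact Complex.exp_pi_mul_I
theorem ex_eq_iff {z w : ℂ} : ex z = ex w ↔ ∃ n : ℤ, z - w = n := by
  rw [← ex_eq_one, ex_sub, div_eq_one_iff_eq (ex_ne w)]
theorem continuous_ex : Continuous ex := by unfold ex; fun_prop
theorem exists_ex {z : ℂ} (hz : z ≠ 0) : ∃ w, ex w = z := by
  refine ⟨Complex.log z / (2 * Real.pi * Complex.I), ?_⟩
  unfold ex; rw [mul_div_cancel₀ _ Complex.two_pi_I_ne_zero, Complex.exp_log hz]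

/-- `L` is a continuous normalized logarithm of `f` on `K`. -/
def IsLog {E : Type*} [TopologicalSpace E] (f : E → ℂ) (K : Set E) (L : E → ℂ) : Prop :=
  ContinuousOn L K ∧ ∀ x ∈ K, ex (L x) = f x

theorem exists_isLog {E : Type*} [NormedAddCommGroup E] [NormedSpace ℝ E] {K : Set E}
    (hK : IsCompact K) {x0 : E} (hx0 : x0 ∈ K) (hs : StarConvex ℝ x0 K) {f : E → ℂ}
    (hf : ContinuousOn f K) (h0 : ∀ x ∈ K, f x ≠ 0) : ∃ L, IsLog f K L := by
  obtain ⟨L, hL, h⟩ := exists_log hK hx0 hs hf h0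
  refine ⟨fun x => L x / (2 * Real.pi * Complex.I), hL.div_const _, fun x hx => ?_⟩
  unfold ex; rw [mul_div_cancel₀ _ Complex.two_pi_I_ne_zero, h x hx]

/-- a continuous function with integer values is constant on preconnected sets -/
theorem int_const {E : Type*} [TopologicalSpace E] {K : Set E} (hK : IsPreconnected K)
    {g : E → ℂ} (hg : ContinuousOn g K) (hi : ∀ x ∈ K, ∃ n : ℤ, g x = n) {x y : E}
    (hx : x ∈ K) (hy : y ∈ K) : g x = g y := by
  have hc : ContinuousOn (fun x => (g x).re) K := Complex.continuous_re.comp_continuousOn hg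
  obtain ⟨n, hn⟩ := hi x hx
  obtain ⟨m, hm⟩ := hi y hy
  have himg : IsPreconnected ((fun x => (g x).re) '' K) := hK.image _ hc
  have key : ∀ n m : ℤ, (n : ℝ) ∈ ((fun x => (g x).re) '' K) →
      (m : ℝ) ∈ ((fun x => (g x).re) '' K) → ¬ n < m := by
    intro n m h1 h2 h
    have h3 := himg.ordConnected.out h1 h2
    have h5 : (n : ℝ) + 1 ≤ m := by exact_mod_cast h
    have h4 : (n : ℝ) + 1/2 ∈ Icc (n : ℝ) m := ⟨by linarith, by linarith⟩
    obtain ⟨z, hz, hz2⟩ := h3 h4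
    obtain ⟨k, hk⟩ := hi z hz
    simp only [hk, Complex.intCast_re] at hz2
    have : (2 * k : ℝ) = 2 * n + 1 := by linarith
    have : (2 * k : ℤ) = 2 * n + 1 := by exact_mod_cast this
    omega
  have hnx : (n : ℝ) ∈ ((fun x => (g x).re) '' K) := ⟨x, hx, by simp [hn]⟩
  have hmy : (m : ℝ) ∈ ((fun x => (g x).re) '' K) := ⟨y, hy, by simp [hm]⟩
  have : n = m := le_antisymm (not_lt.1 (key _ _ hmy hnx)) (not_lt.1 (key _ _ hnx hmy))
  rw [hn, hm, this]

theorem IsLog.sub_eq {E : Type*} [TopologicalSpace E] {K : Set E} (hK : IsPreconnected K)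
    {f : E → ℂ} {L M : E → ℂ} (hL : IsLog f K L) (hM : IsLog f K M) {x y : E}
    (hx : x ∈ K) (hy : y ∈ K) : L x - L y = M x - M y := by
  have := int_const hK (g := fun x => L x - M x) (hL.1.sub hM.1) (fun x hx => by
    rw [← ex_eq_iff, hL.2 x hx, hM.2 x hx]) hx hy
  linear_combination this

theorem IsLog.mono {E : Type*} [TopologicalSpace E] {f : E → ℂ} {K K' : Set E} {L : E → ℂ}
    (h : IsLog f K L) (hs : K' ⊆ K) : IsLog f K' L := ⟨h.1.mono hs, fun x hx => h.2 x (hs hx)⟩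

open Classical in
/-- the increment of the normalized logarithm of `γ - p` over `[a,b]` -/
noncomputable def A (γ : ℝ → ℂ) (a b : ℝ) (p : ℂ) : ℂ :=
  if h : ∃ L, IsLog (fun t => γ t - p) (Icc a b) L then h.choose b - h.choose a else 0

theorem A_eq {γ : ℝ → ℂ} {a b : ℝ} (hab : a ≤ b) {p : ℂ} {L : ℝ → ℂ}
    (hL : IsLog (fun t => γ t - p) (Icc a b) L) : A γ a b p = L b - L a := by
  have h : ∃ L, IsLog (fun t => γ t - p) (Icc a b) L := ⟨L, hL⟩
  rw [A, dif_pos h]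
  exact IsLog.sub_eq isPreconnected_Icc h.choose_spec hL (right_mem_Icc.2 hab) (left_mem_Icc.2 hab)

theorem exists_isLog_path {γ : ℝ → ℂ} {a b : ℝ} (hγ : ContinuousOn γ (Icc a b)) (hab : a ≤ b) {p : ℂ}
    (hp : p ∉ γ '' Icc a b) : ∃ L, IsLog (fun t => γ t - p) (Icc a b) L := by
  refine exists_isLog isCompact_Icc (left_mem_Icc.2 hab)
    ((convex_Icc a b).starConvex (left_mem_Icc.2 hab)) (hγ.sub continuousOn_const) ?_
  intro t ht h
  exact hp ⟨t, ht, sub_eq_zero.1 h⟩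

theorem A_congr {γ δ : ℝ → ℂ} {a b : ℝ} {p : ℂ} (h : ∀ t ∈ Icc a b, γ t = δ t) (hab : a ≤ b)
    (hγ : ContinuousOn γ (Icc a b)) (hp : p ∉ γ '' Icc a b) : A γ a b p = A δ a b p := by
  obtain ⟨L, hL⟩ := exists_isLog_path hγ hab hp
  rw [A_eq hab hL, A_eq hab (L := L) ⟨hL.1, fun x hx => by rw [hL.2 x hx]; simp only [h x hx]⟩]

theorem A_add {γ : ℝ → ℂ} {a b c : ℝ} (hγ : ContinuousOn γ (Icc a c)) (hab : a ≤ b) (hbc : b ≤ c) {p : ℂ}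
    (hp : p ∉ γ '' Icc a c) : A γ a b p + A γ b c p = A γ a c p := by
  obtain ⟨L, hL⟩ := exists_isLog_path hγ (hab.trans hbc) hp
  rw [A_eq (hab.trans hbc) hL, A_eq hab (hL.mono (Icc_subset_Icc_right hbc)),
    A_eq hbc (hL.mono (Icc_subset_Icc_left hab))]
  ring

theorem ex_A {γ : ℝ → ℂ} {a b : ℝ} (hγ : ContinuousOn γ (Icc a b)) (hab : a ≤ b) {p : ℂ}
    (hp : p ∉ γ '' Icc a b) : ex (A γ a b p) = (γ b - p) / (γ a - p) := by
  obtain ⟨L, hL⟩ := exists_isLog_path hγ hab hp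
  rw [A_eq hab hL, ex_sub, hL.2 _ (right_mem_Icc.2 hab), hL.2 _ (left_mem_Icc.2 hab)]

theorem A_self (γ : ℝ → ℂ) (a : ℝ) (p : ℂ) : A γ a a p = 0 := by
  unfold A; split_ifs <;> simp

theorem A_comp {γ φ : ℝ → ℂ} {a b : ℝ} (g : ℝ → ℝ) (hg : ContinuousOn g (Icc a b)) (hab : a ≤ b)
    (h : ∀ t ∈ Icc a b, φ t = γ (g t)) (hm : ∀ t ∈ Icc a b, g t ∈ Icc (g a) (g b))
    (hγ : ContinuousOn γ (Icc (g a) (g b))) {p : ℂ} (hp : p ∉ γ '' Icc (g a) (g b)) :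
    A φ a b p = A γ (g a) (g b) p := by
  have hgab : g a ≤ g b := (hm b (right_mem_Icc.2 hab)).1
  obtain ⟨L, hL⟩ := exists_isLog_path hγ hgab hp
  rw [A_eq hgab hL, A_eq hab (L := L ∘ g) ⟨hL.1.comp hg hm, fun t ht => by
    rw [Function.comp, hL.2 _ (hm t ht)]; simp only [h t ht]⟩]
  rfl

theorem A_comp_rev {γ φ : ℝ → ℂ} {a b : ℝ} (g : ℝ → ℝ) (hg : ContinuousOn g (Icc a b)) (hab : a ≤ b)
    (h : ∀ t ∈ Icc a b, φ t = γ (g t)) (hm : ∀ t ∈ Icc a b, g t ∈ Icc (g b) (g a))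
    (hγ : ContinuousOn γ (Icc (g b) (g a))) {p : ℂ} (hp : p ∉ γ '' Icc (g b) (g a)) :
    A φ a b p = - A γ (g b) (g a) p := by
  have hgab : g b ≤ g a := (hm b (right_mem_Icc.2 hab)).2
  obtain ⟨L, hL⟩ := exists_isLog_path hγ hgab hp
  rw [A_eq hgab hL, A_eq hab (L := L ∘ g) ⟨hL.1.comp hg hm, fun t ht => by
    rw [Function.comp, hL.2 _ (hm t ht)]; simp only [h t ht]⟩]
  simp

/-- evaluation through a logarithm on a planar set -/
theorem A_eq_of_log {γ : ℝ → ℂ} {a b : ℝ} (hγ : ContinuousOn γ (Icc a b)) (hab : a ≤ b) {p : ℂ} {K : Set ℂ}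
    {L : ℂ → ℂ} (hL : IsLog (fun z => z - p) K L) (hK : ∀ t ∈ Icc a b, γ t ∈ K) :
    A γ a b p = L (γ b) - L (γ a) :=
  A_eq hab (L := fun t => L (γ t)) ⟨hL.1.comp hγ hK, fun t ht => hL.2 _ (hK t ht)⟩

/-- joint log over a product `[a,b] × K` with `K` compact convex -/
theorem A_cont_aux {γ : ℝ → ℂ} {a b : ℝ} (hγ : ContinuousOn γ (Icc a b)) (hab : a ≤ b) {K : Set ℂ} (hK : IsCompact K)
    (hc : Convex ℝ K) (hd : Disjoint (γ '' Icc a b) K) : ContinuousOn (A γ a b) K := by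
  rcases K.eq_empty_or_nonempty with rfl | ⟨k, hk⟩
  · exact continuousOn_empty _
  have hS : IsCompact (Icc a b ×ˢ K) := isCompact_Icc.prod hK
  have ha := left_mem_Icc.2 hab
  have hb := right_mem_Icc.2 hab
  obtain ⟨L, hL⟩ := exists_isLog (f := fun z : ℝ × ℂ => γ z.1 - z.2) hS (x0 := (a, k)) ⟨ha, hk⟩
    (((convex_Icc a b).prod hc).starConvex ⟨ha, hk⟩)
    ((hγ.comp continuousOn_fst (fun z hz => hz.1)).sub continuousOn_snd) (by
      rintro ⟨t, p⟩ ⟨ht, hp⟩ h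
      exact hd.le_bot ⟨⟨t, ht, sub_eq_zero.1 h⟩, hp⟩)
  have : ∀ p ∈ K, A γ a b p = L (b, p) - L (a, p) := by
    intro p hp
    apply A_eq hab (L := fun t => L (t, p))
    exact ⟨hL.1.comp (by fun_prop) (fun t ht => ⟨ht, hp⟩), fun t ht => hL.2 (t, p) ⟨ht, hp⟩⟩
  refine ContinuousOn.congr ?_ this
  exact (hL.1.comp (by fun_prop) (fun p hp => ⟨hb, hp⟩)).sub
    (hL.1.comp (by fun_prop) (fun p hp => ⟨ha, hp⟩))

theorem A_continuousOn {γ : ℝ → ℂ} {a b : ℝ} (hγ : ContinuousOn γ (Icc a b)) (hab : a ≤ b) :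
    ContinuousOn (A γ a b) (γ '' Icc a b)ᶜ := by
  have hcl : IsClosed (γ '' Icc a b) := (isCompact_Icc.image_of_continuousOn hγ).isClosed
  intro p hp
  obtain ⟨ε, hε, hb⟩ := Metric.isOpen_iff.1 hcl.isOpen_compl p hp
  have h1 : ContinuousOn (A γ a b) (Metric.closedBall p (ε/2)) := by
    apply A_cont_aux hγ hab (isCompact_closedBall _ _) (convex_closedBall _ _)
    rw [Set.disjoint_left]; intro z hz hz2
    exact hb (Metric.closedBall_subset_ball (by linarith) hz2) hz
  exact (h1.continuousAt (Metric.closedBall_mem_nhds _ (by linarith))).continuousWithinAt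

/-- `W e f p` : winding number of the closed curve `e - f` (both on `[0,1]`). -/
noncomputable def W (e f : ℝ → ℂ) (p : ℂ) : ℂ := A e 0 1 p - A f 0 1 p

/-- intersection form -/
noncomputable def X (α : ℝ → ℂ) (a b : ℝ) (β : ℝ → ℂ) (c d : ℝ) : ℂ :=
  A α a b (β c) - A α a b (β d) + A β c d (α b) - A β c d (α a)

theorem X_int {α β : ℝ → ℂ} {a b c d : ℝ} (hα : ContinuousOn α (Icc a b)) (hβ : ContinuousOn β (Icc c d))
    (hab : a ≤ b) (hcd : c ≤ d)
    (h1 : α a ∉ β '' Icc c d) (h2 : α b ∉ β '' Icc c d) (h3 : β c ∉ α '' Icc a b)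
    (h4 : β d ∉ α '' Icc a b) : ∃ n : ℤ, X α a b β c d = n := by
  rw [← ex_eq_one, X, ex_sub, ex_add, ex_sub, ex_A hα hab h3, ex_A hα hab h4, ex_A hβ hcd h1,
    ex_A hβ hcd h2]
  have ha := left_mem_Icc.2 hab
  have hb := right_mem_Icc.2 hab
  have e1 : α a - β c ≠ 0 := fun h => h3 ⟨a, ha, sub_eq_zero.1 h⟩
  have e2 : α b - β c ≠ 0 := fun h => h3 ⟨b, hb, sub_eq_zero.1 h⟩
  have e3 : α a - β d ≠ 0 := fun h => h4 ⟨a, ha, sub_eq_zero.1 h⟩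
  have e4 : α b - β d ≠ 0 := fun h => h4 ⟨b, hb, sub_eq_zero.1 h⟩
  rw [show β d - α b = -(α b - β d) by ring, show β c - α b = -(α b - β c) by ring,
    show β d - α a = -(α a - β d) by ring, show β c - α a = -(α a - β c) by ring]
  field_simp

theorem X_zero {α β : ℝ → ℂ} {a b c d : ℝ} (hα : ContinuousOn α (Icc a b)) (hβ : ContinuousOn β (Icc c d))
    (hab : a ≤ b) (hcd : c ≤ d) (hd : Disjoint (α '' Icc a b) (β '' Icc c d)) :
    X α a b β c d = 0 := by
  have ha := left_mem_Icc.2 hab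
  have hb := right_mem_Icc.2 hab
  have hc := left_mem_Icc.2 hcd
  have hd' := right_mem_Icc.2 hcd
  obtain ⟨L, hL⟩ := exists_isLog (f := fun z : ℝ × ℝ => α z.1 - β z.2)
    ((isCompact_Icc (a := a) (b := b)).prod (isCompact_Icc (a := c) (b := d)))
    (x0 := (a, c)) ⟨ha, hc⟩ (((convex_Icc a b).prod (convex_Icc c d)).starConvex ⟨ha, hc⟩)
    ((hα.comp continuousOn_fst (fun z hz => hz.1)).sub
      (hβ.comp continuousOn_snd (fun z hz => hz.2))) (by
      rintro ⟨t, s⟩ ⟨ht, hs⟩ h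
      exact hd.le_bot ⟨⟨t, ht, rfl⟩, ⟨s, hs, (sub_eq_zero.1 h).symm⟩⟩)
  have k1 : ∀ s ∈ Icc c d, A α a b (β s) = L (b, s) - L (a, s) := fun s hs =>
    A_eq hab (L := fun t => L (t, s))
      ⟨hL.1.comp (by fun_prop) (fun t ht => ⟨ht, hs⟩), fun t ht => hL.2 (t, s) ⟨ht, hs⟩⟩
  have k2 : ∀ t ∈ Icc a b, A β c d (α t) = L (t, d) - L (t, c) := fun t ht => by
    have := A_eq hcd (γ := β) (p := α t) (L := fun s => L (t, s) + 1/2)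
      ⟨(hL.1.comp (f := fun s => (t, s)) (by fun_prop) (fun s hs => ⟨ht, hs⟩)).add continuousOn_const, fun s hs => by
        rw [ex_add, ex_half]; have := hL.2 (t, s) ⟨ht, hs⟩
        simp only at this; rw [this]; ring⟩
    rw [this]; ring
  rw [X, k1 _ hc, k1 _ hd', k2 _ ha, k2 _ hb]; ring

theorem X_swap (α β : ℝ → ℂ) (a b c d : ℝ) : X β c d α a b = - X α a b β c d := by
  unfold X; ring

theorem X_add {α β : ℝ → ℂ} {a m b c d : ℝ} (hα : ContinuousOn α (Icc a b)) (ham : a ≤ m) (hmb : m ≤ b)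
    (h3 : β c ∉ α '' Icc a b) (h4 : β d ∉ α '' Icc a b) :
    X α a m β c d + X α m b β c d = X α a b β c d := by
  unfold X
  rw [← A_add hα ham hmb h3, ← A_add hα ham hmb h4]; ring

theorem X_sub {α e f : ℝ → ℂ} {a b : ℝ} (h0 : e 0 = f 0) (h1 : e 1 = f 1) :
    X α a b e 0 1 - X α a b f 0 1 = W e f (α b) - W e f (α a) := by
  unfold X W; rw [h0, h1]; ring

theorem W_int {e f : ℝ → ℂ} (he : ContinuousOn e (Icc 0 1)) (hf : ContinuousOn f (Icc 0 1))
    (h0 : e 0 = f 0) (h1 : e 1 = f 1) {p : ℂ} (hp : p ∉ e '' Icc 0 1) (hp' : p ∉ f '' Icc 0 1) :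
    ∃ n : ℤ, W e f p = n := by
  rw [← ex_eq_one, W, ex_sub, ex_A he zero_le_one hp, ex_A hf zero_le_one hp', h0, h1]
  apply div_self
  apply div_ne_zero
  · exact fun h => hp' ⟨1, by simp, sub_eq_zero.1 h⟩
  · exact fun h => hp' ⟨0, by simp, sub_eq_zero.1 h⟩

theorem W_const {e f : ℝ → ℂ} (he : ContinuousOn e (Icc 0 1)) (hf : ContinuousOn f (Icc 0 1))
    (h0 : e 0 = f 0) (h1 : e 1 = f 1) {K : Set ℂ} (hK : IsPreconnected K)
    (hd : Disjoint K (e '' Icc 0 1)) (hd' : Disjoint K (f '' Icc 0 1)) {p q : ℂ} (hp : p ∈ K)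
    (hq : q ∈ K) : W e f p = W e f q := by
  refine int_const hK ?_ ?_ hp hq
  · exact ((A_continuousOn he zero_le_one).mono (hd.subset_compl_right)).sub
      ((A_continuousOn hf zero_le_one).mono (hd'.subset_compl_right))
  · intro x hx
    exact W_int he hf h0 h1 (disjoint_left.1 hd hx) (disjoint_left.1 hd' hx)

/-- if both arcs lie in a compact convex set missing `p`, winding vanishes. -/
theorem W_zero {e f : ℝ → ℂ} (he : ContinuousOn e (Icc 0 1)) (hf : ContinuousOn f (Icc 0 1))
    (h0 : e 0 = f 0) (h1 : e 1 = f 1) {K : Set ℂ} (hK : IsCompact K) (hc : Convex ℝ K) {p : ℂ}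
    (hp : p ∉ K) (h2 : ∀ t ∈ Icc (0 : ℝ) 1, e t ∈ K) (h3 : ∀ t ∈ Icc (0 : ℝ) 1, f t ∈ K) :
    W e f p = 0 := by
  obtain ⟨L, hL⟩ := exists_isLog (f := fun z => z - p) hK (h2 0 (by simp))
    (hc.starConvex (h2 0 (by simp))) (by fun_prop) (fun x hx h => hp (by rwa [← sub_eq_zero.1 h]))
  rw [W, A_eq_of_log he zero_le_one hL h2, A_eq_of_log hf zero_le_one hL h3, h0, h1]; ring

theorem W_self (e : ℝ → ℂ) (p : ℂ) : W e e p = 0 := by simp [W]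
theorem W_symm (e f : ℝ → ℂ) (p : ℂ) : W f e p = - W e f p := by simp [W]
theorem W_add (e f g : ℝ → ℂ) (p : ℂ) : W e f p + W f g p = W e g p := by simp [W]

end CL

namespace CL

/-- the fifteen independent pairs of edges of `K₅` -/
def P15 : List (Fin 5 × Fin 5 × Fin 5 × Fin 5) :=
  [(0,1,2,3),(0,2,1,3),(0,3,1,2),(0,1,2,4),(0,2,1,4),(0,4,1,2),(0,1,3,4),(0,3,1,4),(0,4,1,3),
   (0,2,3,4),(0,3,2,4),(0,4,2,3),(1,2,3,4),(1,3,2,4),(1,4,2,3)]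

set_option maxRecDepth 10000 in
theorem P15_spec : ∀ t ∈ P15, t.1 < t.2.1 ∧ t.2.2.1 < t.2.2.2 ∧ t.1 ≠ t.2.2.1 ∧ t.1 ≠ t.2.2.2 ∧
    t.2.1 ≠ t.2.2.1 ∧ t.2.1 ≠ t.2.2.2 := by decide

/-- algebraic van Kampen invariant -/
theorem vK (p : Fin 5 → ℂ) (hp : Function.Injective p) (a : Fin 5 → Fin 5 → Fin 5 → ℂ)
    (ha : ∀ i j k, i < j → k ≠ i → k ≠ j → ex (a i j k) = (p j - p k) / (p i - p k))
    (x : Fin 5 × Fin 5 × Fin 5 × Fin 5 → ℤ)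
    (hx : ∀ t ∈ P15, (x t : ℂ) = a t.1 t.2.1 t.2.2.1 - a t.1 t.2.1 t.2.2.2
      + a t.2.2.1 t.2.2.2 t.2.1 - a t.2.2.1 t.2.2.2 t.1) :
    Odd (P15.map x).sum := by
  classical
  have h1 : ∀ j k : Fin 5, ∃ l : ℂ, j ≠ k → ex l = p j - p k := by
    intro j k
    by_cases h : j = k
    · exact ⟨0, fun h' => absurd h h'⟩
    · obtain ⟨w, hw⟩ := exists_ex (sub_ne_zero.2 (hp.ne h))
      exact ⟨w, fun _ => hw⟩
  choose M hM using h1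
  let Λ : Fin 5 → Fin 5 → ℂ := fun j k => if j < k then M k j + 1/2 else M j k
  have hΛ : ∀ j k, j ≠ k → ex (Λ j k) = p j - p k := by
    intro j k h
    simp only [Λ]
    split_ifs with h2
    · rw [ex_add, ex_half, hM k j h.symm]; ring
    · exact hM j k h
  have hΛs : ∀ j k, j < k → Λ j k = Λ k j + 1/2 := by
    intro j k h
    simp only [Λ, if_pos h, if_neg h.le.not_gt]
  have h2 : ∀ i j k : Fin 5, ∃ m : ℤ, i < j → k ≠ i → k ≠ j → a i j k = Λ j k - Λ i k + m := by
    intro i j k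
    by_cases h : i < j ∧ k ≠ i ∧ k ≠ j
    · obtain ⟨h1, h2, h3⟩ := h
      have := ha i j k h1 h2 h3
      rw [← hΛ j k h3.symm, ← hΛ i k h2.symm, ← ex_sub, ex_eq_iff] at this
      obtain ⟨n, hn⟩ := this
      exact ⟨n, fun _ _ _ => by rw [← hn]; ring⟩
    · exact ⟨0, fun a b c => absurd ⟨a, b, c⟩ h⟩
  choose m hm using h2
  have key : ∀ i j k l, i < j → k < l → i ≠ k → i ≠ l → j ≠ k → j ≠ l → ∀ y : ℤ,
      (y : ℂ) = a i j k - a i j l + a k l j - a k l i →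
      2 * y = 2 * (m i j k - m i j l + m k l j - m k l i) + ((if j < k then 1 else -1)
       - (if i < k then 1 else -1) - (if j < l then 1 else -1) + (if i < l then 1 else -1)) := by
    intro i j k l h1 h2 h3 h4 h5 h6 y hy
    have hs : ∀ j k, j ≠ k → 2 * (Λ j k - Λ k j) = ((if j < k then 1 else -1 : ℤ) : ℂ) := by
      intro j k h
      rcases lt_or_gt_of_ne h with h | h
      · rw [hΛs j k h, if_pos h]; push_cast; ring
      · rw [hΛs k j h, if_neg h.le.not_gt]; push_cast; ring
    have : ((2 * y : ℤ) : ℂ) = ((2 * (m i j k - m i j l + m k l j - m k l i) + ((if j < k then 1 else -1)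
       - (if i < k then 1 else -1) - (if j < l then 1 else -1) + (if i < l then 1 else -1)) : ℤ) : ℂ) := by
      rw [Int.cast_add, Int.cast_add, Int.cast_sub, Int.cast_sub, ← hs j k h5, ← hs i k h3,
        ← hs j l h6, ← hs i l h4]
      push_cast
      rw [hy, hm i j k h1 h3.symm h5.symm, hm i j l h1 h4.symm h6.symm, hm k l j h2 h5 h6,
        hm k l i h2 h3 h4]
      ring
    exact_mod_cast this
  have key2 : ∀ t ∈ P15, _ := fun t ht => by
    obtain ⟨h1, h2, h3, h4, h5, h6⟩ := P15_spec t ht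
    exact key _ _ _ _ h1 h2 h3 h4 h5 h6 (x t) (hx t ht)
  rw [Int.odd_iff]
  simp only [P15, List.forall_mem_cons, List.map_cons, List.map_nil, List.sum_cons, List.sum_nil] at key2 ⊢
  simp only [show ((0 : Fin 5) < 1) = True by simp, show ((0 : Fin 5) < 2) = True by simp,
    show ((0 : Fin 5) < 3) = True by simp, show ((0 : Fin 5) < 4) = True by simp,
    show ((1 : Fin 5) < 2) = True by simp, show ((1 : Fin 5) < 3) = True by simp,
    show ((1 : Fin 5) < 4) = True by simp, show ((2 : Fin 5) < 3) = True by simp,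
    show ((2 : Fin 5) < 4) = True by simp, show ((3 : Fin 5) < 4) = True by simp,
    show ((2 : Fin 5) < 1) = False by simp, show ((3 : Fin 5) < 1) = False by simp,
    show ((4 : Fin 5) < 1) = False by simp, show ((3 : Fin 5) < 2) = False by simp,
    show ((4 : Fin 5) < 2) = False by simp, show ((4 : Fin 5) < 3) = False by simp,
    if_true, if_false] at key2
  obtain ⟨a1,a2,a3,a4,a5,a6,a7,a8,a9,a10,a11,a12,a13,a14,a15,-⟩ := key2
  omega

/-- no five points joined by paths such that independent paths are disjoint -/
theorem no_K5_paths (p : Fin 5 → ℂ) (γ : Fin 5 → Fin 5 → ℝ → ℂ)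
    (hc : ∀ i j, i < j → ContinuousOn (γ i j) (Icc 0 1))
    (h0 : ∀ i j, i < j → γ i j 0 = p i) (h1 : ∀ i j, i < j → γ i j 1 = p j)
    (hp : Function.Injective p)
    (hoff : ∀ i j k, i < j → k ≠ i → k ≠ j → p k ∉ γ i j '' Icc 0 1)
    (hd : ∀ i j k l, i < j → k < l → i ≠ k → i ≠ l → j ≠ k → j ≠ l →
      Disjoint (γ i j '' Icc 0 1) (γ k l '' Icc 0 1)) : False := by
  have := vK p hp (fun i j k => A (γ i j) 0 1 (p k)) (by
    intro i j k hij hki hkj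
    rw [ex_A (hc i j hij) zero_le_one (hoff i j k hij hki hkj), h0 i j hij, h1 i j hij]) (fun _ => 0) (by
    intro t ht
    obtain ⟨a1, a2, a3, a4, a5, a6⟩ := P15_spec t ht
    have := X_zero (hc _ _ a1) (hc _ _ a2) zero_le_one zero_le_one (hd _ _ _ _ a1 a2 a3 a4 a5 a6)
    rw [X, h0 _ _ a1, h1 _ _ a1, h0 _ _ a2, h1 _ _ a2] at this
    rw [Int.cast_zero, ← this])
  simp [P15] at this

end CL

namespace CL

/-- connected (nonempty) vertex sets of the graph `adj` -/
def Cn {N : Type*} (adj : N → N → Prop) (B : Set N) : Prop :=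
  B.Nonempty ∧ ∀ x ∈ B, ∀ y ∈ B, Relation.ReflTransGen (fun a b => adj a b ∧ a ∈ B ∧ b ∈ B) x y

/-- `adj` has a `K₅` minor -/
def HasK5 {N : Type*} (adj : N → N → Prop) : Prop :=
  ∃ B : Fin 5 → Set N, (∀ i, Cn adj (B i)) ∧ (∀ i j, i ≠ j → Disjoint (B i) (B j)) ∧
    ∀ i j, i ≠ j → ∃ x ∈ B i, ∃ y ∈ B j, adj x y

section basics
variable {N : Type*} {adj : N → N → Prop}

theorem Cn.singleton (a : N) : Cn adj {a} :=
  ⟨⟨a, rfl⟩, by rintro x rfl y rfl; exact .refl⟩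

theorem RT_mono {B B' : Set N} (h : B ⊆ B') {x y : N}
    (hxy : Relation.ReflTransGen (fun a b => adj a b ∧ a ∈ B ∧ b ∈ B) x y) :
    Relation.ReflTransGen (fun a b => adj a b ∧ a ∈ B' ∧ b ∈ B') x y :=
  Relation.ReflTransGen.mono (fun _ _ h' => ⟨h'.1, h h'.2.1, h h'.2.2⟩) _ _ hxy

theorem RT_symm (hs : ∀ a b, adj a b → adj b a) {B : Set N} {x y : N}
    (hxy : Relation.ReflTransGen (fun a b => adj a b ∧ a ∈ B ∧ b ∈ B) x y) :
    Relation.ReflTransGen (fun a b => adj a b ∧ a ∈ B ∧ b ∈ B) y x := by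
  induction hxy with
  | refl => exact .refl
  | tail _ h ih => exact Relation.ReflTransGen.head ⟨hs _ _ h.1, h.2.2, h.2.1⟩ ih

theorem Cn.union_adj (hs : ∀ a b, adj a b → adj b a) {B B' : Set N} (h : Cn adj B) (h' : Cn adj B')
    {x y : N} (hx : x ∈ B) (hy : y ∈ B') (hxy : adj x y) : Cn adj (B ∪ B') := by
  have l : ∀ z ∈ B ∪ B', Relation.ReflTransGen (fun a b => adj a b ∧ a ∈ B ∪ B' ∧ b ∈ B ∪ B') z x := by
    rintro z (hz | hz)
    · exact RT_mono subset_union_left (h.2 z hz x hx)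
    · exact (RT_mono subset_union_right (h'.2 z hz y hy)).tail ⟨hs _ _ hxy, .inr hy, .inl hx⟩
  exact ⟨⟨x, .inl hx⟩, fun a ha b hb => (l a ha).trans (RT_symm hs (l b hb))⟩

theorem Cn.union_inter (hs : ∀ a b, adj a b → adj b a) {B B' : Set N} (h : Cn adj B) (h' : Cn adj B')
    {x : N} (hx : x ∈ B) (hy : x ∈ B') : Cn adj (B ∪ B') := by
  have l : ∀ z ∈ B ∪ B', Relation.ReflTransGen (fun a b => adj a b ∧ a ∈ B ∪ B' ∧ b ∈ B ∪ B') z x := by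
    rintro z (hz | hz)
    · exact RT_mono subset_union_left (h.2 z hz x hx)
    · exact RT_mono subset_union_right (h'.2 z hz x hy)
  exact ⟨⟨x, .inl hx⟩, fun a ha b hb => (l a ha).trans (RT_symm hs (l b hb))⟩

end basics

/-- realization of a vertex set -/
def RB {N : Type*} (adj : N → N → Prop) (K : N → Set ℂ) (Γ : N → N → Set ℂ) (B : Set N) : Set ℂ :=
  {z | (∃ a ∈ B, z ∈ K a) ∨ ∃ a ∈ B, ∃ b ∈ B, adj a b ∧ z ∈ Γ a b}

section B1
variable {N : Type*} {adj : N → N → Prop} {K : N → Set ℂ} {Γ : N → N → Set ℂ}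

theorem RB_pathConn (hK : ∀ a, IsPathConnected (K a))
    (hΓ : ∀ a b, adj a b → IsPathConnected (Γ a b))
    (h1 : ∀ a b, adj a b → (Γ a b ∩ K a).Nonempty) (h2 : ∀ a b, adj a b → (Γ a b ∩ K b).Nonempty)
    {B : Set N} (hB : Cn adj B) : IsPathConnected (RB adj K Γ B) := by
  obtain ⟨⟨r, hr⟩, hB⟩ := hB
  have sK : ∀ a ∈ B, K a ⊆ RB adj K Γ B := fun a ha z hz => .inl ⟨a, ha, hz⟩
  have sG : ∀ a ∈ B, ∀ b ∈ B, adj a b → Γ a b ⊆ RB adj K Γ B :=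
    fun a ha b hb h z hz => .inr ⟨a, ha, b, hb, h, hz⟩
  obtain ⟨z0, hz0⟩ := (hK r).nonempty
  have key : ∀ b, Relation.ReflTransGen (fun a b => adj a b ∧ a ∈ B ∧ b ∈ B) r b → b ∈ B →
      ∀ z ∈ K b, JoinedIn (RB adj K Γ B) z0 z := by
    intro b hb
    induction hb with
    | refl => exact fun _ z hz => ((hK r).joinedIn z0 hz0 z hz).mono (sK r hr)
    | tail _ h ih =>
      rename_i b c _
      intro hc z hz
      obtain ⟨w1, hw1, hw1'⟩ := h1 b c h.1
      obtain ⟨w2, hw2, hw2'⟩ := h2 b c h.1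
      exact ((ih h.2.1 w1 hw1').trans (((hΓ b c h.1).joinedIn w1 hw1 w2 hw2).mono
        (sG b h.2.1 c h.2.2 h.1))).trans (((hK c).joinedIn w2 hw2' z hz).mono (sK c hc))
  refine ⟨z0, sK r hr hz0, ?_⟩
  rintro z (⟨a, ha, hz⟩ | ⟨a, ha, b, hb, hab, hz⟩)
  · exact key a (hB r hr a ha) ha z hz
  · obtain ⟨w1, hw1, hw1'⟩ := h1 a b hab
    exact (key a (hB r hr a ha) ha w1 hw1').trans (((hΓ a b hab).joinedIn w1 hw1 z hz).mono
      (sG a ha b hb hab))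

theorem RB_disjoint (hKd : ∀ a b, a ≠ b → Disjoint (K a) (K b))
    (h3 : ∀ a b c, adj a b → c ≠ a → c ≠ b → Disjoint (Γ a b) (K c))
    (h4 : ∀ a b c d, adj a b → adj c d → a ≠ c → a ≠ d → b ≠ c → b ≠ d → Disjoint (Γ a b) (Γ c d))
    {B B' : Set N} (hd : Disjoint B B') : Disjoint (RB adj K Γ B) (RB adj K Γ B') := by
  have hne : ∀ x ∈ B, ∀ y ∈ B', x ≠ y := fun x hx y hy h => disjoint_left.1 hd hx (h ▸ hy)
  rw [disjoint_left]
  rintro z (⟨a, ha, hz⟩ | ⟨a, ha, b, hb, hab, hz⟩) (⟨c, hc, hz'⟩ | ⟨c, hc, d, hd', hcd, hz'⟩)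
  · exact disjoint_left.1 (hKd a c (hne a ha c hc)) hz hz'
  · exact disjoint_left.1 (h3 c d a hcd (hne a ha c hc) (hne a ha d hd')) hz' hz
  · exact disjoint_left.1 (h3 a b c hab (hne a ha c hc).symm (hne b hb c hc).symm) hz hz'
  · exact disjoint_left.1 (h4 a b c d hab hcd (hne a ha c hc) (hne a ha d hd') (hne b hb c hc)
      (hne b hb d hd')) hz hz'

theorem noK5_planar (hs : ∀ a b, adj a b → adj b a) (hK : ∀ a, IsPathConnected (K a))
    (hΓ : ∀ a b, adj a b → IsPathConnected (Γ a b))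
    (h1 : ∀ a b, adj a b → (Γ a b ∩ K a).Nonempty) (h2 : ∀ a b, adj a b → (Γ a b ∩ K b).Nonempty)
    (hKd : ∀ a b, a ≠ b → Disjoint (K a) (K b))
    (h3 : ∀ a b c, adj a b → c ≠ a → c ≠ b → Disjoint (Γ a b) (K c))
    (h4 : ∀ a b c d, adj a b → adj c d → a ≠ c → a ≠ d → b ≠ c → b ≠ d → Disjoint (Γ a b) (Γ c d)) :
    ¬ HasK5 adj := by
  rintro ⟨B, hB, hBd, hBa⟩
  have hp : ∀ i, ∃ z, z ∈ RB adj K Γ (B i) := by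
    intro i
    obtain ⟨a, ha⟩ := (hB i).1
    obtain ⟨z, hz⟩ := (hK a).nonempty
    exact ⟨z, .inl ⟨a, ha, hz⟩⟩
  choose p hp using hp
  have mono : ∀ {B B' : Set N}, B ⊆ B' → RB adj K Γ B ⊆ RB adj K Γ B' := by
    rintro B B' h z (⟨a, ha, hz⟩ | ⟨a, ha, b, hb, hab, hz⟩)
    · exact .inl ⟨a, h ha, hz⟩
    · exact .inr ⟨a, h ha, b, h hb, hab, hz⟩
  have hpath : ∀ i j : Fin 5, i ≠ j → ∃ γ : ℝ → ℂ, ContinuousOn γ (Icc 0 1) ∧ γ 0 = p i ∧ γ 1 = p j ∧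
      γ '' Icc 0 1 ⊆ RB adj K Γ (B i ∪ B j) := by
    intro i j hij
    obtain ⟨x, hx, y, hy, hxy⟩ := hBa i j hij
    have hc := RB_pathConn hK hΓ h1 h2 ((hB i).union_adj hs (hB j) hx hy hxy)
    have := hc.joinedIn (p i) (mono subset_union_left (hp i)) (p j) (mono subset_union_right (hp j))
    refine ⟨fun t => this.somePath.extend t, this.somePath.continuous_extend.continuousOn, by simp, by simp, ?_⟩
    rintro z ⟨t, ht, rfl⟩
    have h2 := this.somePath_mem ⟨t, ht⟩
    rw [← Path.extend_apply _ ht] at h2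
    exact h2
  choose! γ hγ using hpath
  have dd : ∀ i j k : Fin 5, k ≠ i → k ≠ j → Disjoint (B i ∪ B j) (B k) := by
    intro i j k h1 h2
    rw [disjoint_union_left]; exact ⟨hBd _ _ h1.symm, hBd _ _ h2.symm⟩
  refine no_K5_paths p γ (fun i j h => (hγ i j h.ne).1) (fun i j h => (hγ i j h.ne).2.1)
    (fun i j h => (hγ i j h.ne).2.2.1) ?_ ?_ ?_
  · intro i j h
    by_contra hne
    exact disjoint_left.1 (RB_disjoint hKd h3 h4 (hBd i j hne)) (hp i) (h ▸ hp j)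
  · intro i j k hij h1 h2 hm
    exact disjoint_left.1 (RB_disjoint hKd h3 h4 (dd i j k h1 h2)) ((hγ i j hij.ne).2.2.2 hm) (hp k)
  · intro i j k l hij hkl a1 a2 a3 a4
    refine (RB_disjoint hKd h3 h4 ?_).mono ((hγ i j hij.ne).2.2.2) ((hγ k l hkl.ne).2.2.2)
    rw [disjoint_union_right]; exact ⟨dd i j k a1.symm a3.symm, dd i j l a2.symm a4.symm⟩

end B1

section B2
variable {N : Type*} {adj : N → N → Prop}

/-- formal chains along edges inside `B` -/
inductive Chain (adj : N → N → Prop) (inc : N → N → N → ℂ) (B : Set N) (u : N) : N → (N → ℂ) → Prop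
  | nil : Chain adj inc B u u 0
  | cons {v w : N} {F : N → ℂ} : Chain adj inc B u v F → adj v w → v ∈ B → w ∈ B →
      Chain adj inc B u w (F + inc v w)

/-- bipartite graphs drawn with all independent edges crossing oddly have no `K₅` minor -/
theorem noK5_odd (pos : N → ℂ) (hpos : Function.Injective pos) (c : N → ZMod 2)
    (inc : N → N → N → ℂ) (hs : ∀ a b, adj a b → adj b a)
    (hc : ∀ a b, adj a b → c a + c b = 1)
    (hinc : ∀ a b x, adj a b → x ≠ a → x ≠ b → ex (inc a b x) = (pos b - pos x) / (pos a - pos x))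
    (hodd : ∀ a b a' b', adj a b → adj a' b' → a ≠ a' → a ≠ b' → b ≠ a' → b ≠ b' →
      ∃ n : ℤ, Odd n ∧ inc a b a' - inc a b b' + inc a' b' b - inc a' b' a = n) :
    ¬ HasK5 adj := by
  rintro ⟨B, hB, hBd, hBa⟩
  have hex : ∀ (B : Set N) u v F, Chain adj inc B u v F → u ∈ B → ∀ x ∉ B,
      ex (F x) = (pos v - pos x) / (pos u - pos x) := by
    intro B u v F h hu x hx
    have hu' : pos u - pos x ≠ 0 := sub_ne_zero.2 (hpos.ne (fun h => hx (h ▸ hu)))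
    induction h with
    | nil => rw [Pi.zero_apply, ex_zero, div_self hu']
    | cons _ h h1 h2 ih =>
      rename_i v w F _
      have hv' : pos v - pos x ≠ 0 := sub_ne_zero.2 (hpos.ne (fun h => hx (h ▸ h1)))
      rw [Pi.add_apply, ex_add, ih, hinc v w x h (fun h => hx (h ▸ h1)) (fun h => hx (h ▸ h2))]
      field_simp
  have hcast : ∀ n : ℤ, Odd n → (n : ZMod 2) = 1 := by
    rintro n ⟨k, rfl⟩; push_cast; rw [show (2 : ZMod 2) = 0 from rfl]; ring
  have two : ∀ z : ZMod 2, z + z = 0 := by decide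
  have step1 : ∀ (B B' : Set N), Disjoint B B' → ∀ a b, adj a b → a ∈ B → b ∈ B → ∀ u v F,
      Chain adj inc B' u v F → u ∈ B' →
      ∃ n : ℤ, inc a b u - inc a b v + F b - F a = n ∧ (n : ZMod 2) = c u + c v := by
    intro B B' hd a b hab ha hb u v F h hu
    have hne : ∀ x ∈ B, ∀ y ∈ B', x ≠ y := fun x hx y hy h => disjoint_left.1 hd hx (h ▸ hy)
    induction h with
    | nil => exact ⟨0, by simp, by simp [two]⟩
    | cons _ h h1 h2 ih =>
      rename_i v w F _
      obtain ⟨n, hn, hn2⟩ := ih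
      obtain ⟨m, hm, hm2⟩ := hodd a b v w hab h (hne a ha v h1) (hne a ha w h2) (hne b hb v h1)
        (hne b hb w h2)
      refine ⟨n + m, ?_, ?_⟩
      · push_cast; rw [← hn, ← hm2, Pi.add_apply, Pi.add_apply]; ring
      · push_cast; rw [hn2, hcast m hm, ← hc v w h]
        linear_combination two (c v)
  have step2 : ∀ (B B' : Set N), Disjoint B B' → ∀ u v F, Chain adj inc B u v F → u ∈ B →
      ∀ u' v' F', Chain adj inc B' u' v' F' → u' ∈ B' →
      ∃ n : ℤ, F u' - F v' + F' v - F' u = n ∧ (n : ZMod 2) = (c u + c v) * (c u' + c v') := by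
    intro B B' hd u v F h hu u' v' F' h' hu'
    induction h with
    | nil => exact ⟨0, by simp, by simp [two]⟩
    | cons _ h h1 h2 ih =>
      rename_i v w F _
      obtain ⟨n, hn, hn2⟩ := ih
      obtain ⟨m, hm, hm2⟩ := step1 B B' hd v w h h1 h2 u' v' F' h' hu'
      refine ⟨n + m, ?_, ?_⟩
      · push_cast; rw [← hn, ← hm, Pi.add_apply, Pi.add_apply]; ring
      · push_cast; rw [hn2, hm2]
        have := hc v w h
        linear_combination (- (c u' + c v')) * this + (c u' + c v') * two (c v)
  have hch : ∀ (B : Set N) x y, Relation.ReflTransGen (fun a b => adj a b ∧ a ∈ B ∧ b ∈ B) x y →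
      ∃ F, Chain adj inc B x y F := by
    intro B x y h
    induction h with
    | refl => exact ⟨0, .nil⟩
    | tail _ h ih => obtain ⟨F, hF⟩ := ih; exact ⟨_, hF.cons h.1 h.2.1 h.2.2⟩
  choose r hr using fun i => (hB i).1
  have hF : ∀ i j : Fin 5, i ≠ j → ∃ F, Chain adj inc (B i ∪ B j) (r i) (r j) F := by
    intro i j hij
    obtain ⟨x, hx, y, hy, hxy⟩ := hBa i j hij
    exact hch _ _ _ (((hB i).union_adj hs (hB j) hx hy hxy).2 _ (.inl (hr i)) _ (.inr (hr j)))
  choose! F hF using hF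
  have dd : ∀ i j k : Fin 5, k ≠ i → k ≠ j → Disjoint (B i ∪ B j) (B k) := by
    intro i j k h1 h2
    rw [disjoint_union_left]; exact ⟨hBd _ _ h1.symm, hBd _ _ h2.symm⟩
  have hn : ∀ t : Fin 5 × Fin 5 × Fin 5 × Fin 5, ∃ n : ℤ, t ∈ P15 →
      (n : ℂ) = F t.1 t.2.1 (r t.2.2.1) - F t.1 t.2.1 (r t.2.2.2) + F t.2.2.1 t.2.2.2 (r t.2.1)
        - F t.2.2.1 t.2.2.2 (r t.1) ∧
      (n : ZMod 2) = (c (r t.1) + c (r t.2.1)) * (c (r t.2.2.1) + c (r t.2.2.2)) := by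
    intro t
    by_cases ht : t ∈ P15
    · obtain ⟨a1, a2, a3, a4, a5, a6⟩ := P15_spec t ht
      obtain ⟨n, hn, hn2⟩ := step2 (B t.1 ∪ B t.2.1) (B t.2.2.1 ∪ B t.2.2.2) (by
        rw [disjoint_union_right]; exact ⟨dd _ _ _ a3.symm a5.symm, dd _ _ _ a4.symm a6.symm⟩)
        _ _ _ (hF _ _ a1.ne) (.inl (hr _)) _ _ _ (hF _ _ a2.ne) (.inl (hr _))
      exact ⟨n, fun _ => ⟨hn.symm, hn2⟩⟩
    · exact ⟨0, fun h => absurd h ht⟩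
  choose x hx using hn
  have hrinj : Function.Injective r := by
    intro i j h
    by_contra hne
    exact disjoint_left.1 (hBd i j hne) (hr i) (h ▸ hr j)
  have := vK (pos ∘ r) (hpos.comp hrinj) (fun i j k => F i j (r k)) (by
    intro i j k hij hki hkj
    exact hex _ _ _ _ (hF i j hij.ne) (.inl (hr i)) (r k) (fun h =>
      disjoint_left.1 (dd i j k hki hkj) h (hr k))) x (fun t ht => (hx t ht).1)
  have h2 := hcast _ this
  have h3 : ∀ t ∈ P15, ((x t : ℤ) : ZMod 2) = _ := fun t ht => (hx t ht).2
  simp only [P15, List.forall_mem_cons, List.map_cons, List.map_nil, List.sum_cons, List.sum_nil] at h3 h2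
  push_cast at h2
  obtain ⟨a1,a2,a3,a4,a5,a6,a7,a8,a9,a10,a11,a12,a13,a14,a15,-⟩ := h3
  rw [a1,a2,a3,a4,a5,a6,a7,a8,a9,a10,a11,a12,a13,a14,a15] at h2
  generalize c (r 0) = c0 at h2
  generalize c (r 1) = c1 at h2
  generalize c (r 2) = c2 at h2
  generalize c (r 3) = c3 at h2
  generalize c (r 4) = c4 at h2
  revert c0 c1 c2 c3 c4
  decide

end B2
end CL

namespace CL

section F1
variable {N : Type*}

/-- `K₅` minor inside `T` -/
def HasK5on (adj : N → N → Prop) (T : Finset N) : Prop :=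
  ∃ B : Fin 5 → Set N, (∀ i, Cn adj (B i)) ∧ (∀ i j, i ≠ j → Disjoint (B i) (B j)) ∧
    (∀ i j, i ≠ j → ∃ x ∈ B i, ∃ y ∈ B j, adj x y) ∧ ∀ i, B i ⊆ T

open Classical in
/-- neighbours of `v` in `S` -/
noncomputable def nb (adj : N → N → Prop) (S : Finset N) (v : N) : Finset N := S.filter (adj v)

open Classical in
/-- number of adjacent ordered pairs in `S` -/
noncomputable def prs (adj : N → N → Prop) (S : Finset N) : ℕ := ∑ v ∈ S, (nb adj S v).card

theorem mem_nb {adj : N → N → Prop} {S : Finset N} {v w : N} : w ∈ nb adj S v ↔ w ∈ S ∧ adj v w := by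
  classical
  simp [nb]

variable {adj : N → N → Prop}

open Classical in
theorem prs_insert (hs : ∀ a b, adj a b → adj b a) (hi : ∀ a, ¬ adj a a) {S : Finset N} {v : N}
    (hv : v ∉ S) : prs adj (insert v S) = prs adj S + 2 * (nb adj S v).card := by
  unfold prs
  rw [Finset.sum_insert hv]
  have h1 : nb adj (insert v S) v = nb adj S v := by
    ext w; simp only [mem_nb, Finset.mem_insert]
    constructor
    · rintro ⟨rfl | h, h2⟩
      · exact absurd h2 (hi _)
      · exact ⟨h, h2⟩
    · exact fun h => ⟨.inr h.1, h.2⟩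
  have h2 : ∀ w ∈ S, (nb adj (insert v S) w).card = (nb adj S w).card + if adj v w then 1 else 0 := by
    intro w hw
    split_ifs with h
    · rw [show nb adj (insert v S) w = insert v (nb adj S w) by
        ext x; simp only [mem_nb, Finset.mem_insert]
        constructor
        · rintro ⟨rfl | h, h2⟩
          · exact .inl rfl
          · exact .inr ⟨h, h2⟩
        · rintro (rfl | h2)
          · exact ⟨.inl rfl, hs _ _ h⟩
          · exact ⟨.inr h2.1, h2.2⟩]
      rw [Finset.card_insert_of_notMem (fun h' => hv (mem_nb.1 h').1)]
    · rw [add_zero]; congr 1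
      ext x; simp only [mem_nb, Finset.mem_insert]
      constructor
      · rintro ⟨rfl | h', h2⟩
        · exact absurd (hs _ _ h2) h
        · exact ⟨h', h2⟩
      · exact fun h2 => ⟨.inr h2.1, h2.2⟩
  rw [h1, Finset.sum_congr rfl h2, Finset.sum_add_distrib, Finset.sum_boole]
  simp only [nb, Nat.cast_id]; ring

theorem prs_congr {adj' : N → N → Prop} {S : Finset N} (h : ∀ a ∈ S, ∀ b ∈ S, adj a b ↔ adj' a b) :
    prs adj S = prs adj' S := by
  unfold prs
  refine Finset.sum_congr rfl fun v hv => ?_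
  congr 1; ext w; simp only [mem_nb]
  exact and_congr_right fun hw => h v hv w hw

theorem mkK5 (hs : ∀ a b, adj a b → adj b a) (hi : ∀ a, ¬ adj a a) {T : Finset N} {S : Set N} {a b c d : N}
    (hS : Cn adj S) (hST : S ⊆ T) (ha : a ∈ T) (hb : b ∈ T) (hc : c ∈ T) (hd : d ∈ T)
    (haS : a ∉ S) (hbS : b ∉ S) (hcS : c ∉ S) (hdS : d ∉ S)
    (a' : ∃ x ∈ S, adj x a) (b' : ∃ x ∈ S, adj x b) (c' : ∃ x ∈ S, adj x c) (d' : ∃ x ∈ S, adj x d)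
    (hab : adj a b) (hac : adj a c) (had : adj a d) (hbc : adj b c) (hbd : adj b d) (hcd : adj c d) :
    HasK5on adj T := by
  have ne : ∀ {x y : N}, adj x y → x ≠ y := fun h h' => hi _ (h' ▸ h)
  let B : Fin 5 → Set N := ![S, {a}, {b}, {c}, {d}]
  have key : ∀ i j, i < j → Disjoint (B i) (B j) ∧ ∃ x ∈ B i, ∃ y ∈ B j, adj x y := by
    intro i j hij
    fin_cases i <;> fin_cases j <;> first | (exact absurd hij (by decide)) | skip
    all_goals simp only [B, Matrix.cons_val, Fin.zero_eta, Fin.mk_one, Fin.reduceFinMk, Set.disjoint_singleton_right, Set.mem_singleton_iff, exists_eq_left, Fin.isValue]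
    · exact ⟨haS, a'⟩
    · exact ⟨hbS, b'⟩
    · exact ⟨hcS, c'⟩
    · exact ⟨hdS, d'⟩
    · exact ⟨(ne hab).symm, hab⟩
    · exact ⟨(ne hac).symm, hac⟩
    · exact ⟨(ne had).symm, had⟩
    · exact ⟨(ne hbc).symm, hbc⟩
    · exact ⟨(ne hbd).symm, hbd⟩
    · exact ⟨(ne hcd).symm, hcd⟩
  refine ⟨B, ?_, ?_, ?_, ?_⟩
  · intro i; fin_cases i
    · exact hS
    all_goals exact Cn.singleton _
  · intro i j hij
    rcases lt_or_gt_of_ne hij with h | h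
    · exact (key i j h).1
    · exact (key j i h).1.symm
  · intro i j hij
    rcases lt_or_gt_of_ne hij with h | h
    · exact (key i j h).2
    · obtain ⟨x, hx, y, hy, hxy⟩ := (key j i h).2
      exact ⟨y, hy, x, hx, hs _ _ hxy⟩
  · intro i; fin_cases i
    · exact hST
    all_goals simp [B, ha, hb, hc, hd]

/-- dense small neighbourhood -/
theorem K5_of_nbhd (hs : ∀ a b, adj a b → adj b a) (hi : ∀ a, ¬ adj a a) {T : Finset N} {v : N} (hv : v ∈ T)
    (h4 : 4 ≤ (nb adj T v).card) (h5 : (nb adj T v).card ≤ 5)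
    (h3 : ∀ w ∈ nb adj T v, 3 ≤ (nb adj (nb adj T v) w).card) : HasK5on adj T := by
  classical
  set M := nb adj T v with hM
  have hMT : ∀ w ∈ M, w ∈ T ∧ adj v w := fun w hw => mem_nb.1 hw
  have hvM : v ∉ M := fun h => hi _ (hMT v h).2
  -- each vertex has at most |M|-4 nonneighbours
  have hnon : ∀ w ∈ M, ((M.erase w).filter (fun x => ¬ adj w x)).card + 4 ≤ M.card := by
    intro w hw
    have h1 : nb adj M w = (M.erase w).filter (adj w) := by
      ext x; simp only [mem_nb, Finset.mem_filter, Finset.mem_erase]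
      exact ⟨fun h => ⟨⟨fun h' => hi _ (h' ▸ h.2), h.1⟩, h.2⟩, fun h => ⟨h.1.2, h.2⟩⟩
    have h2 := Finset.card_filter_add_card_filter_not (s := M.erase w) (adj w)
    rw [Finset.card_erase_of_mem hw, ← h1] at h2
    have := h3 w hw
    omega
  have huniq : ∀ w ∈ M, ∀ x ∈ M, ∀ y ∈ M, x ≠ w → y ≠ w → x ≠ y → adj w x ∨ adj w y := by
    intro w hw x hx y hy h1 h2 h3'
    by_contra hcon
    push Not at hcon
    have : 2 ≤ ((M.erase w).filter (fun x => ¬ adj w x)).card := by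
      rw [← Finset.card_pair h3']
      apply Finset.card_le_card
      intro z hz
      simp only [Finset.mem_insert, Finset.mem_singleton] at hz
      rcases hz with rfl | rfl
      · simp [h1, hx, hcon.1]
      · simp [h2, hy, hcon.2]
    have := hnon w hw
    omega
  by_cases hall : ∃ a ∈ M, ∃ b ∈ M, a ≠ b ∧ ¬ adj a b
  · obtain ⟨a, ha, b, hb, hab, hnab⟩ := hall
    have h5' : M.card = 5 := by
      have := hnon a ha
      have h1 : 1 ≤ ((M.erase a).filter (fun x => ¬ adj a x)).card :=
        Finset.card_pos.2 ⟨b, by simp [hab.symm, hb, hnab]⟩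
      omega
    have hnba : ¬ adj b a := fun h => hnab (hs _ _ h)
    have aA : ∀ x ∈ M, x ≠ a → x ≠ b → adj a x := fun x hx h1 h2 =>
      (huniq a ha b hb x hx hab.symm h1 h2.symm).resolve_left hnab
    have bA : ∀ x ∈ M, x ≠ a → x ≠ b → adj b x := fun x hx h1 h2 =>
      (huniq b hb a ha x hx hab h2 h1.symm).resolve_left hnba
    have hc3 : ((M.erase a).erase b).card = 3 := by
      rw [Finset.card_erase_of_mem (by simp [hab.symm, hb]), Finset.card_erase_of_mem ha, h5']
    obtain ⟨c, d, x, hcd, hcx, hdx, hMeq⟩ := Finset.card_eq_three.1 hc3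
    have mem : ∀ y, y ∈ ((M.erase a).erase b) → y ∈ M ∧ y ≠ a ∧ y ≠ b := by
      intro y hy; simp only [Finset.mem_erase] at hy; exact ⟨hy.2.2, hy.2.1, hy.1⟩
    have hc := mem c (by simp [hMeq])
    have hd := mem d (by simp [hMeq])
    have hx := mem x (by simp [hMeq])
    have fin : ∀ c d x, (c ∈ M ∧ c ≠ a ∧ c ≠ b) → (d ∈ M ∧ d ≠ a ∧ d ≠ b) → (x ∈ M ∧ x ≠ a ∧ x ≠ b) →
        c ≠ d → c ≠ x → adj d x → HasK5on adj T := by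
      intro c d x hc hd hx hcd hcx hdx
      have hcn : Cn adj ({a} ∪ {c} : Set N) :=
        (Cn.singleton a).union_adj hs (Cn.singleton c) rfl rfl (aA c hc.1 hc.2.1 hc.2.2)
      refine mkK5 hs hi (S := {a} ∪ {c}) (a := v) (b := b) (c := d) (d := x) hcn ?_ hv (hMT b hb).1 (hMT d hd.1).1
        (hMT x hx.1).1 ?_ ?_ ?_ ?_ ⟨a, by simp, hs _ _ (hMT a ha).2⟩
        ⟨c, by simp, hs _ _ (bA c hc.1 hc.2.1 hc.2.2)⟩ ⟨a, by simp, aA d hd.1 hd.2.1 hd.2.2⟩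
        ⟨a, by simp, aA x hx.1 hx.2.1 hx.2.2⟩ (hMT b hb).2 (hMT d hd.1).2 (hMT x hx.1).2
        (bA d hd.1 hd.2.1 hd.2.2) (bA x hx.1 hx.2.1 hx.2.2) hdx
      · rintro y (rfl | rfl)
        · exact (hMT _ ha).1
        · exact (hMT _ hc.1).1
      · rintro (rfl | rfl)
        · exact hvM ha
        · exact hvM hc.1
      · rintro (h | h)
        · exact hab h.symm
        · exact hc.2.2 h.symm
      · rintro (h | h)
        · exact hd.2.1 h
        · exact hcd h.symm
      · rintro (h | h)
        · exact hx.2.1 h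
        · exact hcx h.symm
    rcases huniq d hd.1 x hx.1 c hc.1 hdx.symm hcd hcx.symm with h | h
    · exact fin c d x hc hd hx hcd hcx h
    · exact fin x d c hx hd hc hdx.symm hcx.symm h
  · push Not at hall
    obtain ⟨M', hM', hc4⟩ := Finset.exists_subset_card_eq h4
    obtain ⟨a, b, c, d, hab, hac, had, hbc, hbd, hcd, rfl⟩ := Finset.card_eq_four.1 hc4
    have ha : a ∈ M := hM' (by simp)
    have hb : b ∈ M := hM' (by simp)
    have hc : c ∈ M := hM' (by simp)
    have hd : d ∈ M := hM' (by simp)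
    refine mkK5 hs hi (S := {v}) (a := a) (b := b) (c := c) (d := d) (Cn.singleton v) (by simp [hv])
      (hMT a ha).1 (hMT b hb).1 (hMT c hc).1 (hMT d hd).1 ?_ ?_ ?_ ?_ ⟨v, rfl, (hMT a ha).2⟩
      ⟨v, rfl, (hMT b hb).2⟩ ⟨v, rfl, (hMT c hc).2⟩ ⟨v, rfl, (hMT d hd).2⟩ (hall a ha b hb hab)
      (hall a ha c hc hac) (hall a ha d hd had) (hall b hb c hc hbc) (hall b hb d hd hbd) (hall c hc d hd hcd)
    · rintro rfl; exact hvM ha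
    · rintro rfl; exact hvM hb
    · rintro rfl; exact hvM hc
    · rintro rfl; exact hvM hd

theorem HasK5on.mono_adj {adj' : N → N → Prop} (h : ∀ a b, adj a b → adj' a b) {T T' : Finset N}
    (hT : T ⊆ T') (hK : HasK5on adj T) : HasK5on adj' T' := by
  obtain ⟨B, h1, h2, h3, h4⟩ := hK
  refine ⟨B, fun i => ⟨(h1 i).1, fun x hx y hy => ?_⟩, h2, fun i j hij => ?_, fun i => (h4 i).trans (by exact_mod_cast hT)⟩
  · exact Relation.ReflTransGen.mono (fun _ _ h' => ⟨h _ _ h'.1, h'.2⟩) _ _ ((h1 i).2 x hx y hy)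
  · obtain ⟨x, hx, y, hy, hxy⟩ := h3 i j hij
    exact ⟨x, hx, y, hy, h _ _ hxy⟩

/-- contraction of `y` into `x` -/
def contr (adj : N → N → Prop) (x y : N) (a b : N) : Prop :=
  a ≠ b ∧ (adj a b ∨ (a = x ∧ adj y b) ∨ (b = x ∧ adj a y))

theorem HasK5on.of_contr [DecidableEq N] (hs : ∀ a b, adj a b → adj b a) {T : Finset N} {x y : N} (hy : y ∈ T)
    (hxy : adj x y) (hK : HasK5on (contr adj x y) (T.erase y)) : HasK5on adj T := by
  obtain ⟨B, h1, h2, h3, h4⟩ := hK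
  let B' : Fin 5 → Set N := fun i => {z | z ∈ B i ∨ (z = y ∧ x ∈ B i)}
  have hyB : ∀ i, y ∉ B i := fun i h => by simpa using h4 i h
  have sub : ∀ i, B i ⊆ B' i := fun i z hz => .inl hz
  have step : ∀ i a b, a ∈ B i → b ∈ B i → contr adj x y a b →
      Relation.ReflTransGen (fun a b => adj a b ∧ a ∈ B' i ∧ b ∈ B' i) a b := by
    rintro i a b ha hb ⟨_, h | ⟨rfl, h⟩ | ⟨rfl, h⟩⟩
    · exact .single ⟨h, .inl ha, .inl hb⟩
    · exact (Relation.ReflTransGen.single ⟨hxy, .inl ha, .inr ⟨rfl, ha⟩⟩).tail ⟨h, .inr ⟨rfl, ha⟩, .inl hb⟩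
    · exact (Relation.ReflTransGen.single ⟨h, .inl ha, .inr ⟨rfl, hb⟩⟩).tail
        ⟨hs _ _ hxy, .inr ⟨rfl, hb⟩, .inl hb⟩
  have conn : ∀ i, ∀ a ∈ B i, ∀ b ∈ B i,
      Relation.ReflTransGen (fun a b => adj a b ∧ a ∈ B' i ∧ b ∈ B' i) a b := by
    intro i a ha b hb
    have := (h1 i).2 a ha b hb
    clear hb
    induction this with
    | refl => exact .refl
    | tail _ h ih => exact ih.trans (step i _ _ h.2.1 h.2.2 h.1)
  refine ⟨B', fun i => ⟨(h1 i).1.mono (sub i), ?_⟩, ?_, ?_, ?_⟩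
  · have toB : ∀ a ∈ B' i, ∃ b ∈ B i,
        Relation.ReflTransGen (fun a b => adj a b ∧ a ∈ B' i ∧ b ∈ B' i) a b := by
      rintro a (ha | ⟨rfl, ha⟩)
      · exact ⟨a, ha, .refl⟩
      · exact ⟨x, ha, .single ⟨hs _ _ hxy, .inr ⟨rfl, ha⟩, .inl ha⟩⟩
    intro a ha b hb
    obtain ⟨a', ha', h5⟩ := toB a ha
    obtain ⟨b', hb', h6⟩ := toB b hb
    exact (h5.trans (conn i a' ha' b' hb')).trans (RT_symm hs h6)
  · intro i j hij
    rw [disjoint_left]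
    rintro z (hz | ⟨rfl, hz⟩) (hz' | ⟨hz1, hz'⟩)
    · exact disjoint_left.1 (h2 i j hij) hz hz'
    · exact hyB i (hz1 ▸ hz)
    · exact hyB j hz'
    · exact disjoint_left.1 (h2 i j hij) hz hz'
  · intro i j hij
    obtain ⟨a, ha, b, hb, ⟨_, h | ⟨rfl, h⟩ | ⟨rfl, h⟩⟩⟩ := h3 i j hij
    · exact ⟨a, .inl ha, b, .inl hb, h⟩
    · exact ⟨y, .inr ⟨rfl, ha⟩, b, .inl hb, h⟩
    · exact ⟨a, .inl ha, y, .inr ⟨rfl, hb⟩, h⟩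
  · rintro i z (hz | ⟨rfl, hz⟩)
    · exact Finset.mem_of_mem_erase (h4 i hz)
    · exact hy

/-- Mader: many edges force a `K₅` minor -/
theorem mader : ∀ (m : ℕ) (adj : N → N → Prop) (T : Finset N), T.card + prs adj T ≤ m →
    (∀ a b, adj a b → adj b a) → (∀ a, ¬ adj a a) → 3 ≤ T.card → 6 * T.card ≤ prs adj T + 10 →
    HasK5on adj T := by
  classical
  intro m
  induction m with
  | zero => intro adj T h _ _ h3; omega
  | succ m ih =>
    intro adj T hm hs hi h3 hp
    by_cases hT3 : T.card = 3
    · exfalso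
      have : prs adj T ≤ ∑ v ∈ T, 2 := by
        apply Finset.sum_le_sum
        intro v hv
        have : nb adj T v ⊆ T.erase v := by
          intro w hw; rw [mem_nb] at hw
          exact Finset.mem_erase.2 ⟨fun h => hi _ (h ▸ hw.2), hw.1⟩
        have := Finset.card_le_card this
        rw [Finset.card_erase_of_mem hv] at this; omega
      rw [Finset.sum_const, hT3] at this
      simp at this; omega
    have h4 : 4 ≤ T.card := by omega
    -- low degree vertex
    by_cases hlow : ∃ v ∈ T, (nb adj T v).card ≤ 3
    · obtain ⟨v, hv, hd⟩ := hlow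
      have h1 := prs_insert hs hi (Finset.notMem_erase v T)
      rw [Finset.insert_erase hv] at h1
      have h2 : (nb adj (T.erase v) v).card ≤ 3 := (Finset.card_le_card (by
        intro w hw; rw [mem_nb] at hw ⊢; exact ⟨Finset.mem_of_mem_erase hw.1, hw.2⟩)).trans hd
      have h5 := Finset.card_erase_of_mem hv
      exact (ih adj (T.erase v) (by omega) hs hi (by omega) (by omega)).mono_adj (fun _ _ h => h)
        (Finset.erase_subset v T)
    push Not at hlow
    -- contractible edge
    by_cases hcon : ∃ x ∈ T, ∃ y ∈ T, adj x y ∧ (nb adj (nb adj T x) y).card ≤ 2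
    · obtain ⟨x, hx, y, hy, hxy, hcm⟩ := hcon
      have hne : x ≠ y := fun h => hi _ (h ▸ hxy)
      set S := (T.erase y).erase x with hS
      have hxS : x ∉ S := Finset.notMem_erase _ _
      have hyS : y ∉ S := fun h => by simp [hS] at h
      have hTy : insert x S = T.erase y := Finset.insert_erase (by simp [hne, hx])
      have e1 := prs_insert hs hi (Finset.notMem_erase y T)
      rw [Finset.insert_erase hy] at e1
      have e2 := prs_insert hs hi hxS
      rw [hTy] at e2
      have hs' : ∀ a b, contr adj x y a b → contr adj x y b a := by
        rintro a b ⟨h, h1 | ⟨h1, h2⟩ | ⟨h1, h2⟩⟩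
        · exact ⟨h.symm, .inl (hs _ _ h1)⟩
        · exact ⟨h.symm, .inr (.inr ⟨h1, hs _ _ h2⟩)⟩
        · exact ⟨h.symm, .inr (.inl ⟨h1, hs _ _ h2⟩)⟩
      have hi' : ∀ a, ¬ contr adj x y a a := fun a h => h.1 rfl
      have e3 := prs_insert hs' hi' hxS
      rw [hTy] at e3
      have e4 : prs (contr adj x y) S = prs adj S := by
        apply prs_congr
        intro a ha b hb
        have hax : a ≠ x := fun h => hxS (h ▸ ha)
        have hbx : b ≠ x := fun h => hxS (h ▸ hb)
        simp only [contr, hax, hbx, false_and, or_false]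
        exact ⟨fun h => h.2, fun h => ⟨fun h' => hi _ (h' ▸ h), h⟩⟩
      have e5 : nb (contr adj x y) S x = nb adj S x ∪ nb adj S y := by
        ext w; simp only [mem_nb, Finset.mem_union, contr]
        constructor
        · rintro ⟨hw, h, h1 | ⟨_, h2⟩ | ⟨h1, h2⟩⟩
          · exact .inl ⟨hw, h1⟩
          · exact .inr ⟨hw, h2⟩
          · exact absurd h1.symm h
        · rintro (⟨hw, h⟩ | ⟨hw, h⟩)
          · exact ⟨hw, fun h' => hxS (h' ▸ hw), .inl h⟩
          · exact ⟨hw, fun h' => hxS (h' ▸ hw), .inr (.inl ⟨by trivial, h⟩)⟩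
      have e6 := Finset.card_union_add_card_inter (nb adj S x) (nb adj S y)
      have e7 : (nb adj S x ∩ nb adj S y).card ≤ 2 := (Finset.card_le_card (by
        intro w hw
        simp only [Finset.mem_inter, mem_nb] at hw ⊢
        exact ⟨⟨by have := hw.1.1; simp [hS] at this; exact this.2.2, hw.1.2⟩, hw.2.2⟩)).trans hcm
      have e8 : (nb adj (T.erase y) y).card = (nb adj S y).card + 1 := by
        rw [← hTy]
        rw [show nb adj (insert x S) y = insert x (nb adj S y) by
          ext w; simp only [mem_nb, Finset.mem_insert]
          constructor
          · rintro ⟨rfl | h, h2⟩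
            · exact .inl rfl
            · exact .inr ⟨h, h2⟩
          · rintro (rfl | h)
            · exact ⟨.inl rfl, hs _ _ hxy⟩
            · exact ⟨.inr h.1, h.2⟩]
        exact Finset.card_insert_of_notMem (fun h => hxS (mem_nb.1 h).1)
      have h5 := Finset.card_erase_of_mem hy
      rw [e5] at e3
      exact (ih (contr adj x y) (T.erase y) (by omega) hs' hi' (by omega) (by omega)).of_contr hs hy hxy
    push Not at hcon
    -- too many edges
    by_cases hbig : prs adj T + 10 < 6 * T.card + 2
    · have hex : ∃ v ∈ T, (nb adj T v).card ≤ 5 := by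
        by_contra hcon2
        push Not at hcon2
        have : ∑ v ∈ T, 6 ≤ prs adj T := Finset.sum_le_sum (fun v hv => hcon2 v hv)
        rw [Finset.sum_const, smul_eq_mul] at this
        omega
      obtain ⟨v, hv, h5⟩ := hex
      refine K5_of_nbhd hs hi hv (hlow v hv) h5 ?_
      intro w hw
      have := mem_nb.1 hw
      exact hcon v hv w this.1 this.2
    · obtain ⟨v, hv⟩ : T.Nonempty := Finset.card_pos.1 (by omega)
      obtain ⟨w, hw⟩ : (nb adj T v).Nonempty := Finset.card_pos.1 (by have := hlow v hv; omega)
      have hvw := mem_nb.1 hw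
      let adj' : N → N → Prop := fun a b => adj a b ∧ ¬ (a = v ∧ b = w) ∧ ¬ (a = w ∧ b = v)
      have hs' : ∀ a b, adj' a b → adj' b a := fun a b h => ⟨hs _ _ h.1, fun h' => h.2.2 h'.symm, fun h' => h.2.1 h'.symm⟩
      have hi' : ∀ a, ¬ adj' a a := fun a h => hi a h.1
      have hnevw : v ≠ w := fun h => hi _ (h ▸ hvw.2)
      have e1 := prs_insert hs hi (Finset.notMem_erase v T)
      have e2 := prs_insert hs' hi' (Finset.notMem_erase v T)
      rw [Finset.insert_erase hv] at e1 e2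
      have e3 : prs adj (T.erase v) = prs adj' (T.erase v) := by
        apply prs_congr
        intro a ha b hb
        have ha' : a ≠ v := Finset.ne_of_mem_erase ha
        have hb' : b ≠ v := Finset.ne_of_mem_erase hb
        simp [adj', ha', hb']
      have e4 : nb adj' (T.erase v) v = (nb adj (T.erase v) v).erase w := by
        ext z; simp only [mem_nb, Finset.mem_erase, adj']
        constructor
        · rintro ⟨h1, h2, h3, h4⟩
          exact ⟨fun h => h3 ⟨by trivial, h⟩, h1, h2⟩
        · rintro ⟨h1, h2, h3⟩
          exact ⟨h2, h3, fun h => h1 h.2, fun h => hnevw h.1⟩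
      have e5 : w ∈ nb adj (T.erase v) v := mem_nb.2 ⟨Finset.mem_erase.2 ⟨hnevw.symm, hvw.1⟩, hvw.2⟩
      have e6 := Finset.card_erase_of_mem e5
      have e7 := Finset.card_pos.2 ⟨w, e5⟩
      rw [e4] at e2
      exact (ih adj' T (by omega) hs' hi' h3 (by omega)).mono_adj (fun _ _ h => h.1) (Finset.Subset.refl T)

/-- graphs without `K₅` minor have few edges -/
theorem prs_le (hs : ∀ a b, adj a b → adj b a) (hi : ∀ a, ¬ adj a a) (hK : ¬ HasK5 adj) (T : Finset N) :
    prs adj T ≤ 6 * T.card := by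
  classical
  by_cases h3 : 3 ≤ T.card
  · by_contra hcon
    obtain ⟨B, h1, h2, h3, _⟩ := mader _ adj T le_rfl hs hi h3 (by omega)
    exact hK ⟨B, h1, h2, h3⟩
  · have : prs adj T ≤ ∑ v ∈ T, 2 := Finset.sum_le_sum fun v hv =>
      (Finset.card_le_card (Finset.filter_subset _ _)).trans (by omega)
    rw [Finset.sum_const, smul_eq_mul] at this
    omega

end F1
end CL

namespace CL

section F2
variable {N : Type*} [DecidableEq N] {adj : N → N → Prop}

/-- total of a natural weight -/
def tot (c : N → ℕ) (S : Finset N) : ℕ := ∑ v ∈ S, c v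

theorem tot_mono (c : N → ℕ) {S T : Finset N} (h : S ⊆ T) : tot c S ≤ tot c T :=
  Finset.sum_le_sum_of_subset h

theorem tot_union_le (c : N → ℕ) (S T : Finset N) : tot c (S ∪ T) ≤ tot c S + tot c T := by
  unfold tot; rw [← Finset.sum_union_inter]; omega

/-- a big connected set in `U \ X` -/
def Big (adj : N → N → Prop) (μ : N → ℕ) (U X D : Finset N) : Prop :=
  Cn adj (D : Set N) ∧ D ⊆ U \ X ∧ tot μ U < 2 * tot μ D

open Classical in
/-- the haven -/
noncomputable def bet (adj : N → N → Prop) (μ : N → ℕ) (U X : Finset N) : Finset N :=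
  U.filter (fun v => ∃ D, Big adj μ U X D ∧ v ∈ D)

variable {μ : N → ℕ} {U : Finset N}

theorem mem_bet {X : Finset N} {v : N} : v ∈ bet adj μ U X ↔ ∃ D, Big adj μ U X D ∧ v ∈ D := by
  classical
  unfold bet
  rw [Finset.mem_filter]
  constructor
  · exact fun h => h.2
  · rintro ⟨D, hD, hv⟩
    exact ⟨(Finset.mem_sdiff.1 (hD.2.1 hv)).1, D, hD, hv⟩

theorem Big.inter {X D D' : Finset N} (h : Big adj μ U X D) (h' : Big adj μ U X D') :
    ∃ v, v ∈ D ∧ v ∈ D' := by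
  by_contra hcon
  push Not at hcon
  have hd : Disjoint D D' := Finset.disjoint_left.2 hcon
  have h1 : tot μ (D ∪ D') = tot μ D + tot μ D' := Finset.sum_union hd
  have h2 := tot_mono μ (S := D ∪ D') (T := U) (Finset.union_subset
    (h.2.1.trans Finset.sdiff_subset) (h'.2.1.trans Finset.sdiff_subset))
  have := h.2.2; have := h'.2.2
  omega

theorem bet_sub {X : Finset N} : bet adj μ U X ⊆ U \ X := by
  intro v hv
  obtain ⟨D, hD, hv⟩ := mem_bet.1 hv
  exact hD.2.1 hv

theorem bet_big (hs : ∀ a b, adj a b → adj b a) {X : Finset N} (h : ∃ D, Big adj μ U X D) :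
    Big adj μ U X (bet adj μ U X) := by
  obtain ⟨D, hD⟩ := h
  obtain ⟨x, hx⟩ := hD.1.1
  have sub : ∀ D', Big adj μ U X D' → D' ⊆ bet adj μ U X := fun D' h v hv => mem_bet.2 ⟨D', h, hv⟩
  have l : ∀ z ∈ bet adj μ U X, Relation.ReflTransGen
      (fun a b => adj a b ∧ a ∈ (bet adj μ U X : Set N) ∧ b ∈ (bet adj μ U X : Set N)) z x := by
    intro z hz
    obtain ⟨D', hD', hz'⟩ := mem_bet.1 hz
    obtain ⟨y, hy, hy'⟩ := hD'.inter hD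
    exact (RT_mono (by exact_mod_cast sub D' hD') (hD'.1.2 z hz' y hy)).trans
      (RT_mono (by exact_mod_cast sub D hD) (hD.1.2 y hy' x hx))
  refine ⟨⟨⟨x, by exact_mod_cast sub D hD hx⟩, fun a ha b hb => (l a ha).trans (RT_symm hs (l b hb))⟩,
    bet_sub, lt_of_lt_of_le hD.2.2 ?_⟩
  have := tot_mono μ (sub D hD)
  omega

theorem bet_anti {X X' : Finset N} (h : X ⊆ X') : bet adj μ U X' ⊆ bet adj μ U X := by
  intro v hv
  obtain ⟨D, hD, hv⟩ := mem_bet.1 hv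
  exact mem_bet.2 ⟨D, ⟨hD.1, hD.2.1.trans (Finset.sdiff_subset_sdiff le_rfl h), hD.2.2⟩, hv⟩

/-- neighbours of the haven lie in the haven or in `X` -/
theorem bet_adj (hs : ∀ a b, adj a b → adj b a) {X : Finset N} {x y : N}
    (hx : x ∈ bet adj μ U X) (hy : y ∈ U) (hyX : y ∉ X) (hxy : adj x y) : y ∈ bet adj μ U X := by
  obtain ⟨D, hD, hxD⟩ := mem_bet.1 hx
  refine mem_bet.2 ⟨D ∪ {y}, ⟨?_, ?_, ?_⟩, by simp⟩
  · rw [Finset.coe_union, Finset.coe_singleton]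
    exact hD.1.union_adj hs (Cn.singleton y) hxD rfl hxy
  · exact Finset.union_subset hD.2.1 (by simp [hy, hyX])
  · have := tot_mono μ (Finset.subset_union_left (s₁ := D) (s₂ := {y})); have := hD.2.2; omega

/-- coveys -/
structure Cov (adj : N → N → Prop) (c μ : N → ℕ) (U : Finset N) (r k : ℕ) (C : Fin k → Finset N)
    (X : Finset N) : Prop where
  hk : k ≤ 4
  conn : ∀ i, Cn adj (C i : Set N)
  disj : ∀ i j, i ≠ j → Disjoint (C i) (C j)
  touch : ∀ i j, i ≠ j → ∃ x ∈ C i, ∃ y ∈ C j, adj x y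
  cover : X ⊆ Finset.univ.biUnion C
  sub : X ⊆ U
  cost : ∀ i, tot c (X ∩ C i) ≤ r
  away : ∀ i, Disjoint (C i) (bet adj μ U X)

theorem Cov.cost_le {c : N → ℕ} {r k : ℕ} {C : Fin k → Finset N} {X : Finset N}
    (h : Cov adj c μ U r k C X) : tot c X ≤ 4 * r := by
  have h1 : tot c X ≤ ∑ i, tot c (X ∩ C i) := by
    have : X = Finset.univ.biUnion (fun i => X ∩ C i) := by
      ext v; simp only [Finset.mem_biUnion, Finset.mem_univ, true_and, Finset.mem_inter]
      constructor
      · intro hv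
        have := h.cover hv
        simp only [Finset.mem_biUnion, Finset.mem_univ, true_and] at this
        obtain ⟨i, hi⟩ := this
        exact ⟨i, hv, hi⟩
      · rintro ⟨i, hv, _⟩; exact hv
    conv_lhs => rw [this]
    unfold tot
    rw [Finset.sum_biUnion]
    intro i _ j _ hij
    exact (h.disj i j hij).mono Finset.inter_subset_right Finset.inter_subset_right
  calc tot c X ≤ ∑ i : Fin k, r := h1.trans (Finset.sum_le_sum fun i _ => h.cost i)
    _ ≤ 4 * r := by simp; exact Nat.mul_le_mul_right r h.hk

/-- Steiner alternative -/
theorem steiner (hs : ∀ a b, adj a b → adj b a) {c : N → ℕ} {r k : ℕ} (hr : 0 < r) (hk : k ≤ 4) (hk0 : 0 < k)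
    {b : Finset N} (hb : Cn adj (b : Set N)) (hμ : ∀ v ∈ b, c v ^ 2 ≤ μ v) (hbr : 4 * tot μ b ≤ r ^ 2)
    (A : Fin k → Finset N) (hA : ∀ i, (A i).Nonempty) (hAb : ∀ i, A i ⊆ b) :
    (∃ T ⊆ b, Cn adj (T : Set N) ∧ (∀ i, ∃ v ∈ A i, v ∈ T) ∧ tot c T ≤ r) ∨
    ∃ Z ⊆ b, tot c Z ≤ r ∧ ∀ D : Finset N, Cn adj (D : Set N) → D ⊆ b \ Z → ∃ i, Disjoint D (A i) := by
  classical
  -- good sets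
  let Gd : ℕ → N → Set ℕ := fun j v => {m | ∃ S : Finset N, S ⊆ b ∧ Cn adj (S : Set N) ∧ v ∈ S ∧
    (∀ i : Fin k, i.val ≤ j → ∃ w ∈ A i, w ∈ S) ∧ tot c S = m}
  let d : ℕ → N → ℕ := fun j v => sInf (Gd j v)
  have hne : ∀ j, ∀ v ∈ b, (Gd j v).Nonempty := by
    intro j v hv
    refine ⟨_, b, le_rfl, hb, hv, fun i _ => ?_, rfl⟩
    obtain ⟨w, hw⟩ := hA i
    exact ⟨w, hw, hAb i hw⟩
  have hd : ∀ j, ∀ v ∈ b, d j v ∈ Gd j v := fun j v hv => Nat.sInf_mem (hne j v hv)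
  by_cases hT : ∃ v ∈ b, d (k-1) v ≤ r
  · obtain ⟨v, hv, hle⟩ := hT
    obtain ⟨S, hSb, hS, hvS, hm, ht⟩ := hd (k-1) v hv
    exact .inl ⟨S, hSb, hS, fun i => hm i (by omega), ht ▸ hle⟩
  push Not at hT
  right
  let Z : ℕ → Finset N := fun θ => b.filter (fun v => ∃ j < k, d j v ≤ θ + c v ∧ θ < d j v)
  have hsum : ∑ θ ∈ Finset.range r, tot c (Z θ) ≤ k * tot μ b := by
    have h1 : ∀ θ, tot c (Z θ) ≤ ∑ v ∈ b, ∑ j ∈ Finset.range k, if (d j v ≤ θ + c v ∧ θ < d j v) then c v else 0 := by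
      intro θ
      unfold tot
      rw [Finset.sum_filter]
      apply Finset.sum_le_sum
      intro v hv
      split_ifs with h
      · obtain ⟨j, hj, h⟩ := h
        have := Finset.single_le_sum (f := fun j => if (d j v ≤ θ + c v ∧ θ < d j v) then c v else 0)
          (fun _ _ => Nat.zero_le _) (Finset.mem_range.2 hj)
        simp only [h, and_self, if_true] at this
        exact this
      · exact Nat.zero_le _
    calc ∑ θ ∈ Finset.range r, tot c (Z θ)
        ≤ ∑ θ ∈ Finset.range r, ∑ v ∈ b, ∑ j ∈ Finset.range k,
          (if (d j v ≤ θ + c v ∧ θ < d j v) then c v else 0) := Finset.sum_le_sum fun θ _ => h1 θ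
      _ = ∑ v ∈ b, ∑ j ∈ Finset.range k, ∑ θ ∈ Finset.range r,
          (if (d j v ≤ θ + c v ∧ θ < d j v) then c v else 0) := by
        rw [Finset.sum_comm]
        exact Finset.sum_congr rfl fun v _ => Finset.sum_comm
      _ ≤ ∑ v ∈ b, ∑ j ∈ Finset.range k, μ v := by
        refine Finset.sum_le_sum fun v hv => Finset.sum_le_sum fun j _ => ?_
        rw [← Finset.sum_filter, Finset.sum_const, smul_eq_mul]
        refine le_trans ?_ (hμ v hv)
        rw [sq]
        refine Nat.mul_le_mul_right _ ?_
        calc _ ≤ (Finset.Ico (d j v - c v) (d j v)).card := Finset.card_le_card (by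
              intro θ hθ
              simp only [Finset.mem_filter, Finset.mem_Ico] at hθ ⊢
              omega)
          _ ≤ c v := by rw [Nat.card_Ico]; omega
      _ = k * tot μ b := by
        unfold tot; rw [Finset.mul_sum]; simp
  obtain ⟨θ, hθ, hZ⟩ : ∃ θ ∈ Finset.range r, tot c (Z θ) ≤ r := by
    by_contra hcon
    push Not at hcon
    have : ∑ θ ∈ Finset.range r, (r + 1) ≤ ∑ θ ∈ Finset.range r, tot c (Z θ) :=
      Finset.sum_le_sum fun θ hθ => hcon θ hθ
    rw [Finset.sum_const, Finset.card_range, smul_eq_mul] at this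
    have h3 : k * tot μ b ≤ 4 * tot μ b := Nat.mul_le_mul_right _ hk
    nlinarith
  rw [Finset.mem_range] at hθ
  refine ⟨Z θ, Finset.filter_subset _ _, hZ, ?_⟩
  intro D hD hDb
  by_contra hcon
  push Not at hcon
  have hmeet : ∀ i, ∃ v ∈ D, v ∈ A i := fun i => by
    have := hcon i; rw [Finset.disjoint_left] at this; push Not at this; exact this
  have hnZ : ∀ v ∈ D, v ∈ b ∧ ∀ j < k, d j v ≤ θ + c v → d j v ≤ θ := by
    intro v hv
    have := Finset.mem_sdiff.1 (hDb hv)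
    refine ⟨this.1, fun j hj h => ?_⟩
    by_contra hlt
    exact this.2 (Finset.mem_filter.2 ⟨this.1, j, hj, h, by omega⟩)
  have spread : ∀ j < k, ∀ v ∈ D, d j v ≤ θ → ∀ w ∈ D, d j w ≤ θ := by
    intro j hj v hv hvθ w hw
    have := hD.2 v hv w hw
    clear hw
    induction this with
    | refl => exact hvθ
    | tail _ h ih =>
      rename_i x y _
      have hxb := (hnZ x h.2.1).1
      have hyb := (hnZ y h.2.2).1
      apply (hnZ y h.2.2).2 j hj
      obtain ⟨S, hSb, hS, hxS, hm, ht⟩ := hd j x hxb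
      have h1 : d j y ≤ tot c (S ∪ {y}) := by
        apply Nat.sInf_le
        refine ⟨S ∪ {y}, Finset.union_subset hSb (by simpa using hyb), ?_, by simp, ?_, rfl⟩
        · rw [Finset.coe_union, Finset.coe_singleton]
          exact hS.union_adj hs (Cn.singleton y) hxS rfl h.1
        · intro i hi
          obtain ⟨w, hw, hw'⟩ := hm i hi
          exact ⟨w, hw, Finset.mem_union_left _ hw'⟩
      have h2 := tot_union_le c S {y}
      have h3 : tot c {y} = c y := by simp [tot]
      omega
  have all : ∀ j < k, ∀ w ∈ D, d j w ≤ θ := by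
    intro j
    induction j with
    | zero =>
      intro hj w hw
      obtain ⟨v, hv, hvA⟩ := hmeet ⟨0, hj⟩
      refine spread 0 hj v hv ?_ w hw
      apply (hnZ v hv).2 0 hj
      have h1 : d 0 v ≤ tot c {v} := by
        apply Nat.sInf_le
        refine ⟨{v}, by simpa using (hnZ v hv).1, ?_, by simp, ?_, rfl⟩
        · rw [Finset.coe_singleton]; exact Cn.singleton v
        · intro i hi
          have : i = ⟨0, hj⟩ := Fin.ext (by simpa using hi)
          subst this
          exact ⟨v, hvA, by simp⟩
      have h3 : tot c {v} = c v := by simp [tot]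
      omega
    | succ j ih =>
      intro hj w hw
      obtain ⟨v, hv, hvA⟩ := hmeet ⟨j+1, hj⟩
      refine spread (j+1) hj v hv ?_ w hw
      obtain ⟨S, hSb, hS, hxS, hm, ht⟩ := hd j v (hnZ v hv).1
      have h0 := ih (by omega) v hv
      refine le_trans (Nat.sInf_le ?_) h0
      refine ⟨S, hSb, hS, hxS, ?_, ht⟩
      intro i hi
      rcases Nat.lt_or_ge j i.val with h | h
      · have : i = ⟨j+1, hj⟩ := Fin.ext (by simp; omega)
        subst this
        exact ⟨v, hvA, hxS⟩
      · exact hm i h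
  obtain ⟨v, hv⟩ := hD.1
  have h1 := all (k-1) (by omega) v hv
  have h2 := hT v (hnZ v hv).1
  omega

end F2
end CL

namespace CL

section F3
variable {N : Type*} [DecidableEq N] {adj : N → N → Prop} {μ : N → ℕ} {U : Finset N}

/-- induction along connectivity: a closed property spreads in a connected set -/
theorem Cn.spread {B : Set N} (hB : Cn adj B) (P : N → Prop) {x : N} (hx : x ∈ B) (hPx : P x)
    (h : ∀ a b, a ∈ B → b ∈ B → P a → adj a b → P b) : ∀ y ∈ B, P y := by
  intro y hy
  have := hB.2 x hx y hy
  clear hy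
  induction this with
  | refl => exact hPx
  | tail _ h' ih => exact h _ _ h'.2.1 h'.2.2 ih h'.1

/-- Alon–Seymour–Thomas separator -/
theorem separator (hs : ∀ a b, adj a b → adj b a) (hK : ¬ HasK5 adj) {c : N → ℕ} {r : ℕ} (hr : 0 < r)
    (hμ : ∀ v ∈ U, c v ^ 2 ≤ μ v) (hbr : 4 * tot μ U ≤ r ^ 2) :
    ∃ X ⊆ U, tot c X ≤ 5 * r ∧ ∀ D : Finset N, Cn adj (D : Set N) → D ⊆ U \ X → 2 * tot μ D ≤ tot μ U := by
  classical
  by_contra hcon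
  push Not at hcon
  have hbig : ∀ X ⊆ U, tot c X ≤ 5 * r → Big adj μ U X (bet adj μ U X) := by
    intro X hX h
    obtain ⟨D, h1, h2, h3⟩ := hcon X hX h
    exact bet_big hs ⟨D, h1, h2, h3⟩
  have main : ∀ m k (C : Fin k → Finset N) X, Cov adj c μ U r k C X →
      5 * (bet adj μ U X).card + k ≤ m → False := by
    intro m
    induction m with
    | zero =>
      intro k C X hC hm
      have := (hbig X hC.sub (by have := hC.cost_le; omega)).1.1
      have : 0 < (bet adj μ U X).card := Finset.card_pos.2 (by exact_mod_cast this)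
      omega
    | succ m ih =>
      intro k C X hC hm
      have hXc := hC.cost_le
      have hB := hbig X hC.sub (by omega)
      set b := bet adj μ U X with hb
      have hbU : b ⊆ U := hB.2.1.trans Finset.sdiff_subset
      have hbX : ∀ v ∈ b, v ∉ X := fun v hv => (Finset.mem_sdiff.1 (hB.2.1 hv)).2
      let A : Fin k → Finset N := fun i => b.filter (fun v => ∃ w ∈ C i, adj v w)
      have addT : ∀ T ⊆ b, Cn adj (T : Set N) → (∀ i, ∃ v ∈ A i, v ∈ T) → tot c T ≤ r → False := by
        intro T hTb hT hTA hTc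
        have hdT : ∀ i, Disjoint (C i) T := fun i => (hC.away i).mono_right hTb
        have htT : ∀ i, ∃ x ∈ C i, ∃ y ∈ T, adj x y := by
          intro i
          obtain ⟨v, hv, hvT⟩ := hTA i
          obtain ⟨_, w, hw, hvw⟩ := Finset.mem_filter.1 hv
          exact ⟨w, hw, v, hvT, hs _ _ hvw⟩
        let C' : Fin (k+1) → Finset N := Fin.cons T C
        have conn : ∀ i, Cn adj (C' i : Set N) := by
          intro i; refine Fin.cases ?_ ?_ i
          · simpa [C'] using hT
          · intro j; simpa [C'] using hC.conn j
        have disj : ∀ i j, i ≠ j → Disjoint (C' i) (C' j) := by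
          intro i j
          refine Fin.cases ?_ (fun i => ?_) i <;> refine Fin.cases ?_ (fun j => ?_) j
          · intro h; exact absurd rfl h
          · intro _; simpa [C'] using (hdT j).symm
          · intro _; simpa [C'] using (hdT i)
          · intro h; simpa [C'] using hC.disj i j (fun h' => h (by rw [h']))
        have touch : ∀ i j, i ≠ j → ∃ x ∈ C' i, ∃ y ∈ C' j, adj x y := by
          intro i j
          refine Fin.cases ?_ (fun i => ?_) i <;> refine Fin.cases ?_ (fun j => ?_) j
          · intro h; exact absurd rfl h
          · intro _
            obtain ⟨x, hx, y, hy, hxy⟩ := htT j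
            exact ⟨y, by simpa [C'] using hy, x, by simpa [C'] using hx, hs _ _ hxy⟩
          · intro _
            obtain ⟨x, hx, y, hy, hxy⟩ := htT i
            exact ⟨x, by simpa [C'] using hx, y, by simpa [C'] using hy, hxy⟩
          · intro h; simpa [C'] using hC.touch i j (fun h' => h (by rw [h']))
        by_cases hk4 : k = 4
        · subst hk4
          apply hK
          refine ⟨fun i => (C' i : Set N), conn, fun i j h => Finset.disjoint_coe.2 (disj i j h), ?_⟩
          intro i j h
          obtain ⟨x, hx, y, hy, hxy⟩ := touch i j h
          exact ⟨x, by exact_mod_cast hx, y, by exact_mod_cast hy, hxy⟩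
        have hk := hC.hk
        have hXT : X ∪ T ⊆ U := Finset.union_subset hC.sub (hTb.trans hbU)
        have hbs : bet adj μ U (X ∪ T) ⊆ b \ T := by
          intro v hv
          refine Finset.mem_sdiff.2 ⟨bet_anti Finset.subset_union_left hv, fun h => ?_⟩
          exact (Finset.mem_sdiff.1 (bet_sub hv)).2 (Finset.mem_union_right _ h)
        refine ih (k+1) C' (X ∪ T) ⟨by omega, conn, disj, touch, ?_, hXT, ?_, ?_⟩ ?_
        · intro v hv
          rw [Finset.mem_biUnion]
          rcases Finset.mem_union.1 hv with h | h
          · obtain ⟨i, _, hi⟩ := Finset.mem_biUnion.1 (hC.cover h)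
            exact ⟨i.succ, Finset.mem_univ _, by simpa [C'] using hi⟩
          · exact ⟨0, Finset.mem_univ _, by simpa [C'] using h⟩
        · intro i; refine Fin.cases ?_ (fun i => ?_) i
          · simp only [C', Fin.cons_zero]
            exact (tot_mono c Finset.inter_subset_right).trans hTc
          · simp only [C', Fin.cons_succ]
            refine (tot_mono c ?_).trans (hC.cost i)
            intro v hv
            simp only [Finset.mem_inter, Finset.mem_union] at hv ⊢
            refine ⟨hv.1.resolve_right fun h => Finset.disjoint_left.1 (hdT i) hv.2 h, hv.2⟩
        · intro i; refine Fin.cases ?_ (fun i => ?_) i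
          · simp only [C', Fin.cons_zero]
            exact Finset.disjoint_left.2 fun v hv hv' => (Finset.mem_sdiff.1 (hbs hv')).2 hv
          · simp only [C', Fin.cons_succ]
            exact (hC.away i).mono_right (hbs.trans Finset.sdiff_subset)
        · have h1 := Finset.card_le_card hbs
          rw [Finset.card_sdiff_of_subset hTb] at h1
          have h2 : 0 < T.card := Finset.card_pos.2 (by exact_mod_cast hT.1)
          have h3 := Finset.card_le_card hTb
          omega
      -- drop
      by_cases hdrop : ∃ i, A i = ∅
      · obtain ⟨i, hi⟩ := hdrop
        have hno : ∀ v ∈ b, ∀ w ∈ C i, ¬ adj v w := fun v hv w hw h => by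
          have : v ∈ A i := Finset.mem_filter.2 ⟨hv, w, hw, h⟩
          rw [hi] at this; simp at this
        obtain ⟨k, rfl⟩ : ∃ k', k = k' + 1 := ⟨k - 1, by have := i.pos; omega⟩
        have hX' : X \ C i ⊆ X := Finset.sdiff_subset
        have hbs : bet adj μ U (X \ C i) ⊆ b := by
          have hB' := hbig (X \ C i) (hX'.trans hC.sub) (by have := tot_mono c hX'; omega)
          obtain ⟨x, hx⟩ := hB.1.1
          have hx' : x ∈ bet adj μ U (X \ C i) := bet_anti hX' hx
          refine hB'.1.spread (fun v => v ∈ b) hx' hx ?_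
          intro v w hv hw hvb hvw
          have hwU := Finset.mem_sdiff.1 (bet_sub hw)
          refine bet_adj hs hvb hwU.1 (fun hwX => ?_) hvw
          refine hwU.2 (Finset.mem_sdiff.2 ⟨hwX, fun hwC => hno v hvb w hwC hvw⟩)
        refine ih k (fun j => C (i.succAbove j)) (X \ C i) ⟨by have := hC.hk; omega, fun j => hC.conn _,
          fun j l h => hC.disj _ _ (fun h' => h (Fin.succAbove_right_injective h')),
          fun j l h => hC.touch _ _ (fun h' => h (Fin.succAbove_right_injective h')), ?_,
          hX'.trans hC.sub, ?_, ?_⟩ ?_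
        · intro v hv
          have hv' := Finset.mem_sdiff.1 hv
          obtain ⟨l, _, hl⟩ := Finset.mem_biUnion.1 (hC.cover hv'.1)
          have : l ≠ i := fun h => hv'.2 (h ▸ hl)
          obtain ⟨j, rfl⟩ := Fin.exists_succAbove_eq this
          exact Finset.mem_biUnion.2 ⟨j, Finset.mem_univ _, hl⟩
        · intro j
          exact (tot_mono c (Finset.inter_subset_inter hX' le_rfl)).trans (hC.cost _)
        · intro j; exact (hC.away _).mono_right hbs
        · have := Finset.card_le_card hbs; omega
      push Not at hdrop
      have hAne : ∀ i, (A i).Nonempty := hdrop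
      rcases Nat.eq_zero_or_pos k with rfl | hk0
      · obtain ⟨v, hv⟩ := hB.1.1
        have hv : v ∈ b := hv
        refine addT {v} (by simpa using hv) (by rw [Finset.coe_singleton]; exact Cn.singleton v)
          (fun i => i.elim0) ?_
        have h1 := hμ v (hbU hv)
        have h2 : μ v ≤ tot μ U := Finset.single_le_sum (f := μ) (fun _ _ => Nat.zero_le _) (hbU hv)
        have h3 : tot c {v} = c v := by simp [tot]
        rw [h3]
        by_contra h
        nlinarith
      rcases steiner (μ := μ) hs hr hC.hk hk0 hB.1 (fun v hv => hμ v (hbU hv))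
        ((Nat.mul_le_mul_left 4 (tot_mono μ hbU)).trans hbr) A hAne (fun i => Finset.filter_subset _ _) with
        ⟨T, h1, h2, h3, h4⟩ | ⟨Z, hZb, hZc, hZ⟩
      · exact addT T h1 h2 h3 h4
      have hXZ : X ∪ Z ⊆ U := Finset.union_subset hC.sub (hZb.trans hbU)
      have hY := hbig (X ∪ Z) hXZ (by have := tot_union_le c X Z; omega)
      set Y := bet adj μ U (X ∪ Z) with hYdef
      have hYb : Y ⊆ b := bet_anti Finset.subset_union_left
      have hYZ : ∀ v ∈ Y, v ∉ Z := fun v hv h =>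
        (Finset.mem_sdiff.1 (hY.2.1 hv)).2 (Finset.mem_union_right _ h)
      obtain ⟨i, hi⟩ := hZ Y hY.1 (fun v hv => Finset.mem_sdiff.2 ⟨hYb hv, hYZ v hv⟩)
      have hYA : ∀ v ∈ Y, v ∉ A i := fun v hv h => Finset.disjoint_left.1 hi hv h
      -- pieces of `b \ Y` reachable from `A i`
      let rel : N → N → Prop := fun a b' => adj a b' ∧ a ∈ ((b \ Y : Finset N) : Set N) ∧ b' ∈ ((b \ Y : Finset N) : Set N)
      let P : Finset N := (b \ Y).filter (fun v => ∃ a ∈ A i, Relation.ReflTransGen rel a v)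
      have hAi : ∀ a ∈ A i, a ∈ P := fun a ha => Finset.mem_filter.2
        ⟨Finset.mem_sdiff.2 ⟨(Finset.mem_filter.1 ha).1, fun h => hYA a h ha⟩, a, ha, .refl⟩
      have hPb : ∀ v ∈ P, v ∈ b ∧ v ∉ Y := fun v hv => Finset.mem_sdiff.1 (Finset.mem_filter.1 hv).1
      have hPcl : ∀ v ∈ P, ∀ w ∈ b, w ∉ Y → adj v w → w ∈ P := by
        intro v hv w hw hwY hvw
        obtain ⟨hv1, a, ha, hav⟩ := Finset.mem_filter.1 hv
        have hwm : w ∈ b \ Y := Finset.mem_sdiff.2 ⟨hw, hwY⟩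
        exact Finset.mem_filter.2 ⟨hwm, a, ha, hav.tail ⟨hvw, hv1, hwm⟩⟩
      have hconn : Cn adj ((C i ∪ P : Finset N) : Set N) := by
        obtain ⟨x, hx⟩ := (hC.conn i).1
        have hx : x ∈ C i := hx
        have l : ∀ z ∈ C i ∪ P, Relation.ReflTransGen (fun a b' => adj a b' ∧
            a ∈ ((C i ∪ P : Finset N) : Set N) ∧ b' ∈ ((C i ∪ P : Finset N) : Set N)) x z := by
          have l1 : ∀ z ∈ C i, Relation.ReflTransGen (fun a b' => adj a b' ∧
            a ∈ ((C i ∪ P : Finset N) : Set N) ∧ b' ∈ ((C i ∪ P : Finset N) : Set N)) x z :=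
            fun z hz => RT_mono (by simp) ((hC.conn i).2 x hx z hz)
          intro z hz
          rcases Finset.mem_union.1 hz with h | h
          · exact l1 z h
          · obtain ⟨hz0, a, ha, haz⟩ := Finset.mem_filter.1 h
            clear hz0
            obtain ⟨_, w, hw, haw⟩ := Finset.mem_filter.1 ha
            have h0 := (l1 w hw).tail (c := a) ⟨hs _ _ haw, by simp [hw], by simp [hAi a ha]⟩
            clear h hz
            have : Relation.ReflTransGen (fun a b' => adj a b' ∧
              a ∈ ((C i ∪ P : Finset N) : Set N) ∧ b' ∈ ((C i ∪ P : Finset N) : Set N)) x z ∧ z ∈ P := by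
              induction haz with
              | refl => exact ⟨h0, hAi a ha⟩
              | tail _ h' ih =>
                have h2 := Finset.mem_sdiff.1 (by exact_mod_cast h'.2.2)
                have h3 := hPcl _ ih.2 _ h2.1 h2.2 h'.1
                exact ⟨ih.1.tail ⟨h'.1, by simp [ih.2], by simp [h3]⟩, h3⟩
            exact this.1
        exact ⟨⟨x, by simp [hx]⟩, fun a ha b' hb' => (RT_symm hs (l a (by exact_mod_cast ha))).trans
          (l b' (by exact_mod_cast hb'))⟩
      let C' : Fin k → Finset N := Function.update C i (C i ∪ P)
      have hC'i : C' i = C i ∪ P := by simp [C']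
      have hC'j : ∀ j, j ≠ i → C' j = C j := fun j h => by simp [C', h]
      have hsubC : ∀ j, C j ⊆ C' j := by
        intro j; by_cases h : j = i
        · subst h; rw [hC'i]; exact Finset.subset_union_left
        · rw [hC'j j h]
      have hPd : ∀ j, Disjoint (C j) P := fun j => (hC.away j).mono_right fun v hv => (hPb v hv).1
      let X' : Finset N := (X \ C i) ∪ (Z ∩ P)
      have hX'U : X' ⊆ U := Finset.union_subset (Finset.sdiff_subset.trans hC.sub)
        (Finset.inter_subset_left.trans (hZb.trans hbU))
      have hcost : ∀ j, tot c (X' ∩ C' j) ≤ r := by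
        intro j; by_cases h : j = i
        · subst h; rw [hC'i]
          refine (tot_mono c ?_).trans hZc
          intro v hv
          obtain ⟨hv1, hv2⟩ := Finset.mem_inter.1 hv
          rcases Finset.mem_union.1 hv1 with h1 | h1
          · have h1 := Finset.mem_sdiff.1 h1
            rcases Finset.mem_union.1 hv2 with h2 | h2
            · exact absurd h2 h1.2
            · exact absurd h1.1 (hbX v (hPb v h2).1)
          · exact (Finset.mem_inter.1 h1).1
        · rw [hC'j j h]
          refine (tot_mono c ?_).trans (hC.cost j)
          intro v hv
          obtain ⟨hv1, hv2⟩ := Finset.mem_inter.1 hv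
          rcases Finset.mem_union.1 hv1 with h1 | h1
          · exact Finset.mem_inter.2 ⟨(Finset.mem_sdiff.1 h1).1, hv2⟩
          · exact absurd (Finset.mem_inter.1 h1).2 (Finset.disjoint_left.1 (hPd j) hv2)
      have hX'cov : X' ⊆ Finset.univ.biUnion C' := by
        intro v hv
        rcases Finset.mem_union.1 hv with h1 | h1
        · obtain ⟨j, _, hj⟩ := Finset.mem_biUnion.1 (hC.cover (Finset.mem_sdiff.1 h1).1)
          exact Finset.mem_biUnion.2 ⟨j, Finset.mem_univ _, hsubC j hj⟩
        · refine Finset.mem_biUnion.2 ⟨i, Finset.mem_univ _, ?_⟩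
          rw [hC'i]; exact Finset.mem_union_right _ (Finset.mem_inter.1 h1).2
      have hX'tot : tot c X' ≤ 5 * r := by
        have h1 := tot_union_le c (X \ C i) (Z ∩ P)
        have h2 := tot_mono c (Finset.sdiff_subset : X \ C i ⊆ X)
        have h3 := tot_mono c (Finset.inter_subset_left : Z ∩ P ⊆ Z)
        have : tot c X' ≤ tot c (X \ C i) + tot c (Z ∩ P) := h1
        omega
      have hB' := hbig X' hX'U hX'tot
      have hYX' : Y ⊆ bet adj μ U X' := by
        intro v hv
        refine mem_bet.2 ⟨Y, ⟨hY.1, ?_, hY.2.2⟩, hv⟩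
        intro w hw
        refine Finset.mem_sdiff.2 ⟨hbU (hYb hw), fun h => ?_⟩
        rcases Finset.mem_union.1 h with h1 | h1
        · exact hbX w (hYb hw) (Finset.mem_sdiff.1 h1).1
        · exact hYZ w hw (Finset.mem_inter.1 h1).1
      have hbs : ∀ v ∈ bet adj μ U X', v ∈ b ∧ v ∉ P := by
        obtain ⟨x, hx⟩ := hY.1.1
        have hx : x ∈ Y := hx
        refine hB'.1.spread (fun v => v ∈ b ∧ v ∉ P) (x := x) (hYX' hx) ⟨hYb hx, fun h => (hPb x h).2 hx⟩ ?_
        intro v w hv hw hvb hvw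
        have hwU := Finset.mem_sdiff.1 (bet_sub hw)
        have hwb : w ∈ b := by
          refine bet_adj hs hvb.1 hwU.1 (fun hwX => hwU.2 ?_) hvw
          refine Finset.mem_union_left _ (Finset.mem_sdiff.2 ⟨hwX, fun hwC => ?_⟩)
          exact hvb.2 (hAi v (Finset.mem_filter.2 ⟨hvb.1, w, hwC, hvw⟩))
        refine ⟨hwb, fun hwP => ?_⟩
        by_cases hvY : v ∈ Y
        · apply (hPb w hwP).2
          refine bet_adj hs hvY hwU.1 (fun h => ?_) hvw
          rcases Finset.mem_union.1 h with h1 | h1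
          · exact hbX w hwb h1
          · exact hwU.2 (Finset.mem_union_right _ (Finset.mem_inter.2 ⟨h1, hwP⟩))
        · exact hvb.2 (hPcl w hwP v hvb.1 hvY (hs _ _ hvw))
      refine ih k C' X' ⟨hC.hk, ?_, ?_, ?_, hX'cov, hX'U, hcost, ?_⟩ ?_
      · intro j; by_cases h : j = i
        · subst h; rw [hC'i]; exact hconn
        · rw [hC'j j h]; exact hC.conn j
      · have h0 : ∀ j, j ≠ i → Disjoint (C' i) (C' j) := by
          intro j hj
          rw [hC'i, hC'j j hj, Finset.disjoint_union_left]
          exact ⟨hC.disj i j hj.symm, (hPd j).symm⟩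
        intro j l hjl
        by_cases h : j = i
        · subst h; exact h0 l hjl.symm
        by_cases h' : l = i
        · subst h'; exact (h0 j h).symm
        rw [hC'j j h, hC'j l h']; exact hC.disj j l hjl
      · intro j l hjl
        obtain ⟨x, hx, y, hy, hxy⟩ := hC.touch j l hjl
        exact ⟨x, hsubC j hx, y, hsubC l hy, hxy⟩
      · intro j; by_cases h : j = i
        · subst h; rw [hC'i, Finset.disjoint_union_left]
          exact ⟨(hC.away j).mono_right fun v hv => (hbs v hv).1,
            Finset.disjoint_left.2 fun v hv hv' => (hbs v hv').2 hv⟩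
        · rw [hC'j j h]; exact (hC.away j).mono_right fun v hv => (hbs v hv).1
      · have h1 : bet adj μ U X' ⊂ b := by
          obtain ⟨a, ha⟩ := hAne i
          exact Finset.ssubset_iff_of_subset (fun v hv => (hbs v hv).1) |>.2
            ⟨a, (hPb a (hAi a ha)).1, fun h => (hbs a h).2 (hAi a ha)⟩
        have := Finset.card_lt_card h1
        omega
  exact main _ 0 (fun i => i.elim0) ∅ ⟨by omega, fun i => i.elim0, fun i => i.elim0, fun i => i.elim0,
    by simp, by simp, fun i => i.elim0, fun i => i.elim0⟩ le_rfl

/-- components of a finite set -/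
theorem exists_comps (hs : ∀ a b, adj a b → adj b a) (U : Finset N) :
    ∃ P : Finset (Finset N), (∀ D ∈ P, Cn adj (D : Set N) ∧ D ⊆ U) ∧
      (∀ D ∈ P, ∀ D' ∈ P, D ≠ D' → Disjoint D D') ∧
      ∀ D : Finset N, Cn adj (D : Set N) → D ⊆ U → ∃ D' ∈ P, D ⊆ D' := by
  classical
  let R : N → N → Prop := Relation.ReflTransGen (fun a b => adj a b ∧ a ∈ (U : Set N) ∧ b ∈ (U : Set N))
  let f : N → Finset N := fun v => U.filter (R v)
  have hself : ∀ v ∈ U, v ∈ f v := fun v hv => Finset.mem_filter.2 ⟨hv, .refl⟩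
  have conn : ∀ v ∈ U, ∀ w ∈ f v, Relation.ReflTransGen
      (fun a b => adj a b ∧ a ∈ (f v : Set N) ∧ b ∈ (f v : Set N)) v w := by
    intro v hv w hw
    have := (Finset.mem_filter.1 hw).2
    clear hw
    induction this with
    | refl => exact .refl
    | tail h1 h ih =>
      rename_i x y
      refine ih.tail ⟨h.1, ?_, ?_⟩
      · exact_mod_cast Finset.mem_filter.2 ⟨h.2.1, h1⟩
      · exact_mod_cast Finset.mem_filter.2 ⟨h.2.2, h1.tail h⟩
  refine ⟨U.image f, ?_, ?_, ?_⟩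
  · intro D hD
    obtain ⟨v, hv, rfl⟩ := Finset.mem_image.1 hD
    exact ⟨⟨⟨v, by exact_mod_cast hself v hv⟩, fun a ha b hb => (RT_symm hs (conn v hv a ha)).trans (conn v hv b hb)⟩,
      Finset.filter_subset _ _⟩
  · intro D hD D' hD' hne
    obtain ⟨v, hv, rfl⟩ := Finset.mem_image.1 hD
    obtain ⟨v', hv', rfl⟩ := Finset.mem_image.1 hD'
    rw [Finset.disjoint_left]
    intro x hx hx'
    apply hne
    have h1 : R v x := (Finset.mem_filter.1 hx).2
    have h2 : R v' x := (Finset.mem_filter.1 hx').2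
    ext y
    simp only [f, Finset.mem_filter]
    refine and_congr_right fun _ => ⟨fun h => ?_, fun h => ?_⟩
    · exact (h2.trans (RT_symm hs h1)).trans h
    · exact (h1.trans (RT_symm hs h2)).trans h
  · intro D hD hDU
    obtain ⟨v, hv⟩ := hD.1
    have hv : v ∈ D := hv
    refine ⟨f v, Finset.mem_image_of_mem f (hDU hv), fun w hw => Finset.mem_filter.2 ⟨hDU hw, ?_⟩⟩
    exact RT_mono (by exact_mod_cast hDU) (hD.2 v hv w hw)

/-- division into pieces of bounded weight -/
theorem division (hs : ∀ a b, adj a b → adj b a) (hK : ¬ HasK5 adj) {c : N → ℕ}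
    (hμ : ∀ v, c v ^ 2 ≤ μ v) {R : ℝ} (hR : 1 ≤ R) : ∀ (m : ℕ) (U : Finset N), tot μ U ≤ m →
    ∃ S ⊆ U, (∀ D : Finset N, Cn adj (D : Set N) → D ⊆ U \ S → (tot μ D : ℝ) ≤ R) ∧
      ((tot μ U : ℝ) ≤ R → tot c S = 0) ∧
      (R < (tot μ U : ℝ) → (tot c S : ℝ) ≤ 53 * tot μ U / √R - 37 * √(tot μ U)) := by
  classical
  intro m
  induction m with
  | zero =>
    intro U hU
    have h0 : tot μ U = 0 := by omega
    refine ⟨∅, by simp, ?_, by simp [tot], ?_⟩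
    · intro D _ hD
      have := tot_mono μ (hD.trans Finset.sdiff_subset)
      have : tot μ D = 0 := by omega
      rw [this]; push_cast; linarith
    · intro h; rw [h0] at h; push_cast at h; linarith
  | succ m ih =>
    intro U hU
    by_cases hle : (tot μ U : ℝ) ≤ R
    · refine ⟨∅, by simp, ?_, by simp [tot], fun h => absurd hle h.not_ge⟩
      intro D _ hD
      have := tot_mono μ (hD.trans Finset.sdiff_subset)
      have : (tot μ D : ℝ) ≤ tot μ U := by exact_mod_cast this
      linarith
    push Not at hle
    set M : ℝ := (tot μ U : ℝ) with hM
    set s := √M with hs'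
    have hs1 : 1 ≤ s := by rw [hs', Real.one_le_sqrt]; linarith
    have hss : s ^ 2 = M := Real.sq_sqrt (by linarith)
    set q := √R with hq
    have hq1 : 1 ≤ q := by rw [hq, Real.one_le_sqrt]; linarith
    have hqs : q < s := Real.sqrt_lt_sqrt (by linarith) hle
    obtain ⟨X, hXU, hXc, hXD⟩ := separator (U := U) (r := ⌈2 * s⌉₊) hs hK (Nat.ceil_pos.2 (by linarith))
      (fun v _ => hμ v) (by
        have h1 := Nat.le_ceil (2 * s)
        have h2 : ((4 * tot μ U : ℕ) : ℝ) ≤ ((⌈2 * s⌉₊ ^ 2 : ℕ) : ℝ) := by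
          push_cast; rw [← hM, ← hss]; nlinarith
        exact_mod_cast h2)
    have hXr : (tot c X : ℝ) ≤ 15 * s := by
      have h1 := (Nat.ceil_lt_add_one (show 0 ≤ 2 * s by linarith))
      have h2 : (tot c X : ℝ) ≤ 5 * (⌈2 * s⌉₊ : ℝ) := by exact_mod_cast hXc
      linarith
    obtain ⟨P, hP1, hP2, hP3⟩ := exists_comps hs (U \ X)
    have hPm : ∀ D ∈ P, tot μ D ≤ m := by
      intro D hD
      have := hXD D (hP1 D hD).1 (hP1 D hD).2
      have h3 : 0 < tot μ U := by
        have : (0 : ℝ) < tot μ U := by rw [← hM]; linarith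
        exact_mod_cast this
      omega
    choose! S hS using fun D (hD : D ∈ P) => ih D (hPm D hD)
    refine ⟨X ∪ P.biUnion S, ?_, ?_, fun h => absurd h hle.not_ge, fun _ => ?_⟩
    · refine Finset.union_subset hXU (Finset.biUnion_subset.2 fun D hD => ?_)
      exact (hS D hD).1.trans ((hP1 D hD).2.trans Finset.sdiff_subset)
    · intro D hD hDU
      obtain ⟨D', hD', hsub⟩ := hP3 D hD (hDU.trans (Finset.sdiff_subset_sdiff le_rfl Finset.subset_union_left))
      refine (hS D' hD').2.1 D hD fun v hv => Finset.mem_sdiff.2 ⟨hsub hv, fun h => ?_⟩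
      exact (Finset.mem_sdiff.1 (hDU hv)).2 (Finset.mem_union_right _ (Finset.mem_biUnion.2 ⟨D', hD', h⟩))
    · set κ : ℝ := 53 / q - 37 * √2 / s with hκ
      have hsq2 : √2 ^ 2 = 2 := Real.sq_sqrt (by norm_num)
      have h2a : 1.41 ≤ √2 := Real.le_sqrt_of_sq_le (by norm_num)
      have h2b : √2 ≤ 1.42 := Real.sqrt_le_iff.2 ⟨by norm_num, by norm_num⟩
      have hκ0 : 0 ≤ κ := by
        have h1 : 37 * √2 / s ≤ 53 / s := by gcongr; linarith
        have h2 : 53 / s ≤ 53 / q := by gcongr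
        rw [hκ]; linarith
      have hpiece : ∀ D ∈ P, (tot c (S D) : ℝ) ≤ tot μ D * κ := by
        intro D hD
        by_cases hsmall : (tot μ D : ℝ) ≤ R
        · rw [(hS D hD).2.2.1 hsmall]; push_cast; positivity
        · push Not at hsmall
          refine ((hS D hD).2.2.2 hsmall).trans ?_
          set x := √(tot μ D : ℝ) with hx
          have hxx : x ^ 2 = tot μ D := Real.sq_sqrt (by linarith)
          have hx0 : 0 ≤ x := Real.sqrt_nonneg _
          have h1 : 2 * (tot μ D : ℝ) ≤ M := by
            rw [hM]; exact_mod_cast hXD D (hP1 D hD).1 (hP1 D hD).2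
          have h2 : x * √2 ≤ s := by
            apply le_of_sq_le_sq _ (by linarith)
            rw [mul_pow, hxx, hsq2, hss]; linarith
          rw [← hxx, hκ]
          have h3 : x ^ 2 * (37 * √2 / s) ≤ 37 * x := by
            rw [mul_div_assoc', div_le_iff₀ (by linarith)]
            nlinarith
          have h4 : 53 * x ^ 2 / q = x ^ 2 * (53 / q) := by ring
          rw [h4, mul_sub]; linarith
      have hsumμ : ∑ D ∈ P, (tot μ D : ℝ) ≤ M := by
        have h1 : ∑ D ∈ P, tot μ D = tot μ (P.biUnion id) := by
          unfold tot
          exact (Finset.sum_biUnion (t := id) (fun D hD D' hD' h => hP2 D hD D' hD' h)).symm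
        have h2 : tot μ (P.biUnion id) ≤ tot μ U := tot_mono μ
          (Finset.biUnion_subset.2 fun D hD => (hP1 D hD).2.trans Finset.sdiff_subset)
        rw [hM]; exact_mod_cast h1.le.trans h2
      have hbU : (tot c (P.biUnion S) : ℝ) ≤ ∑ D ∈ P, (tot c (S D) : ℝ) := by
        have : tot c (P.biUnion S) = ∑ D ∈ P, tot c (S D) := by
          unfold tot
          rw [Finset.sum_biUnion]
          exact fun D hD D' hD' h => (hP2 D hD D' hD' h).mono (hS D hD).1 (hS D' hD').1
        rw [this]; push_cast; exact le_rfl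
      have hun : (tot c (X ∪ P.biUnion S) : ℝ) ≤ tot c X + tot c (P.biUnion S) := by
        exact_mod_cast tot_union_le c X (P.biUnion S)
      have hfin : ∑ D ∈ P, (tot c (S D) : ℝ) ≤ M * κ := by
        refine (Finset.sum_le_sum hpiece).trans ?_
        rw [← Finset.sum_mul]
        exact mul_le_mul_of_nonneg_right hsumμ hκ0
      have h5 : M * κ = 53 * M / q - 37 * √2 * s := by
        rw [hκ, ← hss]; field_simp
      nlinarith

end F3
end CL

namespace CL

/-- connected component of `w` in the complement of `K` -/
def cmp (K : Set ℂ) (w : ℂ) : Set ℂ := connectedComponentIn Kᶜ w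

theorem cmp_open {K : Set ℂ} (hK : IsClosed K) (w : ℂ) : IsOpen (cmp K w) :=
  hK.isOpen_compl.connectedComponentIn

theorem cmp_pre (K : Set ℂ) (w : ℂ) : IsPreconnected (cmp K w) := isPreconnected_connectedComponentIn

theorem mem_cmp {K : Set ℂ} {w : ℂ} (hw : w ∉ K) : w ∈ cmp K w := mem_connectedComponentIn hw

theorem cmp_sub (K : Set ℂ) (w : ℂ) : cmp K w ⊆ Kᶜ := connectedComponentIn_subset _ _

theorem cmp_disj (K : Set ℂ) (w : ℂ) : Disjoint (cmp K w) K :=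
  disjoint_compl_left.mono_left (cmp_sub K w)

theorem cmp_max {K : Set ℂ} {w : ℂ} {S : Set ℂ} (hS : IsPreconnected S) (hw : w ∈ S)
    (hd : Disjoint S K) : S ⊆ cmp K w :=
  hS.subset_connectedComponentIn hw (subset_compl_iff_disjoint_right.2 hd)

theorem cmp_eq {K : Set ℂ} {w z : ℂ} (h : z ∈ cmp K w) : cmp K w = cmp K z :=
  connectedComponentIn_eq h

theorem mem_cmp_or {K : Set ℂ} (hK : IsClosed K) {w z : ℂ} (h : z ∈ closure (cmp K w)) :
    z ∈ cmp K w ∨ z ∈ K := by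
  by_contra hcon
  push Not at hcon
  obtain ⟨y, hy1, hy2⟩ := mem_closure_iff.1 h (cmp K z) (cmp_open hK z) (mem_cmp hcon.2)
  rw [cmp_eq hy2, ← cmp_eq hy1] at hcon
  exact hcon.1 (mem_cmp hcon.2)

theorem insert_pre {D : Set ℂ} (hD : IsPreconnected D) {z : ℂ} (hz : z ∈ closure D) :
    IsPreconnected (insert z D) :=
  hD.subset_closure (subset_insert _ _) (insert_subset hz subset_closure)

theorem open_not_finite {D P : Set ℂ} (hD : IsOpen D) (hne : D.Nonempty) (hP : P.Finite) :
    ¬ D ⊆ P := by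
  intro h
  obtain ⟨x, hx⟩ := hne
  have : (D : Set ℂ).Infinite := infinite_of_mem_nhds x (hD.mem_nhds hx)
  exact this (hP.subset h)

theorem front_inf {K P : Set ℂ} (hK : IsClosed K) {w : ℂ} (hw : w ∉ K) (hP : P.Finite)
    (hKP : ¬ K ⊆ P) : ∃ z ∈ K, z ∉ P ∧ z ∈ closure (cmp K w) := by
  by_contra hcon
  push Not at hcon
  obtain ⟨k, hk, hkP⟩ := not_subset.1 hKP
  have hc : IsPreconnected Pᶜ :=
    (hP.countable.isConnected_compl_of_one_lt_rank (by simp)).isPreconnected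
  obtain ⟨x, hx, hxP⟩ := not_subset.1 (open_not_finite (cmp_open hK w) ⟨w, mem_cmp hw⟩ hP)
  obtain ⟨y, hy⟩ := hc (cmp K w) (closure (cmp K w))ᶜ (cmp_open hK w) isClosed_closure.isOpen_compl
    (fun x hx => by
      by_cases h : x ∈ closure (cmp K w)
      · rcases mem_cmp_or hK h with h' | h'
        · exact Or.inl h'
        · exact absurd h (hcon x h' hx)
      · exact Or.inr h) ⟨x, hxP, hx⟩ ⟨k, hkP, hcon k hk hkP⟩
  exact hy.2.2 (subset_closure hy.2.1)

theorem W_touch {e f : ℝ → ℂ} (he : Continuous e) (hf : Continuous f) (h0 : e 0 = f 0) (h1 : e 1 = f 1)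
    {D : Set ℂ} (hD : IsPreconnected D) (hd : Disjoint D (e '' Icc 0 1)) (hd' : Disjoint D (f '' Icc 0 1))
    {w z : ℂ} (hw : w ∈ D) (hz : z ∈ closure D) (hze : z ∉ e '' Icc 0 1) (hzf : z ∉ f '' Icc 0 1) :
    W e f z = W e f w :=
  W_const he.continuousOn hf.continuousOn h0 h1 (insert_pre hD hz) (disjoint_insert_left.2 ⟨hze, hd⟩)
    (disjoint_insert_left.2 ⟨hzf, hd'⟩) (mem_insert _ _) (mem_insert_of_mem _ hw)

theorem W_unb {e f : ℝ → ℂ} (he : Continuous e) (hf : Continuous f) (h0 : e 0 = f 0) (h1 : e 1 = f 1)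
    {D : Set ℂ} (hD : IsPreconnected D) (hd : Disjoint D (e '' Icc 0 1)) (hd' : Disjoint D (f '' Icc 0 1))
    {w : ℂ} (hw : w ∈ D) (hb : ¬ Bornology.IsBounded D) : W e f w = 0 := by
  have hc : IsCompact (e '' Icc 0 1 ∪ f '' Icc 0 1) :=
    (isCompact_Icc.image he).union (isCompact_Icc.image hf)
  obtain ⟨R, hR⟩ := hc.isBounded.subset_closedBall 0
  have : ¬ D ⊆ Metric.closedBall 0 R := fun h => hb (Metric.isBounded_closedBall.subset h)
  obtain ⟨p, hp, hpR⟩ := not_subset.1 this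
  rw [W_const he.continuousOn hf.continuousOn h0 h1 hD hd hd' hw hp]
  exact W_zero he.continuousOn hf.continuousOn h0 h1 (isCompact_closedBall 0 R) (convex_closedBall 0 R) hpR
    (fun t ht => hR (Or.inl ⟨t, ht, rfl⟩)) (fun t ht => hR (Or.inr ⟨t, ht, rfl⟩))

/-- no log of `z - w` on a circle around `w` -/
theorem no_circle_log {w : ℂ} {R : ℝ} (hR : 0 < R) {L : ℂ → ℂ} {S : Set ℂ}
    (hS : Metric.sphere w R ⊆ S) (hL : ContinuousOn L S) (h : ∀ z ∈ Metric.sphere w R, ex (L z) = z - w) : False := by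
  set c : ℝ → ℂ := fun t => w + R * ex t with hc
  have hcs : ∀ t : ℝ, c t ∈ Metric.sphere w R := by
    intro t
    have : ‖ex t‖ = 1 := by
      unfold ex
      rw [show (2 * Real.pi * Complex.I * t : ℂ) = ((2 * Real.pi * t : ℝ) : ℂ) * Complex.I by push_cast; ring]
      exact Complex.norm_exp_ofReal_mul_I _
    simp [hc, this, abs_of_pos hR]
  have hcc : Continuous c := by
    have := continuous_ex
    simp only [hc]
    fun_prop
  obtain ⟨r, hr⟩ := exists_ex (z := (R : ℂ)) (by exact_mod_cast hR.ne')
  have h1 : IsLog (fun t : ℝ => c t - w) (Icc 0 1) (fun t => L (c t)) :=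
    ⟨hL.comp hcc.continuousOn (fun t _ => hS (hcs t)), fun t _ => h _ (hcs t)⟩
  have h2 : IsLog (fun t : ℝ => c t - w) (Icc 0 1) (fun t => r + (t : ℂ)) := by
    refine ⟨by fun_prop, fun t _ => ?_⟩
    rw [ex_add, hr]; simp [hc]
  have := h1.sub_eq isPreconnected_Icc h2 (x := 1) (y := 0) (by simp) (by simp)
  have h3 : c 1 = c 0 := by
    simp only [hc]
    have := ex_int 1
    push_cast at this ⊢
    rw [this, ex_zero]
  rw [h3] at this
  simp at this

theorem front_log {K F : Set ℂ} (hK : IsClosed K) {w : ℂ} (hw : w ∉ K) (hF : IsClosed F)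
    (hb : Bornology.IsBounded (cmp K w)) (hFK : closure (cmp K w) ∩ K ⊆ F) (L : C(F, ℂ))
    (hL : ∀ z : F, ex (L z) = z - w) : False := by
  classical
  obtain ⟨g, hg⟩ := L.exists_restrict_eq hF
  have hgF : ∀ z ∈ F, ex (g z) = z - w := by
    intro z hz
    rw [← hL ⟨z, hz⟩, ← hg]; rfl
  obtain ⟨R, hR0, hR⟩ := hb.subset_ball_lt 0 w
  set D := cmp K w with hD
  have hcl : IsClosed (closure D) := isClosed_closure
  set h : ℂ → ℂ := fun z => if z ∈ closure D then ex (g z) else z - w with hh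
  have hcont : Continuous h := by
    refine Continuous.if (fun z hz => ?_) (continuous_ex.comp g.continuous) (by fun_prop)
    have hz' : z ∈ frontier (closure D) := hz
    have hz1 : z ∈ closure D := by
      have := frontier_subset_closure hz'
      rwa [closure_closure] at this
    rcases mem_cmp_or hK hz1 with h' | h'
    · exact absurd (interior_mono subset_closure ((cmp_open hK w).interior_eq.symm ▸ h')) hz'.2
    · exact hgF z (hFK ⟨hz1, h'⟩)
  have hne : ∀ z, h z ≠ 0 := by
    intro z
    simp only [hh]
    split_ifs with hz
    · exact ex_ne _
    · intro h0
      rw [sub_eq_zero.1 h0] at hz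
      exact hz (subset_closure (mem_cmp hw))
  obtain ⟨M, hM1, hM2⟩ := exists_isLog (isCompact_closedBall w (R + 1)) (Metric.mem_closedBall_self (by linarith))
    ((convex_closedBall w (R + 1)).starConvex (Metric.mem_closedBall_self (by linarith))) hcont.continuousOn
    (fun z _ => hne z)
  refine no_circle_log (w := w) (R := R + 1) (by linarith) Metric.sphere_subset_closedBall hM1 fun z hz => ?_
  rw [hM2 z (Metric.sphere_subset_closedBall hz)]
  have : z ∉ closure D := by
    intro hz'
    have h1 := closure_mono hR hz'
    have h2 := Metric.closure_ball_subset_closedBall h1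
    rw [Metric.mem_closedBall] at h2
    rw [Metric.mem_sphere] at hz
    linarith
  simp [hh, this]

theorem front_arc {K : Set ℂ} (hK : IsClosed K) {w : ℂ} (hw : w ∉ K)
    (hb : Bornology.IsBounded (cmp K w)) {γ : ℝ → ℂ} (hγ : Continuous γ) (hi : InjOn γ (Icc 0 1))
    (hwγ : w ∉ γ '' Icc 0 1) : ∃ z ∈ K, z ∈ closure (cmp K w) ∧ z ∉ γ '' Icc 0 1 := by
  by_contra hcon
  push Not at hcon
  obtain ⟨L, hL1, hL2⟩ := exists_isLog_path (a := 0) (b := 1) hγ.continuousOn zero_le_one hwγ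
  set g : Icc (0 : ℝ) 1 → ℂ := fun t => γ t with hg
  have hgc : Continuous g := hγ.comp continuous_subtype_val
  have hgi : Function.Injective g := fun s t h => Subtype.ext (hi s.2 t.2 h)
  have hemb := (hgc.isClosedEmbedding hgi)
  let φ := hemb.isEmbedding.toHomeomorph
  have hL : Continuous (fun t : Icc (0 : ℝ) 1 => L t) := continuousOn_iff_continuous_domRestrict.1 hL1
  refine front_log hK hw hemb.isClosed_range hb (fun z hz => ?_)
    ⟨fun z => L (φ.symm z), hL.comp φ.symm.continuous⟩ fun z => ?_
  · obtain ⟨t, ht, rfl⟩ := hcon z hz.2 hz.1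
    exact ⟨⟨t, ht⟩, rfl⟩
  · have h1 := hL2 (φ.symm z) (φ.symm z).2
    have h2 : (φ (φ.symm z) : ℂ) = z := by rw [φ.apply_symm_apply]
    have h3 : (φ (φ.symm z) : ℂ) = γ (φ.symm z) := rfl
    simp only [ContinuousMap.coe_mk]
    rw [h1]
    change γ _ - w = _
    rw [← h3, h2]

end CL

namespace CL

/-- even integer -/
def Ev (z : ℂ) : Prop := ∃ k : ℤ, z = 2 * k
/-- odd integer -/
def Od (z : ℂ) : Prop := ∃ k : ℤ, z = 2 * k + 1

theorem Ev.not_od {z : ℂ} (h : Ev z) (h' : Od z) : False := by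
  obtain ⟨k, hk⟩ := h
  obtain ⟨l, hl⟩ := h'
  rw [hk] at hl
  have : (2 * k : ℤ) = 2 * l + 1 := by exact_mod_cast hl
  omega

theorem ev_or_od {z : ℂ} (h : ∃ n : ℤ, z = n) : Ev z ∨ Od z := by
  obtain ⟨n, rfl⟩ := h
  rcases Int.even_or_odd' n with ⟨k, rfl | rfl⟩
  · left; exact ⟨k, by push_cast; rfl⟩
  · right; exact ⟨k, by push_cast; rfl⟩

theorem Ev.zero : Ev 0 := ⟨0, by simp⟩
theorem Ev.neg {z : ℂ} (h : Ev z) : Ev (-z) := by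
  obtain ⟨k, rfl⟩ := h; exact ⟨-k, by push_cast; ring⟩
theorem Od.neg {z : ℂ} (h : Od z) : Od (-z) := by
  obtain ⟨k, rfl⟩ := h; exact ⟨-k - 1, by push_cast; ring⟩
theorem Ev.add {z w : ℂ} (h : Ev z) (h' : Ev w) : Ev (z + w) := by
  obtain ⟨k, rfl⟩ := h; obtain ⟨l, rfl⟩ := h'; exact ⟨k + l, by push_cast; ring⟩
theorem Ev.sub {z w : ℂ} (h : Ev z) (h' : Ev w) : Ev (z - w) := by
  rw [sub_eq_add_neg]; exact h.add h'.neg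
theorem Od.add {z w : ℂ} (h : Od z) (h' : Od w) : Ev (z + w) := by
  obtain ⟨k, rfl⟩ := h; obtain ⟨l, rfl⟩ := h'; exact ⟨k + l + 1, by push_cast; ring⟩
theorem Od.add_ev {z w : ℂ} (h : Od z) (h' : Ev w) : Od (z + w) := by
  obtain ⟨k, rfl⟩ := h; obtain ⟨l, rfl⟩ := h'; exact ⟨k + l, by push_cast; ring⟩
theorem Ev.add_od {z w : ℂ} (h : Ev z) (h' : Od w) : Od (z + w) := by
  rw [add_comm]; exact h'.add_ev h

/-- image of the parameter interval -/
def im (γ : ℝ → ℂ) : Set ℂ := γ '' Icc (0 : ℝ) 1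

/-- a simple arc -/
structure Arc (γ : ℝ → ℂ) : Prop where
  cont : Continuous γ
  inj : InjOn γ (Icc 0 1)

theorem Arc.compact {γ : ℝ → ℂ} (h : Arc γ) : IsCompact (im γ) := isCompact_Icc.image h.cont

theorem mem_im {γ : ℝ → ℂ} {t : ℝ} (ht : t ∈ Icc (0 : ℝ) 1) : γ t ∈ im γ := ⟨t, ht, rfl⟩
theorem im0 (γ : ℝ → ℂ) : γ 0 ∈ im γ := mem_im (by simp)
theorem im1 (γ : ℝ → ℂ) : γ 1 ∈ im γ := mem_im (by simp)

theorem Arc.infinite {γ : ℝ → ℂ} (h : Arc γ) : (im γ).Infinite :=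
  (Icc_infinite zero_lt_one).image h.inj

/-- two parallel arcs -/
structure Par (e f : ℝ → ℂ) : Prop where
  l : Arc e
  r : Arc f
  h0 : e 0 = f 0
  h1 : e 1 = f 1

/-- the closed curve of a parallel pair -/
def cv (e f : ℝ → ℂ) : Set ℂ := im e ∪ im f

theorem Par.symm {e f : ℝ → ℂ} (h : Par e f) : Par f e := ⟨h.r, h.l, h.h0.symm, h.h1.symm⟩

theorem Par.compact {e f : ℝ → ℂ} (h : Par e f) : IsCompact (cv e f) := h.l.compact.union h.r.compact

theorem Par.int {e f : ℝ → ℂ} (h : Par e f) {p : ℂ} (hp : p ∉ cv e f) : ∃ n : ℤ, W e f p = n :=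
  W_int h.l.cont.continuousOn h.r.cont.continuousOn h.h0 h.h1 (fun h' => hp (Or.inl h')) (fun h' => hp (Or.inr h'))

theorem Par.touch {e f : ℝ → ℂ} (h : Par e f) {D : Set ℂ} (hD : IsPreconnected D)
    (hd : Disjoint D (cv e f)) {w z : ℂ} (hw : w ∈ D) (hz : z ∈ closure D) (hz' : z ∉ cv e f) :
    W e f z = W e f w :=
  W_touch h.l.cont h.r.cont h.h0 h.h1 hD (hd.mono_right subset_union_left)
    (hd.mono_right subset_union_right) hw hz (fun h' => hz' (Or.inl h')) (fun h' => hz' (Or.inr h'))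

theorem Par.const {e f : ℝ → ℂ} (h : Par e f) {D : Set ℂ} (hD : IsPreconnected D)
    (hd : Disjoint D (cv e f)) {w z : ℂ} (hw : w ∈ D) (hz : z ∈ D) : W e f z = W e f w :=
  h.touch hD hd hw (subset_closure hz) (disjoint_left.1 hd hz)

theorem Par.unb {e f : ℝ → ℂ} (h : Par e f) {D : Set ℂ} (hD : IsPreconnected D)
    (hd : Disjoint D (cv e f)) {w : ℂ} (hw : w ∈ D) (hb : ¬ Bornology.IsBounded D) : W e f w = 0 :=
  W_unb h.l.cont h.r.cont h.h0 h.h1 hD (hd.mono_right subset_union_left)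
    (hd.mono_right subset_union_right) hw hb

theorem Par.far {e f : ℝ → ℂ} (h : Par e f) {R : ℝ} (hR : cv e f ⊆ Metric.closedBall 0 R) {w : ℂ}
    (hw : R < ‖w‖) : W e f w = 0 :=
  W_zero h.l.cont.continuousOn h.r.cont.continuousOn h.h0 h.h1 (isCompact_closedBall 0 R)
    (convex_closedBall 0 R) (by simpa using hw)
    (fun t ht => hR (Or.inl (mem_im ht))) (fun t ht => hR (Or.inr (mem_im ht)))

theorem front2 {e f e' f' : ℝ → ℂ} (h : Par e f) (h' : Par e' f') (hfin : (cv e f ∩ cv e' f').Finite)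
    {w : ℂ} (hw : w ∉ cv e f) (hw' : w ∉ cv e' f') :
    (∃ z ∈ cv e f, z ∉ cv e' f' ∧ W e' f' z = W e' f' w) ∨
    (∃ z ∈ cv e' f', z ∉ cv e f ∧ W e f z = W e f w) := by
  have hK : IsClosed (cv e f ∪ cv e' f') := (h.compact.union h'.compact).isClosed
  have hwK : w ∉ cv e f ∪ cv e' f' := by rintro (h | h) <;> contradiction
  obtain ⟨z, hz, hzP, hzc⟩ := front_inf hK hwK hfin (fun hs =>
    h.l.infinite (hfin.subset (fun x hx => hs (Or.inl (Or.inl hx)))))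
  have hd := cmp_disj (cv e f ∪ cv e' f') w
  have hp := cmp_pre (cv e f ∪ cv e' f') w
  rcases hz with hz | hz
  · left
    have hz' : z ∉ cv e' f' := fun h => hzP ⟨hz, h⟩
    exact ⟨z, hz, hz', h'.touch hp (hd.mono_right subset_union_right) (mem_cmp hwK) hzc hz'⟩
  · right
    have hz' : z ∉ cv e f := fun h => hzP ⟨h, hz⟩
    exact ⟨z, hz, hz', h.touch hp (hd.mono_right subset_union_left) (mem_cmp hwK) hzc hz'⟩

theorem front2_unb {e f e' f' : ℝ → ℂ} (h : Par e f) (h' : Par e' f') (hfin : (cv e f ∩ cv e' f').Finite) :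
    (∃ z ∈ cv e f, z ∉ cv e' f' ∧ W e' f' z = 0) ∨ (∃ z ∈ cv e' f', z ∉ cv e f ∧ W e f z = 0) := by
  obtain ⟨R, hR⟩ := (h.compact.union h'.compact).isBounded.subset_closedBall 0
  obtain ⟨R, hR0, hR⟩ : ∃ R : ℝ, 0 ≤ R ∧ cv e f ∪ cv e' f' ⊆ Metric.closedBall 0 R :=
    ⟨max R 0, le_max_right _ _, hR.trans (Metric.closedBall_subset_closedBall (le_max_left _ _))⟩
  have hn : R < ‖((R + 1 : ℝ) : ℂ)‖ := by
    rw [Complex.norm_real, Real.norm_eq_abs, abs_of_nonneg (by linarith)]; linarith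
  have hw : ((R + 1 : ℝ) : ℂ) ∉ cv e f ∪ cv e' f' := fun h => by
    have := hR h; rw [mem_closedBall_zero_iff] at this; linarith
  have h1 := h.far (subset_union_left.trans hR) hn
  have h2 := h'.far (subset_union_right.trans hR) hn
  have := front2 h h' hfin (fun h => hw (Or.inl h)) (fun h => hw (Or.inr h))
  rwa [h1, h2] at this

theorem no_common {e f e' f' : ℝ → ℂ} (h : Par e f) (h' : Par e' f') (hfin : (cv e f ∩ cv e' f').Finite)
    (hA : ∀ z ∈ cv e f, z ∉ cv e' f' → Ev (W e' f' z)) (hB : ∀ z ∈ cv e' f', z ∉ cv e f → Ev (W e f z))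
    {w : ℂ} (hw : w ∉ cv e f) (hw' : w ∉ cv e' f') (ho : Od (W e f w)) (ho' : Od (W e' f' w)) : False := by
  rcases front2 h h' hfin hw hw' with ⟨z, h1, h2, h3⟩ | ⟨z, h1, h2, h3⟩
  · exact (hA z h1 h2).not_od (h3 ▸ ho')
  · exact (hB z h1 h2).not_od (h3 ▸ ho)

theorem ev_partial {α e : ℝ → ℂ} (hα : Arc α) (he : Arc e) (h0 : e 0 ∉ im α) (h1 : e 1 ∉ im α)
    (hs : (im α ∩ im e).Subsingleton) (hX : Ev (X α 0 1 e 0 1)) {t : ℝ} (ht : t ∈ Icc (0 : ℝ) 1)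
    (hte : α t ∉ im e) : Ev (X α 0 t e 0 1) := by
  by_cases hd : Disjoint (α '' Icc 0 t) (im e)
  · rw [X_zero hα.cont.continuousOn he.cont.continuousOn ht.1 zero_le_one hd]; exact Ev.zero
  · have hd2 : Disjoint (α '' Icc t 1) (im e) := by
      obtain ⟨x, ⟨s, hs1, rfl⟩, hx⟩ := not_disjoint_iff.1 hd
      refine disjoint_left.2 ?_
      rintro y ⟨r, hr, rfl⟩ hy
      have h2 : s = r := hα.inj ⟨hs1.1, hs1.2.trans ht.2⟩ ⟨ht.1.trans hr.1, hr.2⟩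
        (hs ⟨mem_im ⟨hs1.1, hs1.2.trans ht.2⟩, hx⟩ ⟨mem_im ⟨ht.1.trans hr.1, hr.2⟩, hy⟩)
      subst h2
      have : s = t := le_antisymm hs1.2 hr.1
      subst this; exact hte hx
    have h3 := X_zero hα.cont.continuousOn he.cont.continuousOn ht.2 zero_le_one hd2
    have h4 := X_add (α := α) (β := e) (a := 0) (m := t) (b := 1) (c := 0) (d := 1) hα.cont.continuousOn ht.1 ht.2 h0 h1
    rw [h3, add_zero] at h4
    rwa [h4]

theorem ev_along {α e f : ℝ → ℂ} (hα : Arc α) (h : Par e f) (h0 : e 0 ∉ im α) (h1 : e 1 ∉ im α)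
    (hs : (im α ∩ im e).Subsingleton) (hs' : (im α ∩ im f).Subsingleton)
    (hX : Ev (X α 0 1 e 0 1)) (hX' : Ev (X α 0 1 f 0 1)) (hW : Ev (W e f (α 0)))
    {t : ℝ} (ht : t ∈ Icc (0 : ℝ) 1) (hte : α t ∉ cv e f) : Ev (W e f (α t)) := by
  have h2 := ev_partial hα h.l h0 h1 hs hX ht (fun h => hte (Or.inl h))
  have h3 := ev_partial hα h.r (h.h0 ▸ h0) (h.h1 ▸ h1) hs' hX' ht (fun h => hte (Or.inr h))
  have h4 := X_sub (α := α) (a := 0) (b := t) h.h0 h.h1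
  have : W e f (α t) = (X α 0 t e 0 1 - X α 0 t f 0 1) + W e f (α 0) := by rw [h4]; ring
  rw [this]
  exact (h2.sub h3).add hW

/-- the `#`-lemma: two lenses with a common odd point and outside ends cross oddly -/
theorem sharp {e f e' f' : ℝ → ℂ} (h : Par e f) (h' : Par e' f')
    (a0 : e 0 ∉ cv e' f') (a1 : e 1 ∉ cv e' f') (b0 : e' 0 ∉ cv e f) (b1 : e' 1 ∉ cv e f)
    (s1 : (im e ∩ im e').Subsingleton) (s2 : (im e ∩ im f').Subsingleton)
    (s3 : (im f ∩ im e').Subsingleton) (s4 : (im f ∩ im f').Subsingleton)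
    (A0 : Ev (W e' f' (e 0))) (A1 : Ev (W e' f' (e 1))) (B0 : Ev (W e f (e' 0))) (B1 : Ev (W e f (e' 1)))
    {w : ℂ} (hw : w ∉ cv e f) (hw' : w ∉ cv e' f') (ho : Od (W e f w)) (ho' : Od (W e' f' w)) :
    Od (X e 0 1 e' 0 1) := by
  have fin : (cv e f ∩ cv e' f').Finite := by
    unfold cv
    rw [union_inter_distrib_right, inter_union_distrib_left, inter_union_distrib_left]
    exact ((s1.finite.union s2.finite).union (s3.finite.union s4.finite))
  have a0' := h.h0 ▸ a0
  have a1' := h.h1 ▸ a1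
  have b0' := h'.h0 ▸ b0
  have b1' := h'.h1 ▸ b1
  simp only [cv, mem_union, not_or] at a0 a1 b0 b1 a0' a1' b0' b1'
  rcases ev_or_od (X_int (α := e) (β := e') (a := 0) (b := 1) (c := 0) (d := 1) h.l.cont.continuousOn
    h'.l.cont.continuousOn zero_le_one zero_le_one a0.1 a1.1 b0.1 b1.1) with hev | hod
  swap
  · exact hod
  exfalso
  have x11 : Ev (X e' 0 1 e 0 1) := by rw [X_swap]; exact hev.neg
  have x12 : Ev (X e' 0 1 f 0 1) := by
    have := X_sub (α := e') (a := 0) (b := 1) h.h0 h.h1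
    have h2 : X e' 0 1 f 0 1 = X e' 0 1 e 0 1 - (W e f (e' 1) - W e f (e' 0)) := by rw [← this]; ring
    rw [h2]; exact x11.sub (B1.sub B0)
  have y12 : Ev (X e 0 1 f' 0 1) := by
    have := X_sub (α := e) (a := 0) (b := 1) h'.h0 h'.h1
    have h2 : X e 0 1 f' 0 1 = X e 0 1 e' 0 1 - (W e' f' (e 1) - W e' f' (e 0)) := by rw [← this]; ring
    rw [h2]; exact hev.sub (A1.sub A0)
  have y21 : Ev (X f 0 1 e' 0 1) := by rw [X_swap]; exact x12.neg
  have y22 : Ev (X f 0 1 f' 0 1) := by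
    have := X_sub (α := f) (a := 0) (b := 1) h'.h0 h'.h1
    have h2 : X f 0 1 f' 0 1 = X f 0 1 e' 0 1 - (W e' f' (f 1) - W e' f' (f 0)) := by rw [← this]; ring
    rw [h2, ← h.h0, ← h.h1]; exact y21.sub (A1.sub A0)
  have x21 : Ev (X f' 0 1 e 0 1) := by rw [X_swap]; exact y12.neg
  have x22 : Ev (X f' 0 1 f 0 1) := by rw [X_swap]; exact y22.neg
  refine no_common h h' fin ?_ ?_ hw hw' ho ho'
  · rintro z (⟨t, ht, rfl⟩ | ⟨t, ht, rfl⟩) hz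
    · exact ev_along h.l h' b0.1 b1.1 s1 s2 hev y12 A0 ht hz
    · exact ev_along h.r h' b0.2 b1.2 s3 s4 y21 y22 (h.h0 ▸ A0) ht hz
  · rintro z (⟨t, ht, rfl⟩ | ⟨t, ht, rfl⟩) hz
    · exact ev_along h'.l h a0.1 a1.1 (inter_comm (im e) _ ▸ s1) (inter_comm (im f) _ ▸ s3) x11 x12 B0 ht hz
    · exact ev_along h'.r h a0.2 a1.2 (inter_comm (im e) _ ▸ s2) (inter_comm (im f) _ ▸ s4) x21 x22 (h'.h0 ▸ B0) ht hz

end CL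

namespace CL

noncomputable def lg (z : ℂ) : ℂ := Complex.log z / (2 * Real.pi * Complex.I)

theorem tpi : (2 * Real.pi * Complex.I : ℂ) ≠ 0 := by
  simp [Real.pi_ne_zero]

theorem ex_lg {z : ℂ} (hz : z ≠ 0) : ex (lg z) = z := by
  unfold ex lg
  rw [mul_div_cancel₀ _ tpi, Complex.exp_log hz]

theorem lg_I {z : ℂ} (hz : 0 < z.re) : lg (Complex.I * z) = lg z + 1 / 4 := by
  unfold lg
  have hz0 : z ≠ 0 := by rintro rfl; simp at hz
  have h := abs_lt.1 (Complex.abs_arg_lt_pi_div_two_iff.2 (Or.inl hz))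
  rw [Complex.log_mul Complex.I_ne_zero hz0 (by rw [Complex.arg_I]; constructor <;> linarith [h.1, h.2]),
    Complex.log_I]
  have := tpi
  field_simp
  ring

theorem lg_neg_I {z : ℂ} (hz : 0 < z.re) : lg (-Complex.I * z) = lg z - 1 / 4 := by
  unfold lg
  have hz0 : z ≠ 0 := by rintro rfl; simp at hz
  have h := abs_lt.1 (Complex.abs_arg_lt_pi_div_two_iff.2 (Or.inl hz))
  rw [Complex.log_mul (neg_ne_zero.2 Complex.I_ne_zero) hz0
    (by rw [Complex.arg_neg_I]; constructor <;> linarith [h.1, h.2]), Complex.log_neg_I]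
  have := tpi
  field_simp
  ring

theorem ex_quarter : ex (1 / 4) = Complex.I := by
  have h := lg_I (z := 1) (by simp)
  have h1 : lg 1 = 0 := by simp [lg]
  rw [h1, zero_add, mul_one] at h
  rw [← h, ex_lg Complex.I_ne_zero]

theorem lg_cont {f : ℂ → ℂ} {S : Set ℂ} (hf : ContinuousOn f S) (h : ∀ z ∈ S, f z ∈ Complex.slitPlane) :
    ContinuousOn (fun z => lg (f z)) S := by
  unfold lg
  exact (hf.clog h).div_const _

noncomputable def Psi (J : ℝ → ℂ) (z : ℂ) : ℂ := lg (z - J 0) - lg (J 1 - z) + A J 0 1 z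

def strip (J : ℝ → ℂ) : Set ℂ := {z | (J 0).re ≤ z.re ∧ z.re ≤ (J 1).re}

theorem slit_of {z : ℂ} (h : 0 ≤ z.re) (h0 : z ≠ 0) : z ∈ Complex.slitPlane := by
  rw [Complex.mem_slitPlane_iff]
  rcases h.lt_or_eq with h | h
  · exact Or.inl h
  · right; intro h'; exact h0 (Complex.ext h.symm h')

theorem Psi_const {J : ℝ → ℂ} (hJ : Continuous J) {S : Set ℂ} (hS : IsPreconnected S)
    (hd : Disjoint S (im J)) (hst : S ⊆ strip J) {p q : ℂ} (hp : p ∈ S) (hq : q ∈ S) : Psi J p = Psi J q := by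
  have n0 : ∀ z ∈ S, z - J 0 ≠ 0 := fun z hz h => disjoint_left.1 hd hz (sub_eq_zero.1 h ▸ im0 J)
  have n1 : ∀ z ∈ S, J 1 - z ≠ 0 := fun z hz h => disjoint_left.1 hd hz (sub_eq_zero.1 h ▸ im1 J)
  have hc : ContinuousOn (Psi J) S := by
    unfold Psi
    refine ((lg_cont (by fun_prop) fun z hz => slit_of ?_ (n0 z hz)).sub
      (lg_cont (by fun_prop) fun z hz => slit_of ?_ (n1 z hz))).add
      ((A_continuousOn hJ.continuousOn zero_le_one).mono (subset_compl_iff_disjoint_right.2 hd))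
    · have := (hst hz).1; simpa using this
    · have := (hst hz).2; simpa using this
  have := int_const hS (g := fun z => Psi J z - 1 / 2) (hc.sub continuousOn_const) (fun z hz => ?_) hp hq
  · simpa using this
  · rw [← ex_eq_one]
    unfold Psi
    rw [ex_sub, ex_half, ex_add, ex_sub, ex_lg (n0 z hz), ex_lg (n1 z hz),
      ex_A hJ.continuousOn zero_le_one (disjoint_left.1 hd hz)]
    have h0 := n0 z hz
    have h1 := n1 z hz
    have h2 : J 0 - z ≠ 0 := by rw [← neg_sub]; exact neg_ne_zero.2 h0
    have h3 : z - J 0 = - (J 0 - z) := by ring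
    rw [h3]
    field_simp

theorem Psi_top {J : ℝ → ℂ} (hJ : Continuous J) {T : ℂ} (h0 : (J 0).re < T.re) (h1 : T.re < (J 1).re)
    (hT : ∀ z ∈ im J, z.im < T.im) : Psi J T = 1 / 2 := by
  have hA : A J 0 1 T = (lg (Complex.I * (J 1 - T)) - 1 / 4) - (lg (Complex.I * (J 0 - T)) - 1 / 4) := by
    refine A_eq_of_log (K := {z | z.im < T.im}) (L := fun z => lg (Complex.I * (z - T)) - 1 / 4)
      hJ.continuousOn zero_le_one ⟨?_, ?_⟩ (fun t ht => hT _ (mem_im ht))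
    · refine (lg_cont (by fun_prop) fun z hz => ?_).sub continuousOn_const
      rw [Complex.mem_slitPlane_iff]; left
      have hz' : z.im < T.im := hz
      simpa using hz'
    · intro z hz
      have hz' : z.im < T.im := hz
      have : z - T ≠ 0 := fun h => by rw [sub_eq_zero.1 h] at hz'; exact lt_irrefl _ hz'
      rw [ex_sub, ex_quarter, ex_lg (mul_ne_zero Complex.I_ne_zero this)]
      field_simp [Complex.I_ne_zero]
  have e1 : Complex.I * (J 0 - T) = -Complex.I * (T - J 0) := by ring
  unfold Psi
  rw [hA, e1, lg_I (by simpa using h1), lg_neg_I (by simpa using h0)]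
  ring

theorem Psi_bot {J : ℝ → ℂ} (hJ : Continuous J) {T : ℂ} (h0 : (J 0).re < T.re) (h1 : T.re < (J 1).re)
    (hT : ∀ z ∈ im J, T.im < z.im) : Psi J T = - (1 / 2) := by
  have hA : A J 0 1 T = (lg (-Complex.I * (J 1 - T)) + 1 / 4) - (lg (-Complex.I * (J 0 - T)) + 1 / 4) := by
    refine A_eq_of_log (K := {z | T.im < z.im}) (L := fun z => lg (-Complex.I * (z - T)) + 1 / 4)
      hJ.continuousOn zero_le_one ⟨?_, ?_⟩ (fun t ht => hT _ (mem_im ht))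
    · refine (lg_cont (by fun_prop) fun z hz => ?_).add continuousOn_const
      rw [Complex.mem_slitPlane_iff]; left
      have hz' : T.im < z.im := hz
      simpa using hz'
    · intro z hz
      have hz' : T.im < z.im := hz
      have : z - T ≠ 0 := fun h => by rw [sub_eq_zero.1 h] at hz'; exact lt_irrefl _ hz'
      rw [ex_add, ex_quarter, ex_lg (mul_ne_zero (neg_ne_zero.2 Complex.I_ne_zero) this)]
      rw [mul_right_comm, neg_mul, Complex.I_mul_I, neg_neg, one_mul]
  have e1 : -Complex.I * (J 0 - T) = Complex.I * (T - J 0) := by ring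
  unfold Psi
  rw [hA, e1, lg_neg_I (by simpa using h1), lg_I (by simpa using h0)]
  ring

/-- point of the vertical line at `x` -/
def ln (x y : ℝ) : ℂ := ⟨x, y⟩

theorem ln_cont (x : ℝ) : Continuous (ln x) := by
  have : ln x = fun y : ℝ => (x : ℂ) + y * Complex.I := by
    funext y; apply Complex.ext <;> simp [ln]
  rw [this]; fun_prop

theorem link_const {J J' : ℝ → ℂ} (hJ : Arc J) (hJ' : Continuous J')
    (hd : im J ∩ im J' ⊆ {J 0, J 1}) (hst : im J ⊆ strip J') {x y1 y2 y3 y4 t t' : ℝ}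
    (hx : x ∈ Icc (J' 0).re (J' 1).re)
    (ht : t ∈ Ioo (0 : ℝ) 1) (ht' : t' ∈ Ioo (0 : ℝ) 1) (h2 : J t = ln x y2) (h3 : J t' = ln x y3)
    (ha : ∀ y ∈ uIcc y1 y2, ln x y ∉ im J') (hb : ∀ y ∈ uIcc y3 y4, ln x y ∉ im J') :
    Psi J' (ln x y1) = Psi J' (ln x y4) ∧ ln x y1 ∉ im J' := by
  have c1 : IsPreconnected (ln x '' uIcc y1 y2) := isPreconnected_uIcc.image _ (ln_cont x).continuousOn
  have c2 : IsPreconnected (J '' uIcc t t') := isPreconnected_uIcc.image _ hJ.cont.continuousOn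
  have c3 : IsPreconnected (ln x '' uIcc y3 y4) := isPreconnected_uIcc.image _ (ln_cont x).continuousOn
  have c12 : IsPreconnected (ln x '' uIcc y1 y2 ∪ J '' uIcc t t') :=
    IsPreconnected.union (J t) ⟨y2, right_mem_uIcc, h2.symm⟩ ⟨t, left_mem_uIcc, rfl⟩ c1 c2
  have c : IsPreconnected ((ln x '' uIcc y1 y2 ∪ J '' uIcc t t') ∪ ln x '' uIcc y3 y4) :=
    IsPreconnected.union (J t') (Or.inr ⟨t', right_mem_uIcc, rfl⟩) ⟨y3, left_mem_uIcc, h3.symm⟩ c12 c3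
  have hsub : uIcc t t' ⊆ Ioo (0 : ℝ) 1 := fun s hs =>
    (ordConnected_Ioo.uIcc_subset ht ht') hs
  refine ⟨Psi_const hJ' c ?_ ?_ (Or.inl (Or.inl ⟨y1, left_mem_uIcc, rfl⟩)) (Or.inr ⟨y4, right_mem_uIcc, rfl⟩),
    ha y1 left_mem_uIcc⟩
  · refine disjoint_left.2 ?_
    rintro z ((⟨y, hy, rfl⟩ | ⟨s, hs, rfl⟩) | ⟨y, hy, rfl⟩) hz
    · exact ha y hy hz
    · have hs' := hsub hs
      rcases hd ⟨mem_im ⟨hs'.1.le, hs'.2.le⟩, hz⟩ with h | h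
      · exact hs'.1.ne' (hJ.inj ⟨hs'.1.le, hs'.2.le⟩ (by simp) h)
      · exact hs'.2.ne (hJ.inj ⟨hs'.1.le, hs'.2.le⟩ (by simp) h)
    · exact hb y hy hz
  · rintro z ((⟨y, hy, rfl⟩ | ⟨s, hs, rfl⟩) | ⟨y, hy, rfl⟩)
    · exact hx
    · exact hst (mem_im ⟨(hsub hs).1.le, (hsub hs).2.le⟩)
    · exact hx

theorem J0 {J1 J2 : ℝ → ℂ} (h : Par J1 J2) (hd : im J1 ∩ im J2 ⊆ {J1 0, J1 1})
    (hst : cv J1 J2 ⊆ strip J1) (hlt : (J1 0).re < (J1 1).re) :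
    ∃ z, z ∉ cv J1 J2 ∧ Od (W J1 J2 z) := by
  obtain ⟨x, hx0, hx1⟩ := exists_between hlt
  have hst2 : cv J1 J2 ⊆ strip J2 := by unfold strip at hst ⊢; rwa [← h.h0, ← h.h1]
  have Yc : ∀ J, Arc J → IsCompact {y | ln x y ∈ im J} := by
    intro J hJ
    have hb := hJ.compact.isBounded
    obtain ⟨R, hR⟩ := hb.subset_closedBall 0
    refine (isCompact_Icc (a := -R) (b := R)).of_isClosed_subset
      (hJ.compact.isClosed.preimage (ln_cont x)) fun y hy => ?_
    have h1 : ‖ln x y‖ ≤ R := by simpa using hR hy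
    have h2 := (Complex.abs_im_le_norm (ln x y)).trans h1
    exact abs_le.1 h2
  have Yn : ∀ J, Arc J → J 0 = J1 0 → J 1 = J1 1 → {y | ln x y ∈ im J}.Nonempty := by
    intro J hJ h0 h1
    have hm : x ∈ Icc (J 0).re (J 1).re := by rw [h0, h1]; exact ⟨hx0.le, hx1.le⟩
    obtain ⟨t, ht, h⟩ := intermediate_value_Icc (f := fun t => (J t).re) (zero_le_one' ℝ)
      (Complex.continuous_re.comp hJ.cont).continuousOn hm
    refine ⟨(J t).im, ?_⟩
    have : ln x (J t).im = J t := Complex.ext h.symm rfl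
    change ln x _ ∈ im J
    rw [this]; exact mem_im ht
  -- times on the line are interior
  have tim : ∀ J, Arc J → J 0 = J1 0 → J 1 = J1 1 → ∀ y, ln x y ∈ im J → ∃ t ∈ Ioo (0 : ℝ) 1, J t = ln x y := by
    rintro J hJ h0 h1 y ⟨t, ht, hty⟩
    refine ⟨t, ⟨ht.1.lt_of_ne ?_, ht.2.lt_of_ne ?_⟩, hty⟩
    · rintro rfl; rw [h0] at hty; rw [hty] at hx0; exact lt_irrefl _ hx0
    · rintro rfl; rw [h1] at hty; rw [hty] at hx1; exact lt_irrefl _ hx1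
  have hdis : ∀ y, ln x y ∈ im J1 → ln x y ∈ im J2 → False := by
    intro y h1 h2
    rcases hd ⟨h1, h2⟩ with h | h
    · rw [← h] at hx0; exact lt_irrefl _ hx0
    · rw [mem_singleton_iff] at h; rw [← h] at hx1; exact lt_irrefl _ hx1
  obtain ⟨H, hH⟩ : ∃ H : ℝ, ∀ z ∈ cv J1 J2, |z.im| < H := by
    obtain ⟨R, hR⟩ := h.compact.isBounded.subset_closedBall 0
    refine ⟨R + 1, fun z hz => ?_⟩
    have h1 : ‖z‖ ≤ R := by simpa using hR hz
    have := Complex.abs_im_le_norm z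
    linarith
  -- main argument, with `ℓ` on the first arc
  have main : ∀ K1 K2 : ℝ → ℂ, Par K1 K2 → K1 0 = J1 0 → K1 1 = J1 1 → im K1 ∩ im K2 ⊆ {K1 0, K1 1} →
      cv K1 K2 = cv J1 J2 → ∀ l, ln x l ∈ im K1 → (∀ y, ln x y ∈ im K2 → y ≤ l) →
      ∃ z, z ∉ cv K1 K2 ∧ Od (W K1 K2 z) := by
    intro K1 K2 hP e0 e1 hd' hcv l hl hlm
    have hx01 : x ∈ Icc (K1 0).re (K1 1).re := by rw [e0, e1]; exact ⟨hx0.le, hx1.le⟩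
    have hx02 : x ∈ Icc (K2 0).re (K2 1).re := by rw [← hP.h0, ← hP.h1]; exact hx01
    have str : strip K1 = strip J1 := by simp [strip, e0, e1]
    have str2 : strip K2 = strip J1 := by simp [strip, ← hP.h0, ← hP.h1, e0, e1]
    have s1 : im K1 ⊆ strip K2 := by
      rw [str2]; exact subset_union_left.trans (hcv.le.trans hst)
    have s2 : im K2 ⊆ strip K1 := by
      rw [str]; exact subset_union_right.trans (hcv.le.trans hst)
    have hdis' : ∀ y, ln x y ∈ im K1 → ln x y ∈ im K2 → False := by
      intro y h1 h2
      rcases hd' ⟨h1, h2⟩ with h | h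
      · rw [e0] at h; rw [← h] at hx0; exact lt_irrefl _ hx0
      · rw [mem_singleton_iff, e1] at h; rw [← h] at hx1; exact lt_irrefl _ hx1
    have tops : ∀ J, Arc J → J 0 = J1 0 → J 1 = J1 1 → im J ⊆ cv J1 J2 →
        Psi J (ln x H) = 1 / 2 ∧ Psi J (ln x (-H)) = - (1 / 2) := by
      intro J hJ h0 h1 hs
      exact ⟨Psi_top hJ.cont (by rw [h0]; exact hx0) (by rw [h1]; exact hx1) fun z hz => (abs_lt.1 (hH z (hs hz))).2,
        Psi_bot hJ.cont (by rw [h0]; exact hx0) (by rw [h1]; exact hx1) fun z hz => (abs_lt.1 (hH z (hs hz))).1⟩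
    have k1 := tops K1 hP.l e0 e1 (hcv ▸ subset_union_left)
    have k2 := tops K2 hP.r (hP.h0.symm.trans e0) (hP.h1.symm.trans e1) (hcv ▸ subset_union_right)
    have hHy : ∀ y, ln x y ∈ cv K1 K2 → -H < y ∧ y < H := fun y hy => abs_lt.1 (hH _ (hcv ▸ hy))
    obtain ⟨m, hm, hmin⟩ := (Yc K1 hP.l).exists_isLeast (Yn K1 hP.l e0 e1)
    have hm' : ln x m ∈ im K1 := hm
    obtain ⟨tm, htm, htm'⟩ := tim K1 hP.l e0 e1 m hm
    obtain ⟨tl, htl, htl'⟩ := tim K1 hP.l e0 e1 l hl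
    have hup : ∀ y ∈ uIcc l H, ln x y ∉ im K2 := by
      intro y hy hy2
      rw [uIcc_of_le (hHy l (Or.inl hl)).2.le] at hy
      have : y = l := le_antisymm (hlm y hy2) hy.1
      subst this; exact hdis' _ hl hy2
    have hex : ∃ y, ln x y ∈ im K2 ∧ y ≤ m := by
      by_contra hcon
      push Not at hcon
      have := (link_const (y1 := -H) (y4 := H) hP.l hP.r.cont hd' s1 hx02 htm htl htm' htl' (fun y hy hy2 => by
        rw [uIcc_of_le (hHy m (Or.inl hm')).1.le] at hy
        exact absurd hy.2 (hcon y hy2).not_ge) hup).1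
      rw [k2.1, k2.2] at this
      norm_num at this
    obtain ⟨p, ⟨hp, hpm⟩, hpmax⟩ := ((Yc K2 hP.r).inter_right (isClosed_Iic (a := m))).exists_isGreatest hex
    have hp' : ln x p ∈ im K2 := hp
    have hpm' : p ≤ m := hpm
    have hpm : p < m := lt_of_le_of_ne hpm' (by rintro rfl; exact hdis' _ hm hp)
    obtain ⟨q, hq, hqmin⟩ := (Yc K2 hP.r).exists_isLeast ⟨p, hp⟩
    have hq' : ln x q ∈ im K2 := hq
    obtain ⟨tp, htp, htp'⟩ := tim K2 hP.r (hP.h0.symm.trans e0) (hP.h1.symm.trans e1) p hp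
    obtain ⟨tq, htq, htq'⟩ := tim K2 hP.r (hP.h0.symm.trans e0) (hP.h1.symm.trans e1) q hq
    have a1 := link_const (y1 := (m + p) / 2) (y4 := H) hP.l hP.r.cont hd' s1 hx02 htm htl htm' htl'
      (fun y hy hy2 => by
        rw [uIcc_of_le (by linarith)] at hy
        have : y ≤ p := hpmax ⟨hy2, hy.2⟩
        linarith [hy.1]) hup
    have hqp : q ≤ p := hqmin hp
    have low : ∀ y, y < m → ln x y ∉ im K1 := fun y hy h => absurd (hmin h) hy.not_ge
    have a2 := link_const (y1 := (m + p) / 2) (y4 := -H) hP.r hP.l.cont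
      (by rw [inter_comm, ← hP.h0, ← hP.h1]; exact hd') s2 hx01 htp htq htp' htq'
      (fun y hy => low y (by rw [uIcc_of_ge (by linarith)] at hy; linarith [hy.2]))
      (fun y hy => low y (by
        rw [uIcc_of_ge (hHy q (Or.inr hq')).1.le] at hy; linarith [hy.2]))
    refine ⟨ln x ((m + p) / 2), fun h => h.elim a2.2 a1.2, -1, ?_⟩
    have : W K1 K2 (ln x ((m + p) / 2)) = Psi K1 (ln x ((m + p) / 2)) - Psi K2 (ln x ((m + p) / 2)) := by
      unfold W Psi; rw [hP.h0, hP.h1]; ring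
    rw [this, a1.1, a2.1, k1.2, k2.1]; norm_num
  obtain ⟨l1, hl1, hmax1⟩ := (Yc J1 h.l).exists_isGreatest (Yn J1 h.l rfl rfl)
  obtain ⟨l2, hl2, hmax2⟩ := (Yc J2 h.r).exists_isGreatest (Yn J2 h.r h.h0.symm h.h1.symm)
  rcases le_total l2 l1 with hle | hle
  · exact main J1 J2 h rfl rfl hd rfl l1 hl1 fun y hy => (hmax2 hy).trans hle
  · obtain ⟨z, hz, ho⟩ := main J2 J1 h.symm h.h0.symm h.h1.symm
      (by rw [inter_comm, ← h.h0, ← h.h1]; exact hd) (union_comm _ _) l2 hl2 fun y hy => (hmax1 hy).trans hle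
    refine ⟨z, by rwa [cv, union_comm], ?_⟩
    rw [W_symm]; exact ho.neg

end CL

namespace CL

/-- periodic loop running along `e` and back along `f` -/
theorem exists_loop {e f : ℝ → ℂ} (h : Par e f) (hd : im e ∩ im f ⊆ {e 0, e 1}) :
    ∃ c : ℝ → ℂ, Continuous c ∧ Function.Periodic c 2 ∧ (∀ t ∈ Icc (0 : ℝ) 1, c t = e t) ∧
      (∀ t ∈ Icc (0 : ℝ) 1, c (2 - t) = f t) ∧ ∀ s t, c s = c t → ∃ n : ℤ, s - t = 2 * n := by
  set g : ℝ → ℂ := fun t => if t ≤ 1 then e t else f (2 - t) with hg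
  have hgc : Continuous g := by
    refine Continuous.if_le h.l.cont (h.r.cont.comp (by fun_prop)) continuous_id continuous_const ?_
    intro x hx; subst hx; norm_num [h.h1]
  have : Fact ((0 : ℝ) < 2) := ⟨by norm_num⟩
  have g02 : g 0 = g 2 := by simp [hg, h.h0]
  have hgi : ∀ s ∈ Ico (0 : ℝ) 2, ∀ t ∈ Ico (0 : ℝ) 2, g s = g t → s = t := by
    have key : ∀ s ∈ Ico (0 : ℝ) 2, ∀ t ∈ Ico (0 : ℝ) 2, s ≤ t → g s = g t → s = t := by
      intro s hs t ht hst heq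
      simp only [hg] at heq
      split_ifs at heq with h1 h2 h2
      · exact h.l.inj ⟨hs.1, h1⟩ ⟨ht.1, h2⟩ heq
      · exfalso
        push Not at h2
        have ht' : (2 - t) ∈ Icc (0 : ℝ) 1 := ⟨by linarith [ht.2], by linarith⟩
        have : f (2 - t) ∈ im e ∩ im f := ⟨heq ▸ mem_im ⟨hs.1, h1⟩, mem_im ht'⟩
        rcases hd this with h3 | h3
        · rw [h.h0] at h3
          have := h.r.inj ht' (by simp) h3
          linarith [ht.2]
        · rw [mem_singleton_iff, h.h1] at h3
          have := h.r.inj ht' (by simp) h3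
          linarith [ht.2]
      · linarith
      · have := h.r.inj (x₁ := 2 - s) (x₂ := 2 - t) ⟨by linarith [hs.2], by linarith⟩ ⟨by linarith [ht.2], by linarith⟩ heq
        linarith
    intro s hs t ht heq
    rcases le_total s t with hst | hst
    · exact key s hs t ht hst heq
    · exact (key t ht s hs hst heq.symm).symm
  set c : ℝ → ℂ := fun t => AddCircle.liftIco 2 0 g (t : AddCircle (2 : ℝ)) with hc
  have hcg : ∀ t ∈ Ico (0 : ℝ) 2, c t = g t := fun t ht =>
    AddCircle.liftIco_zero_coe_apply ht
  have hper : Function.Periodic c 2 := fun t => by simp only [hc, AddCircle.coe_add_period]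
  have hcont : Continuous c :=
    (AddCircle.liftIco_zero_continuous g02 hgc.continuousOn).comp (AddCircle.continuous_mk' 2)
  refine ⟨c, hcont, hper, ?_, ?_, ?_⟩
  · intro t ht
    rw [hcg t ⟨ht.1, by linarith [ht.2]⟩]
    simp [hg, ht.2]
  · intro t ht
    rcases ht.1.eq_or_lt with rfl | h0
    · have := hper 0
      rw [zero_add] at this
      rw [sub_zero, this, hcg 0 (by simp)]
      simp [hg, h.h0]
    · rw [hcg _ ⟨by linarith [ht.2], by linarith⟩]
      simp only [hg]
      split_ifs with h1
      · have : t = 1 := by linarith [ht.2]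
        subst this
        norm_num [h.h1]
      · norm_num
  · intro s t hst
    have e1 : s - toIcoMod (two_pos (α := ℝ)) 0 s = toIcoDiv (two_pos (α := ℝ)) 0 s * 2 := by
      have := self_sub_toIcoMod (two_pos (α := ℝ)) 0 s
      rw [this]; simp
    have e2 : t - toIcoMod (two_pos (α := ℝ)) 0 t = toIcoDiv (two_pos (α := ℝ)) 0 t * 2 := by
      have := self_sub_toIcoMod (two_pos (α := ℝ)) 0 t
      rw [this]; simp
    have m1 := toIcoMod_mem_Ico (two_pos (α := ℝ)) 0 s
    have m2 := toIcoMod_mem_Ico (two_pos (α := ℝ)) 0 t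
    rw [zero_add] at m1 m2
    have f1 : c s = g (toIcoMod (two_pos (α := ℝ)) 0 s) := by
      rw [← hcg _ m1, ← (hper.int_mul (toIcoDiv (two_pos (α := ℝ)) 0 s)) (toIcoMod _ 0 s)]
      congr 1; linarith
    have f2 : c t = g (toIcoMod (two_pos (α := ℝ)) 0 t) := by
      rw [← hcg _ m2, ← (hper.int_mul (toIcoDiv (two_pos (α := ℝ)) 0 t)) (toIcoMod _ 0 t)]
      congr 1; linarith
    have := hgi _ m1 _ m2 (by rw [← f1, ← f2, hst])
    refine ⟨toIcoDiv (two_pos (α := ℝ)) 0 s - toIcoDiv (two_pos (α := ℝ)) 0 t, ?_⟩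
    push_cast
    linarith

theorem exists_odd {e f : ℝ → ℂ} (h : Par e f) (hd : im e ∩ im f ⊆ {e 0, e 1}) :
    ∃ z, z ∉ cv e f ∧ Od (W e f z) := by
  obtain ⟨c, hc, hper, hce, hcf, hinj⟩ := exists_loop h hd
  have cve : cv e f = range c := by
    rw [← hper.image_Icc two_pos 0]
    apply Subset.antisymm
    · rintro z (⟨t, ht, rfl⟩ | ⟨t, ht, rfl⟩)
      · exact ⟨t, ⟨ht.1, by linarith [ht.2]⟩, hce t ht⟩
      · exact ⟨2 - t, ⟨by linarith [ht.2], by linarith [ht.1]⟩, hcf t ht⟩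
    · rintro z ⟨t, ht, rfl⟩
      by_cases h1 : t ≤ 1
      · left; rw [hce t ⟨ht.1, h1⟩]; exact mem_im ⟨ht.1, h1⟩
      · right
        push Not at h1
        have h2 : 2 - t ∈ Icc (0 : ℝ) 1 := ⟨by linarith [ht.2], by linarith⟩
        have := hcf _ h2
        rw [sub_sub_cancel] at this
        rw [this]; exact mem_im h2
  have rc : Continuous fun t => (c t).re := Complex.continuous_re.comp hc
  obtain ⟨a, ha, hamin⟩ := (isCompact_Icc (a := (0 : ℝ)) (b := 2)).exists_isMinOn ⟨0, by simp⟩ rc.continuousOn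
  have hamin' : ∀ t, (c a).re ≤ (c t).re := by
    intro t
    have : c t ∈ c '' Icc 0 (0 + 2) := by rw [hper.image_Icc two_pos 0]; exact ⟨t, rfl⟩
    obtain ⟨s, hs, hst⟩ := this
    rw [zero_add] at hs
    rw [← hst]; exact hamin hs
  obtain ⟨b, hb, hbmax⟩ := (isCompact_Icc (a := a) (b := a + 2)).exists_isMaxOn ⟨a, by simp⟩ rc.continuousOn
  have hbmax' : ∀ t, (c t).re ≤ (c b).re := by
    intro t
    have : c t ∈ c '' Icc a (a + 2) := by rw [hper.image_Icc two_pos a]; exact ⟨t, rfl⟩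
    obtain ⟨s, hs, hst⟩ := this
    rw [← hst]; exact hbmax hs
  have hne : (c a).re ≠ (c b).re := by
    intro heq
    have hall : ∀ t, (c t).re = (c a).re := fun t => le_antisymm (heq ▸ hbmax' t) (hamin' t)
    have ext' : ∀ s t, (c s).im = (c t).im → c s = c t := fun s t hst =>
      Complex.ext ((hall s).trans (hall t).symm) hst
    have hne' : (e 0).im ≠ (e 1).im := by
      intro h'
      rw [← hce 0 (by simp), ← hce 1 (by simp)] at h'
      obtain ⟨n, hn⟩ := hinj _ _ (ext' _ _ h')
      have : (-1 : ℤ) = 2 * n := by exact_mod_cast (by linarith : (-1 : ℝ) = 2 * n)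
      omega
    obtain ⟨m, hm⟩ : ∃ m, m ∈ uIcc (e 0).im (e 1).im ∧ m ≠ (e 0).im ∧ m ≠ (e 1).im := by
      refine ⟨((e 0).im + (e 1).im) / 2, ?_, fun h' => hne' (by linarith), fun h' => hne' (by linarith)⟩
      rcases le_total (e 0).im (e 1).im with h' | h'
      · rw [uIcc_of_le h']; constructor <;> linarith
      · rw [uIcc_of_ge h']; constructor <;> linarith
    obtain ⟨s, hs, hs'⟩ := intermediate_value_uIcc (a := (0 : ℝ)) (b := 1) (f := fun t => (e t).im)
      (Complex.continuous_im.comp h.l.cont).continuousOn hm.1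
    have hm2 : m ∈ uIcc (f 0).im (f 1).im := by rw [← h.h0, ← h.h1]; exact hm.1
    obtain ⟨t, ht, ht'⟩ := intermediate_value_uIcc (a := (0 : ℝ)) (b := 1) (f := fun t => (f t).im)
      (Complex.continuous_im.comp h.r.cont).continuousOn hm2
    rw [uIcc_of_le zero_le_one] at hs ht
    simp only at hs' ht'
    have heq2 : e s = f t := by
      rw [← hce s hs, ← hcf t ht]
      apply ext'
      rw [hce s hs, hcf t ht, hs', ht']
    rcases hd ⟨mem_im hs, heq2 ▸ mem_im ht⟩ with h3 | h3
    · rw [h3] at hs'; exact hm.2.1 hs'.symm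
    · rw [mem_singleton_iff] at h3; rw [h3] at hs'; exact hm.2.2 hs'.symm
  have hlt : (c a).re < (c b).re := lt_of_le_of_ne (hamin' b) hne
  have hab : a < b := hb.1.lt_of_ne (by rintro rfl; exact lt_irrefl _ hlt)
  have hba : b < a + 2 := hb.2.lt_of_ne (by rintro rfl; rw [hper] at hlt; exact lt_irrefl _ hlt)
  set g1 : ℝ → ℝ := fun t => a + t * (b - a) with hg1
  set g2 : ℝ → ℝ := fun t => a + 2 - t * (a + 2 - b) with hg2
  have m1 : ∀ t ∈ Icc (0 : ℝ) 1, g1 t ∈ Icc a b := fun t ht => by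
    constructor <;> simp only [hg1] <;> nlinarith [ht.1, ht.2]
  have m2 : ∀ t ∈ Icc (0 : ℝ) 1, g2 t ∈ Icc b (a + 2) := fun t ht => by
    constructor <;> simp only [hg2] <;> nlinarith [ht.1, ht.2]
  have c1 : Continuous g1 := by fun_prop
  have c2 : Continuous g2 := by fun_prop
  have close : ∀ s t, c s = c t → |s - t| < 2 → s = t := by
    intro s t hst hl
    obtain ⟨n, hn⟩ := hinj s t hst
    rw [hn, abs_lt] at hl
    have h1 : (-1 : ℤ) < n := by exact_mod_cast (by linarith [hl.1] : (-1 : ℝ) < n)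
    have h2 : n < (1 : ℤ) := by exact_mod_cast (by linarith [hl.2] : (n : ℝ) < 1)
    have : n = 0 := by omega
    subst this; simp at hn; linarith
  have hca : c (a + 2) = c a := hper a
  have P : Par (c ∘ g1) (c ∘ g2) := by
    refine ⟨⟨hc.comp c1, ?_⟩, ⟨hc.comp c2, ?_⟩, ?_, ?_⟩
    · intro s hs t ht hst
      have h1 := m1 s hs; have h2 := m1 t ht
      have := close _ _ hst (by rw [abs_lt]; constructor <;> linarith [h1.1, h1.2, h2.1, h2.2])
      simp only [hg1] at this
      have : (s - t) * (b - a) = 0 := by linarith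
      rcases mul_eq_zero.1 this with h | h <;> linarith
    · intro s hs t ht hst
      have h1 := m2 s hs; have h2 := m2 t ht
      have := close _ _ hst (by rw [abs_lt]; constructor <;> linarith [h1.1, h1.2, h2.1, h2.2])
      simp only [hg2] at this
      have : (s - t) * (a + 2 - b) = 0 := by linarith
      rcases mul_eq_zero.1 this with h | h <;> linarith
    · simp [hg1, hg2, hca]
    · simp [hg1, hg2]
  have j0 : (c ∘ g1) 0 = c a := by simp [hg1]
  have j1 : (c ∘ g1) 1 = c b := by simp [hg1]
  have hd' : im (c ∘ g1) ∩ im (c ∘ g2) ⊆ {(c ∘ g1) 0, (c ∘ g1) 1} := by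
    rintro z ⟨⟨s, hs, rfl⟩, ⟨t, ht, hst⟩⟩
    rw [j0, j1]
    have h1 := m1 s hs; have h2 := m2 t ht
    simp only [Function.comp] at hst ⊢
    obtain ⟨n, hn⟩ := hinj _ _ hst
    have hn0 : (-1 : ℤ) < n := by
      exact_mod_cast (by linarith [h1.2, h2.1] : (-1 : ℝ) < n)
    have hn1 : n < (2 : ℤ) := by
      exact_mod_cast (by linarith [h1.1, h2.2] : (n : ℝ) < 2)
    have : n = 0 ∨ n = 1 := by omega
    rcases this with rfl | rfl
    · right
      have : g1 s = b := by simp at hn; linarith [h1.2, h2.1]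
      rw [this]; rfl
    · left
      have : g1 s = a := by push_cast at hn; linarith [h1.1, h2.2]
      rw [this]
  have hcv : cv (c ∘ g1) (c ∘ g2) = cv e f := by
    rw [cve]
    apply Subset.antisymm
    · rintro z (⟨t, ht, rfl⟩ | ⟨t, ht, rfl⟩) <;> exact ⟨_, rfl⟩
    · rw [← hper.image_Icc two_pos a]
      rintro z ⟨t, ht, rfl⟩
      rcases le_total t b with htb | htb
      · left
        have hpos : 0 < b - a := by linarith
        refine ⟨(t - a) / (b - a), ⟨div_nonneg (by linarith [ht.1]) hpos.le, (div_le_one hpos).2 (by linarith)⟩, ?_⟩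
        simp only [Function.comp, hg1]
        congr 1; field_simp; ring
      · right
        have hpos : 0 < a + 2 - b := by linarith
        refine ⟨(a + 2 - t) / (a + 2 - b), ⟨div_nonneg (by linarith [ht.2]) hpos.le, (div_le_one hpos).2 (by linarith)⟩, ?_⟩
        simp only [Function.comp, hg2]
        congr 1; field_simp; ring
  have hst : cv (c ∘ g1) (c ∘ g2) ⊆ strip (c ∘ g1) := by
    rw [hcv, cve]
    rintro z ⟨t, rfl⟩
    change (c t).re ∈ Icc ((c ∘ g1) 0).re ((c ∘ g1) 1).re
    rw [j0, j1]
    exact ⟨hamin' t, hbmax' t⟩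
  obtain ⟨z, hz, ho⟩ := J0 P hd' hst (by rw [j0, j1]; exact hlt)
  rw [hcv] at hz
  refine ⟨z, hz, ?_⟩
  have hz' : ∀ a b, z ∉ c '' Icc a b := by
    rintro a b ⟨t, _, rfl⟩; exact hz (cve ▸ ⟨t, rfl⟩)
  have A1 : A (c ∘ g1) 0 1 z = A c a b z := by
    have := A_comp (γ := c) (φ := c ∘ g1) (a := 0) (b := 1) g1 c1.continuousOn zero_le_one (fun t _ => rfl)
      (by simpa [hg1] using m1) hc.continuousOn (hz' _ _)
    rw [this]; simp [hg1]
  have A2 : A (c ∘ g2) 0 1 z = - A c b (a + 2) z := by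
    have := A_comp_rev (γ := c) (φ := c ∘ g2) (a := 0) (b := 1) g2 c2.continuousOn zero_le_one (fun t _ => rfl)
      (by simpa [hg2] using m2) hc.continuousOn (hz' _ _)
    rw [this]; simp [hg2]
  have A3 : A f 0 1 z = - A c 1 2 z := by
    have := A_comp_rev (γ := c) (φ := f) (a := 0) (b := 1) (fun t => 2 - t) (by fun_prop) zero_le_one
      (fun t ht => (hcf t ht).symm) (fun t ht => ⟨by linarith [ht.2], by linarith [ht.1]⟩) hc.continuousOn (hz' _ _)
    rw [this]; norm_num
  have A4 : A e 0 1 z = A c 0 1 z := by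
    refine A_congr (fun t ht => (hce t ht).symm) zero_le_one h.l.cont.continuousOn fun h' => hz (Or.inl h')
  have A5 : A c 2 (a + 2) z = A c 0 a z := by
    have := A_comp (γ := c) (φ := c) (a := 0) (b := a) (fun t => t + 2) (by fun_prop) ha.1 (fun t _ => (hper t).symm)
      (fun t ht => ⟨by linarith [ht.1], by linarith [ht.2]⟩) hc.continuousOn (hz' _ _)
    rw [this]; simp
  have B1 := A_add (γ := c) hc.continuousOn hab.le hba.le (hz' a (a + 2))
  have B2 := A_add (γ := c) (a := a) (b := 2) (c := a + 2) hc.continuousOn ha.2 (by linarith [ha.1]) (hz' _ _)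
  have B3 := A_add (γ := c) (a := 0) (b := a) (c := 2) hc.continuousOn ha.1 ha.2 (hz' _ _)
  have B4 := A_add (γ := c) (a := 0) (b := 1) (c := 2) hc.continuousOn (by norm_num) (by norm_num) (hz' _ _)
  have : W e f z = W (c ∘ g1) (c ∘ g2) z := by
    unfold W
    rw [A1, A2, A3, A4]
    linear_combination B4 - B3 - B1 + B2 - A5
  rw [this]; exact ho

end CL

namespace CL

theorem arc_mid {γ : ℝ → ℂ} (h : Arc γ) {t1 t2 t3 : ℝ} (h1 : t1 ∈ Icc (0 : ℝ) 1) (h3 : t3 ∈ Icc (0 : ℝ) 1)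
    (h12 : t1 < t2) (h23 : t2 < t3) (hs : segment ℝ (γ t1) (γ t3) ⊆ im γ) : γ t2 ∈ segment ℝ (γ t1) (γ t3) := by
  have h2 : t2 ∈ Icc (0 : ℝ) 1 := ⟨h1.1.trans h12.le, h23.le.trans h3.2⟩
  have hc := (convex_segment (𝕜 := ℝ) (γ t1) (γ t3)).isPreconnected
  obtain ⟨z, hz, ⟨a, ha, rfl⟩, ⟨b, hb, hab⟩⟩ := isPreconnected_closed_iff.1 hc (γ '' Icc 0 t2) (γ '' Icc t2 1)
    (isCompact_Icc.image h.cont).isClosed (isCompact_Icc.image h.cont).isClosed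
    (by
      intro z hz
      obtain ⟨t, ht, rfl⟩ := hs hz
      rcases le_total t t2 with h' | h'
      · left; exact ⟨t, ⟨ht.1, h'⟩, rfl⟩
      · right; exact ⟨t, ⟨h', ht.2⟩, rfl⟩)
    ⟨_, left_mem_segment _ _ _, t1, ⟨h1.1, h12.le⟩, rfl⟩ ⟨_, right_mem_segment _ _ _, t3, ⟨h23.le, h3.2⟩, rfl⟩
  have : b = a := h.inj ⟨h2.1.trans hb.1, hb.2⟩ ⟨ha.1, ha.2.trans h2.2⟩ hab
  have : a = t2 := le_antisymm ha.2 (this ▸ hb.1)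
  rwa [this] at hz

theorem arc_interior {γ : ℝ → ℂ} (h : Arc γ) : interior (im γ) = ∅ := by
  rw [eq_empty_iff_forall_notMem]
  intro c hc
  obtain ⟨r, hr, hb⟩ := Metric.isOpen_iff.1 isOpen_interior c hc
  have hb : Metric.ball c r ⊆ im γ := hb.trans interior_subset
  have hx : c ∈ Metric.ball c r := Metric.mem_ball_self hr
  have hy : c + ((r / 2 : ℝ) : ℂ) ∈ Metric.ball c r := by
    rw [mem_ball_iff_norm, add_sub_cancel_left, Complex.norm_real, Real.norm_eq_abs, abs_of_pos (by positivity)]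
    linarith
  have hz : c + ((r / 2 : ℝ) : ℂ) * Complex.I ∈ Metric.ball c r := by
    rw [mem_ball_iff_norm, add_sub_cancel_left, norm_mul, Complex.norm_I, mul_one, Complex.norm_real,
      Real.norm_eq_abs, abs_of_pos (by positivity)]
    linarith
  have key : ∀ a b d : ℂ, a ∈ Metric.ball c r → b ∈ Metric.ball c r → d ∈ Metric.ball c r →
      ∀ s t u : ℝ, s ∈ Icc (0 : ℝ) 1 → u ∈ Icc (0 : ℝ) 1 → γ s = a → γ t = b → γ u = d →
      ((s < t ∧ t < u) ∨ (u < t ∧ t < s)) → b ∈ segment ℝ a d := by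
    intro a b d ha hb' hd s t u hs hu e1 e2 e3 hor
    have hsub : segment ℝ a d ⊆ im γ := ((convex_ball c r).segment_subset ha hd).trans hb
    subst e1 e2 e3
    rcases hor with ⟨h1, h2⟩ | ⟨h1, h2⟩
    · exact arc_mid h hs hu h1 h2 hsub
    · rw [segment_symm] at hsub ⊢
      exact arc_mid h hu hs h1 h2 hsub
  have n1 : c ∉ segment ℝ (c + ((r / 2 : ℝ) : ℂ)) (c + ((r / 2 : ℝ) : ℂ) * Complex.I) := by
    rintro ⟨a, b, ha, hb, hab, he⟩
    have h1 := congrArg Complex.re he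
    have h2 := congrArg Complex.im he
    simp at h1 h2
    obtain rfl : a = 1 - b := by linarith
    linarith
  have n2 : c + ((r / 2 : ℝ) : ℂ) ∉ segment ℝ c (c + ((r / 2 : ℝ) : ℂ) * Complex.I) := by
    rintro ⟨a, b, ha, hb, hab, he⟩
    have h1 := congrArg Complex.re he
    have h2 := congrArg Complex.im he
    simp at h1 h2
    obtain rfl : a = 1 - b := by linarith
    linarith
  have n3 : c + ((r / 2 : ℝ) : ℂ) * Complex.I ∉ segment ℝ c (c + ((r / 2 : ℝ) : ℂ)) := by
    rintro ⟨a, b, ha, hb, hab, he⟩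
    have h1 := congrArg Complex.re he
    have h2 := congrArg Complex.im he
    simp at h1 h2
    obtain rfl : a = 1 - b := by linarith
    linarith
  obtain ⟨s, hs, es⟩ := hb hx
  obtain ⟨t, ht, et⟩ := hb hy
  obtain ⟨u, hu, eu⟩ := hb hz
  have k1 := fun q => n1 (key _ _ _ hy hx hz t s u ht hu et es eu q)
  have k2 := fun q => n2 (key _ _ _ hx hy hz s t u hs hu es et eu q)
  have k3 := fun q => n3 (key _ _ _ hx hz hy s u t hs ht es eu et q)
  have hr' : ((r / 2 : ℝ) : ℂ) ≠ 0 := by exact_mod_cast (by positivity : (r / 2 : ℝ) ≠ 0)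
  have d1 : s ≠ t := by
    rintro rfl; rw [es] at et; exact hr' (by linear_combination -et)
  have d2 : s ≠ u := by
    rintro rfl; rw [es] at eu
    exact mul_ne_zero hr' Complex.I_ne_zero (by linear_combination -eu)
  have d3 : t ≠ u := by
    rintro rfl; rw [et] at eu
    have := congrArg Complex.im eu
    simp at this; linarith
  rcases lt_or_gt_of_ne d1 with a | a <;> rcases lt_or_gt_of_ne d2 with b | b <;>
    rcases lt_or_gt_of_ne d3 with d | d
  · exact k2 (Or.inl ⟨a, d⟩)
  · exact k3 (Or.inl ⟨b, d⟩)
  · linarith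
  · exact k1 (Or.inr ⟨b, a⟩)
  · exact k1 (Or.inl ⟨a, b⟩)
  · linarith
  · exact k3 (Or.inr ⟨d, b⟩)
  · exact k2 (Or.inr ⟨d, a⟩)

theorem arcs_interior {ι : Type*} (s : Finset ι) (γ : ι → ℝ → ℂ) (h : ∀ i ∈ s, Arc (γ i)) :
    interior (⋃ i ∈ s, im (γ i)) = ∅ := by
  classical
  induction s using Finset.induction_on with
  | empty => simp
  | insert a s ha ih =>
    rw [Finset.set_biUnion_insert, interior_union_isClosed_of_interior_empty
      (h a (by simp)).compact.isClosed (ih fun i hi => h i (by simp [hi])), arc_interior (h a (by simp))]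

end CL

namespace CL

/-- normalised drawing -/
structure Draw where
  V : Finset ℂ
  E : Type
  fin : Fintype E
  γ : E → ℝ → ℂ
  arc : ∀ e, Arc (γ e)
  s0 : ∀ e, γ e 0 ∈ V
  s1 : ∀ e, γ e 1 ∈ V
  av : ∀ e, ∀ t ∈ Ioo (0 : ℝ) 1, γ e t ∉ V
  sc : ∀ e f, e ≠ f → (γ e '' Ioo 0 1 ∩ γ f '' Ioo 0 1).Subsingleton
  par : ∀ e f, e ≠ f → γ e 0 = γ f 0 → γ e 1 = γ f 1 → γ e '' Ioo 0 1 ∩ γ f '' Ioo 0 1 = ∅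
  nop : ∀ e f, ¬ (γ e 0 = γ f 1 ∧ γ e 1 = γ f 0)
  sep : ∀ e f, e ≠ f → γ e 0 = γ f 0 → γ e 1 = γ f 1 →
    ∃ w ∈ V, w ≠ γ e 0 ∧ w ≠ γ e 1 ∧ Od (W (γ e) (γ f) w)

/-- crossing relation of a drawing -/
def Draw.Cr (D : Draw) (e f : D.E) : Prop := e ≠ f ∧ (D.γ e '' Ioo 0 1 ∩ D.γ f '' Ioo 0 1).Nonempty

section conv
variable (G : TopMultigraph)

/-- planar identification -/
noncomputable def ph : (ℝ × ℝ) ≃L[ℝ] ℂ := Complex.equivRealProdCLM.symm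

/-- raw arcs -/
noncomputable def ra (e : G.ι) (t : ℝ) : ℂ := ph (G.arc e (projIcc 0 1 zero_le_one t))

open Classical in
/-- oriented arcs -/
noncomputable def oa (e : G.ι) (t : ℝ) : ℂ :=
  if toLex (G.arc e 0) < toLex (G.arc e 1) then ra G e t else ra G e (1 - t)

theorem ra_arc (e : G.ι) : Arc (ra G e) := by
  refine ⟨ph.continuous.comp ((G.continuous_arc e).comp continuous_projIcc), ?_⟩
  intro s hs t ht hst
  have h1 := G.injective_arc e (ph.injective hst)
  rw [projIcc_of_mem _ hs, projIcc_of_mem _ ht] at h1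
  simpa using h1

theorem oa_arc (e : G.ι) : Arc (oa G e) := by
  unfold oa
  split_ifs
  · exact ra_arc G e
  · refine ⟨(ra_arc G e).cont.comp (by fun_prop), ?_⟩
    intro s hs t ht hst
    have := (ra_arc G e).inj (x₁ := 1 - s) (x₂ := 1 - t) ⟨by linarith [hs.2], by linarith [hs.1]⟩
      ⟨by linarith [ht.2], by linarith [ht.1]⟩ hst
    linarith

theorem rev_Ioo : (fun t : ℝ => 1 - t) '' Ioo 0 1 = Ioo 0 1 := by simp
theorem rev_Icc : (fun t : ℝ => 1 - t) '' Icc 0 1 = Icc 0 1 := by simp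

theorem ra_Ioo (e : G.ι) : ra G e '' Ioo 0 1 = ph '' G.arcInterior e := by
  ext z; constructor
  · rintro ⟨t, ht, rfl⟩
    refine ⟨_, ⟨projIcc 0 1 zero_le_one t, ⟨?_, ?_⟩, rfl⟩, rfl⟩
    · rw [projIcc_of_mem _ (Ioo_subset_Icc_self ht)]
      intro h; exact ht.1.ne' (congrArg Subtype.val h)
    · rw [projIcc_of_mem _ (Ioo_subset_Icc_self ht)]
      intro h; exact ht.2.ne (congrArg Subtype.val h)
  · rintro ⟨_, ⟨t, ⟨h0, h1⟩, rfl⟩, rfl⟩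
    refine ⟨t, ⟨lt_of_le_of_ne t.2.1 fun h => h0 (Subtype.ext h.symm),
      lt_of_le_of_ne t.2.2 fun h => h1 (Subtype.ext h)⟩, ?_⟩
    simp [ra]

theorem oa_Ioo (e : G.ι) : oa G e '' Ioo 0 1 = ph '' G.arcInterior e := by
  rw [← ra_Ioo]
  by_cases h : toLex (G.arc e 0) < toLex (G.arc e 1)
  · have : oa G e = ra G e := by funext t; simp [oa, h]
    rw [this]
  · have : oa G e = ra G e ∘ fun t => 1 - t := by funext t; simp [oa, h]
    rw [this, image_comp, rev_Ioo]

theorem ra_im (e : G.ι) : im (ra G e) = ph '' range (G.arc e) := by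
  ext z; constructor
  · rintro ⟨t, ht, rfl⟩
    exact ⟨_, ⟨_, rfl⟩, rfl⟩
  · rintro ⟨_, ⟨t, rfl⟩, rfl⟩
    exact ⟨t, t.2, by simp [ra]⟩

theorem oa_im (e : G.ι) : im (oa G e) = ph '' range (G.arc e) := by
  rw [← ra_im]
  by_cases h : toLex (G.arc e 0) < toLex (G.arc e 1)
  · have : oa G e = ra G e := by funext t; simp [oa, h]
    rw [this]
  · have : oa G e = ra G e ∘ fun t => 1 - t := by funext t; simp [oa, h]
    rw [im, im, this, image_comp, rev_Icc]

theorem oa_ends (e : G.ι) : ∃ p q, oa G e 0 = ph p ∧ oa G e 1 = ph q ∧ toLex p < toLex q ∧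
    G.endpoints e = {p, q} ∧ p ∈ G.V ∧ q ∈ G.V := by
  by_cases h : toLex (G.arc e 0) < toLex (G.arc e 1)
  · exact ⟨G.arc e 0, G.arc e 1, by simp [oa, h, ra], by simp [oa, h, ra], h, rfl,
      G.source_mem e, G.target_mem e⟩
  · refine ⟨G.arc e 1, G.arc e 0, by simp [oa, h, ra], by simp [oa, h, ra], ?_, pair_comm _ _,
      G.target_mem e, G.source_mem e⟩
    exact lt_of_le_of_ne (not_lt.1 h) fun h' => G.ends_ne e (toLex.injective h').symm

theorem conv_sep (hsep : G.Separated) (e f : G.ι) (hef : e ≠ f) (h0 : oa G e 0 = oa G f 0) (h1 : oa G e 1 = oa G f 1) :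
    oa G e '' Ioo 0 1 ∩ oa G f '' Ioo 0 1 = ∅ ∧
    ∃ w ∈ G.V.image ph, w ≠ oa G e 0 ∧ w ≠ oa G e 1 ∧ Od (W (oa G e) (oa G f) w) := by
  obtain ⟨p, q, e0, e1, hpq, hE, hp, hq⟩ := oa_ends G e
  obtain ⟨p', q', f0, f1, hpq', hF, hp', hq'⟩ := oa_ends G f
  have hpp : p = p' := ph.injective (by rw [← e0, ← f0, h0])
  have hqq : q = q' := ph.injective (by rw [← e1, ← f1, h1])
  subst hpp hqq
  have hpar : G.Parallel e f := ⟨hef, hE.trans hF.symm⟩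
  have hdis : oa G e '' Ioo 0 1 ∩ oa G f '' Ioo 0 1 = ∅ := by
    rw [oa_Ioo, oa_Ioo, ← image_inter ph.injective]
    have := hsep.1 e f hpar
    rw [TopMultigraph.Cross, not_nonempty_iff_eq_empty] at this
    rw [this, image_empty]
  refine ⟨hdis, ?_⟩
  have hP : Par (oa G e) (oa G f) := ⟨oa_arc G e, oa_arc G f, h0, h1⟩
  have hd : im (oa G e) ∩ im (oa G f) ⊆ {oa G e 0, oa G e 1} := by
    rintro z ⟨⟨s, hs, rfl⟩, ⟨t, ht, hst⟩⟩
    by_contra hcon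
    simp only [mem_insert_iff, mem_singleton_iff, not_or] at hcon
    have hs' : s ∈ Ioo (0 : ℝ) 1 := ⟨hs.1.lt_of_ne fun h => hcon.1 (by rw [← h]), hs.2.lt_of_ne fun h => hcon.2 (by rw [← h])⟩
    have ht' : t ∈ Ioo (0 : ℝ) 1 := ⟨ht.1.lt_of_ne fun h => hcon.1 (by rw [← hst, h0, ← h]),
      ht.2.lt_of_ne fun h => hcon.2 (by rw [← hst, h1, ← h])⟩
    have : oa G e s ∈ oa G e '' Ioo 0 1 ∩ oa G f '' Ioo 0 1 := ⟨⟨s, hs', rfl⟩, ⟨t, ht', hst⟩⟩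
    rw [hdis] at this; exact this
  obtain ⟨z, hz, ho⟩ := exists_odd hP hd
  -- open set of odd points
  have hopen : IsOpen (cmp (cv (oa G e) (oa G f)) z) := cmp_open hP.compact.isClosed z
  classical
  have hPU : ph '' G.pairUnion p q = ⋃ i ∈ (Finset.univ : Finset G.ι).filter (fun i => G.Joins i p q), im (oa G i) := by
    rw [TopMultigraph.pairUnion, image_iUnion₂]
    ext x
    simp only [mem_iUnion, Finset.mem_filter, Finset.mem_univ, true_and, mem_ofPred_eq, oa_im, exists_prop]
  have hintr : interior (ph '' G.pairUnion p q) = ∅ := by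
    rw [hPU]; exact arcs_interior _ _ fun i _ => oa_arc G i
  obtain ⟨x, hx1, hx2⟩ : ∃ x ∈ cmp (cv (oa G e) (oa G f)) z, x ∉ ph '' G.pairUnion p q := by
    by_contra hcon
    push Not at hcon
    have := interior_maximal (s := ph '' G.pairUnion p q) hcon hopen (mem_cmp hz)
    rw [hintr] at this; exact this
  have hox : Od (W (oa G e) (oa G f) x) := by
    rw [hP.const (cmp_pre _ _) (cmp_disj _ _) (mem_cmp hz) hx1]; exact ho
  have hx2' : ph.symm x ∉ G.pairUnion p q := fun h => hx2 ⟨_, h, by simp⟩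
  set ℓ := connectedComponentIn (G.pairUnion p q)ᶜ (ph.symm x) with hℓ
  have hxl : x ∈ ph '' ℓ := ⟨ph.symm x, mem_connectedComponentIn hx2', by simp⟩
  have hpre : IsPreconnected (ph '' ℓ) := isPreconnected_connectedComponentIn.image _ ph.continuous.continuousOn
  have hsubU : cv (oa G e) (oa G f) ⊆ ph '' G.pairUnion p q := by
    rw [hPU]
    apply union_subset
    · exact subset_biUnion_of_mem (u := fun i => im (oa G i)) (Finset.mem_coe.2 (Finset.mem_filter.2 ⟨Finset.mem_univ _, hE⟩))
    · exact subset_biUnion_of_mem (u := fun i => im (oa G i)) (Finset.mem_coe.2 (Finset.mem_filter.2 ⟨Finset.mem_univ _, hF⟩))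
  have hdisj : Disjoint (ph '' ℓ) (cv (oa G e) (oa G f)) := by
    refine disjoint_left.2 ?_
    rintro y ⟨y', hy', rfl⟩ hy2
    obtain ⟨y2, hy2', he⟩ := hsubU hy2
    rw [ph.injective he] at hy2'
    exact connectedComponentIn_subset _ _ hy' hy2'
  have hbd : Bornology.IsBounded ℓ := by
    by_contra hb
    have hb' : ¬ Bornology.IsBounded (ph '' ℓ) := by
      intro h
      apply hb
      have := (ph.symm.lipschitz.isBounded_image h)
      rwa [← image_comp, show (⇑ph.symm ∘ ⇑ph) = id from by funext; simp, image_id] at this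
    have := hP.unb hpre hdisj hxl hb'
    rw [this] at hox
    exact Ev.zero.not_od hox
  have hpq' : p ≠ q := fun h => by rw [h] at hpq; exact lt_irrefl _ hpq
  have hlens : G.IsLens ℓ := by
    refine ⟨p, q, hpq', ⟨e, hE⟩, ?_, hbd, ⟨_, hx2', rfl⟩⟩
    intro i j hi hj hij
    exact hsep.1 i j ⟨hij, hi.trans hj.symm⟩
  obtain ⟨v, hv, hvl⟩ := hsep.2 ℓ hlens
  have hvl' : ph v ∈ ph '' ℓ := ⟨v, hvl, rfl⟩
  have hvn : ph v ∉ cv (oa G e) (oa G f) := disjoint_left.1 hdisj hvl'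
  refine ⟨ph v, Finset.mem_image_of_mem _ hv, fun h => hvn (Or.inl (h ▸ im0 _)), fun h => hvn (Or.inl (h ▸ im1 _)), ?_⟩
  rw [hP.const hpre hdisj hxl hvl']
  exact hox

/-- the normalised drawing of a separated graph -/
noncomputable def toDraw (hsc : G.SingleCrossing) (hsep : G.Separated) : Draw where
  V := G.V.image ph
  E := G.ι
  fin := inferInstance
  γ := oa G
  arc := oa_arc G
  s0 e := by
    obtain ⟨p, q, e0, e1, hpq, hE, hp, hq⟩ := oa_ends G e
    rw [e0]; exact Finset.mem_image_of_mem _ hp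
  s1 e := by
    obtain ⟨p, q, e0, e1, hpq, hE, hp, hq⟩ := oa_ends G e
    rw [e1]; exact Finset.mem_image_of_mem _ hq
  av e t ht h := by
    have h1 : oa G e t ∈ oa G e '' Ioo 0 1 := ⟨t, ht, rfl⟩
    rw [oa_Ioo] at h1
    obtain ⟨x, ⟨t', ht', rfl⟩, hx⟩ := h1
    rw [← hx] at h
    obtain ⟨y, hy, hy'⟩ := Finset.mem_image.1 h
    rw [ph.injective hy'] at hy
    exact G.interior_avoids e t' ht'.1 ht'.2 hy
  sc e f hef := by
    rw [oa_Ioo, oa_Ioo, ← image_inter ph.injective]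
    exact (hsc e f hef).image _
  par e f hef h0 h1 := (conv_sep G hsep e f hef h0 h1).1
  nop e f h := by
    obtain ⟨p, q, e0, e1, hpq, hE, hp, hq⟩ := oa_ends G e
    obtain ⟨p', q', f0, f1, hpq', hF, hp', hq'⟩ := oa_ends G f
    have h1 : p = q' := ph.injective (by rw [← e0, ← f1, h.1])
    have h2 : q = p' := ph.injective (by rw [← e1, ← f0, h.2])
    subst h1 h2
    exact lt_asymm hpq hpq'
  sep e f hef h0 h1 := (conv_sep G hsep e f hef h0 h1).2

theorem toDraw_card (hsc : G.SingleCrossing) (hsep : G.Separated) : (toDraw G hsc hsep).V.card = G.V.card :=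
  Finset.card_image_of_injective _ ph.injective

theorem toDraw_cr (hsc : G.SingleCrossing) (hsep : G.Separated) (e f : G.ι) :
    (toDraw G hsc hsep).Cr e f ↔ e ≠ f ∧ G.Cross e f := by
  unfold Draw.Cr
  refine and_congr Iff.rfl ?_
  change (oa G e '' Ioo 0 1 ∩ oa G f '' Ioo 0 1).Nonempty ↔ _
  rw [oa_Ioo, oa_Ioo, ← image_inter ph.injective, image_nonempty]
  rfl

theorem two_cr (hsc : G.SingleCrossing) (hsep : G.Separated) :
    Nat.card {p : G.ι × G.ι // (toDraw G hsc hsep).Cr p.1 p.2} ≤ 2 * G.crossingNumber := by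
  classical
  unfold TopMultigraph.crossingNumber
  rw [Nat.card_eq_fintype_card, Nat.card_eq_fintype_card, Fintype.card_subtype, Fintype.card_subtype]
  rw [mul_comm]
  refine (Finset.card_le_mul_card_image (f := fun p : G.ι × G.ι => s(p.1, p.2)) _ 2 ?_).trans ?_
  · intro p _
    induction p using Sym2.ind with
    | _ a b =>
      refine (Finset.card_le_card (t := {(a, b), (b, a)}) ?_).trans Finset.card_le_two
      rintro ⟨x, y⟩ hxy
      have := (Finset.mem_filter.1 hxy).2
      rw [Sym2.eq_iff] at this
      rcases this with ⟨h1, h2⟩ | ⟨h1, h2⟩ <;> simp at h1 h2 <;> simp [h1, h2]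
  · rw [mul_comm]
    refine Nat.mul_le_mul_right _ (Finset.card_le_card ?_)
    intro p hp
    obtain ⟨⟨x, y⟩, hxy, rfl⟩ := Finset.mem_image.1 hp
    have hc := (toDraw_cr G hsc hsep x y).1 (Finset.mem_filter.1 hxy).2
    refine Finset.mem_filter.2 ⟨Finset.mem_univ _, by simpa using hc.1, ?_⟩
    intro e he f hf hef
    have hc' : G.Cross y x := by
      have := hc.2; unfold TopMultigraph.Cross at this ⊢; rwa [inter_comm]
    rcases Sym2.mem_iff.1 he with rfl | rfl <;> rcases Sym2.mem_iff.1 hf with rfl | rfl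
    · exact absurd rfl hef
    · exact hc.2
    · exact hc'
    · exact absurd rfl hef
end conv
end CL

namespace CL

/-- open arc -/
def ii (γ : ℝ → ℂ) : Set ℂ := γ '' Ioo (0 : ℝ) 1

theorem ii_sub (γ : ℝ → ℂ) : ii γ ⊆ im γ := image_mono Ioo_subset_Icc_self

theorem im_cases {γ : ℝ → ℂ} {z : ℂ} (h : z ∈ im γ) : z = γ 0 ∨ z = γ 1 ∨ z ∈ ii γ := by
  obtain ⟨t, ht, rfl⟩ := h
  rcases ht.1.eq_or_lt with h0 | h0
  · left; rw [h0]
  rcases ht.2.eq_or_lt with h1 | h1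
  · right; left; rw [h1]
  · right; right; exact ⟨t, ⟨h0, h1⟩, rfl⟩

theorem ii_pre {γ : ℝ → ℂ} (h : Arc γ) : IsPreconnected (ii γ) :=
  isPreconnected_Ioo.image _ h.cont.continuousOn

theorem ii_ne0 {γ : ℝ → ℂ} (h : Arc γ) : γ 0 ∉ ii γ := by
  rintro ⟨t, ht, h'⟩
  exact ht.1.ne' (h.inj (Ioo_subset_Icc_self ht) (by simp) h')

theorem ii_ne1 {γ : ℝ → ℂ} (h : Arc γ) : γ 1 ∉ ii γ := by
  rintro ⟨t, ht, h'⟩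
  exact ht.2.ne (h.inj (Ioo_subset_Icc_self ht) (by simp) h')

structure Bundle {ι : Type*} (F : Finset ι) (γ : ι → ℝ → ℂ) (u v : ℂ) : Prop where
  arc : ∀ i ∈ F, Arc (γ i)
  h0 : ∀ i ∈ F, γ i 0 = u
  h1 : ∀ i ∈ F, γ i 1 = v
  dis : ∀ i ∈ F, ∀ j ∈ F, i ≠ j → Disjoint (ii (γ i)) (ii (γ j))

section
variable {ι : Type*} {F : Finset ι} {γ : ι → ℝ → ℂ} {u v : ℂ}

theorem Bundle.par (B : Bundle F γ u v) {i j : ι} (hi : i ∈ F) (hj : j ∈ F) : Par (γ i) (γ j) :=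
  ⟨B.arc i hi, B.arc j hj, (B.h0 i hi).trans (B.h0 j hj).symm, (B.h1 i hi).trans (B.h1 j hj).symm⟩

theorem Bundle.off (B : Bundle F γ u v) {i j : ι} (hi : i ∈ F) (hj : j ∈ F) (hij : i ≠ j) {z : ℂ}
    (hz : z ∈ ii (γ i)) : z ∉ im (γ j) := by
  intro h
  rcases im_cases h with h | h | h
  · rw [h, B.h0 j hj, ← B.h0 i hi] at hz; exact ii_ne0 (B.arc i hi) hz
  · rw [h, B.h1 j hj, ← B.h1 i hi] at hz; exact ii_ne1 (B.arc i hi) hz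
  · exact disjoint_left.1 (B.dis i hi j hj hij) hz h

/-- winding constant along an open arc of the bundle -/
theorem Bundle.along (B : Bundle F γ u v) {i j k : ι} (hi : i ∈ F) (hj : j ∈ F) (hk : k ∈ F) (hij : i ≠ j)
    (hik : i ≠ k) {z w : ℂ} (hz : z ∈ ii (γ i)) (hw : w ∈ ii (γ i)) : W (γ j) (γ k) z = W (γ j) (γ k) w := by
  refine (B.par hj hk).const (ii_pre (B.arc i hi)) (disjoint_left.2 ?_) hw hz
  rintro x hx (h | h)
  · exact B.off hi hj hij hx h
  · exact B.off hi hk hik hx h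

theorem Bundle.outer (B : Bundle F γ u v) (hne : F.Nonempty) :
    ∃ o ∈ F, ∀ f ∈ F, ∀ g ∈ F, f ≠ o → g ≠ o → ∀ z ∈ ii (γ o), W (γ f) (γ g) z = 0 := by
  classical
  set K : Set ℂ := ⋃ i ∈ F, im (γ i) with hK
  have hKc : IsCompact K := F.isCompact_biUnion fun i hi => (B.arc i hi).compact
  have sub : ∀ i ∈ F, im (γ i) ⊆ K := fun i hi => subset_biUnion_of_mem (u := fun i => im (γ i)) (Finset.mem_coe.2 hi)
  obtain ⟨R, hR⟩ := hKc.isBounded.subset_closedBall 0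
  obtain ⟨w, hw⟩ : ∃ w : ℂ, R < ‖w‖ := ⟨((|R| + 1 : ℝ) : ℂ), by
    rw [Complex.norm_real, Real.norm_eq_abs, abs_of_pos (by positivity)]
    linarith [le_abs_self R]⟩
  have hwK : w ∉ K := fun h => by have := hR h; rw [mem_closedBall_zero_iff] at this; linarith
  obtain ⟨i, hi⟩ := hne
  obtain ⟨x, hxK, hxP, hxc⟩ := front_inf hKc.isClosed hwK (P := {u, v}) (by simp)
    (fun h => (B.arc i hi).infinite ((by simp : ({u, v} : Set ℂ).Finite).subset ((sub i hi).trans h)))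
  obtain ⟨o, ho, hxo⟩ := mem_iUnion₂.1 hxK
  have hxo' : x ∈ ii (γ o) := by
    rcases im_cases hxo with h | h | h
    · exact absurd (Or.inl (h.trans (B.h0 o ho))) hxP
    · exact absurd (Or.inr (h.trans (B.h1 o ho))) hxP
    · exact h
  refine ⟨o, ho, fun f hf g hg hfo hgo z hz => ?_⟩
  rw [B.along ho hf hg hfo.symm hgo.symm hz hxo']
  have hsub : cv (γ f) (γ g) ⊆ K := union_subset (sub f hf) (sub g hg)
  rw [(B.par hf hg).touch (cmp_pre K w) ((cmp_disj K w).mono_right hsub) (mem_cmp hwK) hxc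
    (by
      rintro (h | h)
      · exact B.off ho hf hfo.symm hxo' h
      · exact B.off ho hg hgo.symm hxo' h)]
  exact (B.par hf hg).far (hsub.trans hR) hw

theorem Bundle.reach (B : Bundle F γ u v) {o : ι} (ho : o ∈ F)
    (hO : ∀ f ∈ F, ∀ g ∈ F, f ≠ o → g ≠ o → ∀ z ∈ ii (γ o), W (γ f) (γ g) z = 0)
    {f g : ι} (hf : f ∈ F) (hg : g ∈ F) (hfo : f ≠ o) (hgo : g ≠ o) {y : ℂ}
    (y0 : y ∉ im (γ o)) (y1 : y ∉ im (γ f)) (y2 : y ∉ im (γ g)) (hy : Od (W (γ f) (γ g) y)) :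
    ∃ x ∈ ii (γ f), W (γ o) (γ g) x = W (γ o) (γ g) y := by
  set K : Set ℂ := im (γ o) ∪ cv (γ f) (γ g) with hK
  have hKc : IsCompact K := (B.arc o ho).compact.union (B.par hf hg).compact
  have hyK : y ∉ K := by
    rintro (h | h | h)
    exacts [y0 h, y1 h, y2 h]
  have d1 : Disjoint (cmp K y) (cv (γ f) (γ g)) := (cmp_disj K y).mono_right subset_union_right
  have hb : Bornology.IsBounded (cmp K y) := by
    by_contra hb
    rw [(B.par hf hg).unb (cmp_pre K y) d1 (mem_cmp hyK) hb] at hy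
    exact Ev.zero.not_od hy
  obtain ⟨x, hxK, hxc, hxg⟩ := front_arc hKc.isClosed hyK hb (B.arc g hg).cont (B.arc g hg).inj y2
  have hxe : ∀ i ∈ F, x ∈ im (γ i) → x ∈ ii (γ i) := by
    intro i hi h
    rcases im_cases h with h | h | h
    · exact absurd (by rw [h, B.h0 i hi, ← B.h0 g hg]; exact im0 _) hxg
    · exact absurd (by rw [h, B.h1 i hi, ← B.h1 g hg]; exact im1 _) hxg
    · exact h
  rcases hxK with h | h | h
  · exfalso
    have hx := hxe o ho h
    have h1 := hO f hf g hg hfo hgo x hx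
    rw [(B.par hf hg).touch (cmp_pre K y) d1 (mem_cmp hyK) hxc (by
      rintro (h | h)
      · exact B.off ho hf hfo.symm hx h
      · exact B.off ho hg hgo.symm hx h)] at h1
    rw [h1] at hy
    exact Ev.zero.not_od hy
  · have hx := hxe f hf h
    refine ⟨x, hx, ?_⟩
    refine (B.par ho hg).touch (cmp_pre K y) ((cmp_disj K y).mono_right ?_) (mem_cmp hyK) hxc ?_
    · exact union_subset subset_union_left (subset_union_right.trans subset_union_right)
    · rintro (h | h)
      · exact B.off hf ho hfo hx h
      · exact hxg h
  · exact absurd h hxg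

theorem Bundle.chain (B : Bundle F γ u v) (hne : F.Nonempty) :
    ∃ o ∈ F, ∀ f ∈ F, ∀ g ∈ F, ∀ y z, (∀ i ∈ F, y ∉ im (γ i)) → (∀ i ∈ F, z ∉ im (γ i)) →
      Od (W (γ o) (γ f) y) → Ev (W (γ o) (γ g) y) → Od (W (γ o) (γ g) z) → Ev (W (γ o) (γ f) z) → False := by
  obtain ⟨o, ho, hO⟩ := B.outer hne
  refine ⟨o, ho, fun f hf g hg y z hy hz a1 a2 a3 a4 => ?_⟩
  have hfo : f ≠ o := by rintro rfl; rw [W_self] at a1; exact Ev.zero.not_od a1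
  have hgo : g ≠ o := by rintro rfl; rw [W_self] at a3; exact Ev.zero.not_od a3
  have hfg : f ≠ g := by rintro rfl; exact a2.not_od a1
  have key : ∀ x, W (γ f) (γ g) x = - W (γ o) (γ f) x + W (γ o) (γ g) x := fun x => by simp [W]
  obtain ⟨x1, h1, e1⟩ := B.reach ho hO hf hg hfo hgo (hy o ho) (hy f hf) (hy g hg)
    (by rw [key]; exact a1.neg.add_ev a2)
  obtain ⟨x2, h2, e2⟩ := B.reach ho hO hf hg hfo hgo (hz o ho) (hz f hf) (hz g hg)
    (by rw [key]; exact a4.neg.add_od a3)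
  have := B.along hf ho hg hfo hfg h1 h2
  rw [e1, e2] at this
  rw [this] at a2
  exact a2.not_od a3
end

end CL

namespace CL

theorem prs_ge {N ι : Type*} {adj : N → N → Prop} (hs : ∀ a b, adj a b → adj b a) (T : Finset N) (E : Finset ι)
    (s t : ι → N) (hadj : ∀ e ∈ E, adj (s e) (t e)) (hsT : ∀ e ∈ E, s e ∈ T) (htT : ∀ e ∈ E, t e ∈ T)
    (hinj : ∀ e ∈ E, ∀ f ∈ E, s e = s f → t e = t f → e = f)
    (hno : ∀ e ∈ E, ∀ f ∈ E, ¬ (s e = t f ∧ t e = s f)) : 2 * E.card ≤ prs adj T := by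
  classical
  unfold prs
  rw [← Finset.card_sigma]
  set S1 := E.image (fun e => (⟨s e, t e⟩ : Σ _ : N, N)) with h1
  set S2 := E.image (fun e => (⟨t e, s e⟩ : Σ _ : N, N)) with h2
  have c1 : S1.card = E.card := by
    apply Finset.card_image_of_injOn
    intro e he f hf hef
    simp only [Sigma.mk.injEq, heq_eq_eq] at hef
    exact hinj e he f hf hef.1 hef.2
  have c2 : S2.card = E.card := by
    apply Finset.card_image_of_injOn
    intro e he f hf hef
    simp only [Sigma.mk.injEq, heq_eq_eq] at hef
    exact hinj e he f hf hef.2 hef.1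
  have hd : Disjoint S1 S2 := by
    rw [Finset.disjoint_left]
    intro x hx hx'
    obtain ⟨e, he, rfl⟩ := Finset.mem_image.1 hx
    obtain ⟨f, hf, hef⟩ := Finset.mem_image.1 hx'
    simp only [Sigma.mk.injEq, heq_eq_eq] at hef
    exact hno e he f hf ⟨hef.1.symm, hef.2.symm⟩
  have : (S1 ∪ S2).card = 2 * E.card := by rw [Finset.card_union_of_disjoint hd, c1, c2]; ring
  rw [← this]
  apply Finset.card_le_card
  intro x hx
  rcases Finset.mem_union.1 hx with hx | hx
  · obtain ⟨e, he, rfl⟩ := Finset.mem_image.1 hx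
    exact Finset.mem_sigma.2 ⟨hsT e he, mem_nb.2 ⟨htT e he, hadj e he⟩⟩
  · obtain ⟨e, he, rfl⟩ := Finset.mem_image.1 hx
    exact Finset.mem_sigma.2 ⟨htT e he, mem_nb.2 ⟨hsT e he, hs _ _ (hadj e he)⟩⟩

namespace Draw
variable (D : Draw)

/-- parallel edges -/
def Pa (e f : D.E) : Prop := D.γ e 0 = D.γ f 0 ∧ D.γ e 1 = D.γ f 1

variable {D}
theorem Pa.symm {e f : D.E} (h : D.Pa e f) : D.Pa f e := ⟨h.1.symm, h.2.symm⟩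
theorem Pa.trans {e f g : D.E} (h : D.Pa e f) (h' : D.Pa f g) : D.Pa e g := ⟨h.1.trans h'.1, h.2.trans h'.2⟩
theorem Pa.par {e f : D.E} (h : D.Pa e f) : Par (D.γ e) (D.γ f) := ⟨D.arc e, D.arc f, h.1, h.2⟩
variable (D)
theorem Pa.rfl (e : D.E) : D.Pa e e := ⟨Eq.refl _, Eq.refl _⟩

open Classical in
/-- vertices of `U` enclosed by a parallel pair -/
noncomputable def dd (U : Finset ℂ) (e f : D.E) : Finset ℂ :=
  U.filter fun w => w ≠ D.γ e 0 ∧ w ≠ D.γ e 1 ∧ Od (W (D.γ e) (D.γ f) w)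

variable {D}

theorem mem_dd {U : Finset ℂ} {e f : D.E} {w : ℂ} :
    w ∈ D.dd U e f ↔ w ∈ U ∧ w ≠ D.γ e 0 ∧ w ≠ D.γ e 1 ∧ Od (W (D.γ e) (D.γ f) w) := by
  classical
  simp [dd]

theorem vert_off {e : D.E} {w : ℂ} (hw : w ∈ D.V) (h0 : w ≠ D.γ e 0) (h1 : w ≠ D.γ e 1) : w ∉ im (D.γ e) := by
  intro h
  rcases im_cases h with h | h | ⟨t, ht, h⟩
  · exact h0 h
  · exact h1 h
  · exact D.av e t ht (h ▸ hw)

theorem vert_cv {e f : D.E} (h : D.Pa e f) {w : ℂ} (hw : w ∈ D.V) (h0 : w ≠ D.γ e 0) (h1 : w ≠ D.γ e 1) :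
    w ∉ cv (D.γ e) (D.γ f) := by
  rintro (h' | h')
  · exact vert_off hw h0 h1 h'
  · exact vert_off hw (h.1 ▸ h0) (h.2 ▸ h1) h'

theorem ends_ne (e : D.E) : D.γ e 0 ≠ D.γ e 1 := fun h => by
  have := (D.arc e).inj (by simp) (by simp) h
  norm_num at this

theorem ev_of_notin {U : Finset ℂ} {e f : D.E} (h : D.Pa e f) {w : ℂ} (hU : w ∈ U) (hw : w ∈ D.V)
    (h0 : w ≠ D.γ e 0) (h1 : w ≠ D.γ e 1) (hn : w ∉ D.dd U e f) : Ev (W (D.γ e) (D.γ f) w) := by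
  rcases ev_or_od (h.par.int (vert_cv h hw h0 h1)) with h' | h'
  · exact h'
  · exact absurd (mem_dd.2 ⟨hU, h0, h1, h'⟩) hn

theorem od_symm {e f : ℝ → ℂ} {w : ℂ} (h : Od (W e f w)) : Od (W f e w) := by
  rw [W_symm]; exact h.neg

theorem dd_symm {U : Finset ℂ} {e f : D.E} (h : D.Pa e f) : D.dd U e f = D.dd U f e := by
  ext w
  rw [mem_dd, mem_dd, h.1, h.2]
  exact ⟨fun ⟨a, b, c, d⟩ => ⟨a, b, c, od_symm d⟩, fun ⟨a, b, c, d⟩ => ⟨a, b, c, od_symm d⟩⟩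

theorem dd_self {U : Finset ℂ} {e : D.E} : D.dd U e e = ∅ := by
  rw [Finset.eq_empty_iff_forall_notMem]
  intro w hw
  have := (mem_dd.1 hw).2.2.2
  rw [W_self] at this
  exact Ev.zero.not_od this

open scoped symmDiff in
theorem dd_xor {U : Finset ℂ} (hU : U ⊆ D.V) {o e f : D.E} (he : D.Pa o e) (hf : D.Pa o f) :
    D.dd U e f = (D.dd U o e \ D.dd U o f) ∪ (D.dd U o f \ D.dd U o e) := by
  ext w
  simp only [Finset.mem_union, Finset.mem_sdiff]
  have key : W (D.γ e) (D.γ f) w = - W (D.γ o) (D.γ e) w + W (D.γ o) (D.γ f) w := by simp [W]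
  constructor
  · intro h
    obtain ⟨a, b, c, d⟩ := mem_dd.1 h
    rw [← he.1] at b; rw [← he.2] at c
    by_cases h1 : w ∈ D.dd U o e
    · left
      refine ⟨h1, fun h2 => ?_⟩
      rw [key] at d
      exact ((mem_dd.1 h1).2.2.2.neg.add (mem_dd.1 h2).2.2.2).not_od d
    · right
      have h1' := ev_of_notin he a (hU a) b c h1
      refine ⟨mem_dd.2 ⟨a, b, c, ?_⟩, h1⟩
      have : W (D.γ o) (D.γ f) w = W (D.γ o) (D.γ e) w + W (D.γ e) (D.γ f) w := by rw [W_add]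
      rw [this]; exact h1'.add_od d
  · rintro (⟨h1, h2⟩ | ⟨h1, h2⟩)
    · obtain ⟨a, b, c, d⟩ := mem_dd.1 h1
      have h2' := ev_of_notin hf a (hU a) b c h2
      refine mem_dd.2 ⟨a, he.1 ▸ b, he.2 ▸ c, ?_⟩
      rw [key]; exact d.neg.add_ev h2'
    · obtain ⟨a, b, c, d⟩ := mem_dd.1 h1
      have h2' := ev_of_notin he a (hU a) b c h2
      refine mem_dd.2 ⟨a, he.1 ▸ b, he.2 ▸ c, ?_⟩
      rw [key]; exact h2'.neg.add_od d

theorem bundle {F : Finset D.E} {o : D.E} (hF : ∀ f ∈ F, D.Pa o f) : Bundle F D.γ (D.γ o 0) (D.γ o 1) where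
  arc i _ := D.arc i
  h0 i hi := (hF i hi).1.symm
  h1 i hi := (hF i hi).2.symm
  dis i hi j hj hij := by
    have h := (hF i hi).symm.trans (hF j hj)
    exact disjoint_iff_inter_eq_empty.2 (D.par i j hij h.1 h.2)

theorem chain {U : Finset ℂ} (hU : U ⊆ D.V) {F : Finset D.E} (hne : F.Nonempty)
    (hF : ∀ e ∈ F, ∀ f ∈ F, D.Pa e f) :
    ∃ o ∈ F, ∀ f ∈ F, ∀ g ∈ F, D.dd U o f ⊆ D.dd U o g ∨ D.dd U o g ⊆ D.dd U o f := by
  obtain ⟨i, hi⟩ := hne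
  obtain ⟨o, ho, hch⟩ := (bundle (hF i hi)).chain ⟨i, hi⟩
  refine ⟨o, ho, fun f hf g hg => ?_⟩
  by_contra hcon
  push Not at hcon
  obtain ⟨y, hy1, hy2⟩ := Finset.not_subset.1 hcon.1
  obtain ⟨z, hz1, hz2⟩ := Finset.not_subset.1 hcon.2
  obtain ⟨a, b, c, d⟩ := mem_dd.1 hy1
  obtain ⟨a', b', c', d'⟩ := mem_dd.1 hz1
  refine hch f hf g hg y z ?_ ?_ d (ev_of_notin (hF o ho g hg) a (hU a) b c hy2) d'
    (ev_of_notin (hF o ho f hf) a' (hU a') b' c' hz2)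
  · intro i hi
    have h := hF o ho i hi
    exact vert_off (hU a) (h.1 ▸ b) (h.2 ▸ c)
  · intro i hi
    have h := hF o ho i hi
    exact vert_off (hU a') (h.1 ▸ b') (h.2 ▸ c')

variable (D)
/-- separation of a subfamily -/
def Sep (E' : Finset D.E) (U : Finset ℂ) : Prop :=
  ∀ e ∈ E', ∀ f ∈ E', e ≠ f → D.Pa e f → (D.dd U e f).Nonempty

end Draw
end CL

namespace CL

theorem im_pathConn {γ : ℝ → ℂ} (h : Arc γ) : IsPathConnected (im γ) :=
  ((convex_Icc (0 : ℝ) 1).isPathConnected ⟨0, by simp⟩).image h.cont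

namespace Draw
variable (D : Draw)

/-- pairwise noncrossing -/
def NC (E' : Finset D.E) : Prop := ∀ e ∈ E', ∀ f ∈ E', e ≠ f → Disjoint (ii (D.γ e)) (ii (D.γ f))

/-- `e` joins `a` and `b` -/
def Jn (e : D.E) (a b : ℂ) : Prop := (D.γ e 0 = a ∧ D.γ e 1 = b) ∨ (D.γ e 0 = b ∧ D.γ e 1 = a)

variable {D}

theorem Jn.symm {e : D.E} {a b : ℂ} (h : D.Jn e a b) : D.Jn e b a := Or.symm h

theorem Jn.eq {e : D.E} {a b c d : ℂ} (h : D.Jn e a b) (h' : D.Jn e c d) : a = c ∨ a = d := by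
  rcases h with ⟨h1, h2⟩ | ⟨h1, h2⟩ <;> rcases h' with ⟨h3, h4⟩ | ⟨h3, h4⟩ <;>
    simp_all

theorem Jn.cases {e : D.E} {a b z : ℂ} (h : D.Jn e a b) (hz : z ∈ im (D.γ e)) : z = a ∨ z = b ∨ z ∈ ii (D.γ e) := by
  rcases h with ⟨h1, h2⟩ | ⟨h1, h2⟩ <;> rcases im_cases hz with h | h | h <;> simp_all

theorem Jn.mem {e : D.E} {a b : ℂ} (h : D.Jn e a b) : a ∈ im (D.γ e) := by
  rcases h with ⟨h, _⟩ | ⟨_, h⟩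
  · exact h ▸ im0 _
  · exact h ▸ im1 _

theorem ii_notV {e : D.E} {z : ℂ} (h : z ∈ ii (D.γ e)) : z ∉ D.V := by
  obtain ⟨t, ht, rfl⟩ := h
  exact D.av e t ht

theorem simple_bound {E' : Finset D.E} {U : Finset ℂ} (hU : U ⊆ D.V) (hNC : D.NC E')
    (h0 : ∀ e ∈ E', D.γ e 0 ∈ U) (h1 : ∀ e ∈ E', D.γ e 1 ∈ U)
    (hs : ∀ e ∈ E', ∀ f ∈ E', D.Pa e f → e = f) :
    E'.card ≤ 3 * U.card ∧ (3 ≤ U.card → E'.card + 6 ≤ 3 * U.card) := by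
  classical
  set adj : {x // x ∈ U} → {x // x ∈ U} → Prop := fun a b => ∃ e ∈ E', D.Jn e a b with hadj
  have hsy : ∀ a b, adj a b → adj b a := fun a b ⟨e, he, h⟩ => ⟨e, he, h.symm⟩
  have hi : ∀ a, ¬ adj a a := by
    rintro a ⟨e, he, h⟩
    have := ends_ne e
    rcases h with ⟨h1, h2⟩ | ⟨h1, h2⟩ <;> exact this (h1.trans h2.symm)
  have hK : ¬ HasK5 adj := by
    refine noK5_planar (K := fun a => {(a : ℂ)}) (Γ := fun a b => {z | ∃ e ∈ E', D.Jn e a b ∧ z ∈ im (D.γ e)})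
      hsy (fun a => isPathConnected_singleton _) ?_ ?_ ?_ ?_ ?_ ?_
    · rintro a b ⟨e, he, h⟩
      refine ⟨a, ⟨e, he, h, h.mem⟩, ?_⟩
      rintro z ⟨f, hf, h', hz⟩
      exact ((im_pathConn (D.arc f)).joinedIn _ h'.mem _ hz).mono fun x hx => ⟨f, hf, h', hx⟩
    · rintro a b ⟨e, he, h⟩
      exact ⟨a, ⟨e, he, h, h.mem⟩, rfl⟩
    · rintro a b ⟨e, he, h⟩
      exact ⟨b, ⟨e, he, h, h.symm.mem⟩, rfl⟩
    · intro a b hab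
      exact disjoint_singleton.2 fun h => hab (Subtype.ext h)
    · rintro a b c - hca hcb
      rw [disjoint_singleton_right]
      rintro ⟨e, he, h, hz⟩
      rcases h.cases hz with h' | h' | h'
      · exact hca (Subtype.ext h')
      · exact hcb (Subtype.ext h')
      · exact ii_notV h' (hU c.2)
    · rintro a b c d - - hac had hbc hbd
      rw [disjoint_left]
      rintro z ⟨e, he, h, hz⟩ ⟨f, hf, h', hz'⟩
      have hne : e ≠ f := by
        rintro rfl
        rcases h.eq h' with h | h
        · exact hac (Subtype.ext h)
        · exact had (Subtype.ext h)
      rcases h.cases hz with rfl | rfl | h2 <;> rcases h'.cases hz' with h3 | h3 | h3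
      · exact hac (Subtype.ext h3)
      · exact had (Subtype.ext h3)
      · exact ii_notV h3 (hU a.2)
      · exact hbc (Subtype.ext h3)
      · exact hbd (Subtype.ext h3)
      · exact ii_notV h3 (hU b.2)
      · exact ii_notV h2 (h3 ▸ hU c.2)
      · exact ii_notV h2 (h3 ▸ hU d.2)
      · exact disjoint_left.1 (hNC e he f hf hne) h2 h3
  have hT : (Finset.univ : Finset {x // x ∈ U}).card = U.card := by simp
  have hp : 2 * E'.card ≤ prs adj Finset.univ := by
    have := prs_ge hsy Finset.univ (Finset.univ : Finset {e // e ∈ E'}) (fun e => ⟨D.γ e 0, h0 e e.2⟩)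
      (fun e => ⟨D.γ e 1, h1 e e.2⟩) (fun e _ => ⟨e, e.2, .inl ⟨rfl, rfl⟩⟩) (by simp) (by simp)
      (fun e _ f _ h h' => Subtype.ext (hs e e.2 f f.2 ⟨congrArg Subtype.val h, congrArg Subtype.val h'⟩))
      (fun e _ f _ h => D.nop e f ⟨congrArg Subtype.val h.1, congrArg Subtype.val h.2⟩)
    simpa using this
  constructor
  · have := prs_le hsy hi hK Finset.univ
    omega
  · intro h3
    by_contra hcon
    obtain ⟨B, a, b, c, _⟩ := mader _ adj Finset.univ le_rfl hsy hi (by omega) (by omega)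
    exact hK ⟨B, a, b, c⟩

/-- winding number of a disjoint pair is constant along an edge -/
theorem NC.along {E' : Finset D.E} (hNC : D.NC E') {a g h : D.E} (ha : a ∈ E') (hg : g ∈ E') (hh : h ∈ E')
    (hag : a ≠ g) (hah : a ≠ h) (hgh : D.Pa g h) {z w : ℂ} (hz : z ∈ im (D.γ a)) (hw : w ∈ im (D.γ a))
    (hz' : z ∉ cv (D.γ g) (D.γ h)) (hw' : w ∉ cv (D.γ g) (D.γ h)) :
    W (D.γ g) (D.γ h) z = W (D.γ g) (D.γ h) w := by
  have hd : Disjoint (ii (D.γ a)) (cv (D.γ g) (D.γ h)) := by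
    rw [disjoint_left]
    rintro x hx (h | h)
    · rcases im_cases h with h | h | h
      · exact ii_notV hx (h ▸ D.s0 g)
      · exact ii_notV hx (h ▸ D.s1 g)
      · exact disjoint_left.1 (hNC a ha g hg hag) hx h
    · rcases im_cases h with h' | h' | h'
      · exact ii_notV hx (h' ▸ D.s0 _)
      · exact ii_notV hx (h' ▸ D.s1 _)
      · exact disjoint_left.1 (hNC a ha _ hh hah) hx h'
  have hcl : im (D.γ a) ⊆ closure (ii (D.γ a)) := by
    have : im (D.γ a) = D.γ a '' closure (Ioo 0 1) := by rw [closure_Ioo (by norm_num)]; rfl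
    rw [this]
    exact image_closure_subset_closure_image (D.arc a).cont
  have hp : IsPreconnected (insert z (insert w (ii (D.γ a)))) :=
    (ii_pre (D.arc a)).subset_closure ((subset_insert _ _).trans (subset_insert _ _))
      (insert_subset (hcl hz) (insert_subset (hcl hw) subset_closure))
  refine hgh.par.const hp ?_ (by simp) (by simp)
  rw [disjoint_insert_left, disjoint_insert_left]
  exact ⟨hz', hw', hd⟩

theorem NC.fin {E' : Finset D.E} (hNC : D.NC E') {e f g h : D.E} (he : e ∈ E') (hf : f ∈ E') (hg : g ∈ E')
    (hh : h ∈ E') (h1 : e ≠ g) (h2 : e ≠ h) (h3 : f ≠ g) (h4 : f ≠ h) :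
    (cv (D.γ e) (D.γ f) ∩ cv (D.γ g) (D.γ h)).Finite := by
  have key : ∀ a ∈ E', ∀ b ∈ E', a ≠ b → im (D.γ a) ∩ im (D.γ b) ⊆ D.V := by
    rintro a ha b hb hab z ⟨h, h'⟩
    rcases im_cases h with rfl | rfl | h
    · exact D.s0 a
    · exact D.s1 a
    rcases im_cases h' with rfl | rfl | h'
    · exact D.s0 b
    · exact D.s1 b
    · exact absurd h' (disjoint_left.1 (hNC a ha b hb hab) h)
  refine D.V.finite_toSet.subset ?_
  rintro z ⟨h | h, h' | h'⟩
  exacts [key e he g hg h1 ⟨h, h'⟩, key e he _ hh h2 ⟨h, h'⟩, key f hf g hg h3 ⟨h, h'⟩, key f hf _ hh h4 ⟨h, h'⟩]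

end Draw
end CL

namespace CL

theorem chain_eq {α : Type*} [DecidableEq α] {A B C D : Finset α} (h1 : A ⊆ B ∨ B ⊆ A) (h2 : C ⊆ D ∨ D ⊆ C)
    (hAC : A ⊆ C ∨ C ⊆ A) (hAD : A ⊆ D ∨ D ⊆ A) (hBC : B ⊆ C ∨ C ⊆ B) (hBD : B ⊆ D ∨ D ⊆ B)
    (h : (A \ B) ∪ (B \ A) = (C \ D) ∪ (D \ C)) (hne : ((A \ B) ∪ (B \ A)).Nonempty) :
    (A = C ∧ B = D) ∨ (A = D ∧ B = C) := by
  have key : ∀ A B C D : Finset α, A ⊆ B → C ⊆ D → (A ⊆ D ∨ D ⊆ A) → (B ⊆ C ∨ C ⊆ B) →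
      B \ A = D \ C → (B \ A).Nonempty → A = C ∧ B = D := by
    intro A B C D h1 h2 h3 h4 h5 ⟨x, hx⟩
    have e : ∀ y, (y ∈ B ∧ y ∉ A) ↔ (y ∈ D ∧ y ∉ C) := by
      intro y
      rw [← Finset.mem_sdiff, ← Finset.mem_sdiff, h5]
    have hx' := Finset.mem_sdiff.1 hx
    have hx2 := (e x).1 hx'
    have h3' : A ⊆ D := h3.resolve_right fun h => hx'.2 (h hx2.1)
    have h4' : C ⊆ B := h4.resolve_left fun h => hx2.2 (h hx'.1)
    have hAC : A = C := by
      ext y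
      constructor
      · intro hy
        by_contra hc
        exact ((e y).2 ⟨h3' hy, hc⟩).2 hy
      · intro hy
        by_contra hc
        exact ((e y).1 ⟨h4' hy, hc⟩).2 hy
    refine ⟨hAC, ?_⟩
    subst hAC
    ext y
    constructor
    · intro hy
      by_cases hc : y ∈ A
      · exact h2 hc
      · exact ((e y).1 ⟨hy, hc⟩).1
    · intro hy
      by_cases hc : y ∈ A
      · exact h1 hc
      · exact ((e y).2 ⟨hy, hc⟩).1
  have z : ∀ {A B : Finset α}, A ⊆ B → A \ B = ∅ := fun h => Finset.sdiff_eq_empty_iff_subset.2 h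
  rcases h1 with h1 | h1 <;> rcases h2 with h2 | h2 <;> rw [z h1] at h hne <;> rw [z h2] at h <;>
    simp only [Finset.empty_union, Finset.union_empty] at h hne
  · exact .inl (key A B C D h1 h2 hAD hBC h hne)
  · exact .inr (key A B D C h1 h2 hAC hBD h hne)
  · have := key B A C D h1 h2 hBD hAC h hne
    exact .inr ⟨this.2, this.1⟩
  · have := key B A D C h1 h2 hBC hAD h hne
    exact .inl ⟨this.2, this.1⟩

namespace Draw
variable {D : Draw}

theorem other_end (e : D.E) {x : ℂ} (h : x = D.γ e 0 ∨ x = D.γ e 1) : ∃ y, D.Jn e x y := by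
  rcases h with rfl | rfl
  · exact ⟨_, .inl ⟨rfl, rfl⟩⟩
  · exact ⟨_, .inr ⟨rfl, rfl⟩⟩

theorem Jn.ne {e : D.E} {x y : ℂ} (h : D.Jn e x y) : x ≠ y := by
  rcases h with ⟨rfl, rfl⟩ | ⟨rfl, rfl⟩
  · exact ends_ne e
  · exact (ends_ne e).symm

theorem Jn.pa {g h : D.E} (hgh : D.Pa g h) {x y : ℂ} (j : D.Jn g x y) : D.Jn h x y := by
  unfold Jn at *
  rwa [← hgh.1, ← hgh.2]

theorem Jn.off {g h : D.E} (hgh : D.Pa g h) {x y z : ℂ} (j : D.Jn g x y) (hz : z ∈ D.V) (h1 : z ≠ x) (h2 : z ≠ y) :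
    z ∉ cv (D.γ g) (D.γ h) := by
  rcases j with ⟨rfl, rfl⟩ | ⟨rfl, rfl⟩
  · exact vert_cv hgh hz h1 h2
  · exact vert_cv hgh hz h2 h1

theorem plane_bound : ∀ (m : ℕ) (E' : Finset D.E) (U : Finset ℂ), U.card ≤ m → U ⊆ D.V → D.NC E' → D.Sep E' U →
    (∀ e ∈ E', D.γ e 0 ∈ U) → (∀ e ∈ E', D.γ e 1 ∈ U) → E'.card ≤ 3 * U.card := by
  classical
  intro m
  induction m with
  | zero =>
    intro E' U hm hU hNC hS h0 h1
    have : U = ∅ := Finset.card_eq_zero.1 (by omega)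
    subst this
    have : E' = ∅ := Finset.eq_empty_of_forall_notMem fun e he => by simpa using h0 e he
    simp [this]
  | succ m ih =>
    intro E' U hm hU hNC hS h0 h1
    by_cases hsim : ∀ e ∈ E', ∀ f ∈ E', D.Pa e f → e = f
    · exact (simple_bound hU hNC h0 h1 hsim).1
    push Not at hsim
    obtain ⟨e0, he0, f0, hf0, hpa0, hne0⟩ := hsim
    set PP := (E' ×ˢ E').filter (fun p => D.Pa p.1 p.2 ∧ p.1 ≠ p.2) with hPP
    obtain ⟨⟨e, f⟩, hef, hmin⟩ := PP.exists_min_image (fun p => (D.dd U p.1 p.2).card)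
      ⟨(e0, f0), by simp [hPP, he0, hf0, hpa0, hne0]⟩
    have hmin' : ∀ g ∈ E', ∀ h ∈ E', g ≠ h → D.Pa g h → (D.dd U e f).card ≤ (D.dd U g h).card := by
      intro g hg h hh hne hp
      exact hmin (g, h) (by simp [hPP, hg, hh, hp, hne])
    simp only [hPP, Finset.mem_filter, Finset.mem_product] at hef
    obtain ⟨⟨he, hf⟩, hpa, hne⟩ := hef
    set I := D.dd U e f with hI
    set u := D.γ e 0 with hu
    set v := D.γ e 1 with hv
    have hINe : I.Nonempty := hS e he f hf hne hpa
    have hIU : I ⊆ U := fun w hw => (mem_dd.1 hw).1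
    have huI : u ∉ I := fun h => (mem_dd.1 h).2.1 rfl
    have hvI : v ∉ I := fun h => (mem_dd.1 h).2.2.1 rfl
    have huU : u ∈ U := h0 e he
    have hvU : v ∈ U := h1 e he
    have huv : u ≠ v := ends_ne e
    have offI : ∀ x ∈ I, x ∉ cv (D.γ e) (D.γ f) := fun x hx =>
      vert_cv hpa (hU (hIU hx)) (mem_dd.1 hx).2.1 (mem_dd.1 hx).2.2.1
    have hcl : ∀ a ∈ E', ∀ x y, D.Jn a x y → x ∈ I → (a ≠ e ∧ a ≠ f) ∧ (y ∈ I ∨ y = u ∨ y = v) := by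
      intro a ha x y hj hx
      have hae : a ≠ e := by
        rintro rfl; exact offI x hx (.inl hj.mem)
      have haf : a ≠ f := by
        rintro rfl; exact offI x hx (.inr hj.mem)
      refine ⟨⟨hae, haf⟩, ?_⟩
      by_contra hcon
      push Not at hcon
      have hyU : y ∈ U := by
        rcases hj with ⟨_, rfl⟩ | ⟨rfl, _⟩
        · exact h1 a ha
        · exact h0 a ha
      refine hcon.1 (mem_dd.2 ⟨hyU, hcon.2.1, hcon.2.2, ?_⟩)
      rw [hNC.along ha he hf hae haf hpa hj.symm.mem hj.mem (vert_cv hpa (hU hyU) hcon.2.1 hcon.2.2) (offI x hx)]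
      exact (mem_dd.1 hx).2.2.2
    set EI := E'.filter (fun a => D.γ a 0 ∈ I ∨ D.γ a 1 ∈ I) with hEI
    have hEIend : ∀ a ∈ EI, a ∈ E' ∧ ∃ x y, D.Jn a x y ∧ x ∈ I := by
      intro a ha
      obtain ⟨ha, h | h⟩ := Finset.mem_filter.1 ha
      · exact ⟨ha, _, _, .inl ⟨rfl, rfl⟩, h⟩
      · exact ⟨ha, _, _, .inr ⟨rfl, rfl⟩, h⟩
    have heEI : e ∉ EI := by
      intro h
      obtain ⟨_, x, y, hj, hx⟩ := hEIend e h
      exact (hcl e he x y hj hx).1.1 rfl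
    -- the inside is simple
    have hsimple : ∀ g ∈ EI, ∀ h ∈ EI, D.Pa g h → g = h := by
      intro g hgI h hhI hgh
      by_contra hne'
      obtain ⟨hg, x, y, hj, hx⟩ := hEIend g hgI
      obtain ⟨hh, -⟩ := hEIend h hhI
      have hj' := hj.pa hgh
      obtain ⟨⟨hge, hgf⟩, hy⟩ := hcl g hg x y hj hx
      obtain ⟨⟨hhe, hhf⟩, -⟩ := hcl h hh x y hj' hx
      have hxo := (mem_dd.1 hx).2.2.2
      have hxV := hU (hIU hx)
      have hxu : u ≠ x := fun h => huI (h ▸ hx)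
      have hxv : v ≠ x := fun h => hvI (h ▸ hx)
      have hA : ∀ z ∈ cv (D.γ g) (D.γ h), z ∉ cv (D.γ e) (D.γ f) → Od (W (D.γ e) (D.γ f) z) := by
        rintro z (hz | hz) hz'
        · rw [hNC.along hg he hf hge hgf hpa hz hj.mem hz' (offI x hx)]; exact hxo
        · rw [hNC.along hh he hf hhe hhf hpa hz hj'.mem hz' (offI x hx)]; exact hxo
      obtain ⟨m, hm, hmy⟩ : ∃ m, (m = u ∨ m = v) ∧ m ≠ y := by
        by_cases h : u = y
        · exact ⟨v, .inr rfl, fun h' => huv (h.trans h'.symm)⟩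
        · exact ⟨u, .inl rfl, h⟩
      have hmx : m ≠ x := by rcases hm with rfl | rfl <;> assumption
      have hmV : m ∈ D.V := by rcases hm with rfl | rfl; exacts [hU huU, hU hvU]
      have hmo := hj.off hgh hmV hmx hmy
      have hme : m ∈ im (D.γ e) := by rcases hm with rfl | rfl; exacts [im0 _, im1 _]
      have hmf : m ∈ im (D.γ f) := by
        rcases hm with rfl | rfl
        · rw [hu, hpa.1]; exact im0 _
        · rw [hv, hpa.2]; exact im1 _
      have hB : ∀ z ∈ cv (D.γ e) (D.γ f), z ∉ cv (D.γ g) (D.γ h) → W (D.γ g) (D.γ h) z = W (D.γ g) (D.γ h) m := by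
        rintro z (hz | hz) hz'
        · exact hNC.along he hg hh hge.symm hhe.symm hgh hz hme hz' hmo
        · exact hNC.along hf hg hh hgf.symm hhf.symm hgh hz hmf hz' hmo
      have hfin := hNC.fin he hf hg hh hge.symm hhe.symm hgf.symm hhf.symm
      have hm0 : W (D.γ g) (D.γ h) m = 0 := by
        rcases front2_unb hpa.par hgh.par hfin with ⟨z, hz, hz', h0⟩ | ⟨z, hz, hz', h0⟩
        · rw [← hB z hz hz', h0]
        · have := hA z hz hz'
          rw [h0] at this
          exact (Ev.zero.not_od this).elim
      have hsub : D.dd U g h ⊆ I.erase x := by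
        intro w hw
        obtain ⟨hwU, hw0, hw1, hwo⟩ := mem_dd.1 hw
        have hwcv := vert_cv hgh (hU hwU) hw0 hw1
        rw [Finset.mem_erase]
        refine ⟨fun h => hwcv (h ▸ .inl hj.mem), ?_⟩
        by_contra hwI
        have hno : ¬ (w = u ∨ w = v) := by
          intro h
          have : w ∈ cv (D.γ e) (D.γ f) := by
            rcases h with rfl | rfl; exacts [.inl (im0 _), .inl (im1 _)]
          have := hB w this hwcv
          rw [this, hm0] at hwo
          exact Ev.zero.not_od hwo
        push Not at hno
        have hwe := ev_of_notin hpa hwU (hU hwU) hno.1 hno.2 hwI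
        rcases front2 hpa.par hgh.par hfin (vert_cv hpa (hU hwU) hno.1 hno.2) hwcv with ⟨z, hz, hz', h0⟩ | ⟨z, hz, hz', h0⟩
        · rw [hB z hz hz', hm0] at h0
          rw [← h0] at hwo
          exact Ev.zero.not_od hwo
        · rw [← h0] at hwe
          exact hwe.not_od (hA z hz hz')
      have h2 := Finset.card_le_card hsub
      rw [Finset.card_erase_of_mem hx] at h2
      have h3 := hmin' g hg h hh hne' hgh
      have := hINe.card_pos
      omega
    have cnt1 : EI.card + 1 ≤ 3 * I.card := by
      have hsub : insert e EI ⊆ E' := Finset.insert_subset he (Finset.filter_subset _ _)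
      have hjend : ∀ a ∈ insert e EI, D.γ a 0 ∈ insert u (insert v I) ∧ D.γ a 1 ∈ insert u (insert v I) := by
        intro a ha
        rcases Finset.mem_insert.1 ha with rfl | ha
        · simp [← hu, ← hv]
        · obtain ⟨ha', x, y, hj, hx⟩ := hEIend a ha
          have := (hcl a ha' x y hj hx).2
          rcases hj with ⟨rfl, rfl⟩ | ⟨rfl, rfl⟩ <;>
            simp only [Finset.mem_insert] <;> tauto
      have hnopa : ∀ h ∈ EI, ¬ D.Pa e h := by
        intro h hh hp
        obtain ⟨_, x, y, hj, hx⟩ := hEIend h hh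
        rcases hj.pa hp.symm with ⟨h', _⟩ | ⟨_, h'⟩
        · exact huI (hu ▸ h' ▸ hx)
        · exact hvI (hv ▸ h' ▸ hx)
      have := (simple_bound (E' := insert e EI) (U := insert u (insert v I))
        (Finset.insert_subset (hU huU) (Finset.insert_subset (hU hvU) (hIU.trans hU)))
        (fun a ha b hb => hNC a (hsub ha) b (hsub hb)) (fun a ha => (hjend a ha).1) (fun a ha => (hjend a ha).2)
        (by
          intro a ha b hb hab
          rcases Finset.mem_insert.1 ha with rfl | ha <;> rcases Finset.mem_insert.1 hb with rfl | hb
          · rfl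
          · exact absurd hab (hnopa b hb)
          · exact absurd hab.symm (hnopa a ha)
          · exact hsimple a ha b hb hab)).2
      have hc : (insert u (insert v I)).card = I.card + 2 := by
        rw [Finset.card_insert_of_notMem (by simp [huv, huI]), Finset.card_insert_of_notMem hvI]
      rw [hc, Finset.card_insert_of_notMem heEI] at this
      have := this (by have := hINe.card_pos; omega)
      omega
    -- the outside
    set E2 := (E' \ EI).erase f with hE2
    have hE2s : ∀ a ∈ E2, a ∈ E' ∧ a ≠ f ∧ D.γ a 0 ∉ I ∧ D.γ a 1 ∉ I := by
      intro a ha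
      obtain ⟨h1, h2⟩ := Finset.mem_erase.1 ha
      obtain ⟨h2, h3⟩ := Finset.mem_sdiff.1 h2
      refine ⟨h2, h1, fun h => h3 (Finset.mem_filter.2 ⟨h2, .inl h⟩), fun h => h3 (Finset.mem_filter.2 ⟨h2, .inr h⟩)⟩
    have hddU : ∀ g h, D.dd (U \ I) g h = D.dd U g h \ I := by
      intro g h; ext w; simp only [mem_dd, Finset.mem_sdiff]; tauto
    have cnt2 : E2.card ≤ 3 * (U \ I).card := by
      refine ih E2 (U \ I) ?_ (Finset.sdiff_subset.trans hU) (fun a ha b hb => hNC a (hE2s a ha).1 b (hE2s b hb).1) ?_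
        (fun a ha => Finset.mem_sdiff.2 ⟨h0 a (hE2s a ha).1, (hE2s a ha).2.2.1⟩)
        (fun a ha => Finset.mem_sdiff.2 ⟨h1 a (hE2s a ha).1, (hE2s a ha).2.2.2⟩)
      · have := Finset.card_sdiff_add_card_eq_card hIU
        have := hINe.card_pos
        omega
      · intro g hg h hh hne' hgh
        obtain ⟨hg, hgf, hg0, hg1⟩ := hE2s g hg
        obtain ⟨hh, hhf, -, -⟩ := hE2s h hh
        rw [hddU]
        by_contra hcon
        rw [Finset.not_nonempty_iff_eq_empty, Finset.sdiff_eq_empty_iff_subset] at hcon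
        have hEq : D.dd U g h = I := Finset.eq_of_subset_of_card_le hcon (hmin' g hg h hh hne' hgh)
        by_cases hpg : D.Pa e g
        · set F := E'.filter (fun a => D.Pa e a) with hF
          have mF : ∀ a ∈ E', D.Pa e a → a ∈ F := fun a ha h => Finset.mem_filter.2 ⟨ha, h⟩
          have hFp : ∀ a ∈ F, ∀ b ∈ F, D.Pa a b := fun a ha b hb =>
            (Finset.mem_filter.1 ha).2.symm.trans (Finset.mem_filter.1 hb).2
          have me := mF e he (Pa.rfl D e)
          have mf := mF f hf hpa
          have mg := mF g hg hpg
          have mh := mF h hh (hpg.trans hgh)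
          obtain ⟨o, ho, hch⟩ := chain hU ⟨e, me⟩ hFp
          have hinj : ∀ a ∈ F, ∀ b ∈ F, D.dd U o a = D.dd U o b → a = b := by
            intro a ha b hb hab
            by_contra hne3
            have := hS a (Finset.mem_filter.1 ha).1 b (Finset.mem_filter.1 hb).1 hne3 (hFp a ha b hb)
            rw [dd_xor hU (hFp o ho a ha) (hFp o ho b hb), hab] at this
            simp at this
          have x1 := dd_xor hU (hFp o ho e me) (hFp o ho f mf)
          have x2 := dd_xor hU (hFp o ho g mg) (hFp o ho h mh)
          rcases chain_eq (hch e me f mf) (hch g mg h mh) (hch e me g mg) (hch e me h mh) (hch f mf g mg)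
            (hch f mf h mh) (by rw [← x1, ← x2, hEq]) (by rw [← x1]; exact hINe) with ⟨_, h'⟩ | ⟨_, h'⟩
          · exact hhf (hinj f mf h mh h').symm
          · exact hgf (hinj f mf g mg h').symm
        · have hph : ¬ D.Pa e h := fun h => hpg (h.trans hgh.symm)
          have hge : e ≠ g := fun h => hpg (h ▸ Pa.rfl D e)
          have hhe : e ≠ h := fun h => hph (h ▸ Pa.rfl D e)
          obtain ⟨p, q, hj, hpu, hpv, hpI, hpU⟩ : ∃ p q, D.Jn g p q ∧ p ≠ u ∧ p ≠ v ∧ p ∉ I ∧ p ∈ U := by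
            by_cases hc : D.γ g 0 = u ∨ D.γ g 0 = v
            · refine ⟨D.γ g 1, D.γ g 0, .inr ⟨rfl, rfl⟩, ?_, ?_, hg1, h1 g hg⟩
              · intro h'
                rcases hc with hc | hc
                · exact ends_ne g (hc.trans h'.symm)
                · exact D.nop g e ⟨hc, h'⟩
              · intro h'
                rcases hc with hc | hc
                · exact hpg ⟨hc.symm, h'.symm⟩
                · exact ends_ne g (hc.trans h'.symm)
            · push Not at hc
              exact ⟨_, _, .inl ⟨rfl, rfl⟩, hc.1, hc.2, hg0, h0 g hg⟩
          obtain ⟨m, hm, hmq⟩ : ∃ m, (m = u ∨ m = v) ∧ m ≠ q := by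
            by_cases h : u = q
            · exact ⟨v, .inr rfl, fun h' => huv (h.trans h'.symm)⟩
            · exact ⟨u, .inl rfl, h⟩
          have hmp : m ≠ p := by rcases hm with rfl | rfl; exacts [hpu.symm, hpv.symm]
          have hmU : m ∈ U := by rcases hm with rfl | rfl <;> assumption
          have hmI : m ∉ I := by rcases hm with rfl | rfl <;> assumption
          have hmo := hj.off hgh (hU hmU) hmp hmq
          have hme : m ∈ im (D.γ e) := by rcases hm with rfl | rfl; exacts [im0 _, im1 _]
          have hmf : m ∈ im (D.γ f) := by
            rcases hm with rfl | rfl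
            · rw [hu, hpa.1]; exact im0 _
            · rw [hv, hpa.2]; exact im1 _
          have hpe := ev_of_notin hpa hpU (hU hpU) hpu hpv hpI
          have hpo := vert_cv hpa (hU hpU) hpu hpv
          have hmev : Ev (W (D.γ g) (D.γ h) m) := by
            refine ev_of_notin hgh hmU (hU hmU) ?_ ?_ (hEq ▸ hmI)
            · intro h; exact hmo (h ▸ .inl (im0 _))
            · intro h; exact hmo (h ▸ .inl (im1 _))
          obtain ⟨w, hw⟩ := hINe
          have hw' := mem_dd.1 (hEq ▸ hw : w ∈ D.dd U g h)
          refine no_common hpa.par hgh.par (hNC.fin he hf hg hh hge hhe hgf.symm hhf.symm) ?_ ?_ (offI w hw)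
            (vert_cv hgh (hU hw'.1) hw'.2.1 hw'.2.2.1) (mem_dd.1 hw).2.2.2 hw'.2.2.2
          · rintro z (hz | hz) hz'
            · rw [hNC.along he hg hh hge hhe hgh hz hme hz' hmo]; exact hmev
            · rw [hNC.along hf hg hh hgf.symm hhf.symm hgh hz hmf hz' hmo]; exact hmev
          · rintro z (hz | hz) hz'
            · rw [hNC.along hg he hf hge.symm hgf hpa hz hj.mem hz' hpo]; exact hpe
            · rw [hNC.along hh he hf hhe.symm hhf hpa hz (hj.pa hgh).mem hz' hpo]; exact hpe
    have c3 := Finset.card_sdiff_add_card_eq_card hIU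
    have c4 : E'.card ≤ EI.card + (1 + E2.card) := by
      have : E' ⊆ EI ∪ insert f E2 := by
        intro a ha
        by_cases h1 : a ∈ EI
        · exact Finset.mem_union_left _ h1
        · by_cases h2 : a = f
          · simp [h2]
          · simp [hE2, h1, h2, ha]
      have := (Finset.card_le_card this).trans (Finset.card_union_le _ _)
      have := Finset.card_insert_le f E2
      omega
    omega

end Draw
end CL

namespace CL
namespace Draw

theorem cross_lin (D : Draw) : Nat.card D.E ≤ 3 * D.V.card + Nat.card {p : D.E × D.E // D.Cr p.1 p.2} := by
  classical
  haveI := D.fin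
  set A := Finset.univ.filter (fun e : D.E => ∀ f, ¬ D.Cr e f) with hA
  set B := Finset.univ.filter (fun e : D.E => ¬ ∀ f, ¬ D.Cr e f) with hB
  have hAB : A.card + B.card = Nat.card D.E := by
    rw [hA, hB, Finset.card_filter_add_card_filter_not, Finset.card_univ, Nat.card_eq_fintype_card]
  have h1 : A.card ≤ 3 * D.V.card := by
    refine plane_bound _ A D.V le_rfl (Finset.Subset.refl _) ?_ ?_ (fun e _ => D.s0 e) (fun e _ => D.s1 e)
    · intro e he f hf hef
      have := (Finset.mem_filter.1 he).2 f
      rw [disjoint_iff_inter_eq_empty, ← not_nonempty_iff_eq_empty]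
      exact fun h => this ⟨hef, h⟩
    · intro e he f hf hef hp
      obtain ⟨w, hw, h⟩ := D.sep e f hef hp.1 hp.2
      exact ⟨w, mem_dd.2 ⟨hw, h⟩⟩
  have h2 : B.card ≤ Nat.card {p : D.E × D.E // D.Cr p.1 p.2} := by
    have hch : ∀ e : {e // e ∈ B}, ∃ f, D.Cr e f := fun e => by
      have := (Finset.mem_filter.1 e.2).2
      push Not at this
      exact this
    choose f hf using hch
    have : Nat.card {e // e ∈ B} ≤ Nat.card {p : D.E × D.E // D.Cr p.1 p.2} :=
      Nat.card_le_card_of_injective (fun e => ⟨(e.1, f e), hf e⟩) (fun a b h => by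
        have := congrArg (fun x => x.1.1) h
        exact Subtype.ext this)
    simpa using this
  omega

end Draw
end CL

namespace CL

section sampling
variable {α : Type*} [DecidableEq α] {W : Finset α} {q : ℕ}

/-- value of a partial function -/
def Zv (φ : {x // x ∈ W} → Fin q) (x : α) (c : Fin q) : Prop := ∃ h : x ∈ W, φ ⟨x, h⟩ = c

theorem Zv.uniq {φ : {x // x ∈ W} → Fin q} {x : α} {c d : Fin q} (h : Zv φ x c) (h' : Zv φ x d) : c = d := by
  obtain ⟨a, rfl⟩ := h
  obtain ⟨b, rfl⟩ := h'
  rfl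

open Classical in
/-- number of functions with prescribed values -/
noncomputable def cnt (q : ℕ) (W : Finset α) (P : ({x // x ∈ W} → Fin q) → Prop) : ℝ :=
  ((Finset.univ.filter P).card : ℝ)

theorem cnt_def (P : ({x // x ∈ W} → Fin q) → Prop) [DecidablePred P] :
    cnt q W P = ((Finset.univ.filter P).card : ℝ) := by
  unfold cnt
  congr

theorem cnt_mono {P Q : ({x // x ∈ W} → Fin q) → Prop} (h : ∀ φ, P φ → Q φ) : cnt q W P ≤ cnt q W Q := by
  classical
  unfold cnt
  exact_mod_cast Finset.card_le_card (Finset.monotone_filter_right _ fun φ _ => h φ)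

theorem cnt_or {P Q : ({x // x ∈ W} → Fin q) → Prop} : cnt q W (fun φ => P φ ∨ Q φ) ≤ cnt q W P + cnt q W Q := by
  classical
  rw [cnt_def, cnt_def, cnt_def, Finset.filter_or]
  exact_mod_cast Finset.card_union_le _ _

theorem cnt_eq (hq : 0 < q) {A : Finset α} (hA : A ⊆ W) (g : α → Fin q) :
    cnt q W (fun φ => ∀ x ∈ A, Zv φ x (g x)) = (q : ℝ) ^ W.card / (q : ℝ) ^ A.card := by
  classical
  rw [cnt_def]
  have : (Finset.univ.filter (fun φ : {x // x ∈ W} → Fin q => ∀ x ∈ A, Zv φ x (g x))) =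
      Fintype.piFinset (fun x : {x // x ∈ W} => if (x : α) ∈ A then {g x} else Finset.univ) := by
    ext φ
    simp only [Finset.mem_filter, Finset.mem_univ, true_and, Fintype.mem_piFinset]
    constructor
    · intro h x
      by_cases hx : (x : α) ∈ A
      · obtain ⟨h1, h2⟩ := h x hx
        simp [hx, ← h2]
      · simp [hx]
    · intro h x hx
      refine ⟨hA hx, ?_⟩
      have := h ⟨x, hA hx⟩
      simpa [hx] using this
  rw [this, Fintype.card_piFinset]
  have h2 : (∏ x : {x // x ∈ W}, (if (x : α) ∈ A then ({g x} : Finset (Fin q)) else Finset.univ).card) =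
      q ^ (W \ A).card := by
    have : ∀ x : {x // x ∈ W}, (if (x : α) ∈ A then ({g x} : Finset (Fin q)) else Finset.univ).card =
        (fun x : α => if x ∈ A then 1 else q) x := by
      intro x
      by_cases hx : (x : α) ∈ A <;> simp [hx]
    rw [Finset.prod_congr rfl fun x _ => this x, Finset.prod_coe_sort W (fun x : α => if x ∈ A then 1 else q),
      Finset.prod_ite]
    simp only [Finset.prod_const, one_pow, one_mul]
    congr 2
    ext x
    simp
  rw [h2, eq_div_iff (by positivity)]
  have := Finset.card_sdiff_add_card_eq_card hA
  rw [← this, pow_add]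
  push_cast
  ring

theorem cnt1 (hq : 0 < q) {x : α} (hx : x ∈ W) (a : Fin q) :
    cnt q W (fun φ => Zv φ x a) = (q : ℝ) ^ W.card / (q : ℝ) ^ 1 := by
  have := cnt_eq hq (A := {x}) (by simpa using hx) (fun _ => a)
  simpa using this

theorem cnt2 (hq : 0 < q) {x y : α} (hx : x ∈ W) (hy : y ∈ W) (hxy : x ≠ y) (a b : Fin q) :
    cnt q W (fun φ => Zv φ x a ∧ Zv φ y b) = (q : ℝ) ^ W.card / (q : ℝ) ^ 2 := by
  have := cnt_eq hq (A := {x, y}) (by intro z; simp; rintro (rfl | rfl) <;> assumption) (fun z => if z = x then a else b)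
  rw [Finset.card_pair hxy] at this
  rw [← this]
  simp [hxy.symm]

theorem cnt3 (hq : 0 < q) {x y z : α} (hx : x ∈ W) (hy : y ∈ W) (hz : z ∈ W) (hxy : x ≠ y) (hxz : x ≠ z) (hyz : y ≠ z)
    (a b c : Fin q) :
    cnt q W (fun φ => Zv φ x a ∧ Zv φ y b ∧ Zv φ z c) = (q : ℝ) ^ W.card / (q : ℝ) ^ 3 := by
  have := cnt_eq hq (A := {x, y, z}) (by intro z; simp; rintro (rfl | rfl | rfl) <;> assumption)
    (fun w => if w = x then a else if w = y then b else c)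
  rw [Finset.card_eq_three.2 ⟨x, y, z, hxy, hxz, hyz, rfl⟩] at this
  rw [← this]
  simp [hxy.symm, hxz.symm, hyz.symm]

theorem cnt4 (hq : 0 < q) {x y z t : α} (hx : x ∈ W) (hy : y ∈ W) (hz : z ∈ W) (ht : t ∈ W)
    (hxy : x ≠ y) (hxz : x ≠ z) (hyz : y ≠ z) (hxt : x ≠ t) (hyt : y ≠ t) (hzt : z ≠ t) (a b c d : Fin q) :
    cnt q W (fun φ => Zv φ x a ∧ Zv φ y b ∧ Zv φ z c ∧ Zv φ t d) = (q : ℝ) ^ W.card / (q : ℝ) ^ 4 := by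
  have := cnt_eq hq (A := {x, y, z, t}) (by intro z; simp; rintro (rfl | rfl | rfl | rfl) <;> assumption)
    (fun w => if w = x then a else if w = y then b else if w = z then c else d)
  have h4 : ({x, y, z, t} : Finset α).card = 4 := by
    rw [Finset.card_insert_of_notMem (by simp [*]), Finset.card_eq_three.2 ⟨y, z, t, hyz, hyt, hzt, rfl⟩]
  rw [h4] at this
  rw [← this]
  simp [hxy.symm, hxz.symm, hyz.symm, hxt.symm, hyt.symm, hzt.symm]

open Classical in
theorem sampling {ι : Type*} {S : Finset α} (hSW : S ⊆ W) (Λ : Finset ι) (u v : ι → α) (L : ι → Finset α) (i : ℕ)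
    (hL : ∀ f ∈ Λ, L f ⊆ W) (hu : ∀ f ∈ Λ, u f ∈ S) (hv : ∀ f ∈ Λ, v f ∈ S) (huv : ∀ f ∈ Λ, u f ≠ v f)
    (huL : ∀ f ∈ Λ, u f ∉ L f) (hvL : ∀ f ∈ Λ, v f ∉ L f)
    (h1 : ∀ f ∈ Λ, 2 ^ i ≤ (L f).card) (h2 : ∀ f ∈ Λ, (L f).card < 2 ^ (i + 1))
    (hG : ∀ A B : α → Prop, (∀ x, A x → ¬ B x) → ∀ w, A w →
      (Λ.filter (fun f => A (u f) ∧ B (v f) ∧ w ∈ L f ∧ ∀ x ∈ L f, A x ∨ B x → x = w)).card ≤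
        3 * (S.filter (fun x => A x ∨ B x)).card) :
    Λ.card ≤ 96 * (S.card * W.card) + 384 * 2 ^ i * S.card := by
  set q : ℕ := 8 * 2 ^ i with hq
  have hp2 : 0 < 2 ^ i := by positivity
  have hq0 : 0 < q := by omega
  set z : Fin q := ⟨0, by omega⟩ with hz
  set o : Fin q := ⟨1, by omega⟩ with ho
  have hzo : z ≠ o := by simp [hz, ho]
  set M : ℝ := (q : ℝ) ^ W.card with hM
  have hqR : (0 : ℝ) < q := by exact_mod_cast hq0
  have hM0 : 0 < M := by positivity
  set Good : ({x // x ∈ W} → Fin q) → α → ι → Prop := fun φ w f =>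
    Zv φ w z ∧ Zv φ (u f) z ∧ Zv φ (v f) o ∧ w ∈ L f ∧ ∀ x ∈ L f, (Zv φ x z ∨ Zv φ x o) → x = w with hGood
  -- exchange
  have ex1 : ∑ φ : {x // x ∈ W} → Fin q, ∑ w ∈ W, ((Λ.filter (Good φ w)).card : ℝ) =
      ∑ f ∈ Λ, ∑ w ∈ W, cnt q W (fun φ => Good φ w f) := by
    have : ∀ φ w, ((Λ.filter (Good φ w)).card : ℝ) = ∑ f ∈ Λ, if Good φ w f then (1 : ℝ) else 0 := by
      intro φ w; rw [Finset.sum_boole]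
    simp only [this, cnt_def]
    rw [Finset.sum_comm]
    rw [Finset.sum_comm (s := Λ)]
    refine Finset.sum_congr rfl fun w _ => ?_
    rw [Finset.sum_comm]
    refine Finset.sum_congr rfl fun f _ => ?_
    rw [Finset.sum_boole]
  have ex2 : ∑ φ : {x // x ∈ W} → Fin q, ∑ w ∈ W, (if Zv φ w z then ((S.filter (fun x => Zv φ x z ∨ Zv φ x o)).card : ℝ) else 0) =
      ∑ w ∈ W, ∑ x ∈ S, cnt q W (fun φ => Zv φ w z ∧ (Zv φ x z ∨ Zv φ x o)) := by
    rw [Finset.sum_comm]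
    refine Finset.sum_congr rfl fun w _ => ?_
    have : ∀ φ : {x // x ∈ W} → Fin q, (if Zv φ w z then ((S.filter (fun x => Zv φ x z ∨ Zv φ x o)).card : ℝ) else 0) =
        ∑ x ∈ S, if Zv φ w z ∧ (Zv φ x z ∨ Zv φ x o) then (1 : ℝ) else 0 := by
      intro φ
      by_cases h : Zv φ w z <;> simp [h]
    simp only [this, cnt_def]
    rw [Finset.sum_comm]
    refine Finset.sum_congr rfl fun f _ => ?_
    rw [Finset.sum_boole]
  have ub : ∑ φ : {x // x ∈ W} → Fin q, ∑ w ∈ W, ((Λ.filter (Good φ w)).card : ℝ) ≤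
      3 * ∑ φ : {x // x ∈ W} → Fin q, ∑ w ∈ W,
        (if Zv φ w z then ((S.filter (fun x => Zv φ x z ∨ Zv φ x o)).card : ℝ) else 0) := by
    rw [Finset.mul_sum]
    refine Finset.sum_le_sum fun φ _ => ?_
    rw [Finset.mul_sum]
    refine Finset.sum_le_sum fun w _ => ?_
    by_cases h : Zv φ w z
    · rw [if_pos h]
      have := hG (fun x => Zv φ x z) (fun x => Zv φ x o) (fun x h h' => hzo (h.uniq h')) w h
      have e : Λ.filter (Good φ w) = Λ.filter (fun f => Zv φ (u f) z ∧ Zv φ (v f) o ∧ w ∈ L f ∧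
          ∀ x ∈ L f, Zv φ x z ∨ Zv φ x o → x = w) := by
        refine Finset.filter_congr fun f _ => ?_
        simp [hGood, h]
      rw [e]
      exact_mod_cast this
    · rw [if_neg h]
      have : Λ.filter (Good φ w) = ∅ := by
        refine Finset.filter_eq_empty_iff.2 fun f _ hf => h hf.1
      simp [this]
  have ub2 : ∑ w ∈ W, ∑ x ∈ S, cnt q W (fun φ => Zv φ w z ∧ (Zv φ x z ∨ Zv φ x o)) ≤
      (W.card * S.card) * (2 * (M / q ^ 2)) + S.card * (M / q) := by
    have : ∀ w ∈ W, ∀ x ∈ S, cnt q W (fun φ => Zv φ w z ∧ (Zv φ x z ∨ Zv φ x o)) ≤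
        2 * (M / q ^ 2) + if w = x then M / q else 0 := by
      intro w hw x hx
      by_cases hwx : w = x
      · rw [if_pos hwx]
        have := (cnt_mono (q := q) (W := W) (P := fun φ => Zv φ w z ∧ (Zv φ x z ∨ Zv φ x o)) (Q := fun φ => Zv φ w z)
          fun φ h => h.1).trans_eq (cnt1 hq0 hw z)
        rw [pow_one] at this
        have h0 : 0 ≤ 2 * (M / q ^ 2) := by positivity
        linarith
      · rw [if_neg hwx]
        have h1 := (cnt_mono (q := q) (W := W) (P := fun φ => Zv φ w z ∧ (Zv φ x z ∨ Zv φ x o))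
          (Q := fun φ => (Zv φ w z ∧ Zv φ x z) ∨ (Zv φ w z ∧ Zv φ x o)) (fun φ h => by tauto)).trans cnt_or
        rw [cnt2 hq0 hw (hSW hx) hwx, cnt2 hq0 hw (hSW hx) hwx] at h1
        linarith
    refine (Finset.sum_le_sum fun w hw => Finset.sum_le_sum fun x hx => this w hw x hx).trans ?_
    simp only [Finset.sum_add_distrib, Finset.sum_const, nsmul_eq_mul]
    rw [Finset.sum_comm (s := W)]
    simp only [Finset.sum_ite_eq']
    have : ∑ x ∈ S, (if x ∈ W then M / (q : ℝ) else 0) = S.card * (M / q) := by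
      rw [Finset.sum_congr rfl fun x hx => if_pos (hSW hx)]; simp
    rw [this]
    linarith
  have lb : ∀ f ∈ Λ, M / (16 * q ^ 2) ≤ ∑ w ∈ W, cnt q W (fun φ => Good φ w f) := by
    intro f hf
    have c1 := h1 f hf
    have c2 := h2 f hf
    have hw1 : ∀ w ∈ L f, M / (2 * q ^ 3) ≤ cnt q W (fun φ => Good φ w f) := by
      intro w hw
      have wu : w ≠ u f := fun h => huL f hf (h ▸ hw)
      have wv : w ≠ v f := fun h => hvL f hf (h ▸ hw)
      have hwW := hL f hf hw
      have huW := hSW (hu f hf)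
      have hvW := hSW (hv f hf)
      have e3 := cnt3 hq0 hwW huW hvW wu wv (huv f hf) z z o
      have key : cnt q W (fun φ => Zv φ w z ∧ Zv φ (u f) z ∧ Zv φ (v f) o) ≤ cnt q W (fun φ => Good φ w f) +
          ∑ x ∈ (L f).erase w, cnt q W (fun φ => (Zv φ w z ∧ Zv φ (u f) z ∧ Zv φ (v f) o ∧ Zv φ x z) ∨
            (Zv φ w z ∧ Zv φ (u f) z ∧ Zv φ (v f) o ∧ Zv φ x o)) := by
        unfold cnt
        norm_cast
        refine le_trans (Finset.card_le_card ?_) ((Finset.card_union_le _ _).trans (Nat.add_le_add le_rfl (Finset.card_biUnion_le)))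
        intro φ hφ
        simp only [Finset.mem_union, Finset.mem_biUnion, Finset.mem_filter, Finset.mem_univ, true_and] at hφ ⊢
        by_cases hg : Good φ w f
        · exact .inl hg
        · right
          simp only [hGood] at hg
          have : ¬ ∀ x ∈ L f, (Zv φ x z ∨ Zv φ x o) → x = w := fun h => hg ⟨hφ.1, hφ.2.1, hφ.2.2, hw, h⟩
          push Not at this
          obtain ⟨x, hx, hx2, hx3⟩ := this
          refine ⟨x, Finset.mem_erase.2 ⟨hx3, hx⟩, ?_⟩
          tauto
      have key2 : ∀ x ∈ (L f).erase w, cnt q W (fun φ => (Zv φ w z ∧ Zv φ (u f) z ∧ Zv φ (v f) o ∧ Zv φ x z) ∨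
            (Zv φ w z ∧ Zv φ (u f) z ∧ Zv φ (v f) o ∧ Zv φ x o)) ≤ 2 * (M / q ^ 4) := by
        intro x hx
        obtain ⟨hx1, hx2⟩ := Finset.mem_erase.1 hx
        have xu : u f ≠ x := fun h => huL f hf (h ▸ hx2)
        have xv : v f ≠ x := fun h => hvL f hf (h ▸ hx2)
        refine cnt_or.trans ?_
        rw [cnt4 hq0 hwW huW hvW (hL f hf hx2) wu wv (huv f hf) hx1.symm xu xv,
          cnt4 hq0 hwW huW hvW (hL f hf hx2) wu wv (huv f hf) hx1.symm xu xv]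
        linarith
      have key3 := Finset.sum_le_sum key2
      rw [Finset.sum_const, nsmul_eq_mul, Finset.card_erase_of_mem hw] at key3
      rw [e3] at key
      have hc : (((L f).card - 1 : ℕ) : ℝ) * 4 ≤ q := by
        have : ((L f).card - 1) * 4 ≤ q := by
          rw [pow_succ] at c2; omega
        exact_mod_cast this
      have : (((L f).card - 1 : ℕ) : ℝ) * (2 * (M / q ^ 4)) ≤ M / (2 * q ^ 3) := by
        have e : M / (2 * q ^ 3) = (q : ℝ) / 4 * (2 * (M / q ^ 4)) := by field_simp; ring
        rw [e]
        gcongr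
        linarith
      have e : M / (q : ℝ) ^ 3 = M / (2 * q ^ 3) + M / (2 * q ^ 3) := by field_simp; ring
      linarith
    have hge : ∑ w ∈ L f, M / (2 * q ^ 3) ≤ ∑ w ∈ W, cnt q W (fun φ => Good φ w f) :=
      (Finset.sum_le_sum hw1).trans (Finset.sum_le_sum_of_subset_of_nonneg (hL f hf) fun w _ _ => by unfold cnt; positivity)
    rw [Finset.sum_const, nsmul_eq_mul] at hge
    refine le_trans ?_ hge
    have hc : (q : ℝ) / 8 ≤ (L f).card := by
      rw [div_le_iff₀ (by norm_num)]
      have : q ≤ (L f).card * 8 := by omega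
      exact_mod_cast this
    have e : M / (16 * q ^ 2) = (q : ℝ) / 8 * (M / (2 * q ^ 3)) := by field_simp; ring
    rw [e]
    gcongr
  have fin := Finset.sum_le_sum lb
  rw [Finset.sum_const, nsmul_eq_mul, ← ex1] at fin
  rw [ex2] at ub
  have tot : (Λ.card : ℝ) * (M / (16 * q ^ 2)) ≤ 3 * ((W.card * S.card) * (2 * (M / q ^ 2)) + S.card * (M / q)) := by
    linarith
  have e2 : (3 : ℝ) * ((W.card * S.card) * (2 * (M / q ^ 2)) + S.card * (M / q)) =
      (96 * (S.card * W.card) + 48 * q * S.card) * (M / (16 * q ^ 2)) := by field_simp; ring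
  rw [e2] at tot
  have t2 := le_of_mul_le_mul_right tot (by positivity)
  have t3 : Λ.card ≤ 96 * (S.card * W.card) + 48 * q * S.card := by exact_mod_cast t2
  rw [hq] at t3
  calc _ ≤ _ := t3
    _ = _ := by ring

end sampling
end CL

namespace CL
namespace Draw
variable {D : Draw}

/-- lens system of a separated family -/
theorem lens_system {E' : Finset D.E} {S U : Finset ℂ} (hU : U ⊆ D.V) (hS : D.Sep E' U)
    (h0 : ∀ e ∈ E', D.γ e 0 ∈ S) (h1 : ∀ e ∈ E', D.γ e 1 ∈ S) :
    ∃ (Λ : Finset D.E) (p : D.E → D.E), Λ ⊆ E' ∧ E'.card ≤ S.card * S.card + Λ.card ∧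
      (∀ f ∈ Λ, p f ∈ E' ∧ D.Pa f (p f) ∧ (D.dd U f (p f)).Nonempty) ∧
      (∀ f ∈ Λ, ∀ g ∈ Λ, f ≠ g → D.Pa f g → Disjoint (D.dd U f (p f)) (D.dd U g (p g))) := by
  classical
  rcases E'.eq_empty_or_nonempty with rfl | ⟨e0, he0⟩
  · exact ⟨∅, id, by simp⟩
  haveI : Nonempty D.E := ⟨e0⟩
  set ky : D.E → ℂ × ℂ := fun e => (D.γ e 0, D.γ e 1) with hky
  set F : ℂ × ℂ → Finset D.E := fun k => E'.filter (fun e => ky e = k) with hF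
  have hFp : ∀ k, ∀ e ∈ F k, ∀ f ∈ F k, D.Pa e f := by
    intro k e he f hf
    have := (Finset.mem_filter.1 he).2.trans (Finset.mem_filter.1 hf).2.symm
    exact ⟨congrArg Prod.fst this, congrArg Prod.snd this⟩
  have hch : ∀ k, (F k).Nonempty → ∃ o, o ∈ F k ∧
      ∀ f ∈ F k, ∀ g ∈ F k, D.dd U o f ⊆ D.dd U o g ∨ D.dd U o g ⊆ D.dd U o f := fun k hk => by
    obtain ⟨o, ho, h⟩ := chain hU hk (hFp k)
    exact ⟨o, ho, h⟩
  choose! o ho using hch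
  have mF : ∀ e ∈ E', e ∈ F (ky e) := fun e he => Finset.mem_filter.2 ⟨he, rfl⟩
  have ho' : ∀ e ∈ E', o (ky e) ∈ F (ky e) := fun e he => (ho _ ⟨e, mF e he⟩).1
  have hinj : ∀ e ∈ E', ∀ a ∈ F (ky e), ∀ b ∈ F (ky e), D.dd U (o (ky e)) a = D.dd U (o (ky e)) b → a = b := by
    intro e he a ha b hb hab
    by_contra hne
    have := hS a (Finset.mem_filter.1 ha).1 b (Finset.mem_filter.1 hb).1 hne (hFp _ a ha b hb)
    rw [dd_xor hU (hFp _ _ (ho' e he) a ha) (hFp _ _ (ho' e he) b hb), hab] at this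
    simp at this
  set Λ := E'.filter (fun e => e ≠ o (ky e)) with hΛ
  have hpr : ∀ f ∈ Λ, ∃ g ∈ F (ky f), D.dd U (o (ky f)) g ⊂ D.dd U (o (ky f)) f ∧
      ∀ h ∈ F (ky f), D.dd U (o (ky f)) h ⊂ D.dd U (o (ky f)) f → D.dd U (o (ky f)) h ⊆ D.dd U (o (ky f)) g := by
    intro f hf
    obtain ⟨hf, hne⟩ := Finset.mem_filter.1 hf
    set O := o (ky f) with hO
    have hOm := ho' f hf
    have hfm := mF f hf
    obtain ⟨g, hg, hmax⟩ := ((F (ky f)).filter (fun g => D.dd U O g ⊂ D.dd U O f)).exists_max_image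
      (fun g => (D.dd U O g).card) ⟨O, Finset.mem_filter.2 ⟨hOm, by
        rw [dd_self]
        refine Finset.ssubset_iff_subset_ne.2 ⟨Finset.empty_subset _, fun h => hne ?_⟩
        exact hinj f hf f hfm O hOm (by rw [dd_self, ← h])⟩⟩
    obtain ⟨hg1, hg2⟩ := Finset.mem_filter.1 hg
    refine ⟨g, hg1, hg2, fun h hh hlt => ?_⟩
    rcases (ho _ ⟨f, hfm⟩).2 h hh g hg1 with h' | h'
    · exact h'
    · rw [Finset.eq_of_subset_of_card_le h' (hmax h (Finset.mem_filter.2 ⟨hh, hlt⟩))]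
  choose! p hp1 hp2 hp3 using hpr
  have hdd : ∀ f ∈ Λ, D.dd U f (p f) = D.dd U (o (ky f)) f \ D.dd U (o (ky f)) (p f) := by
    intro f hf
    have hf' := (Finset.mem_filter.1 hf).1
    rw [dd_xor hU (hFp _ _ (ho' f hf') f (mF f hf')) (hFp _ _ (ho' f hf') _ (hp1 f hf)),
      Finset.sdiff_eq_empty_iff_subset.2 (hp2 f hf).1, Finset.union_empty]
  refine ⟨Λ, p, Finset.filter_subset _ _, ?_, ?_, ?_⟩
  · have hc : (E'.filter (fun e => ¬ e ≠ o (ky e))).card ≤ (S ×ˢ S).card := by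
      refine Finset.card_le_card_of_injOn ky ?_ ?_
      · intro e he
        have he' := (Finset.mem_filter.1 he).1
        exact Finset.mem_coe.2 (Finset.mem_product.2 ⟨h0 e he', h1 e he'⟩)
      · intro e he f hf hef
        have h1 := (Finset.mem_filter.1 he).2
        have h2 := (Finset.mem_filter.1 hf).2
        push Not at h1 h2
        rw [h1, h2, hef]
    rw [Finset.card_product] at hc
    have h2 : Λ.card + (E'.filter (fun e => ¬ e ≠ o (ky e))).card = E'.card := by
      rw [hΛ]
      convert Finset.card_filter_add_card_filter_not (s := E') (fun e => e ≠ o (ky e))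
    omega
  · intro f hf
    have hf' := (Finset.mem_filter.1 hf).1
    refine ⟨(Finset.mem_filter.1 (hp1 f hf)).1, hFp _ f (mF f hf') _ (hp1 f hf), ?_⟩
    rw [hdd f hf]
    exact Finset.sdiff_nonempty.2 (hp2 f hf).2
  · have key : ∀ f ∈ Λ, ∀ g ∈ Λ, f ≠ g → ky f = ky g → D.dd U (o (ky f)) f ⊆ D.dd U (o (ky f)) g →
        Disjoint (D.dd U f (p f)) (D.dd U g (p g)) := by
      intro f hf g hg hne hk hsub
      have hf' := (Finset.mem_filter.1 hf).1
      have hg' := (Finset.mem_filter.1 hg).1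
      rw [hdd f hf, hdd g hg, ← hk]
      have hgm : g ∈ F (ky f) := hk ▸ mF g hg'
      have hss : D.dd U (o (ky g)) f ⊂ D.dd U (o (ky g)) g := by
        rw [← hk]
        exact Finset.ssubset_iff_subset_ne.2 ⟨hsub, fun h => hne (hinj f hf' f (mF f hf') g hgm h)⟩
      have := hp3 g hg f (hk ▸ mF f hf') hss
      rw [← hk] at this
      exact (Finset.disjoint_sdiff.mono_left (Finset.sdiff_subset.trans this))
    intro f hf g hg hne hpa
    have hk : ky f = ky g := Prod.ext hpa.1 hpa.2
    have hf' := (Finset.mem_filter.1 hf).1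
    have hg' := (Finset.mem_filter.1 hg).1
    rcases (ho _ ⟨f, mF f hf'⟩).2 f (mF f hf') g (hk ▸ mF g hg') with h | h
    · exact key f hf g hg hne hk h
    · exact (key g hg f hf hne.symm hk.symm (hk ▸ h)).symm

/-- images of edges without common ends meet at most once -/
theorem im_sub {e f : D.E} (a : D.γ e 0 ≠ D.γ f 0) (b : D.γ e 0 ≠ D.γ f 1) (c : D.γ e 1 ≠ D.γ f 0)
    (d : D.γ e 1 ≠ D.γ f 1) : (im (D.γ e) ∩ im (D.γ f)).Subsingleton := by
  have hne : e ≠ f := by rintro rfl; exact a rfl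
  have : im (D.γ e) ∩ im (D.γ f) ⊆ ii (D.γ e) ∩ ii (D.γ f) := by
    rintro z ⟨hz, hz'⟩
    constructor
    · rcases im_cases hz with rfl | rfl | h
      · exact absurd hz' (vert_off (D.s0 e) a b)
      · exact absurd hz' (vert_off (D.s1 e) c d)
      · exact h
    · rcases im_cases hz' with rfl | rfl | h
      · exact absurd hz (vert_off (D.s0 f) a.symm c.symm)
      · exact absurd hz (vert_off (D.s1 f) b.symm d.symm)
      · exact h
  exact (D.sc e f hne).anti this

open Classical in
theorem star_bound {S U : Finset ℂ} (hU : U ⊆ D.V) (hSU : S ⊆ U) (Λ : Finset D.E) (p : D.E → D.E)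
    (h0 : ∀ e ∈ Λ, D.γ e 0 ∈ S) (h1 : ∀ e ∈ Λ, D.γ e 1 ∈ S) (hp : ∀ f ∈ Λ, D.Pa f (p f))
    (hd : ∀ f ∈ Λ, ∀ g ∈ Λ, f ≠ g → D.Pa f g → Disjoint (D.dd U f (p f)) (D.dd U g (p g)))
    (A B : ℂ → Prop) (hAB : ∀ x, A x → ¬ B x) (w : ℂ) :
    (Λ.filter (fun f => A (D.γ f 0) ∧ B (D.γ f 1) ∧ w ∈ D.dd U f (p f) ∧
      ∀ x ∈ D.dd U f (p f), A x ∨ B x → x = w)).card ≤ 3 * (S.filter (fun x => A x ∨ B x)).card := by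
  set G := Λ.filter (fun f => A (D.γ f 0) ∧ B (D.γ f 1) ∧ w ∈ D.dd U f (p f) ∧
      ∀ x ∈ D.dd U f (p f), A x ∨ B x → x = w) with hG
  set T := S.filter (fun x => A x ∨ B x) with hT
  have mG : ∀ {f}, f ∈ G → f ∈ Λ ∧ A (D.γ f 0) ∧ B (D.γ f 1) ∧ w ∈ D.dd U f (p f) ∧
      ∀ x ∈ D.dd U f (p f), A x ∨ B x → x = w := fun h => Finset.mem_filter.1 h
  have g0 : ∀ f ∈ G, D.γ f 0 ∈ T := fun f hf => Finset.mem_filter.2 ⟨h0 f (mG hf).1, .inl (mG hf).2.1⟩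
  have g1 : ∀ f ∈ G, D.γ f 1 ∈ T := fun f hf => Finset.mem_filter.2 ⟨h1 f (mG hf).1, .inr (mG hf).2.2.1⟩
  have hTV : ∀ x ∈ T, x ∈ D.V := fun x hx => hU (hSU (Finset.mem_filter.1 hx).1)
  have guniq : ∀ f ∈ G, ∀ g ∈ G, D.Pa f g → f = g := by
    intro f hf g hg hfg
    by_contra hne
    exact Finset.disjoint_left.1 (hd f (mG hf).1 g (mG hg).1 hne hfg) (mG hf).2.2.2.1 (mG hg).2.2.2.1
  set dir : {x // x ∈ T} → {x // x ∈ T} → Prop := fun a b => ∃ f ∈ G, D.γ f 0 = a ∧ D.γ f 1 = b with hdir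
  set adj : {x // x ∈ T} → {x // x ∈ T} → Prop := fun a b => dir a b ∨ dir b a with hadj
  have hs : ∀ a b, adj a b → adj b a := fun a b h => h.symm
  have hi : ∀ a, ¬ adj a a := by
    rintro a (⟨f, hf, h, h'⟩ | ⟨f, hf, h, h'⟩) <;> exact ends_ne f (h.trans h'.symm)
  have dA : ∀ {a b}, dir a b → A a ∧ B b := by
    rintro a b ⟨f, hf, h, h'⟩
    exact ⟨h ▸ (mG hf).2.1, h' ▸ (mG hf).2.2.1⟩
  have hch : ∀ a b, ∃ α : ℝ → ℂ, dir a b → ∃ f ∈ G, D.γ f 0 = a ∧ D.γ f 1 = b ∧ α = D.γ f := by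
    intro a b
    by_cases h : dir a b
    · obtain ⟨f, hf, h1, h2⟩ := h
      exact ⟨D.γ f, fun _ => ⟨f, hf, h1, h2, rfl⟩⟩
    · exact ⟨fun _ => 0, fun h' => absurd h' h⟩
  choose α hα using hch
  set inc : {x // x ∈ T} → {x // x ∈ T} → {x // x ∈ T} → ℂ := fun a b x =>
    if dir a b then CL.A (α a b) 0 1 x else - CL.A (α b a) 0 1 x with hinc
  have i1 : ∀ {a b}, dir a b → ∀ x, inc a b x = CL.A (α a b) 0 1 x := fun h x => by simp [hinc, h]
  have i2 : ∀ {a b}, dir b a → ∀ x, inc a b x = - CL.A (α b a) 0 1 x := fun {a b} h x => by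
    have : ¬ dir a b := fun h' => hAB _ (dA h).1 (dA h').2
    simp [hinc, this]
  have hexd : ∀ a b x, dir a b → x ≠ a → x ≠ b → ex (CL.A (α a b) 0 1 x) = ((b : ℂ) - x) / (a - x) := by
    intro a b x h hxa hxb
    obtain ⟨f, hf, h1, h2, h3⟩ := hα a b h
    rw [h3, ex_A (D.arc f).cont.continuousOn zero_le_one, h1, h2]
    refine vert_off (hTV x x.2) ?_ ?_
    · rw [h1]; exact fun h => hxa (Subtype.ext h)
    · rw [h2]; exact fun h => hxb (Subtype.ext h)
  have hX : ∀ a b a' b', dir a b → dir a' b' → a ≠ a' → a ≠ b' → b ≠ a' → b ≠ b' →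
      Od (X (α a b) 0 1 (α a' b') 0 1) := by
    intro a b a' b' hab hab' n1 n2 n3 n4
    obtain ⟨f, hf, rfa, rfb, h3⟩ := hα a b hab
    obtain ⟨g, hg, rga, rgb, h3'⟩ := hα a' b' hab'
    have m1 : D.γ f 0 ≠ D.γ g 0 := by rw [rfa, rga]; exact fun h => n1 (Subtype.ext h)
    have m2 : D.γ f 0 ≠ D.γ g 1 := by rw [rfa, rgb]; exact fun h => n2 (Subtype.ext h)
    have m3 : D.γ f 1 ≠ D.γ g 0 := by rw [rfb, rga]; exact fun h => n3 (Subtype.ext h)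
    have m4 : D.γ f 1 ≠ D.γ g 1 := by rw [rfb, rgb]; exact fun h => n4 (Subtype.ext h)
    obtain ⟨hfΛ, fA, fB, fw, fall⟩ := mG hf
    obtain ⟨hgΛ, gA, gB, gw, gall⟩ := mG hg
    have pf := hp f hfΛ
    have pg := hp g hgΛ
    have notin : ∀ {f g : D.E}, w ∈ D.dd U g (p g) → (∀ x ∈ D.dd U f (p f), A x ∨ B x → x = w) →
        ∀ y, (y = D.γ g 0 ∨ y = D.γ g 1) → A y ∨ B y → y ∉ D.dd U f (p f) := by
      intro f g hw hall y hy hAB hyd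
      have := hall y hyd hAB
      rcases hy with h | h
      · exact (mem_dd.1 hw).2.1 (this.symm.trans h)
      · exact (mem_dd.1 hw).2.2.1 (this.symm.trans h)
    have hUm : ∀ x ∈ T, x ∈ U := fun x hx => hSU (Finset.mem_filter.1 hx).1
    rw [h3, h3']
    refine sharp pf.par pg.par (vert_cv pg (D.s0 f) m1 m2) (vert_cv pg (D.s1 f) m3 m4)
      (vert_cv pf (D.s0 g) m1.symm m3.symm) (vert_cv pf (D.s1 g) m2.symm m4.symm)
      (im_sub m1 m2 m3 m4) (im_sub (pg.1 ▸ m1) (pg.2 ▸ m2) (pg.1 ▸ m3) (pg.2 ▸ m4))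
      (im_sub (pf.1 ▸ m1) (pf.1 ▸ m2) (pf.2 ▸ m3) (pf.2 ▸ m4)) (im_sub ?_ ?_ ?_ ?_) ?_ ?_ ?_ ?_
      (w := w) ?_ ?_ ?_ ?_
    · rw [← pf.1, ← pg.1]; exact m1
    · rw [← pf.1, ← pg.2]; exact m2
    · rw [← pf.2, ← pg.1]; exact m3
    · rw [← pf.2, ← pg.2]; exact m4
    · exact ev_of_notin pg (hUm _ (g0 f hf)) (D.s0 f) m1 m2 (notin fw gall _ (.inl rfl) (.inl fA))
    · exact ev_of_notin pg (hUm _ (g1 f hf)) (D.s1 f) m3 m4 (notin fw gall _ (.inr rfl) (.inr fB))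
    · exact ev_of_notin pf (hUm _ (g0 g hg)) (D.s0 g) m1.symm m3.symm (notin gw fall _ (.inl rfl) (.inl gA))
    · exact ev_of_notin pf (hUm _ (g1 g hg)) (D.s1 g) m2.symm m4.symm (notin gw fall _ (.inr rfl) (.inr gB))
    · have := mem_dd.1 fw
      exact vert_cv pf (hU this.1) this.2.1 this.2.2.1
    · have := mem_dd.1 gw
      exact vert_cv pg (hU this.1) this.2.1 this.2.2.1
    · exact (mem_dd.1 fw).2.2.2
    · exact (mem_dd.1 gw).2.2.2
  have hXe : ∀ a b a' b', dir a b → dir a' b' → X (α a b) 0 1 (α a' b') 0 1 =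
      CL.A (α a b) 0 1 a' - CL.A (α a b) 0 1 b' + CL.A (α a' b') 0 1 b - CL.A (α a' b') 0 1 a := by
    intro a b a' b' hab hab'
    obtain ⟨f, hf, rfa, rfb, h3⟩ := hα a b hab
    obtain ⟨g, hg, rga, rgb, h3'⟩ := hα a' b' hab'
    rw [X, h3, h3', rfa, rfb, rga, rgb]
  have hK : ¬ HasK5 adj := by
    refine noK5_odd (fun a => (a : ℂ)) Subtype.val_injective (fun a => if A a then 0 else 1) inc hs ?_ ?_ ?_
    · rintro a b (h | h)
      · have hb : ¬ A b := fun h' => hAB _ h' (dA h).2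
        simp [(dA h).1, hb]
      · have hb : ¬ A a := fun h' => hAB _ h' (dA h).2
        simp [(dA h).1, hb]
    · rintro a b x (h | h) hxa hxb
      · rw [i1 h]; exact hexd a b x h hxa hxb
      · rw [i2 h, ex_neg, hexd b a x h hxb hxa, inv_div]
    · have conv : ∀ z : ℂ, Od z → ∃ n : ℤ, Odd n ∧ z = n := by
        rintro z ⟨k, rfl⟩
        exact ⟨2 * k + 1, ⟨k, rfl⟩, by push_cast; ring⟩
      rintro a b a' b' (h | h) (h' | h') n1 n2 n3 n4 <;> apply conv
      · rw [i1 h, i1 h, i1 h', i1 h', ← hXe a b a' b' h h']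
        exact hX a b a' b' h h' n1 n2 n3 n4
      · rw [i1 h, i1 h, i2 h', i2 h']
        have := (hX a b b' a' h h' n2 n1 n4 n3).neg
        rw [hXe a b b' a' h h'] at this
        convert this using 1; ring
      · rw [i2 h, i2 h, i1 h', i1 h']
        have := (hX b a a' b' h h' n3 n4 n1 n2).neg
        rw [hXe b a a' b' h h'] at this
        convert this using 1; ring
      · rw [i2 h, i2 h, i2 h', i2 h']
        have := hX b a b' a' h h' n4 n3 n2 n1
        rw [hXe b a b' a' h h'] at this
        convert this using 1; ring
  have hp : 2 * G.card ≤ prs adj Finset.univ := by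
    have := prs_ge hs Finset.univ (Finset.univ : Finset {e // e ∈ G}) (fun e => ⟨D.γ e 0, g0 e e.2⟩)
      (fun e => ⟨D.γ e 1, g1 e e.2⟩) (fun e _ => .inl ⟨e, e.2, rfl, rfl⟩) (by simp) (by simp)
      (fun e _ f _ h h' => Subtype.ext (guniq e e.2 f f.2 ⟨congrArg Subtype.val h, congrArg Subtype.val h'⟩))
      (fun e _ f _ h => D.nop e f ⟨congrArg Subtype.val h.1, congrArg Subtype.val h.2⟩)
    simpa using this
  have := prs_le hs hi hK Finset.univ
  have hc : (Finset.univ : Finset {x // x ∈ T}).card = T.card := by simp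
  omega

end Draw
end CL

namespace CL
namespace Draw
variable {D : Draw}

/-- few edges have big lenses -/
theorem big_bound {S U : Finset ℂ} (Λ : Finset D.E) (p : D.E → D.E)
    (h0 : ∀ e ∈ Λ, D.γ e 0 ∈ S) (h1 : ∀ e ∈ Λ, D.γ e 1 ∈ S)
    (hd : ∀ f ∈ Λ, ∀ g ∈ Λ, f ≠ g → D.Pa f g → Disjoint (D.dd U f (p f)) (D.dd U g (p g)))
    (hb : ∀ f ∈ Λ, S.card ≤ (D.dd U f (p f)).card) : Λ.card ≤ S.card * U.card := by
  classical
  rcases Nat.eq_zero_or_pos S.card with hS | hS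
  · have : Λ = ∅ := by
      rw [Finset.eq_empty_iff_forall_notMem]
      intro f hf
      have := h0 f hf
      rw [Finset.card_eq_zero.1 hS] at this
      simp at this
    simp [this]
  have key : ∑ f ∈ Λ, (D.dd U f (p f)).card ≤ ∑ w ∈ U, S.card * S.card := by
    have e1 : ∀ f ∈ Λ, (D.dd U f (p f)).card = ∑ w ∈ U, if w ∈ D.dd U f (p f) then 1 else 0 := by
      intro f hf
      rw [Finset.sum_boole, Finset.filter_mem_eq_inter, Finset.inter_eq_right.2]
      · simp
      · intro w hw; exact (mem_dd.1 hw).1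
    rw [Finset.sum_congr rfl e1, Finset.sum_comm]
    refine Finset.sum_le_sum fun w hw => ?_
    rw [Finset.sum_boole, ← Finset.card_product]
    simp only [Nat.cast_id]
    refine Finset.card_le_card_of_injOn (fun f => (D.γ f 0, D.γ f 1)) ?_ ?_
    · intro f hf
      have hf := (Finset.mem_filter.1 hf).1
      exact Finset.mem_coe.2 (Finset.mem_product.2 ⟨h0 f hf, h1 f hf⟩)
    · intro f hf g hg hfg
      have hf := Finset.mem_filter.1 hf
      have hg := Finset.mem_filter.1 hg
      by_contra hne
      have hpa : D.Pa f g := ⟨congrArg Prod.fst hfg, congrArg Prod.snd hfg⟩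
      exact Finset.disjoint_left.1 (hd f hf.1 g hg.1 hne hpa) hf.2 hg.2
  have h2 : Λ.card * S.card ≤ ∑ f ∈ Λ, (D.dd U f (p f)).card := by
    rw [← smul_eq_mul]
    exact Finset.card_nsmul_le_sum _ _ _ hb
  rw [Finset.sum_const, smul_eq_mul] at key
  have : Λ.card * S.card ≤ (S.card * U.card) * S.card := by
    calc _ ≤ _ := h2
      _ ≤ _ := key
      _ = _ := by ring
  exact Nat.le_of_mul_le_mul_right this hS

theorem piece_count {E' : Finset D.E} {S U : Finset ℂ} (hU : U ⊆ D.V) (hSU : S ⊆ U) (hS : D.Sep E' U)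
    (h0 : ∀ e ∈ E', D.γ e 0 ∈ S) (h1 : ∀ e ∈ E', D.γ e 1 ∈ S) :
    E'.card ≤ S.card * U.card * (2 + 480 * (Nat.log 2 S.card + 1)) := by
  classical
  obtain ⟨Λ, p, hΛ, hc, hp, hd⟩ := lens_system hU hS h0 h1
  have hSU' := Finset.card_le_card hSU
  set L : D.E → Finset ℂ := fun f => D.dd U f (p f) with hL
  set Λb := Λ.filter (fun f => S.card ≤ (L f).card) with hΛb
  set Λs := Λ.filter (fun f => ¬ S.card ≤ (L f).card) with hΛs
  have hsum : Λb.card + Λs.card = Λ.card := by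
    rw [hΛb, hΛs]
    convert Finset.card_filter_add_card_filter_not (s := Λ) (fun f => S.card ≤ (L f).card)
  have hbig : Λb.card ≤ S.card * U.card := by
    refine big_bound Λb p (fun e he => h0 e (hΛ (Finset.mem_filter.1 he).1))
      (fun e he => h1 e (hΛ (Finset.mem_filter.1 he).1)) ?_ fun f hf => (Finset.mem_filter.1 hf).2
    intro f hf g hg
    exact hd f (Finset.mem_filter.1 hf).1 g (Finset.mem_filter.1 hg).1
  have hsmall : Λs.card ≤ ∑ i ∈ Finset.range (Nat.log 2 S.card + 1), 480 * (S.card * U.card) := by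
    have hm : ∀ f ∈ Λs, Nat.log 2 (L f).card ∈ Finset.range (Nat.log 2 S.card + 1) := by
      intro f hf
      have := (Finset.mem_filter.1 hf).2
      exact Finset.mem_range.2 (Nat.lt_succ_of_le (Nat.log_mono_right (not_le.1 this).le))
    rw [Finset.card_eq_sum_card_fiberwise (f := fun f => Nat.log 2 (L f).card) (fun f hf => Finset.mem_coe.2 (hm f hf))]
    refine Finset.sum_le_sum fun i hi => ?_
    set Λi := Λs.filter (fun f => Nat.log 2 (L f).card = i) with hΛi
    have mi : ∀ f ∈ Λi, f ∈ Λ ∧ (L f).card < S.card ∧ 2 ^ i ≤ (L f).card ∧ (L f).card < 2 ^ (i + 1) := by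
      intro f hf
      obtain ⟨hf, hi⟩ := Finset.mem_filter.1 hf
      obtain ⟨hf, hlt⟩ := Finset.mem_filter.1 hf
      refine ⟨hf, not_le.1 hlt, ?_, ?_⟩
      · rw [← hi]; exact Nat.pow_log_le_self 2 (Finset.card_pos.2 (hp f hf).2.2).ne'
      · rw [← hi]; exact Nat.lt_pow_succ_log_self (by norm_num) _
    rcases Λi.eq_empty_or_nonempty with h | ⟨f0, hf0⟩
    · rw [h]; simp
    have := sampling hSU Λi (fun f => D.γ f 0) (fun f => D.γ f 1) L i
      (fun f hf x hx => (mem_dd.1 hx).1) (fun f hf => h0 f (hΛ (mi f hf).1)) (fun f hf => h1 f (hΛ (mi f hf).1))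
      (fun f hf => ends_ne f) (fun f hf h => (mem_dd.1 h).2.1 rfl) (fun f hf h => (mem_dd.1 h).2.2.1 rfl)
      (fun f hf => (mi f hf).2.2.1) (fun f hf => (mi f hf).2.2.2) (fun A B hAB w hw =>
        by convert star_bound hU hSU Λi p (fun f hf => h0 f (hΛ (mi f hf).1)) (fun f hf => h1 f (hΛ (mi f hf).1))
              (fun f hf => (hp f (mi f hf).1).2.1) (fun f hf g hg => hd f (mi f hf).1 g (mi g hg).1) A B hAB w)
    have h3 : 2 ^ i ≤ U.card := ((mi f0 hf0).2.2.1.trans (mi f0 hf0).2.1.le).trans hSU'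
    have h4 : 384 * 2 ^ i * S.card ≤ 384 * U.card * S.card := by gcongr
    nlinarith
  rw [Finset.sum_const, Finset.card_range, smul_eq_mul] at hsmall
  have h5 : S.card * S.card ≤ S.card * U.card := Nat.mul_le_mul_left _ hSU'
  nlinarith
end Draw
end CL

namespace CL

/-- a compact set has an unbounded complementary component -/
theorem exists_unb {Z : Set ℂ} (hZ : IsCompact Z) : ∃ x, x ∉ Z ∧ ¬ Bornology.IsBounded (cmp Z x) := by
  obtain ⟨R, hR⟩ := hZ.isBounded.subset_closedBall 0
  set S : Set ℂ := (fun t : ℝ => (t : ℂ)) '' Ioi (max R 0) with hS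
  have hSp : IsPreconnected S := isPreconnected_Ioi.image _ (by fun_prop)
  have hd : Disjoint S Z := by
    rw [disjoint_left]
    rintro _ ⟨t, ht, rfl⟩ hz
    have := hR hz
    rw [mem_closedBall_zero_iff, Complex.norm_real, Real.norm_eq_abs] at this
    have h2 := le_abs_self t
    have h3 := le_max_left R 0
    have h4 : max R 0 < t := ht
    linarith
  have hx : ((max R 0 + 1 : ℝ) : ℂ) ∈ S := ⟨_, by simp, rfl⟩
  refine ⟨_, disjoint_left.1 hd hx, fun hb => ?_⟩
  obtain ⟨R', hR'⟩ := (hb.subset (cmp_max hSp hx hd)).subset_closedBall 0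
  set t := max (max R 0) R' + 1 with ht
  have h1 : (t : ℂ) ∈ S := ⟨t, by
    have := le_max_left (max R 0) R'
    simp only [mem_Ioi]; linarith, rfl⟩
  have := hR' h1
  rw [mem_closedBall_zero_iff, Complex.norm_real, Real.norm_eq_abs] at this
  have h2 := le_abs_self t
  have := le_max_right (max R 0) R'
  linarith

theorem cmp_eq_of {K : Set ℂ} {x y z : ℂ} (h : z ∈ cmp K x) (h' : z ∈ cmp K y) : cmp K x = cmp K y :=
  (cmp_eq h).trans (cmp_eq h').symm

open Classical in
/-- nesting count -/
theorem nest {ι : Type*} [Fintype ι] (Q F : ι → Set ℂ) (hc : ∀ i, IsPreconnected (Q i))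
    (hne : ∀ i, (Q i).Nonempty) (hFf : ∀ i, (F i).Finite) (hFc : ∀ i, F i ⊆ closure (Q i))
    (hZ : ∀ i, IsCompact (Q i ∪ F i)) (hQF : ∀ i j, Disjoint (Q i) (F j))
    (hQ : ∀ i j, i ≠ j → Disjoint (Q i) (Q j)) (V : Finset ℂ)
    (hV : ∀ w ∈ V, ∀ i, w ∉ F i → ∃ j, j ≠ i ∧ w ∈ F j) :
    ∑ i, ((V.filter (fun w => w ∉ Q i ∪ F i ∧ Bornology.IsBounded (cmp (Q i ∪ F i) w))).image
      (cmp (Q i ∪ F i))).card ≤ Fintype.card ι := by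
  set Z : ι → Set ℂ := fun i => Q i ∪ F i with hZd
  choose q hq using hne
  have hQZ : ∀ i j, j ≠ i → Disjoint (Q j) (Z i) := fun i j h => disjoint_union_right.2 ⟨hQ j i h, hQF j i⟩
  have qn : ∀ i j, j ≠ i → q j ∉ Z i := fun i j h => disjoint_left.1 (hQZ i j h) (hq j)
  have fa : ∀ i j, j ≠ i → Q j ⊆ cmp (Z i) (q j) := fun i j h => cmp_max (hc j) (hq j) (hQZ i j h)
  have fa' : ∀ i j w, j ≠ i → ¬ Disjoint (cmp (Z i) w) (Q j) → cmp (Z i) w = cmp (Z i) (q j) := by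
    intro i j w hij hd
    obtain ⟨z, hz, hz'⟩ := not_disjoint_iff.1 hd
    exact cmp_eq_of hz (fa i j hij hz')
  have fb : ∀ i w, w ∉ Z i → IsPreconnected (cmp (Z i) w ∪ Q i) := by
    intro i w hw
    obtain ⟨z, hz, hzF, hzc⟩ := front_inf (hZ i).isClosed hw (hFf i) (fun h =>
      disjoint_left.1 (hQF i i) (hq i) (h (Or.inl (hq i))))
    have hzQ : z ∈ Q i := hz.resolve_right hzF
    have := IsPreconnected.union z (mem_insert _ _) hzQ (insert_pre (cmp_pre (Z i) w) hzc) (hc i)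
    rwa [insert_union, insert_eq_of_mem (mem_union_right _ hzQ)] at this
  have fc : ∀ i k w, i ≠ k → w ∉ Z i → Disjoint (cmp (Z i) w) (Q k) → cmp (Z i) w ⊆ cmp (Z k) (q i) := by
    intro i k w hik hw hd
    have h1 : Disjoint (cmp (Z i) w) (Z k) := by
      refine disjoint_union_right.2 ⟨hd, ?_⟩
      exact (hd.closure_right (cmp_open (hZ i).isClosed w)).mono_right (hFc k)
    exact subset_union_left.trans (cmp_max (fb i w hw) (Or.inr (hq i)) (disjoint_union_left.2 ⟨h1, hQZ k i hik⟩))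
  set In : ι → ι → Prop := fun j i => j ≠ i ∧ Bornology.IsBounded (cmp (Z i) (q j)) with hIn
  have fd : ∀ i k, In i k → In k i → False := by
    intro i k h h'
    obtain ⟨x, hx, hxb⟩ := exists_unb (hZ i)
    by_cases hd : Disjoint (cmp (Z i) x) (Q k)
    · exact hxb (h.2.subset (fc i k x h.1 hx hd))
    · rw [fa' i k x h.1.symm hd] at hxb
      exact hxb h'.2
  have fe : ∀ j k i, In j k → In k i → In j i := by
    intro j k i h h'
    refine ⟨?_, ?_⟩
    · rintro rfl; exact fd _ _ h h'
    by_cases hd : Disjoint (cmp (Z k) (q j)) (Q i)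
    · have := fc k i (q j) h'.1 (qn k j h.1) hd (mem_cmp (qn k j h.1))
      rw [← cmp_eq this]; exact h'.2
    · have h2 := h.2
      rw [fa' k i (q j) h'.1.symm hd] at h2
      exact (fd i k ⟨h'.1.symm, h2⟩ h').elim
  set cn : ι → ℕ := fun j => (Finset.univ.filter (fun k => In j k)).card with hcn
  have fcn : ∀ j k, In j k → cn k < cn j := by
    intro j k h
    refine Finset.card_lt_card (Finset.ssubset_iff_of_subset (fun x hx => ?_) |>.2 ⟨k, ?_, ?_⟩)
    · exact Finset.mem_filter.2 ⟨Finset.mem_univ _, fe _ _ _ h (Finset.mem_filter.1 hx).2⟩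
    · exact Finset.mem_filter.2 ⟨Finset.mem_univ _, h⟩
    · intro h'; exact (Finset.mem_filter.1 h').2.1 rfl
  set Bs : ι → Finset (Set ℂ) := fun i => ((V.filter (fun w => w ∉ Z i ∧ Bornology.IsBounded (cmp (Z i) w))).image
      (cmp (Z i))) with hBs
  have hsel : ∀ i, ∀ B ∈ Bs i, ∃ j, j ≠ i ∧ B = cmp (Z i) (q j) ∧ Bornology.IsBounded B ∧
      ∀ k, k ≠ i → B = cmp (Z i) (q k) → cn j ≤ cn k := by
    intro i B hB
    obtain ⟨w, hw, rfl⟩ := Finset.mem_image.1 hB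
    obtain ⟨hwV, hwZ, hb⟩ := Finset.mem_filter.1 hw
    obtain ⟨j, hj, hwj⟩ := hV w hwV i (fun h => hwZ (Or.inr h))
    have hjm : cmp (Z i) w = cmp (Z i) (q j) := by
      refine fa' i j w hj (fun hd => ?_)
      have := hd.closure_right (cmp_open (hZ i).isClosed w)
      exact disjoint_left.1 this (mem_cmp hwZ) (hFc j hwj)
    obtain ⟨k, hk, hmin⟩ := (Finset.univ.filter (fun k => k ≠ i ∧ cmp (Z i) w = cmp (Z i) (q k))).exists_min_image cn
      ⟨j, Finset.mem_filter.2 ⟨Finset.mem_univ _, hj, hjm⟩⟩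
    have hk := (Finset.mem_filter.1 hk).2
    exact ⟨k, hk.1, hk.2, hb, fun l hl hl' => hmin l (Finset.mem_filter.2 ⟨Finset.mem_univ _, hl, hl'⟩)⟩
  choose! f hf1 hf2 hf3 hf4 using hsel
  have hcard : ∑ i, (Bs i).card = (Finset.univ.sigma Bs).card := (Finset.card_sigma _ _).symm
  change ∑ i, (Bs i).card ≤ _
  rw [hcard, ← Finset.card_univ]
  refine Finset.card_le_card_of_injOn (fun x => f x.1 x.2) (fun x _ => Finset.mem_coe.2 (Finset.mem_univ _)) ?_
  rintro ⟨i, B⟩ hx ⟨i', B'⟩ hx' hff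
  have hB : B ∈ Bs i := (Finset.mem_sigma.1 hx).2
  have hB' : B' ∈ Bs i' := (Finset.mem_sigma.1 hx').2
  simp only at hff
  have e1 := hf2 i B hB
  have e1' := hf2 i' B' hB'
  have n1 := hf1 i B hB
  have n1' := hf1 i' B' hB'
  have b1 := hf3 i B hB
  have b1' := hf3 i' B' hB'
  have m1 := hf4 i B hB
  have m1' := hf4 i' B' hB'
  rw [← hff] at e1' n1' m1'
  set j := f i B with hj
  by_cases hii : i = i'
  · subst hii
    rw [e1, e1']
  exfalso
  have in1 : In j i := ⟨n1, e1 ▸ b1⟩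
  have in1' : In j i' := ⟨n1', e1' ▸ b1'⟩
  have hd : Disjoint (cmp (Z i) (q j)) (Q i') := by
    by_contra hd
    have := m1 i' (Ne.symm hii) (e1.trans (fa' i i' (q j) (Ne.symm hii) hd))
    have := fcn _ _ in1'
    omega
  have h2 := fc i i' (q j) hii (qn i j n1) hd (mem_cmp (qn i j n1))
  have := m1' i hii (e1'.trans (cmp_eq h2).symm)
  have := fcn _ _ in1
  omega
end CL

namespace CL

/-- planarization of a drawing with bounded groups at the vertices -/
structure Plan (D : Draw) (Dg : ℕ) where
  N : Type
  fin : Finite N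
  adj : N → N → Prop
  K : N → Set ℂ
  Γ : N → N → Set ℂ
  hs : ∀ a b, adj a b → adj b a
  hK : ∀ a, IsPathConnected (K a)
  hΓ : ∀ a b, adj a b → IsPathConnected (Γ a b)
  h1 : ∀ a b, adj a b → (Γ a b ∩ K a).Nonempty
  h2 : ∀ a b, adj a b → (Γ a b ∩ K b).Nonempty
  hKd : ∀ a b, a ≠ b → Disjoint (K a) (K b)
  h3 : ∀ a b c, adj a b → c ≠ a → c ≠ b → Disjoint (Γ a b) (K c)
  h4 : ∀ a b c d, adj a b → adj c d → a ≠ c → a ≠ d → b ≠ c → b ≠ d → Disjoint (Γ a b) (Γ c d)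
  G : N → Prop
  vt : N → ℂ
  hKV : ∀ a, Disjoint (K a) (D.V : Set ℂ)
  hΓV : ∀ a b, adj a b → Disjoint (Γ a b) (D.V : Set ℂ)
  vcl : ∀ a, G a → vt a ∈ closure (K a)
  vV : ∀ a, G a → vt a ∈ D.V
  vsurj : ∀ w ∈ D.V, ∃ a, G a ∧ vt a = w
  cG : ∀ a, G a → IsCompact (insert (vt a) (K a))
  cK : ∀ a, ¬ G a → IsCompact (K a)
  cΓ : ∀ a b, adj a b → ∃ C, IsCompact C ∧ Γ a b = C ∪ K a ∪ K b
  P : D.E → Finset N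
  hP : ∀ e, Cn adj (P e : Set N)
  e0 : ∀ e, ∃ a ∈ P e, G a ∧ vt a = D.γ e 0
  e1 : ∀ e, ∃ a ∈ P e, G a ∧ vt a = D.γ e 1
  γ' : D.E → ℝ → ℂ
  γc : ∀ e, Continuous (γ' e)
  γ0 : ∀ e, γ' e 0 = D.γ e 0
  γ1 : ∀ e, γ' e 1 = D.γ e 1
  γm : ∀ e, ∀ t ∈ Ioo (0 : ℝ) 1, γ' e t ∈ RB adj K Γ (P e : Set N)
  γA : ∀ e, ∀ w ∈ D.V, w ≠ D.γ e 0 → w ≠ D.γ e 1 → CL.A (γ' e) 0 1 w = CL.A (D.γ e) 0 1 w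
  cGb : ∀ a, G a → Nat.card {e // a ∈ P e} ≤ Dg
  nG : ∀ T : Finset N, (∀ a ∈ T, G a) → T.card ≤ 3 * D.V.card
  cX : ∀ T : Finset N, (∀ a ∈ T, ¬ G a) → ∑ a ∈ T, (Nat.card {e // a ∈ P e}) ^ 2 ≤
    2 * Nat.card {p : D.E × D.E // D.Cr p.1 p.2}

namespace Plan
variable {D : Draw} {Dg : ℕ} (p : Plan D Dg)

theorem noK5 : ¬ HasK5 p.adj :=
  noK5_planar p.hs p.hK p.hΓ p.h1 p.h2 p.hKd p.h3 p.h4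

open Classical in
/-- vertices represented in a set of nodes -/
noncomputable def vs (B : Finset p.N) : Finset ℂ := (B.filter p.G).image p.vt

/-- region of a set of nodes -/
def Q (B : Finset p.N) : Set ℂ := RB p.adj p.K p.Γ (B : Set p.N)

theorem mem_vs {B : Finset p.N} {w : ℂ} : w ∈ p.vs B ↔ ∃ a ∈ B, p.G a ∧ p.vt a = w := by
  classical
  simp [vs, and_assoc]

theorem K_sub {B : Finset p.N} {a : p.N} (ha : a ∈ B) : p.K a ⊆ p.Q B := fun z hz => .inl ⟨a, ha, hz⟩

theorem vs_closure (B : Finset p.N) : (p.vs B : Set ℂ) ⊆ closure (p.Q B) := by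
  intro w hw
  obtain ⟨a, ha, hG, rfl⟩ := p.mem_vs.1 hw
  exact closure_mono (p.K_sub ha) (p.vcl a hG)

theorem vs_sub (B : Finset p.N) : p.vs B ⊆ D.V := by
  intro w hw
  obtain ⟨a, ha, hG, rfl⟩ := p.mem_vs.1 hw
  exact p.vV a hG

theorem Q_V (B : Finset p.N) : Disjoint (p.Q B) (D.V : Set ℂ) := by
  rw [disjoint_left]
  rintro z (⟨a, ha, hz⟩ | ⟨a, ha, b, hb, hab, hz⟩) hz'
  · exact disjoint_left.1 (p.hKV a) hz hz'
  · exact disjoint_left.1 (p.hΓV a b hab) hz hz'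

theorem Z_compact (B : Finset p.N) : IsCompact (p.Q B ∪ p.vs B) := by
  classical
  have hC : ∀ a b, ∃ C, IsCompact C ∧ (p.adj a b → p.Γ a b = C ∪ p.K a ∪ p.K b) ∧ (¬ p.adj a b → C = ∅) := by
    intro a b
    by_cases h : p.adj a b
    · obtain ⟨C, h1, h2⟩ := p.cΓ a b h
      exact ⟨C, h1, fun _ => h2, fun h' => absurd h h'⟩
    · exact ⟨∅, isCompact_empty, fun h' => absurd h' h, fun _ => rfl⟩
  choose C hC1 hC2 hC3 using hC
  have heq : p.Q B ∪ p.vs B = (⋃ a ∈ B, (if p.G a then insert (p.vt a) (p.K a) else p.K a)) ∪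
      ⋃ a ∈ B, ⋃ b ∈ B, C a b := by
    ext z
    constructor
    · rintro ((⟨a, ha, hz⟩ | ⟨a, ha, b, hb, hab, hz⟩) | hz)
      · left
        refine mem_iUnion₂.2 ⟨a, ha, ?_⟩
        split_ifs
        · exact Or.inr hz
        · exact hz
      · rw [hC2 a b hab] at hz
        rcases hz with (hz | hz) | hz
        · right
          exact mem_iUnion₂.2 ⟨a, ha, mem_iUnion₂.2 ⟨b, hb, hz⟩⟩
        · left
          refine mem_iUnion₂.2 ⟨a, ha, ?_⟩
          split_ifs
          · exact Or.inr hz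
          · exact hz
        · left
          refine mem_iUnion₂.2 ⟨b, hb, ?_⟩
          split_ifs
          · exact Or.inr hz
          · exact hz
      · obtain ⟨a, ha, hG, rfl⟩ := p.mem_vs.1 hz
        left
        refine mem_iUnion₂.2 ⟨a, ha, ?_⟩
        rw [if_pos hG]
        exact mem_insert _ _
    · rintro (hz | hz)
      · obtain ⟨a, ha, hz⟩ := mem_iUnion₂.1 hz
        split_ifs at hz with hG
        · rcases hz with rfl | hz
          · right; exact p.mem_vs.2 ⟨a, ha, hG, rfl⟩
          · left; exact p.K_sub ha hz
        · left; exact p.K_sub ha hz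
      · obtain ⟨a, ha, hz⟩ := mem_iUnion₂.1 hz
        obtain ⟨b, hb, hz⟩ := mem_iUnion₂.1 hz
        by_cases h : p.adj a b
        · left; right
          exact ⟨a, ha, b, hb, h, by rw [hC2 a b h]; exact Or.inl (Or.inl hz)⟩
        · rw [hC3 a b h] at hz; exact hz.elim
  rw [heq]
  refine IsCompact.union ?_ ?_
  · refine B.isCompact_biUnion fun a _ => ?_
    split_ifs with h
    · exact p.cG a h
    · exact p.cK a h
  · exact B.isCompact_biUnion fun a _ => B.isCompact_biUnion fun b _ => hC1 a b

theorem Q_mono {B B' : Finset p.N} (h : B ⊆ B') : p.Q B ⊆ p.Q B' := by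
  rintro z (⟨a, ha, hz⟩ | ⟨a, ha, b, hb, hab, hz⟩)
  · exact .inl ⟨a, h ha, hz⟩
  · exact .inr ⟨a, h ha, b, h hb, hab, hz⟩

theorem im_sub {B : Finset p.N} {e : D.E} (h : p.P e ⊆ B) : p.γ' e '' Icc 0 1 ⊆ p.Q B ∪ p.vs B := by
  rintro _ ⟨t, ht, rfl⟩
  rcases eq_or_lt_of_le ht.1 with rfl | h0
  · obtain ⟨a, ha, hG, hv⟩ := p.e0 e
    right; rw [p.γ0]; exact p.mem_vs.2 ⟨a, h ha, hG, hv⟩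
  rcases eq_or_lt_of_le ht.2 with rfl | h1
  · obtain ⟨a, ha, hG, hv⟩ := p.e1 e
    right; rw [p.γ1]; exact p.mem_vs.2 ⟨a, h ha, hG, hv⟩
  left; exact p.Q_mono h (p.γm e t ⟨h0, h1⟩)

/-- separation inside a piece -/
theorem sep {B : Finset p.N} {e f : D.E} (he : p.P e ⊆ B) (hf : p.P f ⊆ B) (hne : e ≠ f) (hpa : D.Pa e f) :
    ∃ w ∈ D.V, w ≠ D.γ e 0 ∧ w ≠ D.γ e 1 ∧ Od (W (D.γ e) (D.γ f) w) ∧ (w ∉ p.vs B →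
      Bornology.IsBounded (cmp (p.Q B ∪ p.vs B) w) ∧ ∀ w' ∈ D.V, w' ∉ p.vs B →
        cmp (p.Q B ∪ p.vs B) w' = cmp (p.Q B ∪ p.vs B) w → w' ∈ D.dd D.V e f) := by
  obtain ⟨w, hw, h0, h1, ho⟩ := D.sep e f hne hpa.1 hpa.2
  have hWe : ∀ w ∈ D.V, w ≠ D.γ e 0 → w ≠ D.γ e 1 → W (p.γ' e) (p.γ' f) w = W (D.γ e) (D.γ f) w := by
    intro w hw h0 h1
    unfold W
    rw [p.γA e w hw h0 h1, p.γA f w hw (hpa.1 ▸ h0) (hpa.2 ▸ h1)]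
  have ee0 : p.γ' e 0 = p.γ' f 0 := by rw [p.γ0, p.γ0, hpa.1]
  have ee1 : p.γ' e 1 = p.γ' f 1 := by rw [p.γ1, p.γ1, hpa.2]
  have hE : ∀ x, Disjoint (cmp (p.Q B ∪ p.vs B) x) (p.γ' e '' Icc 0 1) := fun x =>
    (cmp_disj _ x).mono_right (p.im_sub he)
  have hF : ∀ x, Disjoint (cmp (p.Q B ∪ p.vs B) x) (p.γ' f '' Icc 0 1) := fun x =>
    (cmp_disj _ x).mono_right (p.im_sub hf)
  have nz : ∀ x ∈ D.V, x ∉ p.vs B → x ∉ p.Q B ∪ p.vs B := by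
    rintro x hx hxB (h | h)
    · exact disjoint_left.1 (p.Q_V B) h hx
    · exact hxB h
  refine ⟨w, hw, h0, h1, ho, fun hwB => ⟨?_, ?_⟩⟩
  · by_contra hb
    have := W_unb (p.γc e) (p.γc f) ee0 ee1 (cmp_pre _ w) (hE w) (hF w) (mem_cmp (nz w hw hwB)) hb
    rw [hWe w hw h0 h1] at this
    rw [this] at ho
    exact Ev.zero.not_od ho
  · intro w' hw' hwB' hcm
    have a0 : w' ≠ D.γ e 0 := by
      rintro rfl
      obtain ⟨a, ha, hG, hv⟩ := p.e0 e
      exact hwB' (p.mem_vs.2 ⟨a, he ha, hG, hv⟩)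
    have a1 : w' ≠ D.γ e 1 := by
      rintro rfl
      obtain ⟨a, ha, hG, hv⟩ := p.e1 e
      exact hwB' (p.mem_vs.2 ⟨a, he ha, hG, hv⟩)
    have hm : w' ∈ cmp (p.Q B ∪ p.vs B) w := hcm ▸ mem_cmp (nz w' hw' hwB')
    have := W_const (p.γc e).continuousOn (p.γc f).continuousOn ee0 ee1 (cmp_pre _ w) (hE w) (hF w)
      (mem_cmp (nz w hw hwB)) hm
    rw [hWe w hw h0 h1, hWe w' hw' a0 a1] at this
    exact Draw.mem_dd.2 ⟨hw', a0, a1, this ▸ ho⟩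

theorem dd_mono {U U' : Finset ℂ} {e f : D.E} {w : ℂ} (h : w ∈ D.dd U e f) (hw : w ∈ U') : w ∈ D.dd U' e f :=
  Draw.mem_dd.2 ⟨hw, (Draw.mem_dd.1 h).2⟩

open Classical in
/-- edges of a piece -/
noncomputable def es (B : Finset p.N) : Finset D.E := (@Finset.univ _ D.fin).filter fun e => p.P e ⊆ B

theorem mem_es {B : Finset p.N} {e : D.E} : e ∈ p.es B ↔ p.P e ⊆ B := by
  classical
  haveI := D.fin
  simp [es]

open Classical in
/-- bounded faces of a piece which contain vertices -/
noncomputable def fc (B : Finset p.N) : Finset (Set ℂ) :=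
  (D.V.filter (fun w => w ∉ p.Q B ∪ p.vs B ∧ Bornology.IsBounded (cmp (p.Q B ∪ p.vs B) w))).image
      (cmp (p.Q B ∪ p.vs B))

theorem piece (B : Finset p.N) : (p.es B).card ≤ (p.vs B).card * ((p.vs B).card + (p.fc B).card) *
    (2 + 480 * (Nat.log 2 (p.vs B).card + 1)) := by
  classical
  have hr : ∀ b ∈ p.fc B, ∃ w ∈ D.V, w ∉ p.Q B ∪ p.vs B ∧ cmp (p.Q B ∪ p.vs B) w = b := by
    intro b hb
    obtain ⟨w, hw, rfl⟩ := Finset.mem_image.1 hb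
    have := Finset.mem_filter.1 hw
    exact ⟨w, this.1, this.2.1, rfl⟩
  choose! r hr1 hr2 hr3 using hr
  set U := p.vs B ∪ (p.fc B).image r with hU
  have hUc : U.card ≤ (p.vs B).card + (p.fc B).card :=
    (Finset.card_union_le _ _).trans (Nat.add_le_add_left Finset.card_image_le _)
  have hUV : U ⊆ D.V := by
    refine Finset.union_subset (p.vs_sub B) fun w hw => ?_
    obtain ⟨b, hb, rfl⟩ := Finset.mem_image.1 hw
    exact hr1 b hb
  have hS : D.Sep (p.es B) U := by
    intro e he f hf hne hpa
    obtain ⟨w, hw, h0, h1, ho, hc⟩ := p.sep (p.mem_es.1 he) (p.mem_es.1 hf) hne hpa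
    by_cases hwB : w ∈ p.vs B
    · exact ⟨w, Draw.mem_dd.2 ⟨Finset.mem_union_left _ hwB, h0, h1, ho⟩⟩
    obtain ⟨hb, hc⟩ := hc hwB
    have hm : cmp (p.Q B ∪ p.vs B) w ∈ p.fc B := by
      refine Finset.mem_image.2 ⟨w, Finset.mem_filter.2 ⟨hw, ?_, hb⟩, rfl⟩
      rintro (h | h)
      · exact disjoint_left.1 (p.Q_V B) h hw
      · exact hwB h
    refine ⟨r (cmp (p.Q B ∪ p.vs B) w), dd_mono (hc _ (hr1 _ hm) (fun h => hr2 _ hm (Or.inr h)) (hr3 _ hm)) ?_⟩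
    exact Finset.mem_union_right _ (Finset.mem_image_of_mem _ hm)
  have := Draw.piece_count hUV Finset.subset_union_left hS (fun e he => by
      obtain ⟨a, ha, hG, hv⟩ := p.e0 e
      exact p.mem_vs.2 ⟨a, p.mem_es.1 he ha, hG, hv⟩) (fun e he => by
      obtain ⟨a, ha, hG, hv⟩ := p.e1 e
      exact p.mem_vs.2 ⟨a, p.mem_es.1 he ha, hG, hv⟩)
  refine this.trans ?_
  gcongr

end Plan
end CL

namespace CL
namespace Plan
variable {D : Draw} {Dg : ℕ} (p : Plan D Dg)

open Classical in
/-- all pieces of a disjoint family together -/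
theorem pieces (I : Finset (Finset p.N)) (hc : ∀ B ∈ I, Cn p.adj (B : Set p.N)) (hd : ∀ B ∈ I, ∀ B' ∈ I, B ≠ B' → Disjoint B B')
    (hg : ∀ B ∈ I, ∃ a ∈ B, p.G a) (hall : ∀ a, p.G a → ∃ B ∈ I, a ∈ B) (s : ℕ)
    (hs : ∀ B ∈ I, (B.filter p.G).card ≤ s) :
    ∑ B ∈ I, (p.es B).card ≤ 6 * D.V.card * (s * (482 + 480 * Nat.log 2 s)) := by
  have hG : ∑ B ∈ I, (B.filter p.G).card ≤ 3 * D.V.card := by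
    rw [← Finset.card_biUnion]
    · refine p.nG _ fun a ha => ?_
      obtain ⟨B, _, h⟩ := Finset.mem_biUnion.1 ha
      exact (Finset.mem_filter.1 h).2
    · intro B hB B' hB' hne
      exact (hd B hB B' hB' hne).mono (Finset.filter_subset _ _) (Finset.filter_subset _ _)
  have hI : I.card ≤ 3 * D.V.card := by
    refine le_trans ?_ hG
    rw [Finset.card_eq_sum_ones]
    refine Finset.sum_le_sum fun B hB => ?_
    obtain ⟨a, ha, hga⟩ := hg B hB
    exact Finset.card_pos.2 ⟨a, Finset.mem_filter.2 ⟨ha, hga⟩⟩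
  have hvs : ∀ B, (p.vs B).card ≤ (B.filter p.G).card := fun B => by
    unfold vs; exact Finset.card_image_le
  have hn : ∑ B ∈ I, (p.fc B).card ≤ I.card := by
    have := nest (ι := {B // B ∈ I}) (fun B => p.Q B.1) (fun B => (p.vs B.1 : Set ℂ))
      (fun B => (RB_pathConn p.hK p.hΓ p.h1 p.h2 (hc B.1 B.2)).isConnected.isPreconnected)
      (fun B => (RB_pathConn p.hK p.hΓ p.h1 p.h2 (hc B.1 B.2)).nonempty)
      (fun B => Finset.finite_toSet _) (fun B => p.vs_closure B.1) (fun B => p.Z_compact B.1)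
      (fun B B' => (p.Q_V B.1).mono_right (Finset.coe_subset.2 (p.vs_sub B'.1)))
      (fun B B' hne => RB_disjoint p.hKd p.h3 p.h4 (Finset.disjoint_coe.2
        (hd B.1 B.2 B'.1 B'.2 fun h => hne (Subtype.ext h)))) D.V ?_
    · rw [Fintype.card_coe] at this
      refine le_trans (le_of_eq ?_) this
      rw [Finset.univ_eq_attach, ← Finset.sum_attach]
      refine Finset.sum_congr rfl fun B _ => ?_
      unfold fc
      congr!
    · intro w hw B hwB
      obtain ⟨a, ha, rfl⟩ := p.vsurj w hw
      obtain ⟨B', hB', haB⟩ := hall a ha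
      have hm : p.vt a ∈ p.vs B' := p.mem_vs.2 ⟨a, haB, ha, rfl⟩
      refine ⟨⟨B', hB'⟩, ?_, hm⟩
      rintro rfl
      exact hwB hm
  calc ∑ B ∈ I, (p.es B).card ≤ ∑ B ∈ I, (s * (482 + 480 * Nat.log 2 s)) * ((B.filter p.G).card + (p.fc B).card) := by
        refine Finset.sum_le_sum fun B hB => (p.piece B).trans ?_
        have h1 : (p.vs B).card ≤ s := (hvs B).trans (hs B hB)
        have h2 := hvs B
        have h3 : Nat.log 2 (p.vs B).card ≤ Nat.log 2 s := Nat.log_mono_right h1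
        calc _ ≤ s * ((B.filter p.G).card + (p.fc B).card) * (2 + 480 * (Nat.log 2 s + 1)) := by gcongr
          _ = _ := by ring
    _ = (s * (482 + 480 * Nat.log 2 s)) * (∑ B ∈ I, (B.filter p.G).card + ∑ B ∈ I, (p.fc B).card) := by
        rw [← Finset.mul_sum, Finset.sum_add_distrib]
    _ ≤ (s * (482 + 480 * Nat.log 2 s)) * (3 * D.V.card + 3 * D.V.card) := by
        gcongr
        exact hn.trans hI
    _ = _ := by ring

theorem main (p : Plan D Dg) (W0 s : ℕ) (hW : 1 ≤ W0) (hs1 : 1 ≤ s) :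
    (Nat.card D.E : ℝ) ≤ 53 * (2 * Nat.card {q : D.E × D.E // D.Cr q.1 q.2} + 3 * D.V.card * (Dg ^ 2 + W0)) / √(s * W0)
      + 6 * D.V.card * (s * (482 + 480 * Nat.log 2 s)) := by
  classical
  haveI := p.fin
  haveI : Fintype p.N := Fintype.ofFinite _
  haveI := D.fin
  set X := Nat.card {q : D.E × D.E // D.Cr q.1 q.2} with hX
  set c : p.N → ℕ := fun a => Nat.card {e // a ∈ p.P e} with hc
  set μ : p.N → ℕ := fun a => c a ^ 2 + if p.G a then W0 else 0 with hμ
  have hT : tot μ Finset.univ ≤ 2 * X + 3 * D.V.card * (Dg ^ 2 + W0) := by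
    unfold tot
    rw [← Finset.sum_filter_add_sum_filter_not Finset.univ p.G, add_comm]
    refine Nat.add_le_add ?_ ?_
    · refine le_trans (le_of_eq ?_) (p.cX (Finset.univ.filter fun a => ¬ p.G a) fun a ha => (Finset.mem_filter.1 ha).2)
      refine Finset.sum_congr rfl fun a ha => ?_
      simp only [hμ, hc]
      rw [if_neg (Finset.mem_filter.1 ha).2, add_zero]
    · calc _ ≤ ∑ a ∈ Finset.univ.filter p.G, (Dg ^ 2 + W0) := by
            refine Finset.sum_le_sum fun a ha => ?_
            have hG := (Finset.mem_filter.1 ha).2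
            simp only [hμ, hc]
            rw [if_pos hG]
            have := p.cGb a hG
            gcongr
        _ ≤ _ := by
            rw [Finset.sum_const, smul_eq_mul]
            gcongr
            exact p.nG _ fun a ha => (Finset.mem_filter.1 ha).2
  have hT' : (tot μ Finset.univ : ℝ) ≤ 2 * X + 3 * D.V.card * (Dg ^ 2 + W0) := by exact_mod_cast hT
  have hR : (1 : ℝ) ≤ (s * W0 : ℕ) := by
    have : 1 ≤ s * W0 := Nat.mul_pos hs1 hW
    exact_mod_cast this
  obtain ⟨S, -, hS1, hS2, hS3⟩ := division (c := c) (μ := μ) p.hs p.noK5 (fun v => Nat.le_add_right _ _) hR _ Finset.univ le_rfl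
  have hcost : (tot c S : ℝ) ≤ 53 * (2 * X + 3 * D.V.card * (Dg ^ 2 + W0)) / √(s * W0) := by
    rcases le_or_gt (tot μ Finset.univ : ℝ) ((s * W0 : ℕ) : ℝ) with h | h
    · rw [hS2 h]; simp only [Nat.cast_zero]; positivity
    · have h1 := hS3 h
      push_cast at h1
      have h2 : 0 ≤ 37 * √(tot μ Finset.univ : ℝ) := by positivity
      have h3 : 53 * (tot μ Finset.univ : ℝ) / √(s * W0) ≤ 53 * (2 * X + 3 * D.V.card * (Dg ^ 2 + W0)) / √(s * W0) := by
        gcongr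
      linarith
  obtain ⟨Pt, hP1, hP2, hP3⟩ := exists_comps p.hs (Finset.univ \ S)
  set I := (Pt ∪ S.image fun a => {a}).filter (fun B => ∃ a ∈ B, p.G a) with hI
  have hIc : ∀ B ∈ I, (B ∈ Pt ∨ ∃ a ∈ S, B = {a}) ∧ ∃ a ∈ B, p.G a := by
    intro B hB
    obtain ⟨h, hg⟩ := Finset.mem_filter.1 hB
    refine ⟨?_, hg⟩
    rcases Finset.mem_union.1 h with h | h
    · exact Or.inl h
    · obtain ⟨a, ha, rfl⟩ := Finset.mem_image.1 h
      exact Or.inr ⟨a, ha, rfl⟩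
  have hdS : ∀ B ∈ Pt, ∀ a ∈ S, a ∉ B := fun B hB a ha h => (Finset.mem_sdiff.1 ((hP1 B hB).2 h)).2 ha
  have hsum := p.pieces I (fun B hB => by
      rcases (hIc B hB).1 with h | ⟨a, ha, rfl⟩
      · exact (hP1 B h).1
      · simpa using Cn.singleton a)
    (fun B hB B' hB' hne => by
      rcases (hIc B hB).1 with h | ⟨a, ha, rfl⟩ <;> rcases (hIc B' hB').1 with h' | ⟨a', ha', rfl⟩
      · exact hP2 B h B' h' hne
      · exact Finset.disjoint_singleton_right.2 (hdS B h a' ha')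
      · exact Finset.disjoint_singleton_left.2 (hdS B' h' a ha)
      · exact Finset.disjoint_singleton.2 fun h => hne (by rw [h]))
    (fun B hB => (hIc B hB).2)
    (fun a ha => by
      by_cases haS : a ∈ S
      · exact ⟨{a}, Finset.mem_filter.2 ⟨Finset.mem_union_right _ (Finset.mem_image_of_mem _ haS),
          a, Finset.mem_singleton_self a, ha⟩, Finset.mem_singleton_self a⟩
      · obtain ⟨B, hB, hs⟩ := hP3 {a} (by simpa using Cn.singleton a) (by simpa using haS)
        have hm : a ∈ B := hs (Finset.mem_singleton_self a)
        exact ⟨B, Finset.mem_filter.2 ⟨Finset.mem_union_left _ hB, a, hm, ha⟩, hm⟩) s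
    (fun B hB => by
      rcases (hIc B hB).1 with h | ⟨a, ha, rfl⟩
      · have h1 := hS1 B (hP1 B h).1 (hP1 B h).2
        have h1 : tot μ B ≤ s * W0 := by exact_mod_cast h1
        have h2 : (B.filter p.G).card * W0 ≤ tot μ B := by
          unfold tot
          rw [← smul_eq_mul]
          refine (Finset.card_nsmul_le_sum _ μ _ fun a ha => ?_).trans
            (Finset.sum_le_sum_of_subset (Finset.filter_subset _ _))
          simp only [hμ]
          rw [if_pos (Finset.mem_filter.1 ha).2]
          exact Nat.le_add_left _ _
        exact Nat.le_of_mul_le_mul_right (h2.trans h1) hW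
      · refine (Finset.card_filter_le _ _).trans ?_
        simpa using hs1)
  have hE : Nat.card D.E ≤ tot c S + ∑ B ∈ I, (p.es B).card := by
    have hsub : (Finset.univ : Finset D.E) ⊆ (S.biUnion fun a => Finset.univ.filter fun e => a ∈ p.P e) ∪ I.biUnion p.es := by
      intro e _
      by_cases h : ∃ a ∈ S, a ∈ p.P e
      · obtain ⟨a, ha, h⟩ := h
        exact Finset.mem_union_left _ (Finset.mem_biUnion.2 ⟨a, ha, Finset.mem_filter.2 ⟨Finset.mem_univ _, h⟩⟩)
      · push Not at h
        obtain ⟨B, hB, hs⟩ := hP3 (p.P e) (p.hP e) (fun a ha => Finset.mem_sdiff.2 ⟨Finset.mem_univ _, fun h' => h a h' ha⟩)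
        obtain ⟨a, ha, hG, -⟩ := p.e0 e
        exact Finset.mem_union_right _ (Finset.mem_biUnion.2 ⟨B, Finset.mem_filter.2
          ⟨Finset.mem_union_left _ hB, a, hs ha, hG⟩, p.mem_es.2 hs⟩)
    rw [Nat.card_eq_fintype_card, ← Finset.card_univ]
    refine (Finset.card_le_card hsub).trans ((Finset.card_union_le _ _).trans (Nat.add_le_add ?_ Finset.card_biUnion_le))
    refine Finset.card_biUnion_le.trans (le_of_eq ?_)
    unfold tot
    refine Finset.sum_congr rfl fun a _ => ?_
    simp only [hc]
    rw [Nat.card_eq_fintype_card, Fintype.card_subtype]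
  have hE' : (Nat.card D.E : ℝ) ≤ tot c S + ∑ B ∈ I, ((p.es B).card : ℝ) := by exact_mod_cast hE
  have hsum' : ∑ B ∈ I, ((p.es B).card : ℝ) ≤ 6 * D.V.card * (s * (482 + 480 * Nat.log 2 s)) := by exact_mod_cast hsum
  linarith
end Plan
end CL

namespace CL

/-- a system of arcs passing through pairwise disjoint connected nodes -/
structure Net (E N : Type) where
  γ : E → ℝ → ℂ
  K : N → Set ℂ
  T : E → Finset ℝ
  nd : E → ℝ → N
  lo : E → ℝ
  hi : E → ℝ
  cont : ∀ e, Continuous (γ e)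
  inj : ∀ e, InjOn (γ e) (Icc (lo e) (hi e))
  loT : ∀ e, lo e ∈ T e
  hiT : ∀ e, hi e ∈ T e
  sub : ∀ e, ∀ t ∈ T e, t ∈ Icc (lo e) (hi e)
  hK : ∀ x, IsPathConnected (K x)
  hKd : ∀ x y, x ≠ y → Disjoint (K x) (K y)
  mem : ∀ e, ∀ t ∈ T e, γ e t ∈ K (nd e t)
  st : ∀ e, ∀ t ∈ Icc (lo e) (hi e), ∀ x, γ e t ∈ K x → t ∈ T e ∧ nd e t = x
  cr : ∀ e f, e ≠ f → ∀ s ∈ Icc (lo e) (hi e), ∀ t ∈ Icc (lo f) (hi f), γ e s = γ f t → s ∈ T e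

namespace Net
variable {E N : Type} (M : Net E N)

/-- consecutive node times -/
def Co (e : E) (s t : ℝ) : Prop := s ∈ M.T e ∧ t ∈ M.T e ∧ s < t ∧ ∀ r ∈ M.T e, s < r → ¬ r < t

/-- a segment joins two nodes -/
def Jo (x y : N) (e : E) (s t : ℝ) : Prop :=
  M.Co e s t ∧ (M.nd e s = x ∧ M.nd e t = y ∨ M.nd e s = y ∧ M.nd e t = x)

/-- adjacency of nodes -/
def adj (x y : N) : Prop := ∃ e s t, M.Jo x y e s t

/-- union of the segments between two nodes -/
def sg (x y : N) : Set ℂ := {z | ∃ e s t, M.Jo x y e s t ∧ z ∈ M.γ e '' Icc s t}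

/-- connection of two nodes -/
def Γ (x y : N) : Set ℂ := M.sg x y ∪ M.K x ∪ M.K y

variable {M}

theorem Jo.symm {x y : N} {e : E} {s t : ℝ} (h : M.Jo x y e s t) : M.Jo y x e s t := ⟨h.1, h.2.symm⟩

theorem adj.symm {x y : N} (h : M.adj x y) : M.adj y x := by
  obtain ⟨e, s, t, h⟩ := h
  exact ⟨e, s, t, h.symm⟩

theorem Co.dom {e : E} {s t r : ℝ} (h : M.Co e s t) (hr : r ∈ Icc s t) : r ∈ Icc (M.lo e) (M.hi e) :=
  ⟨(M.sub e s h.1).1.trans hr.1, hr.2.trans (M.sub e t h.2.1).2⟩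

theorem Co.ends {e : E} {s t r : ℝ} (h : M.Co e s t) (hr : r ∈ Icc s t) (hT : r ∈ M.T e) : r = s ∨ r = t := by
  rcases eq_or_lt_of_le hr.1 with h1 | h1
  · exact .inl h1.symm
  · rcases eq_or_lt_of_le hr.2 with h2 | h2
    · exact .inr h2
    · exact absurd h2 (h.2.2.2 r hT h1)

theorem Jo.node {x y : N} {e : E} {s t r : ℝ} (h : M.Jo x y e s t) (hr : r ∈ Icc s t) (hT : r ∈ M.T e) :
    M.nd e r = x ∨ M.nd e r = y := by
  rcases h.1.ends hr hT with rfl | rfl <;> rcases h.2 with h' | h' <;> simp [h']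

theorem h3 (a b c : N) (hca : c ≠ a) (hcb : c ≠ b) : Disjoint (M.Γ a b) (M.K c) := by
  rw [disjoint_left]
  rintro z ((⟨e, s, t, h, r, hr, rfl⟩ | hz) | hz) hc
  · obtain ⟨hT, hn⟩ := M.st e r (h.1.dom hr) c hc
    rcases h.node hr hT with h' | h'
    · exact hca (hn.symm.trans h')
    · exact hcb (hn.symm.trans h')
  · exact disjoint_left.1 (M.hKd a c hca.symm) hz hc
  · exact disjoint_left.1 (M.hKd b c hcb.symm) hz hc

theorem h4 (a b c d : N) (hac : a ≠ c) (had : a ≠ d) (hbc : b ≠ c) (hbd : b ≠ d) :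
    Disjoint (M.Γ a b) (M.Γ c d) := by
  rw [disjoint_left]
  intro z hz hz'
  have key : ∀ x, (x = c ∨ x = d) → z ∈ M.K x → False := by
    rintro x (rfl | rfl) h
    · exact disjoint_left.1 (h3 a b x hac.symm hbc.symm) hz h
    · exact disjoint_left.1 (h3 a b x had.symm hbd.symm) hz h
  have key2 : ∀ x, (x = a ∨ x = b) → z ∈ M.K x → False := by
    rintro x (rfl | rfl) h
    · exact disjoint_left.1 (h3 c d x hac had) hz' h
    · exact disjoint_left.1 (h3 c d x hbc hbd) hz' h
  rcases hz with (⟨e, s, t, h, r, hr, rfl⟩ | hz) | hz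
  · rcases hz' with (⟨f, s', t', h', r', hr', he⟩ | hz') | hz'
    · by_cases hT : r ∈ M.T e
      · exact key2 _ (h.node hr hT) (M.mem e r hT)
      · by_cases hef : e = f
        · subst hef
          have hrr := M.inj e (h'.1.dom hr') (h.1.dom hr) he
          subst hrr
          have ne : ∀ q ∈ M.T e, q ≠ r' := fun q hq h => hT (h ▸ hq)
          have a1 : s < r' := lt_of_le_of_ne hr.1 (ne s h.1.1)
          have a2 : r' < t := lt_of_le_of_ne hr.2 (ne t h.1.2.1).symm
          have a3 : s' < r' := lt_of_le_of_ne hr'.1 (ne s' h'.1.1)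
          have a4 : r' < t' := lt_of_le_of_ne hr'.2 (ne t' h'.1.2.1).symm
          have b1 : s = s' := le_antisymm
            (not_lt.1 fun hh => h'.1.2.2.2 s h.1.1 hh (a1.trans a4))
            (not_lt.1 fun hh => h.1.2.2.2 s' h'.1.1 hh (a3.trans a2))
          subst b1
          rcases h.2 with ⟨h1, -⟩ | ⟨h1, -⟩ <;> rcases h'.2 with ⟨h2, -⟩ | ⟨h2, -⟩
          · exact hac (h1.symm.trans h2)
          · exact had (h1.symm.trans h2)
          · exact hbc (h1.symm.trans h2)
          · exact hbd (h1.symm.trans h2)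
        · exact hT (M.cr e f hef r (h.1.dom hr) r' (h'.1.dom hr') he.symm)
    · exact key c (.inl rfl) hz'
    · exact key d (.inr rfl) hz'
  · exact key2 a (.inl rfl) hz
  · exact key2 b (.inr rfl) hz

theorem seg_pc (e : E) {s t : ℝ} (h : s ≤ t) : IsPathConnected (M.γ e '' Icc s t) :=
  ((convex_Icc s t).isPathConnected ⟨s, le_rfl, h⟩).image (M.cont e)

theorem Jo.x1 {x y : N} {e : E} {s t : ℝ} (h : M.Jo x y e s t) : ∃ z ∈ M.γ e '' Icc s t, z ∈ M.K x := by
  rcases h.2 with ⟨h1, -⟩ | ⟨-, h1⟩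
  · exact ⟨_, ⟨s, ⟨le_rfl, h.1.2.2.1.le⟩, rfl⟩, h1 ▸ M.mem e s h.1.1⟩
  · exact ⟨_, ⟨t, ⟨h.1.2.2.1.le, le_rfl⟩, rfl⟩, h1 ▸ M.mem e t h.1.2.1⟩

theorem hΓ {x y : N} (h : M.adj x y) : IsPathConnected (M.Γ x y) := by
  obtain ⟨e, s, t, h⟩ := h
  obtain ⟨p, hp, hpx⟩ := h.x1
  obtain ⟨q, hq, hqy⟩ := h.symm.x1
  have hsg : ∀ {e s t}, M.Jo x y e s t → M.γ e '' Icc s t ⊆ M.Γ x y :=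
    fun {e s t} h z hz => .inl (.inl ⟨e, s, t, h, hz⟩)
  have hKx : M.K x ⊆ M.Γ x y := fun z hz => .inl (.inr hz)
  have hKy : M.K y ⊆ M.Γ x y := fun z hz => .inr hz
  refine ⟨p, hKx hpx, ?_⟩
  intro z hz
  rcases hz with (⟨e', s', t', h', hz⟩ | hz) | hz
  · obtain ⟨p', hp', hpx'⟩ := h'.x1
    exact (((M.hK x).joinedIn p hpx p' hpx').mono hKx).trans
      (((seg_pc e' h'.1.2.2.1.le).joinedIn p' hp' z hz).mono (hsg h'))
  · exact ((M.hK x).joinedIn p hpx z hz).mono hKx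
  · exact (((seg_pc e h.1.2.2.1.le).joinedIn p hp q hq).mono (hsg h)).trans
      (((M.hK y).joinedIn q hqy z hz).mono hKy)

theorem h1 {x y : N} : (M.Γ x y ∩ M.K x).Nonempty := by
  obtain ⟨z, hz⟩ := (M.hK x).nonempty
  exact ⟨z, .inl (.inr hz), hz⟩

theorem h2 {x y : N} : (M.Γ x y ∩ M.K y).Nonempty := by
  obtain ⟨z, hz⟩ := (M.hK y).nonempty
  exact ⟨z, .inr hz, hz⟩

theorem sg_compact [Finite E] (x y : N) : IsCompact (M.sg x y) := by
  classical
  have : M.sg x y = ⋃ e : E, ⋃ q ∈ (M.T e ×ˢ M.T e).filter (fun q => M.Jo x y e q.1 q.2), M.γ e '' Icc q.1 q.2 := by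
    ext z
    simp only [mem_iUnion, Finset.mem_filter, Finset.mem_product, Prod.exists, exists_prop, sg, mem_ofPred_eq]
    constructor
    · rintro ⟨e, s, t, h, hz⟩
      exact ⟨e, s, t, ⟨⟨h.1.1, h.1.2.1⟩, h⟩, hz⟩
    · rintro ⟨e, s, t, ⟨-, h⟩, hz⟩
      exact ⟨e, s, t, h, hz⟩
  rw [this]
  exact isCompact_iUnion fun e => Finset.isCompact_biUnion _ fun q _ => isCompact_Icc.image (M.cont e)

/-- predecessor time -/
theorem pred {e : E} {t : ℝ} (h : M.lo e < t) : ∃ s ∈ M.T e, s < t ∧ ∀ r ∈ M.T e, s < r → ¬ r < t := by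
  classical
  have hne : ((M.T e).filter (· < t)).Nonempty := ⟨M.lo e, Finset.mem_filter.2 ⟨M.loT e, h⟩⟩
  obtain ⟨s, hs, hm⟩ := Finset.exists_max_image _ id hne
  obtain ⟨h1, h2⟩ := Finset.mem_filter.1 hs
  exact ⟨s, h1, h2, fun r hr hsr hrt => absurd (hm r (Finset.mem_filter.2 ⟨hr, hrt⟩)) (not_le.2 hsr)⟩

theorem succ {e : E} {t : ℝ} (h : t < M.hi e) : ∃ s ∈ M.T e, t < s ∧ ∀ r ∈ M.T e, t < r → ¬ r < s := by
  classical
  have hne : ((M.T e).filter (t < ·)).Nonempty := ⟨M.hi e, Finset.mem_filter.2 ⟨M.hiT e, h⟩⟩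
  obtain ⟨s, hs, hm⟩ := Finset.exists_min_image _ id hne
  obtain ⟨h1, h2⟩ := Finset.mem_filter.1 hs
  exact ⟨s, h1, h2, fun r hr hsr hrt => absurd (hm r (Finset.mem_filter.2 ⟨hr, hsr⟩)) (not_le.2 hrt)⟩

open Classical in
variable (M) in
/-- nodes of an edge -/
noncomputable def P (e : E) : Finset N := (M.T e).image (M.nd e)

theorem mem_P {e : E} {x : N} : x ∈ M.P e ↔ ∃ t ∈ M.T e, M.nd e t = x := by
  classical
  simp [P]

theorem hP (e : E) : Cn M.adj (M.P e : Set N) := by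
  classical
  have hs : ∀ a b, M.adj a b → M.adj b a := fun a b h => h.symm
  have key : ∀ n : ℕ, ∀ t ∈ M.T e, ((M.T e).filter (· < t)).card = n →
      Relation.ReflTransGen (fun a b => M.adj a b ∧ a ∈ (M.P e : Set N) ∧ b ∈ (M.P e : Set N)) (M.nd e (M.lo e)) (M.nd e t) := by
    intro n
    induction n using Nat.strong_induction_on with
    | _ n ih =>
      intro t ht hn
      rcases eq_or_lt_of_le (M.sub e t ht).1 with h | h
      · rw [h]
      · obtain ⟨s, hsT, hst, hno⟩ := pred h
        have hlt : ((M.T e).filter (· < s)).card < n := by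
          rw [← hn]
          refine Finset.card_lt_card ⟨fun r hr => ?_, fun hsub => ?_⟩
          · obtain ⟨a1, a2⟩ := Finset.mem_filter.1 hr
            exact Finset.mem_filter.2 ⟨a1, lt_trans a2 hst⟩
          · exact lt_irrefl s (Finset.mem_filter.1 (hsub (Finset.mem_filter.2 ⟨hsT, hst⟩))).2
        refine (ih _ hlt s hsT rfl).tail ⟨⟨e, s, t, ⟨hsT, ht, hst, hno⟩, .inl ⟨rfl, rfl⟩⟩, ?_, ?_⟩
        · exact Finset.mem_coe.2 (mem_P.2 ⟨s, hsT, rfl⟩)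
        · exact Finset.mem_coe.2 (mem_P.2 ⟨t, ht, rfl⟩)
  refine ⟨⟨M.nd e (M.lo e), Finset.mem_coe.2 (mem_P.2 ⟨_, M.loT e, rfl⟩)⟩, ?_⟩
  intro x hx y hy
  obtain ⟨s, hs1, rfl⟩ := mem_P.1 (Finset.mem_coe.1 hx)
  obtain ⟨t, ht1, rfl⟩ := mem_P.1 (Finset.mem_coe.1 hy)
  exact (RT_symm hs (key _ s hs1 rfl)).trans (key _ t ht1 rfl)

theorem γm (e : E) {t : ℝ} (ht : t ∈ Icc (M.lo e) (M.hi e)) : M.γ e t ∈ RB M.adj M.K M.Γ (M.P e : Set N) := by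
  by_cases hT : t ∈ M.T e
  · exact .inl ⟨_, Finset.mem_coe.2 (mem_P.2 ⟨t, hT, rfl⟩), M.mem e t hT⟩
  · have h1 : M.lo e < t := lt_of_le_of_ne ht.1 fun h => hT (h ▸ M.loT e)
    have h2 : t < M.hi e := lt_of_le_of_ne ht.2 fun h => hT (h ▸ M.hiT e)
    obtain ⟨s, hs, hst, hs'⟩ := pred h1
    obtain ⟨r, hr, htr, hr'⟩ := succ h2
    have hJ : M.Jo (M.nd e s) (M.nd e r) e s r := by
      refine ⟨⟨hs, hr, hst.trans htr, fun q hq hsq hqr => ?_⟩, .inl ⟨rfl, rfl⟩⟩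
      rcases lt_trichotomy q t with h | h | h
      · exact hs' q hq hsq h
      · exact hT (h ▸ hq)
      · exact hr' q hq h hqr
    exact .inr ⟨_, Finset.mem_coe.2 (mem_P.2 ⟨s, hs, rfl⟩), _, Finset.mem_coe.2 (mem_P.2 ⟨r, hr, rfl⟩),
      ⟨e, s, r, hJ⟩, .inl (.inl ⟨e, s, r, hJ, t, ⟨hst.le, htr.le⟩, rfl⟩)⟩

end Net
end CL

namespace CL

/-- last visit of a small circle around the start point -/
theorem exit1 {γ : ℝ → ℂ} (hγ : Continuous γ) {η ρ : ℝ} (h1 : η < 1) (hρ : 0 < ρ)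
    (hout : ∀ t ∈ Icc η 1, ρ < dist (γ t) (γ 0)) :
    ∃ a ∈ Ioo 0 η, dist (γ a) (γ 0) = ρ ∧ ∀ t ∈ Icc (0 : ℝ) 1, a < t → ρ < dist (γ t) (γ 0) := by
  have hc : Continuous fun t => dist (γ t) (γ 0) := hγ.dist continuous_const
  have hS : IsCompact (Icc (0 : ℝ) 1 ∩ {t | dist (γ t) (γ 0) ≤ ρ}) :=
    isCompact_Icc.inter_right (isClosed_le hc continuous_const)
  obtain ⟨a, ⟨ha, had⟩, hm⟩ := hS.exists_isGreatest ⟨0, by simp, by simp [hρ.le]⟩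
  have hlast : ∀ t ∈ Icc (0 : ℝ) 1, a < t → ρ < dist (γ t) (γ 0) := by
    intro t ht hat
    by_contra h
    exact absurd (hm ⟨ht, not_lt.1 h⟩) (not_le.2 hat)
  have haη : a < η := by
    by_contra h
    exact absurd (hout a ⟨not_lt.1 h, ha.2⟩) (not_lt.2 had)
  have heq : dist (γ a) (γ 0) = ρ := by
    refine le_antisymm had ?_
    by_contra h
    obtain ⟨t, ht, hte⟩ := intermediate_value_Icc haη.le hc.continuousOn
      (show ρ ∈ Icc (dist (γ a) (γ 0)) (dist (γ η) (γ 0)) from ⟨had, (hout η ⟨le_rfl, h1.le⟩).le⟩)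
    have hat : a < t := lt_of_le_of_ne ht.1 fun h' => h (by rw [h']; exact hte.ge)
    exact absurd hte (hlast t ⟨ha.1.trans ht.1, ht.2.trans h1.le⟩ hat).ne'
  refine ⟨a, ⟨lt_of_le_of_ne ha.1 ?_, haη⟩, heq, hlast⟩
  rintro rfl
  simp at heq
  exact hρ.ne heq

/-- a drawing truncated near the vertices -/
structure Tr (D : Draw) where
  ρ : ℝ
  hρ : 0 < ρ
  δ : ℝ
  hδ : ρ ≤ δ
  a : D.E → ℝ
  b : D.E → ℝ
  a0 : ∀ e, 0 < a e
  ab : ∀ e, a e < b e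
  b1 : ∀ e, b e < 1
  sa : ∀ e, dist (D.γ e (a e)) (D.γ e 0) = ρ
  sb : ∀ e, dist (D.γ e (b e)) (D.γ e 1) = ρ
  out : ∀ e, ∀ t ∈ Icc (a e) (b e), ∀ u ∈ D.V, dist (D.γ e t) u ≤ ρ → (t = a e ∧ u = D.γ e 0) ∨ (t = b e ∧ u = D.γ e 1)
  sepv : ∀ u ∈ D.V, ∀ v ∈ D.V, u ≠ v → 2 * δ < dist u v
  da : ∀ e, ∀ t ∈ Icc 0 (a e), dist (D.γ e t) (D.γ e 0) ≤ δ
  db : ∀ e, ∀ t ∈ Icc (b e) 1, dist (D.γ e t) (D.γ e 1) ≤ δ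
  crm : ∀ e f, e ≠ f → ∀ t ∈ Ioo (0 : ℝ) 1, D.γ e t ∈ D.γ f '' Ioo 0 1 → t ∈ Ioo (a e) (b e)

/-- crossing points -/
def Draw.cp (D : Draw) : Set ℂ := {z | ∃ e f, e ≠ f ∧ z ∈ D.γ e '' Ioo 0 1 ∧ z ∈ D.γ f '' Ioo 0 1}

theorem Draw.cp_fin (D : Draw) : D.cp.Finite := by
  have := D.fin
  have : D.cp ⊆ ⋃ e, ⋃ f, {z | e ≠ f ∧ z ∈ D.γ e '' Ioo 0 1 ∧ z ∈ D.γ f '' Ioo 0 1} := by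
    rintro z ⟨e, f, h⟩
    exact mem_iUnion.2 ⟨e, mem_iUnion.2 ⟨f, h⟩⟩
  refine (finite_iUnion fun e => finite_iUnion fun f => ?_).subset this
  by_cases h : e = f
  · simp [h]
  · exact (D.sc e f h).finite.subset fun z hz => hz.2

theorem Draw.cp_V (D : Draw) {z : ℂ} (h : z ∈ D.cp) : z ∉ D.V := by
  obtain ⟨e, f, -, ⟨t, ht, rfl⟩, -⟩ := h
  exact D.av e t ht

theorem exists_delta {S : Set ℂ} (hS : S.Finite) : ∃ δ > 0, ∀ u ∈ S, ∀ v ∈ S, u ≠ v → 2 * δ < dist u v := by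
  have hfin : ((S ×ˢ S) ∩ {q | q.1 ≠ q.2}).Finite := (hS.prod hS).subset inter_subset_left
  have : ∀ᶠ δ in nhdsWithin (0 : ℝ) (Ioi 0), ∀ q ∈ (S ×ˢ S) ∩ {q | q.1 ≠ q.2}, 2 * δ < dist q.1 q.2 := by
    rw [Filter.eventually_all_finite hfin]
    intro q hq
    have h : 0 < dist q.1 q.2 := dist_pos.2 hq.2
    filter_upwards [Ioo_mem_nhdsGT (show (0 : ℝ) < dist q.1 q.2 / 2 by linarith)] with x hx
    linarith [hx.2]
  obtain ⟨δ, h1, h2⟩ := (this.and self_mem_nhdsWithin).exists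
  exact ⟨δ, h2, fun u hu v hv hne => h1 (u, v) ⟨⟨hu, hv⟩, hne⟩⟩

theorem pos_dist {γ : ℝ → ℂ} (hγ : Continuous γ) {x y : ℝ} {u : ℂ} (h : u ∉ γ '' Icc x y) :
    ∀ᶠ ρ in nhdsWithin (0 : ℝ) (Ioi 0), ∀ t ∈ Icc x y, ρ < dist (γ t) u := by
  have hcl : IsClosed (γ '' Icc x y) := (isCompact_Icc.image hγ).isClosed
  obtain ⟨ε, hε, hb⟩ := Metric.isOpen_iff.1 hcl.isOpen_compl u h
  filter_upwards [Ioo_mem_nhdsGT hε] with ρ hρ t ht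
  by_contra hle
  exact hb (Metric.mem_ball.2 ((not_lt.1 hle).trans_lt hρ.2)) ⟨t, ht, rfl⟩

theorem exists_tr (D : Draw) : Nonempty (Tr D) := by
  classical
  have := D.fin
  obtain ⟨δ, hδ, hsep⟩ := exists_delta (D.cp_fin.union D.V.finite_toSet)
  have hη : ∀ e, ∃ η, 0 < η ∧ η < 1 / 2 ∧ (∀ t ∈ Icc 0 η, dist (D.γ e t) (D.γ e 0) < δ) ∧
      ∀ t ∈ Icc (1 - η) 1, dist (D.γ e t) (D.γ e 1) < δ := by
    intro e
    obtain ⟨η1, h1, h1'⟩ := Metric.continuous_iff.1 (D.arc e).cont 0 δ hδ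
    obtain ⟨η2, h2, h2'⟩ := Metric.continuous_iff.1 (D.arc e).cont 1 δ hδ
    refine ⟨min (1 / 3) (min (η1 / 2) (η2 / 2)), by positivity, lt_of_le_of_lt (min_le_left _ _) (by norm_num), ?_, ?_⟩
    · intro t ht
      refine h1' t ?_
      have := ht.2.trans ((min_le_right _ _).trans (min_le_left _ _))
      rw [Real.dist_eq, abs_of_nonneg (by linarith [ht.1])]; linarith
    · intro t ht
      refine h2' t ?_
      have : min (1 / 3) (min (η1 / 2) (η2 / 2)) ≤ η2 / 2 := (min_le_right _ _).trans (min_le_right _ _)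
      rw [Real.dist_eq, abs_of_nonpos (by linarith [ht.2])]; linarith [ht.1]
  choose η hη0 hη1 hηa hηb using hη
  have hall : ∀ᶠ ρ in nhdsWithin (0 : ℝ) (Ioi 0), ∀ e, (∀ t ∈ Icc (η e) 1, ρ < dist (D.γ e t) (D.γ e 0)) ∧
      (∀ t ∈ Icc 0 (1 - η e), ρ < dist (D.γ e t) (D.γ e 1)) ∧
      ∀ u ∈ D.V, u ≠ D.γ e 0 → u ≠ D.γ e 1 → ∀ t ∈ Icc (0 : ℝ) 1, ρ < dist (D.γ e t) u := by
    rw [Filter.eventually_all]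
    intro e
    refine Filter.Eventually.and ?_ (Filter.Eventually.and ?_ ?_)
    · refine pos_dist (D.arc e).cont ?_
      rintro ⟨t, ht, h⟩
      have := (D.arc e).inj ⟨(hη0 e).le.trans ht.1, ht.2⟩ ⟨le_rfl, zero_le_one⟩ h
      linarith [ht.1, hη0 e]
    · refine pos_dist (D.arc e).cont ?_
      rintro ⟨t, ht, h⟩
      have := (D.arc e).inj ⟨ht.1, ht.2.trans (by linarith [hη0 e])⟩ ⟨zero_le_one, le_rfl⟩ h
      linarith [ht.2, hη0 e]
    · rw [Filter.eventually_all_finset]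
      intro u hu
      by_cases h0 : u = D.γ e 0
      · exact Filter.Eventually.of_forall fun _ h => absurd h0 h
      · by_cases h1 : u = D.γ e 1
        · exact Filter.Eventually.of_forall fun _ _ h => absurd h1 h
        · filter_upwards [pos_dist (D.arc e).cont (D.vert_off hu h0 h1)] with x hx _ _
          exact hx
  obtain ⟨ρ, ⟨h, hρδ⟩, hρ⟩ := ((hall.and (Ioo_mem_nhdsGT hδ)).and self_mem_nhdsWithin).exists
  have hρ : 0 < ρ := hρ
  have hA : ∀ e, _ := fun e => exit1 (D.arc e).cont (by linarith [hη1 e]) hρ (h e).1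
  have hB : ∀ e, _ := fun e => exit1 (γ := fun t => D.γ e (1 - t)) ((D.arc e).cont.comp (by fun_prop)) (η := η e)
    (by linarith [hη1 e]) hρ (fun t ht => by
      simp only [sub_zero]
      exact (h e).2.1 _ ⟨by linarith [ht.2], by linarith [ht.1]⟩)
  choose a ha1 ha2 ha3 using hA
  choose b hb1 hb2 hb3 using hB
  simp only [sub_zero] at hb2 hb3
  have hcd : ∀ z ∈ D.cp, ∀ u ∈ D.V, 2 * δ < dist z u := fun z hz u hu =>
    hsep z (.inl hz) u (.inr hu) fun h => D.cp_V hz (h ▸ hu)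
  refine ⟨{ ρ := ρ, hρ := hρ, δ := δ, hδ := hρδ.2.le, a := a, b := fun e => 1 - b e, a0 := fun e => (ha1 e).1, ab := ?_, b1 := ?_, sa := ha2, sb := hb2, out := ?_, sepv := ?_, da := ?_, db := ?_, crm := ?_}⟩
  · intro e; linarith [(ha1 e).2, (hb1 e).2, hη1 e]
  · intro e; linarith [(hb1 e).1]
  · intro e t ht u hu hd
    have ht0 : t ∈ Icc (0 : ℝ) 1 := ⟨(ha1 e).1.le.trans ht.1, by linarith [ht.2, (hb1 e).1]⟩
    by_cases h0 : u = D.γ e 0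
    · refine .inl ⟨?_, h0⟩
      by_contra hne
      have := ha3 e t ht0 (lt_of_le_of_ne ht.1 (Ne.symm hne))
      rw [h0] at hd; linarith
    · by_cases h1 : u = D.γ e 1
      · refine .inr ⟨?_, h1⟩
        by_contra hne
        have := hb3 e (1 - t) ⟨by linarith [ht0.2], by linarith [ht0.1]⟩
          (by have := lt_of_le_of_ne ht.2 hne; linarith)
        rw [sub_sub_cancel] at this
        rw [h1] at hd; linarith
      · have := (h e).2.2 u hu h0 h1 t ht0
        linarith
  · exact fun u hu v hv => hsep u (.inr hu) v (.inr hv)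
  · exact fun e t ht => (hηa e t ⟨ht.1, ht.2.trans (ha1 e).2.le⟩).le
  · exact fun e t ht => (hηb e t ⟨by linarith [ht.1, (hb1 e).2], ht.2⟩).le
  · intro e f hef t ht hz
    have hcp : D.γ e t ∈ D.cp := ⟨e, f, hef, ⟨t, ht, rfl⟩, hz⟩
    constructor
    · by_contra hle
      have h1 := hηa e t ⟨ht.1.le, (not_lt.1 hle).trans (ha1 e).2.le⟩
      have h2 := hcd _ hcp _ (D.s0 e)
      linarith
    · by_contra hle
      have h1 := hηb e t ⟨by linarith [not_lt.1 hle, (hb1 e).2], ht.2.le⟩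
      have h2 := hcd _ hcp _ (D.s1 e)
      linarith

end CL

namespace CL

/-- circular sector without its centre -/
noncomputable def wd (u : ℂ) (ρ α β : ℝ) : Set ℂ :=
  (fun q : ℝ × ℝ => u + (q.1 * ρ : ℝ) * Complex.exp (q.2 * Complex.I)) '' (Ioc 0 1 ×ˢ Icc α β)

theorem wd_cont (u : ℂ) (ρ : ℝ) : Continuous fun q : ℝ × ℝ => u + (q.1 * ρ : ℝ) * Complex.exp (q.2 * Complex.I) := by
  fun_prop

theorem wd_pc (u : ℂ) (ρ : ℝ) {α β : ℝ} (h : α ≤ β) : IsPathConnected (wd u ρ α β) := by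
  refine IsPathConnected.image ?_ (wd_cont u ρ)
  exact ((convex_Ioc 0 1).prod (convex_Icc α β)).isPathConnected ⟨(1, α), ⟨by norm_num, by norm_num⟩, le_rfl, h⟩

theorem wd_compact (u : ℂ) (ρ : ℝ) {α β : ℝ} (h : α ≤ β) : IsCompact (insert u (wd u ρ α β)) := by
  have : insert u (wd u ρ α β) = (fun q : ℝ × ℝ => u + (q.1 * ρ : ℝ) * Complex.exp (q.2 * Complex.I)) '' (Icc 0 1 ×ˢ Icc α β) := by
    ext z; constructor
    · rintro (rfl | ⟨q, hq, rfl⟩)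
      · exact ⟨(0, α), ⟨⟨le_rfl, zero_le_one⟩, le_rfl, h⟩, by simp⟩
      · exact ⟨q, ⟨⟨hq.1.1.le, hq.1.2⟩, hq.2⟩, rfl⟩
    · rintro ⟨q, hq, rfl⟩
      rcases eq_or_lt_of_le hq.1.1 with h0 | h0
      · left; simp [← h0]
      · exact .inr ⟨q, ⟨⟨h0, hq.1.2⟩, hq.2⟩, rfl⟩
  rw [this]
  exact (isCompact_Icc.prod isCompact_Icc).image (wd_cont u ρ)

theorem wd_closure (u : ℂ) (ρ : ℝ) {α β : ℝ} (h : α ≤ β) : u ∈ closure (wd u ρ α β) := by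
  have h1 : ((0 : ℝ), α) ∈ closure (Ioc (0 : ℝ) 1 ×ˢ Icc α β) := by
    rw [closure_prod_eq, closure_Ioc zero_ne_one, closure_Icc]
    exact ⟨⟨le_rfl, zero_le_one⟩, le_rfl, h⟩
  have := image_closure_subset_closure_image (wd_cont u ρ) ⟨_, h1, rfl⟩
  simpa [wd] using this

theorem wd_spec {u z : ℂ} {ρ α β : ℝ} (hρ : 0 < ρ) (hα : -Real.pi < α) (hβ : β ≤ Real.pi) :
    z ∈ wd u ρ α β ↔ z ≠ u ∧ dist z u ≤ ρ ∧ α ≤ Complex.arg (z - u) ∧ Complex.arg (z - u) ≤ β := by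
  constructor
  · rintro ⟨⟨r, θ⟩, ⟨⟨h1, h2⟩, h3, h4⟩, rfl⟩
    simp only at h1 h2 h3 h4 ⊢
    have hp : 0 < r * ρ := mul_pos h1 hρ
    have harg : Complex.arg ((r * ρ : ℝ) * Complex.exp (θ * Complex.I)) = θ :=
      by rw [Complex.exp_mul_I]; exact Complex.arg_mul_cos_add_sin_mul_I hp ⟨by linarith, by linarith⟩
    have hn : ‖((r * ρ : ℝ) : ℂ) * Complex.exp (θ * Complex.I)‖ = r * ρ := by
      rw [norm_mul, Complex.norm_exp_ofReal_mul_I, mul_one, Complex.norm_real, Real.norm_of_nonneg hp.le]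
    refine ⟨?_, ?_, ?_⟩
    · intro h
      have : ((r * ρ : ℝ) : ℂ) * Complex.exp (θ * Complex.I) = 0 := by simpa using h
      rw [this, norm_zero] at hn
      linarith
    · rw [dist_eq_norm, add_sub_cancel_left, hn]; nlinarith
    · rw [add_sub_cancel_left, harg]; exact ⟨h3, h4⟩
  · rintro ⟨h1, h2, h3, h4⟩
    have hz : z - u ≠ 0 := sub_ne_zero.2 h1
    refine ⟨(‖z - u‖ / ρ, Complex.arg (z - u)), ⟨⟨by simp; positivity, ?_⟩, h3, h4⟩, ?_⟩
    · simp only; rw [div_le_one hρ, ← dist_eq_norm]; exact h2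
    · simp only
      rw [div_mul_cancel₀ _ hρ.ne', Complex.norm_mul_exp_arg_mul_I]; ring

/-- rank group of an element of a finite set of reals -/
noncomputable def grp (Θ : Finset ℝ) (d : ℕ) (θ : ℝ) : ℕ := (Θ.filter (· < θ)).card / d

theorem grp_mono (Θ : Finset ℝ) (d : ℕ) : Monotone (grp Θ d) := fun x y h =>
  Nat.div_le_div_right (Finset.card_le_card fun r hr => by
    obtain ⟨a1, a2⟩ := Finset.mem_filter.1 hr
    exact Finset.mem_filter.2 ⟨a1, a2.trans_le h⟩)

theorem rank_lt {Θ : Finset ℝ} {x y : ℝ} (hx : x ∈ Θ) (h : x < y) :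
    (Θ.filter (· < x)).card < (Θ.filter (· < y)).card := by
  refine Finset.card_lt_card ⟨fun r hr => ?_, fun hsub => ?_⟩
  · obtain ⟨a1, a2⟩ := Finset.mem_filter.1 hr
    exact Finset.mem_filter.2 ⟨a1, a2.trans h⟩
  · exact lt_irrefl x (Finset.mem_filter.1 (hsub (Finset.mem_filter.2 ⟨hx, h⟩))).2

theorem grp_fiber (Θ : Finset ℝ) {d : ℕ} (hd : 1 ≤ d) (j : ℕ) : (Θ.filter fun θ => grp Θ d θ = j).card ≤ d := by
  have : (Θ.filter fun θ => grp Θ d θ = j).card ≤ (Finset.Ico (j * d) (j * d + d)).card := by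
    refine Finset.card_le_card_of_injOn (fun θ => (Θ.filter (· < θ)).card) ?_ ?_
    · intro θ hθ
      have h := (Finset.mem_filter.1 (Finset.mem_coe.1 hθ)).2
      unfold grp at h
      rw [Finset.mem_coe, Finset.mem_Ico]
      simp only
      have h1 := Nat.div_add_mod (Θ.filter (· < θ)).card d
      have h2 := Nat.mod_lt (Θ.filter (· < θ)).card hd
      rw [h, mul_comm] at h1
      omega
    · intro x hx y hy h
      have hx := (Finset.mem_filter.1 (Finset.mem_coe.1 hx)).1
      have hy := (Finset.mem_filter.1 (Finset.mem_coe.1 hy)).1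
      simp only at h
      rcases lt_trichotomy x y with h' | h' | h'
      · exact absurd h (rank_lt hx h').ne
      · exact h'
      · exact absurd h (rank_lt hy h').ne'
  simpa using this

theorem grp_image (Θ : Finset ℝ) (d : ℕ) : (Θ.image (grp Θ d)).card ≤ (Θ.card - 1) / d + 1 := by
  have : Θ.image (grp Θ d) ⊆ Finset.range ((Θ.card - 1) / d + 1) := by
    intro j hj
    obtain ⟨θ, hθ, rfl⟩ := Finset.mem_image.1 hj
    rw [Finset.mem_range, Nat.lt_succ_iff]
    refine Nat.div_le_div_right ?_
    have : (Θ.filter (· < θ)).card < Θ.card := Finset.card_lt_card ⟨Finset.filter_subset _ _, fun h =>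
      lt_irrefl θ (Finset.mem_filter.1 (h hθ)).2⟩
    omega
  simpa using Finset.card_le_card this

/-- extreme angles of a group -/
noncomputable def glo (Θ : Finset ℝ) (d j : ℕ) : ℝ := sInf {θ | θ ∈ Θ ∧ grp Θ d θ = j}
/-- extreme angles of a group -/
noncomputable def ghi (Θ : Finset ℝ) (d j : ℕ) : ℝ := sSup {θ | θ ∈ Θ ∧ grp Θ d θ = j}

theorem gfin (Θ : Finset ℝ) (d j : ℕ) : {θ | θ ∈ Θ ∧ grp Θ d θ = j}.Finite := Θ.finite_toSet.subset fun _ h => h.1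

theorem glo_mem {Θ : Finset ℝ} {d j : ℕ} (h : j ∈ Θ.image (grp Θ d)) : glo Θ d j ∈ Θ ∧ grp Θ d (glo Θ d j) = j := by
  obtain ⟨θ, hθ, h⟩ := Finset.mem_image.1 h
  exact Set.Nonempty.csInf_mem (s := {θ | θ ∈ Θ ∧ grp Θ d θ = j}) ⟨θ, hθ, h⟩ (gfin Θ d j)

theorem ghi_mem {Θ : Finset ℝ} {d j : ℕ} (h : j ∈ Θ.image (grp Θ d)) : ghi Θ d j ∈ Θ ∧ grp Θ d (ghi Θ d j) = j := by
  obtain ⟨θ, hθ, h⟩ := Finset.mem_image.1 h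
  exact Set.Nonempty.csSup_mem (s := {θ | θ ∈ Θ ∧ grp Θ d θ = j}) ⟨θ, hθ, h⟩ (gfin Θ d j)

theorem glo_le {Θ : Finset ℝ} {d : ℕ} {θ : ℝ} (h : θ ∈ Θ) : glo Θ d (grp Θ d θ) ≤ θ :=
  csInf_le (gfin Θ d _).bddBelow ⟨h, rfl⟩

theorem le_ghi {Θ : Finset ℝ} {d : ℕ} {θ : ℝ} (h : θ ∈ Θ) : θ ≤ ghi Θ d (grp Θ d θ) :=
  le_csSup (gfin Θ d _).bddAbove ⟨h, rfl⟩

theorem glo_ghi {Θ : Finset ℝ} {d j : ℕ} (h : j ∈ Θ.image (grp Θ d)) : glo Θ d j ≤ ghi Θ d j := by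
  obtain ⟨θ, hθ, rfl⟩ := Finset.mem_image.1 h
  exact (glo_le hθ).trans (le_ghi hθ)

/-- every angle between the extremes belongs to the group -/
theorem grp_eq {Θ : Finset ℝ} {d j : ℕ} (h : j ∈ Θ.image (grp Θ d)) {θ : ℝ} (h1 : glo Θ d j ≤ θ) (h2 : θ ≤ ghi Θ d j) :
    grp Θ d θ = j := by
  have a := grp_mono Θ d h1
  have b := grp_mono Θ d h2
  rw [(glo_mem h).2] at a
  rw [(ghi_mem h).2] at b
  omega

end CL

namespace CL

theorem ball_log {c w : ℂ} {r : ℝ} (hr : 0 ≤ r) (h : r < dist w c) :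
    ∃ L, IsLog (fun z => z - w) (Metric.closedBall c r) L := by
  refine exists_isLog (isCompact_closedBall c r) (Metric.mem_closedBall_self hr)
    ((convex_closedBall c r).starConvex (Metric.mem_closedBall_self hr)) (by fun_prop) ?_
  intro z hz h0
  rw [sub_eq_zero] at h0
  subst h0
  exact absurd (Metric.mem_closedBall.1 hz) (not_le.2 h)

theorem A_reroute {γ γ' : ℝ → ℂ} (hγ : Continuous γ) (hγ' : Continuous γ') {a b r : ℝ} {c d w : ℂ} (hr : 0 ≤ r)
    (h0a : 0 ≤ a) (hab : a ≤ b) (hb1 : b ≤ 1) (hc : r < dist w c) (hd : r < dist w d)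
    (h1 : ∀ t ∈ Icc 0 a, γ t ∈ Metric.closedBall c r) (h1' : ∀ t ∈ Icc 0 a, γ' t ∈ Metric.closedBall c r)
    (h2 : ∀ t ∈ Icc a b, γ' t = γ t)
    (h3 : ∀ t ∈ Icc b 1, γ t ∈ Metric.closedBall d r) (h3' : ∀ t ∈ Icc b 1, γ' t ∈ Metric.closedBall d r)
    (e0 : γ' 0 = γ 0) (e1 : γ' 1 = γ 1) (hw : w ∉ γ '' Icc a b) : CL.A γ' 0 1 w = CL.A γ 0 1 w := by
  obtain ⟨L, hL⟩ := ball_log hr hc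
  obtain ⟨M, hM⟩ := ball_log hr hd
  have nm : ∀ φ : ℝ → ℂ, (∀ t ∈ Icc 0 a, φ t ∈ Metric.closedBall c r) → (∀ t ∈ Icc a b, φ t = γ t) →
      (∀ t ∈ Icc b 1, φ t ∈ Metric.closedBall d r) → w ∉ φ '' Icc 0 1 := by
    rintro φ g1 g2 g3 ⟨t, ht, rfl⟩
    rcases le_total t a with h | h
    · exact absurd (Metric.mem_closedBall.1 (g1 t ⟨ht.1, h⟩)) (not_le.2 hc)
    · rcases le_total t b with h' | h'
      · exact hw ⟨t, ⟨h, h'⟩, (g2 t ⟨h, h'⟩).symm⟩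
      · exact absurd (Metric.mem_closedBall.1 (g3 t ⟨h', ht.2⟩)) (not_le.2 hd)
  have n1 := nm γ h1 (fun _ _ => rfl) h3
  have n2 := nm γ' h1' h2 h3'
  have sp : ∀ φ : ℝ → ℂ, Continuous φ → w ∉ φ '' Icc 0 1 → CL.A φ 0 a w + (CL.A φ a b w + CL.A φ b 1 w) = CL.A φ 0 1 w := by
    intro φ hφ hn
    rw [A_add hφ.continuousOn hab hb1 fun h => hn (image_mono (Icc_subset_Icc h0a le_rfl) h),
      A_add hφ.continuousOn h0a (hab.trans hb1) hn]
  rw [← sp γ hγ n1, ← sp γ' hγ' n2, A_eq_of_log hγ.continuousOn h0a hL h1, A_eq_of_log hγ'.continuousOn h0a hL h1',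
    A_eq_of_log hγ.continuousOn hb1 hM h3, A_eq_of_log hγ'.continuousOn hb1 hM h3',
    A_congr h2 hab hγ'.continuousOn (fun h => n2 (image_mono (Icc_subset_Icc h0a hb1) h)),
    e0, e1, h2 a ⟨le_rfl, hab⟩, h2 b ⟨hab, le_rfl⟩]

namespace Tr
variable {D : Draw} (τ : Tr D)

/-- curve rerouted along radii near its end points -/
noncomputable def gp (e : D.E) (t : ℝ) : ℂ :=
  if t ≤ τ.a e then D.γ e 0 + (t / τ.a e : ℝ) * (D.γ e (τ.a e) - D.γ e 0)
  else if t ≤ τ.b e then D.γ e t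
  else D.γ e 1 + ((1 - t) / (1 - τ.b e) : ℝ) * (D.γ e (τ.b e) - D.γ e 1)

theorem gp_cont (e : D.E) : Continuous (τ.gp e) := by
  have ha := (τ.a0 e).ne'
  have hb : 1 - τ.b e ≠ 0 := by linarith [τ.b1 e]
  have hc := (D.arc e).cont
  unfold gp
  refine Continuous.if_le ?_ (Continuous.if_le hc ?_ continuous_id continuous_const ?_) continuous_id continuous_const ?_
  · fun_prop
  · fun_prop
  · rintro t rfl
    rw [div_self hb]; simp
  · rintro t rfl
    rw [if_pos (τ.ab e).le, div_self ha]; simp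

theorem gp_lo (e : D.E) {t : ℝ} (h : t ≤ τ.a e) :
    τ.gp e t = D.γ e 0 + (t / τ.a e : ℝ) * (D.γ e (τ.a e) - D.γ e 0) := if_pos h

theorem gp_mid (e : D.E) {t : ℝ} (h : t ∈ Icc (τ.a e) (τ.b e)) : τ.gp e t = D.γ e t := by
  rcases eq_or_lt_of_le h.1 with h' | h'
  · subst h'; rw [gp_lo τ e le_rfl, div_self (τ.a0 e).ne']; simp
  · rw [gp, if_neg (not_le.2 h'), if_pos h.2]

theorem gp_hi (e : D.E) {t : ℝ} (h : τ.b e ≤ t) :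
    τ.gp e t = D.γ e 1 + ((1 - t) / (1 - τ.b e) : ℝ) * (D.γ e (τ.b e) - D.γ e 1) := by
  rcases eq_or_lt_of_le h with h' | h'
  · subst h'
    rw [gp_mid τ e ⟨(τ.ab e).le, le_rfl⟩, div_self (by linarith [τ.b1 e])]; simp
  · rw [gp, if_neg (not_le.2 ((τ.ab e).trans h')), if_neg (not_le.2 h')]

theorem gp0 (e : D.E) : τ.gp e 0 = D.γ e 0 := by rw [gp_lo τ e (τ.a0 e).le]; simp

theorem gp1 (e : D.E) : τ.gp e 1 = D.γ e 1 := by rw [gp_hi τ e (τ.b1 e).le]; simp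

theorem ball_of {c z : ℂ} {ρ s : ℝ} (h : dist z c = ρ) (hs0 : 0 ≤ s) (hs1 : s ≤ 1) : dist (c + (s : ℂ) * (z - c)) c ≤ ρ := by
  rw [dist_eq_norm] at h ⊢
  rw [add_sub_cancel_left, norm_mul, h, Complex.norm_real, Real.norm_of_nonneg hs0]
  have : 0 ≤ ρ := h ▸ norm_nonneg _
  nlinarith

theorem gpA (e : D.E) {w : ℂ} (hw : w ∈ D.V) (h0 : w ≠ D.γ e 0) (h1 : w ≠ D.γ e 1) :
    CL.A (τ.gp e) 0 1 w = CL.A (D.γ e) 0 1 w := by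
  have hδ : 0 ≤ τ.δ := τ.hρ.le.trans τ.hδ
  refine A_reroute (D.arc e).cont (τ.gp_cont e) (a := τ.a e) (b := τ.b e) (r := τ.δ) (c := D.γ e 0) (d := D.γ e 1) hδ
    (τ.a0 e).le (τ.ab e).le (τ.b1 e).le ?_ ?_ (τ.da e) ?_ (fun t => τ.gp_mid e) (τ.db e) ?_ (τ.gp0 e) (τ.gp1 e) ?_
  · linarith [τ.sepv w hw _ (D.s0 e) h0]
  · linarith [τ.sepv w hw _ (D.s1 e) h1]
  · intro t ht
    rw [gp_lo τ e ht.2]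
    exact (ball_of (τ.sa e) (div_nonneg ht.1 (τ.a0 e).le) ((div_le_one (τ.a0 e)).2 ht.2)).trans τ.hδ
  · intro t ht
    rw [gp_hi τ e ht.1]
    have hb := τ.b1 e
    exact (ball_of (τ.sb e) (div_nonneg (by linarith [ht.2]) (by linarith)) ((div_le_one (by linarith)).2 (by linarith [ht.1]))).trans τ.hδ
  · exact fun h => D.vert_off hw h0 h1 (image_mono (Icc_subset_Icc (τ.a0 e).le (τ.b1 e).le) h)

end Tr
end CL

namespace CL
namespace Tr
variable {D : Draw} (τ : Tr D) (g : ℕ)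

/-- exit angle at the start -/
noncomputable def an0 (e : D.E) : ℝ := Complex.arg (D.γ e (τ.a e) - D.γ e 0)
/-- exit angle at the end -/
noncomputable def an1 (e : D.E) : ℝ := Complex.arg (D.γ e (τ.b e) - D.γ e 1)

open Classical in
/-- all exit angles at a vertex (and the angle zero) -/
noncomputable def Th (u : ℂ) : Finset ℝ := by
  haveI := D.fin
  exact insert 0 ((Finset.univ.filter fun e => D.γ e 0 = u).image τ.an0 ∪ (Finset.univ.filter fun e => D.γ e 1 = u).image τ.an1)

theorem mem_Th {u : ℂ} {θ : ℝ} : θ ∈ τ.Th u ↔ θ = 0 ∨ (∃ e, D.γ e 0 = u ∧ τ.an0 e = θ) ∨ ∃ e, D.γ e 1 = u ∧ τ.an1 e = θ := by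
  classical
  simp [Th]

theorem Th_pi {u : ℂ} {θ : ℝ} (h : θ ∈ τ.Th u) : -Real.pi < θ ∧ θ ≤ Real.pi := by
  rcases τ.mem_Th.1 h with rfl | ⟨e, -, rfl⟩ | ⟨e, -, rfl⟩
  · constructor <;> linarith [Real.pi_pos]
  · exact ⟨Complex.neg_pi_lt_arg _, Complex.arg_le_pi _⟩
  · exact ⟨Complex.neg_pi_lt_arg _, Complex.arg_le_pi _⟩

/-- groups at a vertex -/
noncomputable def gs (u : ℂ) : Finset ℕ := (τ.Th u).image (grp (τ.Th u) g)

open Classical in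
/-- all nodes -/
noncomputable def NS : Finset (ℂ × ℕ) :=
  (D.V.biUnion fun u => (τ.gs g u).image fun j => (u, j)) ∪ D.cp_fin.toFinset.image fun z => (z, 0)

theorem mem_NS {x : ℂ × ℕ} : x ∈ τ.NS g ↔ (x.1 ∈ D.V ∧ x.2 ∈ τ.gs g x.1) ∨ (x.1 ∈ D.cp ∧ x.2 = 0) := by
  classical
  obtain ⟨u, j⟩ := x
  simp only [NS, Finset.mem_union, Finset.mem_biUnion, Finset.mem_image, Prod.mk.injEq, Set.Finite.mem_toFinset]
  constructor
  · rintro (⟨v, hv, i, hi, rfl, rfl⟩ | ⟨z, hz, rfl, rfl⟩)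
    · exact .inl ⟨hv, hi⟩
    · exact .inr ⟨hz, rfl⟩
  · rintro (⟨h1, h2⟩ | ⟨h1, rfl⟩)
    · exact .inl ⟨u, h1, j, h2, rfl, rfl⟩
    · exact .inr ⟨u, h1, rfl, rfl⟩

/-- node type -/
abbrev NN : Type := {x : ℂ × ℕ // x ∈ τ.NS g}

/-- sector of a group -/
noncomputable def se (u : ℂ) (j : ℕ) : Set ℂ := wd u τ.ρ (glo (τ.Th u) g j) (ghi (τ.Th u) g j)

open Classical in
/-- region of a node -/
noncomputable def KK (x : τ.NN g) : Set ℂ := if x.1.1 ∈ D.V then τ.se g x.1.1 x.1.2 else {x.1.1}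

variable {τ g}
theorem NN.gs {x : τ.NN g} (h : x.1.1 ∈ D.V) : x.1.2 ∈ τ.gs g x.1.1 := by
  rcases (τ.mem_NS g).1 x.2 with h' | h'
  · exact h'.2
  · exact absurd h (D.cp_V h'.1)

theorem NN.cp {x : τ.NN g} (h : x.1.1 ∉ D.V) : x.1.1 ∈ D.cp ∧ x.1.2 = 0 := by
  rcases (τ.mem_NS g).1 x.2 with h' | h'
  · exact absurd h'.1 h
  · exact h'

theorem KK_V {x : τ.NN g} (h : x.1.1 ∈ D.V) : τ.KK g x = τ.se g x.1.1 x.1.2 := if_pos h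
theorem KK_cp {x : τ.NN g} (h : x.1.1 ∉ D.V) : τ.KK g x = {x.1.1} := if_neg h

theorem mem_se {u z : ℂ} {j : ℕ} (hj : j ∈ τ.gs g u) : z ∈ τ.se g u j ↔
    z ≠ u ∧ dist z u ≤ τ.ρ ∧ glo (τ.Th u) g j ≤ Complex.arg (z - u) ∧ Complex.arg (z - u) ≤ ghi (τ.Th u) g j :=
  wd_spec τ.hρ (τ.Th_pi (glo_mem hj).1).1 (τ.Th_pi (ghi_mem hj).1).2

theorem se_grp {u z : ℂ} {j : ℕ} (hj : j ∈ τ.gs g u) (h : z ∈ τ.se g u j) : grp (τ.Th u) g (Complex.arg (z - u)) = j :=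
  grp_eq hj ((mem_se hj).1 h).2.2.1 ((mem_se hj).1 h).2.2.2

theorem se_of {u z : ℂ} (hz : z ≠ u) (hd : dist z u ≤ τ.ρ) (ha : Complex.arg (z - u) ∈ τ.Th u) :
    z ∈ τ.se g u (grp (τ.Th u) g (Complex.arg (z - u))) :=
  (mem_se (Finset.mem_image_of_mem _ ha)).2 ⟨hz, hd, glo_le ha, le_ghi ha⟩

theorem KK_pc (x : τ.NN g) : IsPathConnected (τ.KK g x) := by
  by_cases h : x.1.1 ∈ D.V
  · rw [KK_V h]; exact wd_pc _ _ (glo_ghi (NN.gs h))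
  · rw [KK_cp h]; exact isPathConnected_singleton _

/-- crossing points are far from vertices -/
theorem cp_far {z u : ℂ} (hz : z ∈ D.cp) (hu : u ∈ D.V) (τ : Tr D) : τ.ρ < dist z u := by
  obtain ⟨e, f, hef, ⟨t, ht, rfl⟩, hf⟩ := hz
  have h := τ.crm e f hef t ht hf
  by_contra hd
  rcases τ.out e t ⟨h.1.le, h.2.le⟩ u hu (not_lt.1 hd) with h' | h'
  · exact h.1.ne' h'.1
  · exact h.2.ne h'.1

theorem KK_d (x y : τ.NN g) (hxy : x ≠ y) : Disjoint (τ.KK g x) (τ.KK g y) := by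
  rw [disjoint_left]
  intro z hx hy
  have vc : ∀ x y : τ.NN g, x.1.1 ∈ D.V → y.1.1 ∉ D.V → z ∈ τ.KK g x → z ∈ τ.KK g y → False := by
    intro x y h1 h2 hx hy
    rw [KK_V h1] at hx
    rw [KK_cp h2] at hy
    have := ((mem_se (NN.gs h1)).1 hx).2.1
    rw [mem_singleton_iff.1 hy] at this
    exact absurd this (not_le.2 (cp_far (NN.cp h2).1 h1 τ))
  by_cases h1 : x.1.1 ∈ D.V <;> by_cases h2 : y.1.1 ∈ D.V
  · rw [KK_V h1] at hx
    rw [KK_V h2] at hy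
    by_cases he : x.1.1 = y.1.1
    · have e1 := se_grp (NN.gs h1) hx
      have e2 := se_grp (NN.gs h2) hy
      rw [← he] at e2
      exact hxy (Subtype.ext (Prod.ext he (e1.symm.trans e2)))
    · have d1 := ((mem_se (NN.gs h1)).1 hx).2.1
      have d2 := ((mem_se (NN.gs h2)).1 hy).2.1
      have := τ.sepv _ h1 _ h2 he
      have := dist_triangle_left x.1.1 y.1.1 z
      linarith [τ.hδ]
  · exact vc x y h1 h2 hx hy
  · exact vc y x h2 h1 hy hx
  · rw [KK_cp h1] at hx
    rw [KK_cp h2] at hy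
    exact hxy (Subtype.ext (Prod.ext ((mem_singleton_iff.1 hx).symm.trans (mem_singleton_iff.1 hy))
      ((NN.cp h1).2.trans (NN.cp h2).2.symm)))

theorem KK_Vd (x : τ.NN g) : Disjoint (τ.KK g x) (D.V : Set ℂ) := by
  rw [disjoint_left]
  intro z hx hz
  by_cases h1 : x.1.1 ∈ D.V
  · rw [KK_V h1] at hx
    obtain ⟨a1, a2, -⟩ := (mem_se (NN.gs h1)).1 hx
    have := τ.sepv z hz _ h1 a1
    linarith [τ.hδ, τ.hρ]
  · rw [KK_cp h1] at hx
    exact h1 (mem_singleton_iff.1 hx ▸ hz)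

/-- crossing times -/
def ct (D : Draw) (e : D.E) : Set ℝ := {t | t ∈ Ioo (0 : ℝ) 1 ∧ ∃ f, e ≠ f ∧ D.γ e t ∈ D.γ f '' Ioo 0 1}

theorem ct_fin (e : D.E) : (ct D e).Finite := by
  refine Set.Finite.of_finite_image (f := D.γ e) (D.cp_fin.subset ?_) ((D.arc e).inj.mono fun t ht => Ioo_subset_Icc_self ht.1)
  rintro z ⟨t, ⟨ht, f, hef, hf⟩, rfl⟩
  exact ⟨e, f, hef, ⟨t, ht, rfl⟩, hf⟩

theorem ct_cp {e : D.E} {t : ℝ} (h : t ∈ ct D e) : D.γ e t ∈ D.cp := by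
  obtain ⟨ht, f, hef, hf⟩ := h
  exact ⟨e, f, hef, ⟨t, ht, rfl⟩, hf⟩

theorem cp_ct {e : D.E} {t : ℝ} (ht : t ∈ Ioo (0 : ℝ) 1) (h : D.γ e t ∈ D.cp) : t ∈ ct D e := by
  obtain ⟨f, f', hff, h1, h2⟩ := h
  by_cases hef : e = f
  · subst hef; exact ⟨ht, f', hff, h2⟩
  · exact ⟨ht, f, hef, h1⟩

theorem ct_mid {e : D.E} {t : ℝ} (τ : Tr D) (h : t ∈ ct D e) : t ∈ Ioo (τ.a e) (τ.b e) := by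
  obtain ⟨ht, f, hef, hf⟩ := h
  exact τ.crm e f hef t ht hf

variable (τ) in
open Classical in
/-- node times -/
noncomputable def TT (e : D.E) : Finset ℝ := insert (τ.a e) (insert (τ.b e) (ct_fin e).toFinset)

theorem mem_TT {e : D.E} {t : ℝ} : t ∈ τ.TT e ↔ t = τ.a e ∨ t = τ.b e ∨ t ∈ ct D e := by
  classical
  simp [TT]

theorem mid01 {e : D.E} {t : ℝ} (h : t ∈ Icc (τ.a e) (τ.b e)) : t ∈ Ioo (0 : ℝ) 1 :=
  ⟨(τ.a0 e).trans_le h.1, h.2.trans_lt (τ.b1 e)⟩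

theorem an0_mem (e : D.E) : τ.an0 e ∈ τ.Th (D.γ e 0) := τ.mem_Th.2 (.inr (.inl ⟨e, rfl, rfl⟩))
theorem an1_mem (e : D.E) : τ.an1 e ∈ τ.Th (D.γ e 1) := τ.mem_Th.2 (.inr (.inr ⟨e, rfl, rfl⟩))

variable (τ g) in
/-- start node -/
noncomputable def n0 (e : D.E) : τ.NN g := ⟨(D.γ e 0, grp (τ.Th (D.γ e 0)) g (τ.an0 e)),
  (τ.mem_NS g).2 (.inl ⟨D.s0 e, Finset.mem_image_of_mem _ (an0_mem e)⟩)⟩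

variable (τ g) in
/-- end node -/
noncomputable def n1 (e : D.E) : τ.NN g := ⟨(D.γ e 1, grp (τ.Th (D.γ e 1)) g (τ.an1 e)),
  (τ.mem_NS g).2 (.inl ⟨D.s1 e, Finset.mem_image_of_mem _ (an1_mem e)⟩)⟩

variable (τ g) in
open Classical in
/-- node at a time -/
noncomputable def nd (e : D.E) (t : ℝ) : τ.NN g :=
  if t = τ.b e then τ.n1 g e else if h : t ∈ ct D e then ⟨(D.γ e t, 0), (τ.mem_NS g).2 (.inr ⟨ct_cp h, rfl⟩)⟩ else τ.n0 g e

theorem nd_a (e : D.E) : τ.nd g e (τ.a e) = τ.n0 g e := by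
  unfold nd
  rw [if_neg (τ.ab e).ne, dif_neg fun h => (ct_mid τ h).1.false]

theorem nd_b (e : D.E) : τ.nd g e (τ.b e) = τ.n1 g e := if_pos rfl

theorem nd_c {e : D.E} {t : ℝ} (h : t ∈ ct D e) : τ.nd g e t = ⟨(D.γ e t, 0), (τ.mem_NS g).2 (.inr ⟨ct_cp h, rfl⟩)⟩ := by
  unfold nd
  rw [if_neg (ct_mid τ h).2.ne, dif_pos h]

theorem ne_of_dist {z u : ℂ} (h : dist z u = τ.ρ) : z ≠ u := by
  rintro rfl
  rw [dist_self] at h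
  exact τ.hρ.ne h

theorem KK_n0 (e : D.E) : τ.KK g (τ.n0 g e) = τ.se g (D.γ e 0) (grp (τ.Th (D.γ e 0)) g (τ.an0 e)) := KK_V (D.s0 e)
theorem KK_n1 (e : D.E) : τ.KK g (τ.n1 g e) = τ.se g (D.γ e 1) (grp (τ.Th (D.γ e 1)) g (τ.an1 e)) := KK_V (D.s1 e)

theorem nmem (e : D.E) (t : ℝ) (ht : t ∈ τ.TT e) : D.γ e t ∈ τ.KK g (τ.nd g e t) := by
  rcases mem_TT.1 ht with rfl | rfl | h
  · rw [nd_a, KK_n0]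
    exact se_of (ne_of_dist (τ.sa e)) (τ.sa e).le (an0_mem e)
  · rw [nd_b, KK_n1]
    exact se_of (ne_of_dist (τ.sb e)) (τ.sb e).le (an1_mem e)
  · have hv := D.cp_V (ct_cp h)
    rw [nd_c h, KK_cp hv]
    rfl

theorem nst (e : D.E) (t : ℝ) (ht : t ∈ Icc (τ.a e) (τ.b e)) (x : τ.NN g) (hx : D.γ e t ∈ τ.KK g x) :
    t ∈ τ.TT e ∧ τ.nd g e t = x := by
  by_cases h1 : x.1.1 ∈ D.V
  · rw [KK_V h1] at hx
    have hg := se_grp (NN.gs h1) hx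
    rcases τ.out e t ht _ h1 ((mem_se (NN.gs h1)).1 hx).2.1 with ⟨rfl, h⟩ | ⟨rfl, h⟩
    · refine ⟨mem_TT.2 (.inl rfl), ?_⟩
      rw [nd_a]
      rw [h] at hg
      exact Subtype.ext (Prod.ext h.symm hg)
    · refine ⟨mem_TT.2 (.inr (.inl rfl)), ?_⟩
      rw [nd_b]
      rw [h] at hg
      exact Subtype.ext (Prod.ext h.symm hg)
  · rw [KK_cp h1] at hx
    have hx := mem_singleton_iff.1 hx
    have hc : t ∈ ct D e := cp_ct (mid01 ht) (hx ▸ (NN.cp h1).1)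
    refine ⟨mem_TT.2 (.inr (.inr hc)), ?_⟩
    rw [nd_c hc]
    exact Subtype.ext (Prod.ext hx (NN.cp h1).2.symm)

variable (τ g) in
/-- the net of a truncated drawing -/
noncomputable def net : Net D.E (τ.NN g) where
  γ := D.γ
  K := τ.KK g
  T := τ.TT
  nd := τ.nd g
  lo := τ.a
  hi := τ.b
  cont e := (D.arc e).cont
  inj e := (D.arc e).inj.mono (Icc_subset_Icc (τ.a0 e).le (τ.b1 e).le)
  loT e := mem_TT.2 (.inl rfl)
  hiT e := mem_TT.2 (.inr (.inl rfl))
  sub e t ht := by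
    rcases mem_TT.1 ht with rfl | rfl | h
    · exact ⟨le_rfl, (τ.ab e).le⟩
    · exact ⟨(τ.ab e).le, le_rfl⟩
    · exact Ioo_subset_Icc_self (ct_mid τ h)
  hK := KK_pc
  hKd := KK_d
  mem := nmem
  st := nst
  cr e f hef s hs t ht h := mem_TT.2 (.inr (.inr ⟨mid01 hs, f, hef, t, mid01 ht, h.symm⟩))

end Tr
end CL

namespace CL
namespace Tr
variable {D : Draw} {τ : Tr D} {g : ℕ}

theorem mem_P0 {e : D.E} {x : τ.NN g} (hx : x.1.1 ∈ D.V) (h : x ∈ (τ.net g).P e) : x = τ.n0 g e ∨ x = τ.n1 g e := by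
  obtain ⟨t, ht, rfl⟩ := Net.mem_P.1 h
  rcases mem_TT.1 ht with rfl | rfl | hc
  · exact .inl (nd_a e)
  · exact .inr (nd_b e)
  · exfalso
    have hx : (τ.nd g e t).1.1 ∈ D.V := hx
    rw [nd_c hc] at hx
    exact D.cp_V (ct_cp hc) hx

theorem mem_P1 {e : D.E} {x : τ.NN g} (hx : x.1.1 ∉ D.V) : x ∈ (τ.net g).P e ↔ x.1.1 ∈ D.γ e '' Ioo 0 1 := by
  constructor
  · intro h
    obtain ⟨t, ht, rfl⟩ := Net.mem_P.1 h
    have hx : (τ.nd g e t).1.1 ∉ D.V := hx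
    have ht0 : t ∈ Ioo (0 : ℝ) 1 := mid01 ((τ.net g).sub e t ht)
    rcases mem_TT.1 ht with rfl | rfl | hc
    · rw [nd_a] at hx; exact absurd (D.s0 e) hx
    · rw [nd_b] at hx; exact absurd (D.s1 e) hx
    · refine ⟨t, ht0, ?_⟩
      change _ = (τ.nd g e t).1.1
      rw [nd_c hc]
  · rintro ⟨t, ht, h⟩
    have hc : t ∈ ct D e := cp_ct ht (h ▸ (NN.cp hx).1)
    refine Net.mem_P.2 ⟨t, mem_TT.2 (.inr (.inr hc)), ?_⟩
    change τ.nd g e t = x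
    rw [nd_c hc]
    exact Subtype.ext (Prod.ext h (NN.cp hx).2.symm)

open Classical in
variable (τ) in
/-- exit time of an edge at a vertex -/
noncomputable def xt (u : ℂ) (e : D.E) : ℝ := if D.γ e 0 = u then τ.a e else τ.b e

theorem xt_spec {e : D.E} {x : τ.NN g} (hx : x.1.1 ∈ D.V) (h : x ∈ (τ.net g).P e) :
    (τ.xt x.1.1 e = τ.a e ∨ τ.xt x.1.1 e = τ.b e) ∧
    dist (D.γ e (τ.xt x.1.1 e)) x.1.1 = τ.ρ ∧
    Complex.arg (D.γ e (τ.xt x.1.1 e) - x.1.1) ∈ (τ.Th x.1.1).filter fun θ => grp (τ.Th x.1.1) g θ = x.1.2 := by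
  rcases mem_P0 hx h with rfl | rfl
  · have : τ.xt (τ.n0 g e).1.1 e = τ.a e := if_pos rfl
    rw [this]
    exact ⟨.inl rfl, τ.sa e, Finset.mem_filter.2 ⟨an0_mem e, rfl⟩⟩
  · have : τ.xt (τ.n1 g e).1.1 e = τ.b e := if_neg (D.ends_ne e)
    rw [this]
    exact ⟨.inr rfl, τ.sb e, Finset.mem_filter.2 ⟨an1_mem e, rfl⟩⟩

theorem cGb (hg : 1 ≤ g) (x : τ.NN g) (hx : x.1.1 ∈ D.V) : Nat.card {e // x ∈ (τ.net g).P e} ≤ g := by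
  classical
  have := D.fin
  rw [Nat.card_eq_fintype_card, Fintype.card_subtype]
  refine le_trans ?_ (grp_fiber (τ.Th x.1.1) hg x.1.2)
  refine Finset.card_le_card_of_injOn (fun e => Complex.arg (D.γ e (τ.xt x.1.1 e) - x.1.1)) ?_ ?_
  · intro e he
    exact (xt_spec hx (Finset.mem_filter.1 (Finset.mem_coe.1 he)).2).2.2
  · intro e he f hf hef
    obtain ⟨e1, e2, -⟩ := xt_spec hx (Finset.mem_filter.1 (Finset.mem_coe.1 he)).2
    obtain ⟨f1, f2, -⟩ := xt_spec hx (Finset.mem_filter.1 (Finset.mem_coe.1 hf)).2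
    simp only at hef
    have heq : D.γ e (τ.xt x.1.1 e) = D.γ f (τ.xt x.1.1 f) := by
      have := Complex.ext_norm_arg (x := D.γ e (τ.xt x.1.1 e) - x.1.1) (y := D.γ f (τ.xt x.1.1 f) - x.1.1)
        (by rw [← dist_eq_norm, ← dist_eq_norm, e2, f2]) hef
      exact sub_left_inj.1 this
    by_contra hne
    have m : ∀ e : D.E, (τ.xt x.1.1 e = τ.a e ∨ τ.xt x.1.1 e = τ.b e) → τ.xt x.1.1 e ∈ Ioo (0 : ℝ) 1 := by
      rintro e (h | h) <;> rw [h]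
      · exact mid01 ⟨le_rfl, (τ.ab e).le⟩
      · exact mid01 ⟨(τ.ab e).le, le_rfl⟩
    have hc := τ.crm e f hne _ (m e e1) ⟨_, m f f1, heq.symm⟩
    rcases e1 with h | h <;> rw [h] at hc
    · exact hc.1.false
    · exact hc.2.false

theorem Th_card (u : ℂ) [Fintype D.E] [DecidableEq ℂ] : (τ.Th u).card - 1 ≤
    (Finset.univ.filter fun e => D.γ e 0 = u).card + (Finset.univ.filter fun e => D.γ e 1 = u).card := by
  classical
  have : (τ.Th u).card ≤ ((Finset.univ.filter fun e => D.γ e 0 = u).card + (Finset.univ.filter fun e => D.γ e 1 = u).card) + 1 := by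
    have hs : τ.Th u ⊆ insert 0 ((Finset.univ.filter fun e => D.γ e 0 = u).image τ.an0 ∪ (Finset.univ.filter fun e => D.γ e 1 = u).image τ.an1) := by
      intro θ hθ
      rcases τ.mem_Th.1 hθ with rfl | ⟨e, h, rfl⟩ | ⟨e, h, rfl⟩
      · exact Finset.mem_insert_self _ _
      · exact Finset.mem_insert_of_mem (Finset.mem_union_left _ (Finset.mem_image_of_mem _ (Finset.mem_filter.2 ⟨Finset.mem_univ _, h⟩)))
      · exact Finset.mem_insert_of_mem (Finset.mem_union_right _ (Finset.mem_image_of_mem _ (Finset.mem_filter.2 ⟨Finset.mem_univ _, h⟩)))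
    refine (Finset.card_le_card hs).trans ((Finset.card_insert_le _ _).trans (Nat.add_le_add_right ?_ 1))
    exact (Finset.card_union_le _ _).trans (Nat.add_le_add Finset.card_image_le Finset.card_image_le)
  omega

theorem nG (hg : 1 ≤ g) (hE : Nat.card D.E ≤ D.V.card * g) (T : Finset (τ.NN g)) (hT : ∀ a ∈ T, a.1.1 ∈ D.V) :
    T.card ≤ 3 * D.V.card := by
  classical
  have := D.fin
  have h1 : T.card ≤ ∑ u ∈ D.V, (τ.gs g u).card := by
    rw [← Finset.card_sigma]
    refine Finset.card_le_card_of_injOn (fun a => (⟨a.1.1, a.1.2⟩ : Sigma fun _ : ℂ => ℕ)) ?_ ?_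
    · intro a ha
      exact Finset.mem_coe.2 (Finset.mem_sigma.2 ⟨hT a ha, NN.gs (hT a ha)⟩)
    · intro a _ b _ h
      simp only [Sigma.mk.injEq, heq_eq_eq] at h
      exact Subtype.ext (Prod.ext h.1 h.2)
  have hsum : ∑ u ∈ D.V, ((τ.Th u).card - 1) ≤ 2 * Nat.card D.E := by
    refine (Finset.sum_le_sum fun u _ => Th_card u).trans ?_
    rw [Finset.sum_add_distrib, ← Finset.card_eq_sum_card_fiberwise (fun e _ => D.s0 e),
      ← Finset.card_eq_sum_card_fiberwise (fun e _ => D.s1 e), Finset.card_univ, Nat.card_eq_fintype_card]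
    omega
  have h2 : ∑ u ∈ D.V, (τ.gs g u).card ≤ ∑ u ∈ D.V, ((τ.Th u).card - 1) / g + D.V.card := by
    rw [Finset.card_eq_sum_ones D.V, ← Finset.sum_add_distrib]
    exact Finset.sum_le_sum fun u _ => grp_image _ _
  have h3 : g * ∑ u ∈ D.V, ((τ.Th u).card - 1) / g ≤ g * (2 * D.V.card) := by
    rw [Finset.mul_sum]
    refine (Finset.sum_le_sum fun u _ => Nat.mul_div_le _ _).trans (hsum.trans ?_)
    nlinarith
  have h4 := Nat.le_of_mul_le_mul_left h3 hg
  omega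

theorem cX (T : Finset (τ.NN g)) (hT : ∀ a ∈ T, a.1.1 ∉ D.V) : ∑ a ∈ T, (Nat.card {e // a ∈ (τ.net g).P e}) ^ 2 ≤
    2 * Nat.card {p : D.E × D.E // D.Cr p.1 p.2} := by
  classical
  have := D.fin
  set S : τ.NN g → Finset D.E := fun a => Finset.univ.filter fun e => a ∈ (τ.net g).P e with hS
  have hc : ∀ a, Nat.card {e // a ∈ (τ.net g).P e} = (S a).card := fun a => by
    rw [Nat.card_eq_fintype_card, Fintype.card_subtype]
  have h2 : ∀ a ∈ T, 2 ≤ (S a).card := by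
    intro a ha
    obtain ⟨e, f, hef, he, hf⟩ := (NN.cp (hT a ha)).1
    exact Finset.one_lt_card.2 ⟨e, Finset.mem_filter.2 ⟨Finset.mem_univ _, (mem_P1 (hT a ha)).2 he⟩, f,
      Finset.mem_filter.2 ⟨Finset.mem_univ _, (mem_P1 (hT a ha)).2 hf⟩, hef⟩
  have hm : ∀ a ∈ T, ∀ e ∈ S a, a.1.1 ∈ D.γ e '' Ioo 0 1 := fun a ha e he =>
    (mem_P1 (hT a ha)).1 (Finset.mem_filter.1 he).2
  have hX : ∑ a ∈ T, (S a).offDiag.card ≤ Nat.card {p : D.E × D.E // D.Cr p.1 p.2} := by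
    rw [Nat.card_eq_fintype_card, Fintype.card_subtype, ← Finset.card_biUnion]
    · refine Finset.card_le_card fun p hp => ?_
      obtain ⟨a, ha, hp⟩ := Finset.mem_biUnion.1 hp
      obtain ⟨h1, h2, h3⟩ := Finset.mem_offDiag.1 hp
      exact Finset.mem_filter.2 ⟨Finset.mem_univ _, h3, a.1.1, hm a ha _ h1, hm a ha _ h2⟩
    · intro a ha b hb hab
      rw [Function.onFun, Finset.disjoint_left]
      intro p hp hp'
      obtain ⟨h1, h2, h3⟩ := Finset.mem_offDiag.1 hp
      obtain ⟨h1', h2', -⟩ := Finset.mem_offDiag.1 hp'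
      have := D.sc _ _ h3 ⟨hm a ha _ h1, hm a ha _ h2⟩ ⟨hm b hb _ h1', hm b hb _ h2'⟩
      exact hab (Subtype.ext (Prod.ext this ((NN.cp (hT a ha)).2.trans (NN.cp (hT b hb)).2.symm)))
  refine le_trans ?_ (Nat.mul_le_mul_left 2 hX)
  rw [Finset.mul_sum]
  refine Finset.sum_le_sum fun a ha => ?_
  rw [hc, Finset.offDiag_card]
  have := h2 a ha
  have h3 : (S a).card ≤ (S a).card * (S a).card := Nat.le_mul_self _
  zify [h3]
  nlinarith

theorem ray {c z : ℂ} {s : ℝ} (hs : 0 < s) : Complex.arg (c + (s : ℂ) * (z - c) - c) = Complex.arg (z - c) := by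
  rw [add_sub_cancel_left, Complex.arg_real_mul _ hs]

theorem ray_ne {c z : ℂ} {s : ℝ} (hs : 0 < s) (h : z ≠ c) : c + (s : ℂ) * (z - c) ≠ c := by
  intro h'
  have : (s : ℂ) * (z - c) = 0 := by simpa using h'
  rcases mul_eq_zero.1 this with h1 | h1
  · exact hs.ne' (by exact_mod_cast h1)
  · exact h (sub_eq_zero.1 h1)

theorem gpm (e : D.E) (t : ℝ) (ht : t ∈ Ioo (0 : ℝ) 1) :
    τ.gp e t ∈ RB (τ.net g).adj (τ.net g).K (τ.net g).Γ ((τ.net g).P e : Set (τ.NN g)) := by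
  rcases le_total t (τ.a e) with h | h
  · refine .inl ⟨τ.n0 g e, Finset.mem_coe.2 (Net.mem_P.2 ⟨τ.a e, mem_TT.2 (.inl rfl), nd_a e⟩), ?_⟩
    change _ ∈ τ.KK g (τ.n0 g e)
    have hp : 0 < t / τ.a e := div_pos ht.1 (τ.a0 e)
    rw [KK_n0, gp_lo τ e h, an0, ← ray hp]
    exact se_of (ray_ne hp (ne_of_dist (τ.sa e))) (ball_of (τ.sa e) hp.le ((div_le_one (τ.a0 e)).2 h))
      (by rw [ray hp]; exact an0_mem e)
  · rcases le_total t (τ.b e) with h' | h'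
    · rw [gp_mid τ e ⟨h, h'⟩]
      exact Net.γm (M := τ.net g) e ⟨h, h'⟩
    · refine .inl ⟨τ.n1 g e, Finset.mem_coe.2 (Net.mem_P.2 ⟨τ.b e, mem_TT.2 (.inr (.inl rfl)), nd_b e⟩), ?_⟩
      change _ ∈ τ.KK g (τ.n1 g e)
      have hb : 0 < 1 - τ.b e := by linarith [τ.b1 e]
      have hp : 0 < (1 - t) / (1 - τ.b e) := div_pos (by linarith [ht.2]) hb
      rw [KK_n1, gp_hi τ e h', an1, ← ray hp]
      exact se_of (ray_ne hp (ne_of_dist (τ.sb e))) (ball_of (τ.sb e) hp.le ((div_le_one hb).2 (by linarith)))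
        (by rw [ray hp]; exact an1_mem e)

variable (τ) in
/-- the planarization of a truncated drawing -/
noncomputable def plan (hg : 1 ≤ g) (hE : Nat.card D.E ≤ D.V.card * g) : Plan D g where
  N := τ.NN g
  fin := Finite.of_fintype _
  adj := (τ.net g).adj
  K := (τ.net g).K
  Γ := (τ.net g).Γ
  hs _ _ h := h.symm
  hK := (τ.net g).hK
  hΓ _ _ h := Net.hΓ h
  h1 _ _ _ := Net.h1
  h2 _ _ _ := Net.h2
  hKd := (τ.net g).hKd
  h3 a b c _ := Net.h3 a b c
  h4 a b c d _ _ := Net.h4 a b c d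
  G a := a.1.1 ∈ D.V
  vt a := a.1.1
  hKV := KK_Vd
  hΓV a b _ := by
    rw [disjoint_left]
    rintro z ((⟨e, s, t, h, r, hr, rfl⟩ | hz) | hz) hc
    · exact D.av e r (mid01 (h.1.dom hr)) hc
    · exact disjoint_left.1 (KK_Vd a) hz hc
    · exact disjoint_left.1 (KK_Vd b) hz hc
  vcl a h := by
    change _ ∈ closure (τ.KK g a)
    rw [KK_V h]; exact wd_closure _ _ (glo_ghi (NN.gs h))
  vV _ h := h
  vsurj w hw := ⟨⟨(w, grp (τ.Th w) g 0), (τ.mem_NS g).2 (.inl ⟨hw, Finset.mem_image_of_mem _ (τ.mem_Th.2 (.inl rfl))⟩)⟩, hw, rfl⟩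
  cG a h := by
    change IsCompact (insert _ (τ.KK g a))
    rw [KK_V h]; exact wd_compact _ _ (glo_ghi (NN.gs h))
  cK a h := by
    change IsCompact (τ.KK g a)
    rw [KK_cp h]; exact isCompact_singleton
  cΓ a b _ := by
    have := D.fin
    exact ⟨(τ.net g).sg a b, Net.sg_compact a b, rfl⟩
  P := (τ.net g).P
  hP := Net.hP
  e0 e := ⟨τ.n0 g e, Net.mem_P.2 ⟨τ.a e, mem_TT.2 (.inl rfl), nd_a e⟩, D.s0 e, rfl⟩
  e1 e := ⟨τ.n1 g e, Net.mem_P.2 ⟨τ.b e, mem_TT.2 (.inr (.inl rfl)), nd_b e⟩, D.s1 e, rfl⟩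
  γ' := τ.gp
  γc := τ.gp_cont
  γ0 := τ.gp0
  γ1 := τ.gp1
  γm := gpm
  γA e _ hw h0 h1 := τ.gpA e hw h0 h1
  cGb := cGb hg
  nG := nG hg hE
  cX := cX

end Tr

theorem exists_plan (D : Draw) {g : ℕ} (hg : 1 ≤ g) (hE : Nat.card D.E ≤ D.V.card * g) : Nonempty (Plan D g) := by
  obtain ⟨τ⟩ := exists_tr D
  exact ⟨τ.plan hg hE⟩

end CL

namespace CL

theorem logb_bd {d : ℝ} (hd : 10 ^ 12 ≤ d) : Real.logb 2 d ≤ 42 * (d / 10 ^ 12) := by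
  have h0 : (0 : ℝ) < d / 10 ^ 12 := by positivity
  have h1 : (1 : ℝ) ≤ d / 10 ^ 12 := by rw [le_div_iff₀ (by norm_num)]; linarith
  have e1 : d = 10 ^ 12 * (d / 10 ^ 12) := by field_simp
  have e2 : Real.logb 2 d = Real.logb 2 (10 ^ 12) + Real.logb 2 (d / 10 ^ 12) := by
    conv_lhs => rw [e1]
    exact Real.logb_mul (by norm_num) h0.ne'
  have b1 : Real.logb 2 (10 ^ 12) ≤ 40 := by
    rw [Real.logb_le_iff_le_rpow (by norm_num) (by norm_num)]
    norm_num
  have b2 : Real.logb 2 (d / 10 ^ 12) ≤ 2 * (d / 10 ^ 12) := by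
    unfold Real.logb
    rw [div_le_iff₀ (Real.log_pos (by norm_num))]
    have := Real.log_le_sub_one_of_pos h0
    have := Real.log_two_gt_d9
    nlinarith
  rw [e2]; exact (add_le_add b1 b2).trans (by linarith)

theorem num_main {d L x s m : ℝ} (hd : 10 ^ 12 ≤ d) (hL2 : 2 ≤ L) (hL : L ≤ 42 * (d / 10 ^ 12))
    {Dg : ℝ} (hDg0 : 0 ≤ Dg) (hDg : Dg ≤ d + 1)
    (hs : s ≤ d / (10 ^ 4 * L)) (hs' : d / (10 ^ 4 * L) - 1 ≤ s)
    (hm : m ≤ d / 1300) (hm' : d / 1300 - 1 ≤ m)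
    (H : d ≤ 53 * (2 * x + 3 * (Dg ^ 2 + s * m ^ 2)) / (s * m) + 6 * (s * (482 + 480 * L))) :
    2 * 10 ^ (-25 : ℤ) * d ^ 3 / L ≤ x := by
  set q := d / (10 ^ 4 * L) with hq
  have hLp : 0 < L := by linarith
  have hdp : 0 < d := by linarith
  have hqL : q * L = d / 10 ^ 4 := by rw [hq]; field_simp
  have hq1 : 2300000 ≤ q := by
    rw [hq, le_div_iff₀ (by positivity)]
    linarith
  have hs1 : 2200000 ≤ s := by linarith
  have hm1 : d / 1301 ≤ m := by linarith
  have hmp : 0 < m := by linarith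
  have hsL : s * L ≤ d / 10 ^ 4 := by
    rw [← hqL]; exact mul_le_mul_of_nonneg_right hs hLp.le
  have hsp : 0 < s := by linarith
  have t2 : 6 * (s * (482 + 480 * L)) ≤ d / 2 := by
    nlinarith
  have h1 : d / 2 * (s * m) ≤ 53 * (2 * x + 3 * (Dg ^ 2 + s * m ^ 2)) := by
    rw [← le_div_iff₀ (by positivity)]; linarith
  have h2 : 159 * (s * m ^ 2) ≤ d / 8 * (s * m) := by
    have : 159 * m ≤ d / 8 := by linarith
    nlinarith [mul_le_mul_of_nonneg_right this (mul_pos hsp hmp).le]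
  have h3 : 159 * Dg ^ 2 ≤ d / 8 * (s * m) := by
    have a : Dg ^ 2 ≤ 1.01 * d ^ 2 := by nlinarith
    have b : 1690 * d ≤ s * m := by
      calc 1690 * d ≤ 2200000 * (d / 1301) := by linarith
        _ ≤ s * m := by gcongr
    nlinarith
  have h4 : d / 4 * (s * m) ≤ 106 * x := by linarith
  have h5 : q / 2 * (d / 1301) ≤ s * m := mul_le_mul (by linarith) hm1 (by positivity) hsp.le
  have h6 : d / 4 * (q / 2 * (d / 1301)) ≤ 106 * x := le_trans (by gcongr) h4
  have h7 : 2 * 10 ^ (-25 : ℤ) * d ^ 3 / L = 2 * 10 ^ (-21 : ℤ) * d ^ 2 * q := by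
    rw [hq]; field_simp
  rw [h7]
  have h8 : 0 ≤ d ^ 2 * q := by positivity
  norm_num
  nlinarith

theorem final {D : Draw} {cr : ℕ} (hX : Nat.card {q : D.E × D.E // D.Cr q.1 q.2} ≤ 2 * cr)
    (he : 4 * D.V.card ≤ Nat.card D.E) :
    (10 : ℝ) ^ (-25 : ℤ) * (Nat.card D.E : ℝ) ^ 3 /
      ((D.V.card : ℝ) ^ 2 * Real.logb 2 ((Nat.card D.E : ℝ) / (D.V.card : ℝ))) ≤ cr := by
  have hlin := D.cross_lin
  have hmain := fun (g : ℕ) (hg : 1 ≤ g) (hE : Nat.card D.E ≤ D.V.card * g) (W0 s : ℕ) (hW : 1 ≤ W0)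
    (hs : 1 ≤ s) => (exists_plan D hg hE).some.main W0 s hW hs
  set X := Nat.card {q : D.E × D.E // D.Cr q.1 q.2}
  set e := Nat.card D.E
  set n := D.V.card
  rcases Nat.eq_zero_or_pos n with h0 | hn
  · rw [h0]; simp
  have hnp : (0 : ℝ) < n := by exact_mod_cast hn
  have he' : 4 * (n : ℝ) ≤ e := by exact_mod_cast he
  have hXr : (X : ℝ) ≤ 2 * cr := by exact_mod_cast hX
  have hlr : (e : ℝ) ≤ 3 * n + X := by exact_mod_cast hlin
  obtain ⟨d, hd⟩ : ∃ d : ℝ, d = e / n := ⟨_, rfl⟩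
  have hed : (e : ℝ) = n * d := by rw [hd]; field_simp
  rw [← hd]
  have hd4 : 4 ≤ d := by rw [hd, le_div_iff₀ hnp]; exact he'
  obtain ⟨L, hLd⟩ : ∃ L : ℝ, L = Real.logb 2 d := ⟨_, rfl⟩
  rw [← hLd]
  have hL2 : 2 ≤ L := by
    rw [hLd, Real.le_logb_iff_rpow_le (by norm_num) (by linarith)]; norm_num; exact hd4
  have hg : (10 : ℝ) ^ (-25 : ℤ) * (e : ℝ) ^ 3 / ((n : ℝ) ^ 2 * L) = n * (10 ^ (-25 : ℤ) * d ^ 3 / L) := by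
    rw [hed]; field_simp
  rw [hg]
  rcases le_total d (10 ^ 12) with hsm | hbig
  · have h1 : 10 ^ (-25 : ℤ) * d ^ 3 / L ≤ d / 8 := by
      rw [div_le_iff₀ (by linarith)]
      have a : d ^ 2 ≤ 10 ^ 24 := by nlinarith
      have b : d ^ 3 ≤ 10 ^ 24 * d := by nlinarith
      norm_num
      nlinarith
    have h2 := mul_le_mul_of_nonneg_left h1 hnp.le
    linarith
  · have hLb := logb_bd hbig
    rw [← hLd] at hLb
    have hLp : 0 < L := by linarith
    have hdp : 0 < d := by linarith
    have hq0 : 0 ≤ d / (10 ^ 4 * L) := by positivity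
    have hm0 : 0 ≤ d / 1300 := by positivity
    have s1 := Nat.floor_le hq0
    have s2 := (Nat.sub_one_lt_floor (d / (10 ^ 4 * L))).le
    have m1 := Nat.floor_le hm0
    have m2 := (Nat.sub_one_lt_floor (d / 1300)).le
    have g1 := (Nat.ceil_lt_add_one hdp.le).le
    have g2 := Nat.le_ceil d
    set s := ⌊d / (10 ^ 4 * L)⌋₊
    set m := ⌊d / 1300⌋₊
    set g := ⌈d⌉₊
    have hq1 : 2300000 ≤ d / (10 ^ 4 * L) := by
      rw [le_div_iff₀ (by positivity)]; linarith
    have hs : 1 ≤ s := by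
      have : (1 : ℝ) ≤ s := by linarith
      exact_mod_cast this
    have hm : 1 ≤ m := by
      have : (1 : ℝ) ≤ m := by linarith
      exact_mod_cast this
    have hgg : 1 ≤ g := by
      have : (1 : ℝ) ≤ g := by linarith
      exact_mod_cast this
    have hE : e ≤ n * g := by
      have : (e : ℝ) ≤ n * g := by rw [hed]; exact mul_le_mul_of_nonneg_left g2 hnp.le
      exact_mod_cast this
    have H := hmain g hgg hE (s * m ^ 2) s (Nat.mul_pos hs (pow_pos hm 2)) hs
    have hsr : (1 : ℝ) ≤ s := by exact_mod_cast hs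
    have hmr : (1 : ℝ) ≤ m := by exact_mod_cast hm
    have hsq : √((s : ℝ) * ((s * m ^ 2 : ℕ) : ℝ)) = s * m := by
      rw [show (s : ℝ) * ((s * m ^ 2 : ℕ) : ℝ) = (s * m) ^ 2 by push_cast; ring]
      exact Real.sqrt_sq (by positivity)
    rw [hsq] at H
    have hlog : (Nat.log 2 s : ℝ) ≤ L := by
      rw [hLd, Real.le_logb_iff_rpow_le (by norm_num) hdp, Real.rpow_natCast]
      have a : (2 : ℝ) ^ Nat.log 2 s ≤ s := by exact_mod_cast Nat.pow_log_le_self 2 (by omega)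
      have b : d / (10 ^ 4 * L) ≤ d := div_le_self hdp.le (by linarith)
      linarith
    have hx := num_main (x := X / n) (s := s) (m := m) hbig hL2 hLb (Nat.cast_nonneg g) g1 s1 s2 m1 m2 (by
      have H2 : (e : ℝ) ≤ n * (53 * (2 * (X / n) + 3 * ((g : ℝ) ^ 2 + s * m ^ 2)) / (s * m) + 6 * (s * (482 + 480 * L))) := by
        refine H.trans ?_
        rw [mul_add (n : ℝ)]
        refine add_le_add (le_of_eq ?_) ?_
        · push_cast; field_simp
        · rw [show (6 : ℝ) * n * (s * (482 + 480 * (Nat.log 2 s : ℝ))) = n * (6 * (s * (482 + 480 * (Nat.log 2 s : ℝ)))) by ring]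
          refine mul_le_mul_of_nonneg_left (mul_le_mul_of_nonneg_left ?_ (by norm_num)) hnp.le
          exact mul_le_mul_of_nonneg_left (by linarith) (by linarith)
      rw [hed] at H2
      exact le_of_mul_le_mul_left H2 hnp)
    rw [le_div_iff₀ hnp] at hx
    have : 2 * (n * ((10 : ℝ) ^ (-25 : ℤ) * d ^ 3 / L)) = 2 * 10 ^ (-25 : ℤ) * d ^ 3 / L * n := by ring
    linarith
end CL

/-- **Crossing lemma for separated multigraphs.** A separated single-crossing topological
multigraph on `n` vertices with `e ≥ 4n` edges has at least `10⁻²⁵ e³ / (n² log₂(e/n))`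
crossings. -/
theorem crossing_lemma_separated (G : TopMultigraph)
    (hsc : G.SingleCrossing) (hsep : G.Separated)
    (he : 4 * G.V.card ≤ G.edgeCount) :
    (10 : ℝ) ^ (-25 : ℤ) * (G.edgeCount : ℝ) ^ 3 /
        ((G.V.card : ℝ) ^ 2 * Real.logb 2 ((G.edgeCount : ℝ) / (G.V.card : ℝ)))
      ≤ (G.crossingNumber : ℝ) := by
  have hc : Nat.card (CL.toDraw G hsc hsep).E = G.edgeCount := by
    unfold TopMultigraph.edgeCount
    rfl
  have hv := CL.toDraw_card G hsc hsep
  have := CL.final (D := CL.toDraw G hsc hsep) (cr := G.crossingNumber) (CL.two_cr G hsc hsep)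
    (by rw [hc, hv]; exact he)
  rw [hc, hv] at this
  exact this
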